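/- Let (X_n) be a regular sequence of compact length surfaces, each with q > 0 boundary components and reduced connectivity number c, converging in the Gromov-Hausdorff sense to X, with doubles 2X_n converging to 2X containing the isometric copies X^+, X^- of X and with (∂X_n) converging to ∂∞X. If b is a connected component of ∂∞X and T is a maximal cyclic subset of 2X such that T ∩ b^+ contains more than one point, then T ∩ b^+ is homeomorphic to the 1-sphere. -/

import Mathlib

open Filter Topology Metric Set GromovHausdorff
open scoped ENNReal unitInterval

noncomputable section

/-! ## Model spaces -/

/-- The closed upper half plane in `ℝ × ℝ` (used for topological charts). -/
def HalfPlane : Set (ℝ × ℝ) := {p | 0 ≤ p.2}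

/-- The closed upper half plane in the Euclidean plane (used for metric charts). -/
def EHalfPlane : Set (EuclideanSpace ℝ (Fin 2)) := {p | 0 ≤ p 1}

/-- The unit circle (the 1-sphere). -/
def Circle1 : Set (EuclideanSpace ℝ (Fin 2)) := Metric.sphere 0 1

/-- The 2-sphere. -/
def Sphere2 : Set (EuclideanSpace ℝ (Fin 3)) := Metric.sphere 0 1

/-- The closed 2-disc. -/
def Disc2 : Set (EuclideanSpace ℝ (Fin 2)) := Metric.closedBall 0 1

/-- The relation on the unit square generating the Möbius identification
`(0, y) ∼ (1, 1 - y)`. -/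
def mobiusRel (p q : I × I) : Prop :=
  ((p.1 : ℝ) = 0 ∧ (q.1 : ℝ) = 1 ∧ (p.2 : ℝ) = 1 - (q.2 : ℝ)) ∨
  ((p.1 : ℝ) = 1 ∧ (q.1 : ℝ) = 0 ∧ (p.2 : ℝ) = 1 - (q.2 : ℝ))

/-- The Möbius band, as a quotient of the unit square. -/
def MobiusBand : Type := Quot mobiusRel

instance : TopologicalSpace MobiusBand :=
  inferInstanceAs (TopologicalSpace (Quot mobiusRel))

/-! ## Surfaces -/

/-- A topological 2-manifold with (possibly empty) boundary: every point has an open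
neighborhood homeomorphic to an open subset of the closed half plane. -/
def IsSurface (X : Type*) [TopologicalSpace X] : Prop :=
  ∀ x : X, ∃ (U : Set X) (V : Set HalfPlane),
    IsOpen U ∧ x ∈ U ∧ IsOpen V ∧ Nonempty (↥U ≃ₜ ↥V)

/-- A compact surface: a compact connected (Hausdorff) topological 2-manifold with
possibly empty boundary. -/
def IsCompactSurface (X : Type*) [TopologicalSpace X] : Prop :=
  CompactSpace X ∧ ConnectedSpace X ∧ T2Space X ∧ IsSurface X

/-- The (manifold) boundary of a surface: the set of points having no open neighborhood
homeomorphic to an open subset of the plane. -/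
def surfaceBoundary (X : Type*) [TopologicalSpace X] : Set X :=
  {x | ¬ ∃ (U : Set X) (V : Set (ℝ × ℝ)), IsOpen U ∧ x ∈ U ∧ IsOpen V ∧ Nonempty (↥U ≃ₜ ↥V)}

/-- The set of boundary components of a surface, i.e. the connected components of the
boundary. -/
def surfaceBoundaryComponents (X : Type*) [TopologicalSpace X] : Set (Set X) :=
  {b | ∃ x ∈ surfaceBoundary X, b = connectedComponentIn (surfaceBoundary X) x}

/-- A surface is orientable iff it contains no subset homeomorphic to the Möbius band. -/
def SurfOrientable (X : Type*) [TopologicalSpace X] : Prop :=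
  ¬ ∃ A : Set X, Nonempty (↥A ≃ₜ MobiusBand)

/-- The free rank of the first homology (the abelianized fundamental group). -/
noncomputable def h1Rank (X : Type*) [TopologicalSpace X] : ℕ :=
  ⨆ x : X, (Module.rank ℤ (Additive (Abelianization (FundamentalGroup X x)))).toNat

open Classical in
/-- The connectivity number of a compact surface `S`, i.e. `2 - χ(S)`.  By the
classification of compact surfaces this equals the free rank of the first homology,
plus one unless the surface is closed and orientable. -/
noncomputable def connNum (X : Type*) [TopologicalSpace X] : ℕ :=
  h1Rank X + (if surfaceBoundary X = ∅ ∧ SurfOrientable X then 0 else 1)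

/-- The reduced connectivity number: the connectivity number minus the number of
boundary components. -/
noncomputable def redConnNum (X : Type*) [TopologicalSpace X] : ℤ :=
  (connNum X : ℤ) - ((surfaceBoundaryComponents X).ncard : ℤ)

/-! ## Length and geodesic spaces -/

/-- The length of a path, as the total variation of the parametrization. -/
noncomputable def pathLength {X : Type*} [MetricSpace X] {x y : X} (γ : Path x y) : ℝ≥0∞ :=
  eVariationOn (fun t => γ t) Set.univ

/-- A metric space is a length space if the distance between any two points is the
infimum of the lengths of paths joining them. -/
def IsLengthSpace (X : Type*) [MetricSpace X] : Prop :=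
  ∀ x y : X, edist x y = ⨅ γ : Path x y, pathLength γ

/-- A metric space is geodesic if any two points are joined by a path whose length
realizes the distance. -/
def IsGeodesicSpace (X : Type*) [MetricSpace X] : Prop :=
  ∀ x y : X, ∃ γ : Path x y, pathLength γ = edist x y

/-! ## Peano spaces, Jordan curves and cyclic elements -/

/-- A Peano space: a compact connected locally connected metric space. -/
def IsPeano (X : Type*) [MetricSpace X] : Prop :=
  CompactSpace X ∧ ConnectedSpace X ∧ LocallyConnectedSpace X

/-- A Jordan curve: a subset homeomorphic to the 1-sphere. -/
def IsJordanCurve {X : Type*} [TopologicalSpace X] (J : Set X) : Prop :=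
  Nonempty (↥J ≃ₜ ↥Circle1)

/-- A set is cyclicly connected if every pair of distinct points of it lies on a common
Jordan curve contained in it. -/
def CycliclyConnected {X : Type*} [TopologicalSpace X] (A : Set X) : Prop :=
  ∀ x ∈ A, ∀ y ∈ A, x ≠ y → ∃ J : Set X, J ⊆ A ∧ IsJordanCurve J ∧ x ∈ J ∧ y ∈ J

/-- A maximal cyclic subset: a nondegenerate cyclicly connected subset which is not a
proper subset of any cyclicly connected subset. -/
def IsMaximalCyclic {X : Type*} [TopologicalSpace X] (A : Set X) : Prop :=
  A.Nontrivial ∧ CycliclyConnected A ∧ ∀ B : Set X, CycliclyConnected B → A ⊆ B → A = B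

/-- A subcontinuum: a compact connected (hence nonempty) subset. -/
def IsSubcontinuum {X : Type*} [TopologicalSpace X] (C : Set X) : Prop :=
  IsCompact C ∧ IsConnected C

/-- `b` is a boundary component of the subset `T` (viewed as a subspace). -/
def IsBoundaryComponentOf {X : Type*} [TopologicalSpace X] (T b : Set X) : Prop :=
  ∃ b' ∈ surfaceBoundaryComponents ↥T, b = Subtype.val '' b'

/-- An admissible subcontinuum: it meets every maximal cyclic subset `T` in at most a
point or in a boundary component of `T`. -/
def IsAdmissible {X : Type*} [TopologicalSpace X] (C : Set X) : Prop :=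
  IsSubcontinuum C ∧
    ∀ T : Set X, IsMaximalCyclic T →
      ((T ∩ C).Subsingleton ∨ IsBoundaryComponentOf T (T ∩ C))

/-- A 1-cactoid: a Peano space all of whose maximal cyclic subsets are homeomorphic to
the 1-sphere. -/
def IsOneCactoid (X : Type*) [MetricSpace X] : Prop :=
  IsPeano X ∧ ∀ T : Set X, IsMaximalCyclic T → Nonempty (↥T ≃ₜ ↥Circle1)

/-- A subset homeomorphic to the 2-sphere or the closed 2-disc. -/
def SphereOrDisc {X : Type*} [TopologicalSpace X] (T : Set X) : Prop :=
  Nonempty (↥T ≃ₜ ↥Sphere2) ∨ Nonempty (↥T ≃ₜ ↥Disc2)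

/-! ## Generalized cactoids -/

/-- A generalized cactoid. -/
def IsGeneralizedCactoid (X : Type*) [MetricSpace X] : Prop :=
  IsPeano X ∧ (∀ T : Set X, IsMaximalCyclic T → IsCompactSurface ↥T) ∧
  {T : Set X | IsMaximalCyclic T ∧ ¬ SphereOrDisc T}.Finite ∧
  ∃ (n : ℕ) (C : Fin n → Set X),
    (∀ i, IsAdmissible (C i)) ∧ (Pairwise fun i j => Disjoint (C i) (C j)) ∧
    ∀ T b : Set X, IsMaximalCyclic T → IsBoundaryComponentOf T b → b ⊆ ⋃ i, C i

/-- A pre-boundary consisting of `n` disjoint admissible subcontinua, each containing a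
boundary component of some maximal cyclic subset, which together cover all boundary
components of all maximal cyclic subsets. -/
def IsPreBoundaryOfSize {X : Type*} [TopologicalSpace X] (n : ℕ) (P : Set X) : Prop :=
  ∃ C : Fin n → Set X,
    (∀ i, IsAdmissible (C i)) ∧ (Pairwise fun i j => Disjoint (C i) (C j)) ∧
    (∀ i, ∃ T b : Set X, IsMaximalCyclic T ∧ IsBoundaryComponentOf T b ∧ b ⊆ C i) ∧
    (∀ T b : Set X, IsMaximalCyclic T → IsBoundaryComponentOf T b → b ⊆ ⋃ i, C i) ∧
    P = ⋃ i, C i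

def IsPreBoundary {X : Type*} [TopologicalSpace X] (P : Set X) : Prop :=
  ∃ n, IsPreBoundaryOfSize n P

/-- A minimal pre-boundary: one with the minimal possible number of pieces. -/
def IsMinimalPreBoundary {X : Type*} [TopologicalSpace X] (P : Set X) : Prop :=
  ∃ n, IsPreBoundaryOfSize n P ∧ ∀ (m : ℕ) (Q : Set X), IsPreBoundaryOfSize m Q → n ≤ m

/-- The boundary of a generalized cactoid: the union of all minimal pre-boundaries. -/
def cactoidBoundary (X : Type*) [TopologicalSpace X] : Set X :=
  ⋃₀ {P : Set X | IsMinimalPreBoundary P}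

/-- The boundary components of a generalized cactoid: the connected components of its
boundary. -/
def cactoidBoundaryComponents (X : Type*) [TopologicalSpace X] : Set (Set X) :=
  {b | ∃ x ∈ cactoidBoundary X, b = connectedComponentIn (cactoidBoundary X) x}

/-- The connectivity number of a generalized cactoid: the sum of the reduced
connectivity numbers of its maximal cyclic subsets plus the number of its boundary
components. -/
noncomputable def cactoidConnNum (X : Type*) [TopologicalSpace X] : ℤ :=
  (∑ᶠ T ∈ {T : Set X | IsMaximalCyclic T}, redConnNum ↥T) +
    ((cactoidBoundaryComponents X).ncard : ℤ)

/-! ## Bundled spaces -/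

structure BundledMet where
  carrier : Type
  [str : MetricSpace carrier]

attribute [instance] BundledMet.str

structure BundledTop where
  carrier : Type
  [str : TopologicalSpace carrier]

attribute [instance] BundledTop.str

/-! ## Metric two-point identifications -/

/-- `p : A → B` is (the projection of) a metric 2-point identification: it glues exactly
two distinct points `x₁, x₂` of `A` and carries the corresponding quotient metric. -/
def IsTwoPointIdentification {A B : Type*} [MetricSpace A] [MetricSpace B] (p : A → B) : Prop :=
  Function.Surjective p ∧ ∃ x₁ x₂ : A, x₁ ≠ x₂ ∧
    (∀ a b : A, p a = p b ↔ (a = b ∨ (a = x₁ ∧ b = x₂) ∨ (a = x₂ ∧ b = x₁))) ∧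
    ∀ a b : A, dist (p a) (p b) =
      min (dist a b) (min (dist a x₁ + dist x₂ b) (dist a x₂ + dist x₁ b))

/-- `Y` is obtained from `X` by a successive application of `k` metric 2-point
identifications, exactly `k₀` of which are boundary identifications with respect to the
subset `B ⊆ X`. -/
def ObtainedByIdentifications (X : Type) [MetricSpace X] (B : Set X) (k k0 : ℕ)
    (Y : Type) [MetricSpace Y] : Prop :=
  ∃ (Z : ℕ → BundledMet) (p : ∀ i : ℕ, (Z i).carrier → (Z (i + 1)).carrier)
    (e : X ≃ᵢ (Z 0).carrier) (f : (Z k).carrier ≃ᵢ Y) (q : ∀ i : ℕ, X → (Z i).carrier),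
    (∀ i, i < k → IsTwoPointIdentification (p i)) ∧
    (∀ x, q 0 x = e x) ∧ (∀ i x, q (i + 1) x = p i (q i x)) ∧
    {i : ℕ | i < k ∧ ∃ a b : (Z i).carrier,
        a ∈ q i '' B ∧ b ∈ q i '' B ∧ a ≠ b ∧ p i a = p i b}.ncard = k0

/-! ## Gromov–Hausdorff sequences of surfaces -/

/-- A sequence of (isometry classes of) compact length surfaces with connectivity
number `c`. -/
def IsSurfaceGHSeq (c : ℕ) (K : ℕ → GHSpace) : Prop :=
  ∀ n, IsCompactSurface (K n).Rep ∧ IsLengthSpace (K n).Rep ∧ connNum (K n).Rep = c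

/-- The structural description of the limit spaces in the Main Theorem: `X` is obtained
from a geodesic generalized cactoid `Y` by `k` successive metric 2-point
identifications, `k₀` of them boundary identifications, where the connectivity number
of `Y` is at most `c + k₀ - 2k`. -/
def MainThmRHS (c : ℕ) (X : Type) [MetricSpace X] : Prop :=
  ∃ (k k0 : ℕ) (Y : BundledMet),
    IsGeneralizedCactoid Y.carrier ∧ IsGeodesicSpace Y.carrier ∧
    ObtainedByIdentifications Y.carrier (cactoidBoundary Y.carrier) k k0 X ∧
    cactoidConnNum Y.carrier ≤ (c : ℤ) + (k0 : ℤ) - 2 * (k : ℤ)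

/-! ## Covering dimension -/

/-- `X` has covering dimension at most `n`: every open cover admits an open refinement
of order at most `n + 1`. -/
def CoveringDimLE (X : Type*) [TopologicalSpace X] (n : ℕ) : Prop :=
  ∀ U : Set (Set X), (∀ u ∈ U, IsOpen u) → ⋃₀ U = Set.univ →
    ∃ V : Set (Set X), (∀ v ∈ V, IsOpen v) ∧ ⋃₀ V = Set.univ ∧
      (∀ v ∈ V, ∃ u ∈ U, v ⊆ u) ∧
      ∀ x : X, {v | v ∈ V ∧ x ∈ v}.encard ≤ (n : ℕ∞) + 1

/-! ## Curves in surfaces -/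

/-- A continuous map from the circle is nullhomotopic if it is homotopic to a constant. -/
def IsNullhomotopic {X : Type*} [TopologicalSpace X] (f : C(↥Circle1, X)) : Prop :=
  ∃ y : X, f.Homotopic (ContinuousMap.const _ y)

/-- A contractible Jordan curve. -/
def IsContractibleJordanCurve {X : Type*} [TopologicalSpace X] (J : Set X) : Prop :=
  IsJordanCurve J ∧
    ∀ f : C(↥Circle1, X), Function.Injective f → Set.range f = J → IsNullhomotopic f

/-- A non-contractible Jordan curve. -/
def IsNonContractibleJordanCurve {X : Type*} [TopologicalSpace X] (J : Set X) : Prop :=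
  IsJordanCurve J ∧
    ∀ f : C(↥Circle1, X), Function.Injective f → Set.range f = J → ¬ IsNullhomotopic f

/-- A simple arc in a surface: an injective path whose endpoints lie on the boundary and
whose interior does not. -/
def IsSimpleArc {X : Type*} [TopologicalSpace X] (γ : C(I, X)) : Prop :=
  Function.Injective γ ∧ γ 0 ∈ surfaceBoundary X ∧ γ 1 ∈ surfaceBoundary X ∧
    ∀ t : I, t ≠ 0 → t ≠ 1 → γ t ∉ surfaceBoundary X

/-- A subset separates the space if its complement is disconnected. -/
def SeparatesSpace {X : Type*} [TopologicalSpace X] (A : Set X) : Prop :=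
  ¬ IsPreconnected Aᶜ

/-- The arc `γ` forms a contractible Jordan curve together with a subarc of some
boundary component. -/
def FormsContractibleJordanWithBoundary {X : Type*} [TopologicalSpace X]
    (γ : C(I, X)) : Prop :=
  ∃ β : C(I, X), Function.Injective β ∧ Set.range β ⊆ surfaceBoundary X ∧
    β 0 = γ 0 ∧ β 1 = γ 1 ∧ IsContractibleJordanCurve (Set.range γ ∪ Set.range β)

/-- `z` separates `x` and `y` inside the subset `A`: both lie in `A \ {z}` and no
connected subset of `A \ {z}` contains both. -/
def SeparatesIn {X : Type*} [TopologicalSpace X] (A : Set X) (z x y : X) : Prop :=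
  x ∈ A \ {z} ∧ y ∈ A \ {z} ∧
    ∀ C : Set X, C ⊆ A \ {z} → IsPreconnected C → ¬ (x ∈ C ∧ y ∈ C)

/-! ## Metric doubles -/

/-- `D` together with the two canonical maps `ip, im : X → D` is the metric double of
`X` along the subset `B`. -/
structure IsMetricDouble (X : Type*) [MetricSpace X] (B : Set X) (D : Type*)
    [MetricSpace D] (ip im : X → D) : Prop where
  isom_p : Isometry ip
  isom_m : Isometry im
  surj : Set.range ip ∪ Set.range im = Set.univ
  agree : ∀ z ∈ B, ip z = im z
  dist_mix : ∀ a b : X, dist (ip a) (im b) = ⨅ z : ↥B, (dist a (z : X) + dist (z : X) b)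

/-- Regularity of a sequence of doubles: there is no sequence of non-contractible
Jordan curves in the doubles with vanishing diameters. -/
def RegularDoubleSeq (D : ℕ → Type) [∀ n, MetricSpace (D n)] : Prop :=
  ∀ J : ∀ n, Set (D n), (∀ n, IsNonContractibleJordanCurve (J n)) →
    0 < ⨅ n, Metric.diam (J n)

/-- The copy `A^+` (or `A^-`) in the double limit corresponding to a subset `A` of the
limit `X`, via the isometric identification `j` of `X` with `X^+` (resp. `X^-`). -/
def plusCopy {Z D : Type*} {X : Set Z} {Xp : Set D} (j : ↥X → ↥Xp) (A : Set Z) :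
    Set D :=
  (fun x => ((j x : ↥Xp) : D)) '' {x : ↥X | (x : Z) ∈ A}

/-! ## Riemannian and polyhedral surfaces -/

/-- The Riemannian length integrand `√(g_{γ(t)}(γ'(t), γ'(t)))`. -/
noncomputable def riemLengthIntegrand (g : (ℝ × ℝ) → (ℝ × ℝ) → (ℝ × ℝ) → ℝ)
    (γ : ℝ → ℝ × ℝ) (t : ℝ) : ℝ :=
  Real.sqrt (g (γ t) (deriv γ t) (deriv γ t))

/-- A compact connected smooth Riemannian 2-manifold, as a metric space: a compact
length surface such that around every point there is a chart in which the length of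
every C¹ curve is computed by a smooth positive definite symmetric bilinear metric. -/
def IsSmoothRiemannianSurface (X : Type*) [MetricSpace X] : Prop :=
  IsCompactSurface X ∧ IsLengthSpace X ∧
  ∀ x : X, ∃ (U : Set X) (V : Set (ℝ × ℝ)) (φ : X → ℝ × ℝ) (ψ : ℝ × ℝ → X)
      (g : (ℝ × ℝ) → (ℝ × ℝ) → (ℝ × ℝ) → ℝ),
    IsOpen U ∧ x ∈ U ∧ (∃ V' : Set (ℝ × ℝ), IsOpen V' ∧ V = V' ∩ HalfPlane) ∧
    ContinuousOn φ U ∧ φ '' U = V ∧ ContinuousOn ψ V ∧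
    (∀ y ∈ U, ψ (φ y) = y) ∧ (∀ v ∈ V, φ (ψ v) = v) ∧
    (∀ m : ℕ, ContDiffOn ℝ m
      (fun pq : (ℝ × ℝ) × (ℝ × ℝ) × (ℝ × ℝ) => g pq.1 pq.2.1 pq.2.2)
      (V ×ˢ ((Set.univ : Set (ℝ × ℝ)) ×ˢ (Set.univ : Set (ℝ × ℝ))))) ∧
    (∀ p u v, g p u v = g p v u) ∧
    (∀ p (a : ℝ) u u' v, g p (a • u + u') v = a * g p u v + g p u' v) ∧
    (∀ p ∈ V, ∀ u : ℝ × ℝ, u ≠ 0 → 0 < g p u u) ∧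
    ∀ (cur : ℝ → X) (a b : ℝ), a ≤ b → Set.MapsTo cur (Set.Icc a b) U →
      ContDiffOn ℝ 1 (φ ∘ cur) (Set.Icc a b) →
      eVariationOn cur (Set.Icc a b) =
        ENNReal.ofReal (∫ t in a..b, riemLengthIntegrand g (φ ∘ cur) t)

/-- A polyhedral surface: a compact length surface which is flat (locally isometric to
a subset of the Euclidean half plane) away from finitely many singular points. -/
def IsPolyhedralSurface (X : Type*) [MetricSpace X] : Prop :=
  IsCompactSurface X ∧ IsLengthSpace X ∧
  ∃ F : Set X, F.Finite ∧ ∀ x : X, x ∉ F →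
    ∃ (U : Set X) (W : Set (EuclideanSpace ℝ (Fin 2))),
      IsOpen U ∧ x ∈ U ∧ W ⊆ EHalfPlane ∧ Nonempty (↥U ≃ᵢ ↥W)

end

/-! ## Arcs -/

section Arcs

variable {M : Type*} [MetricSpace M]

/-- `S` is an arc with endpoints `p` and `q`. -/
def IsArc (S : Set M) (p q : M) : Prop :=
  ∃ f : ℝ → M, ContinuousOn f (Icc 0 1) ∧ InjOn f (Icc 0 1) ∧ f 0 = p ∧ f 1 = q ∧
    f '' Icc 0 1 = S

theorem IsArc.of_Icc {a b : ℝ} (hab : a < b) {f : ℝ → M} (hf : ContinuousOn f (Icc a b))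
    (hi : InjOn f (Icc a b)) : IsArc (f '' Icc a b) (f a) (f b) := by
  have hm : ∀ t ∈ Icc (0 : ℝ) 1, a + t * (b - a) ∈ Icc a b := by
    intro t ht
    constructor
    · nlinarith [ht.1]
    · nlinarith [ht.2]
  refine ⟨fun t => f (a + t * (b - a)), ?_, ?_, by simp, by simp, ?_⟩
  · exact hf.comp (by fun_prop) hm
  · intro s hs t ht h
    have := hi (hm s hs) (hm t ht) h
    have h2 : (s - t) * (b - a) = 0 := by linarith
    rcases mul_eq_zero.1 h2 with h | h <;> linarith
  · ext x
    constructor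
    · rintro ⟨t, ht, rfl⟩
      exact ⟨_, hm t ht, rfl⟩
    · rintro ⟨t, ht, rfl⟩
      have hba : 0 < b - a := by linarith
      refine ⟨(t - a) / (b - a), ⟨div_nonneg (by linarith [ht.1]) hba.le,
        (div_le_one hba).2 (by linarith [ht.2])⟩, ?_⟩
      simp only
      congr 1
      field_simp
      ring

namespace IsArc

variable {S S₁ S₂ : Set M} {p q x y : M}

theorem symm (h : IsArc S p q) : IsArc S q p := by
  obtain ⟨f, hc, hi, h0, h1, rfl⟩ := h
  have hm : ∀ t ∈ Icc (0 : ℝ) 1, 1 - t ∈ Icc (0 : ℝ) 1 := fun t ht =>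
    ⟨by linarith [ht.2], by linarith [ht.1]⟩
  refine ⟨fun t => f (1 - t), hc.comp (by fun_prop) hm, ?_, by simp [h1], by simp [h0], ?_⟩
  · intro s hs t ht h
    have := hi (hm s hs) (hm t ht) h
    linarith
  · ext x
    constructor
    · rintro ⟨t, ht, rfl⟩
      exact ⟨_, hm t ht, rfl⟩
    · rintro ⟨t, ht, rfl⟩
      exact ⟨1 - t, hm t ht, by simp⟩

theorem left_mem (h : IsArc S p q) : p ∈ S := by
  obtain ⟨f, hc, hi, h0, h1, rfl⟩ := h
  exact ⟨0, by simp, h0⟩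

theorem right_mem (h : IsArc S p q) : q ∈ S := h.symm.left_mem

theorem ne (h : IsArc S p q) : p ≠ q := by
  obtain ⟨f, hc, hi, rfl, rfl, rfl⟩ := h
  intro h
  have := hi (by simp) (by simp) h
  norm_num at this

theorem isCompact (h : IsArc S p q) : IsCompact S := by
  obtain ⟨f, hc, hi, h0, h1, rfl⟩ := h
  exact isCompact_Icc.image_of_continuousOn hc

theorem isClosed (h : IsArc S p q) : IsClosed S := h.isCompact.isClosed

theorem isPreconnected (h : IsArc S p q) : IsPreconnected S := by
  obtain ⟨f, hc, hi, h0, h1, rfl⟩ := h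
  exact isPreconnected_Icc.image f hc

theorem image {N : Type*} [MetricSpace N] (h : IsArc S p q) {g : M → N} (hg : ContinuousOn g S)
    (hi : InjOn g S) : IsArc (g '' S) (g p) (g q) := by
  obtain ⟨f, hc, hfi, h0, h1, rfl⟩ := h
  refine ⟨g ∘ f, hg.comp hc (mapsTo_image f _), ?_, by simp [h0], by simp [h1],
    by rw [image_comp]⟩
  exact hi.comp hfi (mapsTo_image f _)

/-- An arc splits at an interior point. -/
theorem split (h : IsArc S p q) (hx : x ∈ S) (hp : x ≠ p) (hq : x ≠ q) :
    ∃ A B, IsArc A p x ∧ IsArc B x q ∧ A ∪ B = S ∧ A ∩ B = {x} := by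
  obtain ⟨f, hc, hi, rfl, rfl, rfl⟩ := h
  obtain ⟨t, ht, rfl⟩ := hx
  have h0 : 0 < t := lt_of_le_of_ne ht.1 (by rintro rfl; exact hp rfl)
  have h1 : t < 1 := lt_of_le_of_ne ht.2 (by rintro rfl; exact hq rfl)
  have s1 : Icc 0 t ⊆ Icc (0 : ℝ) 1 := Icc_subset_Icc_right ht.2
  have s2 : Icc t 1 ⊆ Icc (0 : ℝ) 1 := Icc_subset_Icc_left ht.1
  refine ⟨f '' Icc 0 t, f '' Icc t 1, of_Icc h0 (hc.mono s1) (hi.mono s1),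
    of_Icc h1 (hc.mono s2) (hi.mono s2), ?_, ?_⟩
  · rw [← image_union, Icc_union_Icc_eq_Icc ht.1 ht.2]
  · rw [← hi.image_inter s1 s2, Icc_inter_Icc_eq_singleton ht.1 ht.2, image_singleton]

theorem exists_left (h : IsArc S p q) (hx : x ∈ S) (hp : x ≠ p) :
    ∃ A ⊆ S, IsArc A p x := by
  by_cases hq : x = q
  · subst hq; exact ⟨S, Subset.rfl, h⟩
  · obtain ⟨A, B, hA, -, hAB, -⟩ := h.split hx hp hq
    exact ⟨A, hAB ▸ subset_union_left, hA⟩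

theorem exists_right (h : IsArc S p q) (hx : x ∈ S) (hq : x ≠ q) :
    ∃ A ⊆ S, IsArc A x q := by
  obtain ⟨A, hA, h⟩ := h.symm.exists_left hx hq
  exact ⟨A, hA, h.symm⟩

theorem concat (h₁ : IsArc S₁ p x) (h₂ : IsArc S₂ x q) (h : S₁ ∩ S₂ = {x}) :
    IsArc (S₁ ∪ S₂) p q := by
  obtain ⟨f, fc, fi, f0, f1, rfl⟩ := h₁
  obtain ⟨g, gc, gi, g0, g1, rfl⟩ := h₂
  set k : ℝ → M := fun t => if t ≤ 1 then f t else g (t - 1) with hk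
  have k1 : ∀ t ∈ Icc (0 : ℝ) 1, k t = f t := fun t ht => by simp [hk, ht.2]
  have k2 : ∀ t ∈ Icc (1 : ℝ) 2, k t = g (t - 1) := fun t ht => by
    by_cases h : t ≤ 1
    · have : t = 1 := le_antisymm h ht.1
      subst this
      simp [hk, f1, g0]
    · simp [hk, h]
  have m2 : MapsTo (fun t : ℝ => t - 1) (Icc 1 2) (Icc 0 1) := fun t ht =>
    ⟨by linarith [ht.1], by linarith [ht.2]⟩
  have e1 : k '' Icc 0 1 = f '' Icc 0 1 := image_congr k1
  have e2 : k '' Icc 1 2 = g '' Icc 0 1 := by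
    rw [image_congr k2]
    ext z
    constructor
    · rintro ⟨t, ht, rfl⟩
      exact ⟨_, m2 ht, rfl⟩
    · rintro ⟨t, ht, rfl⟩
      exact ⟨t + 1, ⟨by linarith [ht.1], by linarith [ht.2]⟩, by simp⟩
  have eu : Icc (0 : ℝ) 1 ∪ Icc 1 2 = Icc 0 2 := Icc_union_Icc_eq_Icc (by norm_num) (by norm_num)
  have kc : ContinuousOn k (Icc 0 2) := by
    rw [← eu]
    refine ContinuousOn.union_of_isClosed ?_ ?_ isClosed_Icc isClosed_Icc
    · exact fc.congr k1
    · exact ContinuousOn.congr (gc.comp (by fun_prop) m2) k2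
  have i1 : InjOn k (Icc 0 1) := fi.congr (fun t ht => (k1 t ht).symm)
  have i2 : InjOn k (Icc 1 2) := by
    intro s hs t ht hst
    rw [k2 s hs, k2 t ht] at hst
    linarith [gi (m2 hs) (m2 ht) hst]
  have key : ∀ s ∈ Icc (0 : ℝ) 1, ∀ t ∈ Icc (1 : ℝ) 2, k s = k t → s = t := by
    intro s hs t ht hst
    have hm : k s ∈ f '' Icc 0 1 ∩ g '' Icc 0 1 :=
      ⟨e1 ▸ mem_image_of_mem k hs, e2 ▸ hst ▸ mem_image_of_mem k ht⟩
    rw [h, mem_singleton_iff] at hm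
    have hs1 : s = 1 := i1 hs (by simp) (by rw [hm, k1 1 (by simp), f1])
    have ht1 : t = 1 := i2 ht (by simp) (by rw [← hst, hm, k1 1 (by simp), f1])
    rw [hs1, ht1]
  have ki : InjOn k (Icc 0 2) := by
    intro s hs t ht hst
    rw [← eu] at hs ht
    rcases hs with hs | hs <;> rcases ht with ht | ht
    · exact i1 hs ht hst
    · exact key s hs t ht hst
    · exact (key t ht s hs hst.symm).symm
    · exact i2 hs ht hst
  have := of_Icc (by norm_num : (0 : ℝ) < 2) kc ki
  rw [← eu, image_union, e1, e2, k1 0 (by simp), k2 2 (by simp)] at this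
  norm_num [f0, g1] at this
  exact this

/-- The first point of an arc in a closed set. -/
theorem first_hit (h : IsArc S p q) {K : Set M} (hK : IsClosed K) (hp : p ∉ K)
    (hne : (S ∩ K).Nonempty) : ∃ x ∈ K, ∃ A ⊆ S, IsArc A p x ∧ A ∩ K = {x} := by
  obtain ⟨f, fc, fi, f0, f1, rfl⟩ := h
  set E := Icc (0 : ℝ) 1 ∩ f ⁻¹' K
  have hE : IsClosed E := fc.preimage_isClosed_of_isClosed isClosed_Icc hK
  have hEc : IsCompact E := isCompact_Icc.of_isClosed_subset hE inter_subset_left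
  have hEn : E.Nonempty := by
    obtain ⟨_, ⟨t, ht, rfl⟩, h⟩ := hne
    exact ⟨t, ht, h⟩
  obtain ⟨t, ht, hmin⟩ := hEc.exists_isLeast hEn
  have h0 : 0 < t := lt_of_le_of_ne ht.1.1 (by rintro rfl; exact hp (f0 ▸ ht.2))
  have s1 : Icc 0 t ⊆ Icc (0 : ℝ) 1 := Icc_subset_Icc_right ht.1.2
  refine ⟨f t, ht.2, f '' Icc 0 t, image_mono s1,
    f0 ▸ of_Icc h0 (fc.mono s1) (fi.mono s1), ?_⟩
  ext z
  constructor
  · rintro ⟨⟨s, hs, rfl⟩, hsK⟩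
    have : t ≤ s := hmin ⟨s1 hs, hsK⟩
    rw [mem_singleton_iff, le_antisymm hs.2 this]
  · rintro rfl
    exact ⟨⟨t, ⟨h0.le, le_rfl⟩, rfl⟩, ht.2⟩

/-- Two consecutive arcs contain an arc joining the extreme endpoints. -/
theorem exists_trans (h₁ : IsArc S₁ p x) (h₂ : IsArc S₂ x q) (hpq : p ≠ q) :
    ∃ S ⊆ S₁ ∪ S₂, IsArc S p q := by
  by_cases hp : p ∈ S₂
  · obtain ⟨A, hA, h⟩ := h₂.exists_right hp hpq
    exact ⟨A, hA.trans subset_union_right, h⟩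
  · obtain ⟨y, hy, A, hA, hAarc, hAy⟩ :=
      h₁.first_hit h₂.isClosed hp ⟨x, h₁.right_mem, h₂.left_mem⟩
    by_cases hyq : y = q
    · subst hyq
      exact ⟨A, hA.trans subset_union_left, hAarc⟩
    · obtain ⟨B, hB, hBarc⟩ := h₂.exists_right hy hyq
      refine ⟨A ∪ B, union_subset_union hA hB, hAarc.concat hBarc ?_⟩
      apply Subset.antisymm
      · rw [← hAy]; exact inter_subset_inter_right _ hB
      · rintro _ rfl
        exact ⟨hAarc.right_mem, hBarc.left_mem⟩

theorem nontrivial (h : IsArc S p q) : S.Nontrivial := ⟨p, h.left_mem, q, h.right_mem, h.ne⟩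

end IsArc

/-! ## Jordan curves -/

theorem nonempty_circle1_homeomorph : Nonempty (↥Circle1 ≃ₜ AddCircle (1 : ℝ)) := by
  let e : ℂ ≃ₗᵢ[ℝ] EuclideanSpace ℝ (Fin 2) := Complex.orthonormalBasisOneI.repr
  have h1 : (Submonoid.unitSphere ℂ : Set ℂ) = sphere 0 1 := rfl
  have : e '' (sphere (0 : ℂ) 1) = Circle1 := by
    rw [e.image_sphere]; simp [Circle1]
  have c1 : Circle ≃ₜ ↥(sphere (0 : ℂ) 1) := Homeomorph.refl _
  have c2 : ↥(sphere (0 : ℂ) 1) ≃ₜ ↥(e '' (sphere (0 : ℂ) 1)) := e.toHomeomorph.image _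
  have c3 : ↥(e '' (sphere (0 : ℂ) 1)) ≃ₜ ↥Circle1 := Homeomorph.setCongr this
  exact ⟨((AddCircle.homeomorphCircle one_ne_zero).trans (c1.trans (c2.trans c3))).symm⟩

theorem isJordanCurve_iff {J : Set M} : IsJordanCurve J ↔
    ∃ F : AddCircle (1 : ℝ) → M, Continuous F ∧ Function.Injective F ∧ range F = J := by
  obtain ⟨e⟩ := nonempty_circle1_homeomorph
  have : Fact ((0 : ℝ) < 1) := ⟨one_pos⟩
  constructor
  · rintro ⟨h⟩
    refine ⟨fun x => (h.symm (e.symm x) : M), by fun_prop,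
      Subtype.val_injective.comp (h.symm.injective.comp e.symm.injective), ?_⟩
    have : (fun x => (h.symm (e.symm x) : M)) = Subtype.val ∘ (h.symm ∘ e.symm) := rfl
    rw [this, range_comp, (h.symm.surjective.comp e.symm.surjective).range_eq]
    simp
  · rintro ⟨F, hc, hi, rfl⟩
    have := hc.isClosedEmbedding hi
    exact ⟨(e.trans this.toIsEmbedding.toHomeomorph).symm⟩

theorem IsJordanCurve.isCompact {J : Set M} (h : IsJordanCurve J) : IsCompact J := by
  have : Fact ((0 : ℝ) < 1) := ⟨one_pos⟩
  obtain ⟨F, hc, hi, rfl⟩ := isJordanCurve_iff.1 h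
  exact isCompact_range hc

theorem IsJordanCurve.isClosed {J : Set M} (h : IsJordanCurve J) : IsClosed J :=
  h.isCompact.isClosed

theorem IsJordanCurve.split {J : Set M} (h : IsJordanCurve J) {x y : M} (hx : x ∈ J)
    (hy : y ∈ J) (hxy : x ≠ y) :
    ∃ A B, IsArc A x y ∧ IsArc B x y ∧ A ∪ B = J ∧ A ∩ B = {x, y} := by
  have : Fact ((0 : ℝ) < 1) := ⟨one_pos⟩
  obtain ⟨F, hc, hi, rfl⟩ := isJordanCurve_iff.1 h
  obtain ⟨s, rfl⟩ := hx
  obtain ⟨t', rfl⟩ := hy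
  set g : ℝ → M := fun t => F (s + (t : AddCircle (1 : ℝ))) with hg
  have gc : Continuous g := hc.comp (continuous_const.add (AddCircle.continuous_mk' 1))
  have gI : InjOn g (Ico 0 1) := by
    intro a ha b hb h
    have h2 := add_left_cancel (hi h)
    have h0 : (0 : ℝ) + 1 = 1 := by norm_num
    exact AddCircle.coe_eq_coe_iff_of_mem_Ico (p := (1 : ℝ)) (a := 0) (by simpa using ha)
      (by simpa using hb) |>.1 h2
  have g0 : g 0 = F s := by simp [hg]
  have g1 : g 1 = F s := by
    have : ((1 : ℝ) : AddCircle (1 : ℝ)) = 0 := AddCircle.coe_period 1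
    simp [hg, this]
  have gsurj : ∀ z, ∃ t ∈ Ico (0 : ℝ) 1, g t = F z := by
    intro z
    obtain ⟨t, ht, h⟩ := (AddCircle.coe_image_Ico_eq (1 : ℝ) 0).symm.subset (mem_univ (z - s))
    refine ⟨t, by simpa using ht, ?_⟩
    simp [hg, h]
  obtain ⟨t, ht, htt⟩ := gsurj t'
  have t0 : 0 < t := lt_of_le_of_ne ht.1 (by rintro rfl; exact hxy (g0.symm.trans htt))
  have i1 : InjOn g (Icc 0 t) := gI.mono (Icc_subset_Ico_right ht.2)
  have i2 : InjOn g (Icc t 1) := by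
    intro a ha b hb h
    rcases eq_or_lt_of_le ha.2 with rfl | ha1 <;> rcases eq_or_lt_of_le hb.2 with rfl | hb1
    · rfl
    · have := gI ⟨le_rfl, one_pos⟩ ⟨t0.le.trans hb.1, hb1⟩ (by rw [← h, g0, g1])
      linarith [hb.1]
    · have := gI ⟨t0.le.trans ha.1, ha1⟩ ⟨le_rfl, one_pos⟩ (by rw [h, g0, g1])
      linarith [ha.1]
    · exact gI ⟨t0.le.trans ha.1, ha1⟩ ⟨t0.le.trans hb.1, hb1⟩ h
  refine ⟨g '' Icc 0 t, g '' Icc t 1, ?_, ?_, ?_, ?_⟩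
  · have := IsArc.of_Icc t0 gc.continuousOn i1
    rwa [g0, htt] at this
  · have := IsArc.of_Icc ht.2 gc.continuousOn i2
    rw [g1, htt] at this
    exact this.symm
  · rw [← image_union, Icc_union_Icc_eq_Icc ht.1 ht.2.le]
    ext z
    constructor
    · rintro ⟨u, hu, rfl⟩
      exact ⟨_, rfl⟩
    · rintro ⟨u, rfl⟩
      obtain ⟨v, hv, h⟩ := gsurj u
      exact ⟨v, Ico_subset_Icc_self hv, h⟩
  · ext z
    constructor
    · rintro ⟨⟨a, ha, rfl⟩, ⟨b, hb, h⟩⟩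
      rcases eq_or_lt_of_le hb.2 with rfl | hb1
      · left; rw [← h, g1]
      · have := gI ⟨t0.le.trans hb.1, hb1⟩ ⟨ha.1, ha.2.trans_lt ht.2⟩ h
        subst this
        right
        rw [le_antisymm ha.2 hb.1, htt]; rfl
    · rintro (rfl | rfl)
      · exact ⟨⟨0, ⟨le_rfl, t0.le⟩, g0⟩, ⟨1, ⟨ht.2.le, le_rfl⟩, g1⟩⟩
      · exact ⟨⟨t, ⟨t0.le, le_rfl⟩, htt⟩, ⟨t, ⟨le_rfl, ht.2.le⟩, htt⟩⟩

/-- Two arcs meeting exactly at their endpoints form a Jordan curve. -/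
theorem IsArc.isJordanCurve_union {A B : Set M} {x y : M} (hA : IsArc A x y) (hB : IsArc B x y)
    (h : A ∩ B = {x, y}) : IsJordanCurve (A ∪ B) := by
  have : Fact ((0 : ℝ) < 1) := ⟨one_pos⟩
  obtain ⟨f, fc, fi, f0, f1, rfl⟩ := hA
  obtain ⟨g, gc, gi, g0, g1, rfl⟩ := hB.symm
  set k : ℝ → M := fun t => if t ≤ 1 / 2 then f (2 * t) else g (2 * t - 1) with hk
  have k1 : ∀ t ∈ Icc (0 : ℝ) (1 / 2), k t = f (2 * t) := fun t ht => if_pos ht.2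
  have k2 : ∀ t ∈ Icc (1 / 2 : ℝ) 1, k t = g (2 * t - 1) := fun t ht => by
    by_cases h : t ≤ 1 / 2
    · have : t = 1 / 2 := le_antisymm h ht.1
      subst this
      norm_num [hk, f1, g0]
    · simp only [hk, h, if_false]
  have m1 : MapsTo (fun t : ℝ => 2 * t) (Icc 0 (1 / 2)) (Icc 0 1) := fun t ht =>
    ⟨by linarith [ht.1], by linarith [ht.2]⟩
  have m2 : MapsTo (fun t : ℝ => 2 * t - 1) (Icc (1 / 2) 1) (Icc 0 1) := fun t ht =>
    ⟨by linarith [ht.1], by linarith [ht.2]⟩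
  have e1 : k '' Icc 0 (1 / 2) = f '' Icc 0 1 := by
    rw [image_congr k1]
    ext z
    constructor
    · rintro ⟨t, ht, rfl⟩
      exact ⟨_, m1 ht, rfl⟩
    · rintro ⟨t, ht, rfl⟩
      exact ⟨t / 2, ⟨by linarith [ht.1], by linarith [ht.2]⟩, by ring_nf⟩
  have e2 : k '' Icc (1 / 2) 1 = g '' Icc 0 1 := by
    rw [image_congr k2]
    ext z
    constructor
    · rintro ⟨t, ht, rfl⟩
      exact ⟨_, m2 ht, rfl⟩
    · rintro ⟨t, ht, rfl⟩
      exact ⟨(t + 1) / 2, ⟨by linarith [ht.1], by linarith [ht.2]⟩, by ring_nf⟩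
  have eu : Icc (0 : ℝ) (1 / 2) ∪ Icc (1 / 2) 1 = Icc 0 1 :=
    Icc_union_Icc_eq_Icc (by norm_num) (by norm_num)
  have kc : ContinuousOn k (Icc 0 1) := by
    rw [← eu]
    refine ContinuousOn.union_of_isClosed ?_ ?_ isClosed_Icc isClosed_Icc
    · exact ContinuousOn.congr (fc.comp (by fun_prop) m1) k1
    · exact ContinuousOn.congr (gc.comp (by fun_prop) m2) k2
  have k0 : k 0 = x := by rw [k1 0 (by norm_num)]; simp [f0]
  have k1' : k 1 = x := by rw [k2 1 (by norm_num)]; norm_num [g1]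
  have khalf : k (1 / 2) = y := by rw [k2 (1 / 2) (by norm_num)]; norm_num [g0]
  have i1 : InjOn k (Icc 0 (1 / 2)) := by
    intro s hs t ht hst
    rw [k1 s hs, k1 t ht] at hst
    linarith [fi (m1 hs) (m1 ht) hst]
  have i2 : InjOn k (Icc (1 / 2) 1) := by
    intro s hs t ht hst
    rw [k2 s hs, k2 t ht] at hst
    linarith [gi (m2 hs) (m2 ht) hst]
  have key : ∀ s ∈ Icc (0 : ℝ) (1 / 2), ∀ t ∈ Ico (1 / 2 : ℝ) 1, k s = k t → s = t := by
    intro s hs t ht hst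
    have ht' : t ∈ Icc (1 / 2 : ℝ) 1 := Ico_subset_Icc_self ht
    have hm : k s ∈ f '' Icc 0 1 ∩ g '' Icc 0 1 :=
      ⟨e1 ▸ mem_image_of_mem k hs, e2 ▸ hst ▸ mem_image_of_mem k ht'⟩
    rw [h] at hm
    rcases hm with hm | hm
    · have := i2 ht' (by norm_num) (by rw [← hst, hm, k1'] : k t = k 1)
      linarith [ht.2]
    · have h1 := i2 ht' (by norm_num) (by rw [← hst, hm, khalf] : k t = k (1 / 2))
      have h2 := i1 hs (by norm_num) (by rw [hm, khalf] : k s = k (1 / 2))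
      rw [h1, h2]
  have ki : InjOn k (Ico 0 1) := by
    intro s hs t ht hst
    rcases le_total s (1 / 2) with h1 | h1 <;> rcases le_total t (1 / 2) with h2 | h2
    · exact i1 ⟨hs.1, h1⟩ ⟨ht.1, h2⟩ hst
    · exact key s ⟨hs.1, h1⟩ t ⟨h2, ht.2⟩ hst
    · exact (key t ⟨ht.1, h2⟩ s ⟨h1, hs.2⟩ hst.symm).symm
    · exact i2 ⟨h1, hs.2.le⟩ ⟨h2, ht.2.le⟩ hst
  refine isJordanCurve_iff.2 ⟨AddCircle.liftIco 1 0 k, ?_, ?_, ?_⟩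
  · refine AddCircle.liftIco_continuous (by simp [k0, k1']) (by simpa using kc)
  · intro a b hab
    obtain ⟨s, hs, rfl⟩ := (AddCircle.coe_image_Ico_eq (1 : ℝ) 0).symm.subset (mem_univ a)
    obtain ⟨t, ht, rfl⟩ := (AddCircle.coe_image_Ico_eq (1 : ℝ) 0).symm.subset (mem_univ b)
    rw [AddCircle.liftIco_coe_apply hs, AddCircle.liftIco_coe_apply ht] at hab
    rw [ki (by simpa using hs) (by simpa using ht) hab]
  · rw [← e1, ← e2, ← image_union, eu]
    ext z
    constructor
    · rintro ⟨a, rfl⟩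
      obtain ⟨s, hs, rfl⟩ := (AddCircle.coe_image_Ico_eq (1 : ℝ) 0).symm.subset (mem_univ a)
      rw [AddCircle.liftIco_coe_apply hs]
      exact ⟨s, by simpa using Ico_subset_Icc_self hs, rfl⟩
    · rintro ⟨t, ht, rfl⟩
      rcases eq_or_lt_of_le ht.2 with rfl | h1
      · refine ⟨((0 : ℝ) : AddCircle (1 : ℝ)), ?_⟩
        rw [AddCircle.liftIco_coe_apply (by simp), k0, k1']
      · exact ⟨(t : AddCircle (1 : ℝ)), AddCircle.liftIco_coe_apply (by simpa using ⟨ht.1, h1⟩)⟩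

end Arcs

/-! ## Cyclic subsets -/

section Cyclic

variable {M : Type*} [MetricSpace M] {T : Set M}

theorem CycliclyConnected.exists_arc_through (hT : CycliclyConnected T) {s v t : M} (hs : s ∈ T)
    (hv : v ∈ T) (ht : t ∈ T) (hsv : s ≠ v) (hvt : v ≠ t) (hst : s ≠ t) :
    ∃ A B, IsArc A s v ∧ IsArc B v t ∧ A ∩ B = {v} ∧ A ⊆ T ∧ B ⊆ T := by
  obtain ⟨J, hJT, hJ, hsJ, hvJ⟩ := hT s hs v hv hsv
  obtain ⟨J', hJT', hJ', htJ', hvJ'⟩ := hT t ht v hv hvt.symm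
  -- an arc of `J` from `s` to `w` through `v`
  have through : ∀ w ∈ J, w ≠ s → w ≠ v → ∃ A B, IsArc A s v ∧ IsArc B v w ∧ A ∩ B = {v} ∧
      A ⊆ J ∧ B ⊆ J := by
    intro w hw hws hwv
    obtain ⟨P, Q, hP, hQ, hPQ, -⟩ := hJ.split hsJ hw hws.symm
    have : v ∈ P ∪ Q := hPQ ▸ hvJ
    rcases this with h | h
    · obtain ⟨A, B, hA, hB, hAB, hi⟩ := hP.split h hsv.symm hwv.symm
      have : P ⊆ J := hPQ ▸ subset_union_left
      exact ⟨A, B, hA, hB, hi, (hAB ▸ subset_union_left : A ⊆ P).trans this,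
        (hAB ▸ subset_union_right : B ⊆ P).trans this⟩
    · obtain ⟨A, B, hA, hB, hAB, hi⟩ := hQ.split h hsv.symm hwv.symm
      have : Q ⊆ J := hPQ ▸ subset_union_right
      exact ⟨A, B, hA, hB, hi, (hAB ▸ subset_union_left : A ⊆ Q).trans this,
        (hAB ▸ subset_union_right : B ⊆ Q).trans this⟩
  by_cases htJ : t ∈ J
  · obtain ⟨A, B, hA, hB, hi, h1, h2⟩ := through t htJ hst.symm hvt.symm
    exact ⟨A, B, hA, hB, hi, h1.trans hJT, h2.trans hJT⟩
  have : ∃ w ∈ J, w ≠ s ∧ ∃ C ⊆ T, IsArc C t w ∧ C ∩ J = {w} := by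
    obtain ⟨B₁, B₂, hB₁, hB₂, hU, hI⟩ := hJ'.split htJ' hvJ' hvt.symm
    obtain ⟨w₁, hw₁, C₁, hC₁, hC₁a, hC₁J⟩ := hB₁.first_hit hJ.isClosed htJ ⟨v, hB₁.right_mem, hvJ⟩
    obtain ⟨w₂, hw₂, C₂, hC₂, hC₂a, hC₂J⟩ := hB₂.first_hit hJ.isClosed htJ ⟨v, hB₂.right_mem, hvJ⟩
    by_cases h1 : w₁ = s
    · refine ⟨w₂, hw₂, ?_, C₂, hC₂.trans ((hU ▸ subset_union_right).trans hJT'), hC₂a, hC₂J⟩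
      intro h2
      have : s ∈ B₁ ∩ B₂ := ⟨h1 ▸ hC₁ hC₁a.right_mem, h2 ▸ hC₂ hC₂a.right_mem⟩
      rw [hI] at this
      rcases this with h | h
      · exact hst h
      · exact hsv h
    · exact ⟨w₁, hw₁, h1, C₁, hC₁.trans ((hU ▸ subset_union_left).trans hJT'), hC₁a, hC₁J⟩
  obtain ⟨w, hw, hws, C, hCT, hC, hCJ⟩ := this
  by_cases hwv : w = v
  · subst hwv
    obtain ⟨P, Q, hP, hQ, hPQ, -⟩ := hJ.split hsJ hw hsv
    have hPJ : P ⊆ J := hPQ ▸ subset_union_left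
    refine ⟨P, C, hP, hC.symm, ?_, hPJ.trans hJT, hCT⟩
    apply Subset.antisymm
    · rw [← hCJ]; exact fun z hz => ⟨hz.2, hPJ hz.1⟩
    · rintro _ rfl; exact ⟨hP.right_mem, hC.right_mem⟩
  · obtain ⟨A, B, hA, hB, hi, h1, h2⟩ := through w hw hws hwv
    have hBC : B ∩ C = {w} := by
      apply Subset.antisymm
      · rw [← hCJ]; exact fun z hz => ⟨hz.2, h2 hz.1⟩
      · rintro _ rfl; exact ⟨hB.right_mem, hC.right_mem⟩
    refine ⟨A, B ∪ C, hA, hB.concat hC.symm hBC, ?_, h1.trans hJT,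
      union_subset (h2.trans hJT) hCT⟩
    rw [inter_union_distrib_left, hi]
    apply Subset.antisymm
    · rintro z (hz | hz)
      · exact hz
      · exfalso
        have : z ∈ C ∩ J := ⟨hz.2, h1 hz.1⟩
        rw [hCJ, mem_singleton_iff] at this
        subst this
        have : z ∈ A ∩ B := ⟨hz.1, hB.right_mem⟩
        rw [hi] at this
        exact hwv this
    · exact subset_union_left

theorem CycliclyConnected.union_jordan (hT : CycliclyConnected T) {J : Set M}
    (hJ : IsJordanCurve J) (h : (T ∩ J).Nontrivial) : CycliclyConnected (T ∪ J) := by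
  obtain ⟨p, hp, q, hq, hpq⟩ := h
  have key : ∀ t ∈ T, t ∉ J → ∀ s ∈ J, ∃ K ⊆ T ∪ J, IsJordanCurve K ∧ t ∈ K ∧ s ∈ K := by
    intro t ht htJ s hs
    have hpt : p ≠ t := by rintro rfl; exact htJ hp.2
    have hqt : q ≠ t := by rintro rfl; exact htJ hq.2
    obtain ⟨A, B, hA, hB, hAB, hAT, hBT⟩ :=
      hT.exists_arc_through hp.1 ht hq.1 hpt hqt.symm hpq
    obtain ⟨w₁, hw₁, C₁, hC₁, hC₁a, hC₁J⟩ :=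
      hA.symm.first_hit hJ.isClosed htJ ⟨p, hA.left_mem, hp.2⟩
    obtain ⟨w₂, hw₂, C₂, hC₂, hC₂a, hC₂J⟩ :=
      hB.first_hit hJ.isClosed htJ ⟨q, hB.right_mem, hq.2⟩
    have hI : C₁ ∩ C₂ = {t} := by
      apply Subset.antisymm
      · rw [← hAB]; exact inter_subset_inter hC₁ hC₂
      · rintro _ rfl; exact ⟨hC₁a.left_mem, hC₂a.left_mem⟩
    have hw : w₁ ≠ w₂ := by
      rintro rfl
      have : w₁ ∈ C₁ ∩ C₂ := ⟨hC₁a.right_mem, hC₂a.right_mem⟩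
      rw [hI] at this
      exact htJ (this ▸ hw₁)
    have hE : IsArc (C₁ ∪ C₂) w₁ w₂ := hC₁a.symm.concat hC₂a hI
    have hET : C₁ ∪ C₂ ⊆ T := union_subset (hC₁.trans hAT) (hC₂.trans hBT)
    have hEJ : (C₁ ∪ C₂) ∩ J = {w₁, w₂} := by
      rw [union_inter_distrib_right, hC₁J, hC₂J]; rfl
    obtain ⟨P, Q, hP, hQ, hPQ, -⟩ := hJ.split hw₁ hw₂ hw
    have aux : ∀ P, P ⊆ J → IsArc P w₁ w₂ → IsJordanCurve ((C₁ ∪ C₂) ∪ P) := by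
      intro P hPJ hP
      refine hE.isJordanCurve_union hP (Subset.antisymm ?_ ?_)
      · rw [← hEJ]; exact inter_subset_inter_right _ hPJ
      · rintro z (rfl | rfl)
        · exact ⟨hE.left_mem, hP.left_mem⟩
        · exact ⟨hE.right_mem, hP.right_mem⟩
    have : s ∈ P ∪ Q := hPQ ▸ hs
    rcases this with h | h
    · have hPJ : P ⊆ J := hPQ ▸ subset_union_left
      exact ⟨_, union_subset_union hET hPJ, aux P hPJ hP, Or.inl (Or.inl hC₁a.left_mem), Or.inr h⟩
    · have hPJ : Q ⊆ J := hPQ ▸ subset_union_right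
      exact ⟨_, union_subset_union hET hPJ, aux Q hPJ hQ, Or.inl (Or.inl hC₁a.left_mem), Or.inr h⟩
  intro x hx y hy hxy
  by_cases hxJ : x ∈ J <;> by_cases hyJ : y ∈ J
  · exact ⟨J, subset_union_right, hJ, hxJ, hyJ⟩
  · obtain ⟨K, h1, h2, h3, h4⟩ := key y (hy.resolve_right hyJ) hyJ x hxJ
    exact ⟨K, h1, h2, h4, h3⟩
  · obtain ⟨K, h1, h2, h3, h4⟩ := key x (hx.resolve_right hxJ) hxJ y hyJ
    exact ⟨K, h1, h2, h3, h4⟩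
  · obtain ⟨K, h1, h2⟩ := hT x (hx.resolve_right hxJ) y (hy.resolve_right hyJ) hxy
    exact ⟨K, h1.trans subset_union_left, h2⟩

theorem IsMaximalCyclic.jordan_subset (hT : IsMaximalCyclic T) {J : Set M}
    (hJ : IsJordanCurve J) (h : (T ∩ J).Nontrivial) : J ⊆ T := by
  rw [hT.2.2 _ (hT.2.1.union_jordan hJ h) subset_union_left]
  exact subset_union_right

theorem IsMaximalCyclic.arc_subset (hT : IsMaximalCyclic T) {L : Set M} {p q : M}
    (hL : IsArc L p q) (hp : p ∈ T) (hq : q ∈ T) : L ⊆ T := by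
  intro x hx
  by_contra hxT
  obtain ⟨J, hJT, hJ, hpJ, hqJ⟩ := hT.2.1 p hp q hq hL.ne
  have hxJ : x ∉ J := fun h => hxT (hJT h)
  obtain ⟨A, B, hA, hB, hAB, hI⟩ := hL.split hx (by rintro rfl; exact hxT hp)
    (by rintro rfl; exact hxT hq)
  obtain ⟨w₁, hw₁, C₁, hC₁, hC₁a, hC₁J⟩ :=
    hA.symm.first_hit hJ.isClosed hxJ ⟨p, hA.left_mem, hpJ⟩
  obtain ⟨w₂, hw₂, C₂, hC₂, hC₂a, hC₂J⟩ :=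
    hB.first_hit hJ.isClosed hxJ ⟨q, hB.right_mem, hqJ⟩
  have hI' : C₁ ∩ C₂ = {x} := by
    apply Subset.antisymm
    · rw [← hI]; exact inter_subset_inter hC₁ hC₂
    · rintro _ rfl; exact ⟨hC₁a.left_mem, hC₂a.left_mem⟩
  have hw : w₁ ≠ w₂ := by
    rintro rfl
    have : w₁ ∈ C₁ ∩ C₂ := ⟨hC₁a.right_mem, hC₂a.right_mem⟩
    rw [hI'] at this
    exact hxJ (this ▸ hw₁)
  have hE : IsArc (C₁ ∪ C₂) w₁ w₂ := hC₁a.symm.concat hC₂a hI'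
  obtain ⟨P, Q, hP, hQ, hPQ, -⟩ := hJ.split hw₁ hw₂ hw
  have hPJ : P ⊆ J := hPQ ▸ subset_union_left
  have hJor : IsJordanCurve ((C₁ ∪ C₂) ∪ P) := by
    refine hE.isJordanCurve_union hP (Subset.antisymm ?_ ?_)
    · have : (C₁ ∪ C₂) ∩ J = {w₁, w₂} := by
        rw [union_inter_distrib_right, hC₁J, hC₂J]; rfl
      rw [← this]; exact inter_subset_inter_right _ hPJ
    · rintro z (rfl | rfl)
      · exact ⟨hE.left_mem, hP.left_mem⟩
      · exact ⟨hE.right_mem, hP.right_mem⟩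
  have := hT.jordan_subset hJor ⟨w₁, ⟨hJT hw₁, Or.inl hE.left_mem⟩, w₂,
    ⟨hJT hw₂, Or.inl hE.right_mem⟩, hw⟩
  exact hxT (this (Or.inl (Or.inl hC₁a.left_mem)))

/-- Nearby points are joined by arcs in small balls. -/
def LocallyArcJoined (M : Type*) [MetricSpace M] : Prop :=
  ∀ d : M, ∃ r > 0, ∀ d', d' ≠ d → dist d' d < r → ∃ A ⊆ closedBall d (dist d' d), IsArc A d d'

/-- No arc leaves and reenters the closure of a maximal cyclic set. -/
theorem IsMaximalCyclic.not_ear (hT : IsMaximalCyclic T) (hM : LocallyArcJoined M) {A : Set M}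
    {z₁ z₂ : M} (hA : IsArc A z₁ z₂) (hAT : A ∩ closure T = {z₁, z₂}) : False := by
  have h1 : z₁ ∈ closure T := (hAT.symm.subset (Or.inl rfl)).2
  have h2 : z₂ ∈ closure T := (hAT.symm.subset (Or.inr rfl)).2
  set r := dist z₁ z₂ / 3 with hr
  have hr0 : 0 < r := by have := dist_pos.2 hA.ne; positivity
  have near : ∀ z ∈ closure T, ∃ t ∈ T, ∃ G ⊆ closedBall z r, IsPreconnected G ∧
      (t = z ∧ G = {z} ∨ IsArc G z t) := by
    intro z hz
    obtain ⟨r₀, hr₀, h⟩ := hM z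
    obtain ⟨t, ht, hd⟩ := Metric.mem_closure_iff.1 hz (min r r₀) (lt_min hr0 hr₀)
    rw [dist_comm] at hd
    by_cases htz : t = z
    · exact ⟨t, ht, {z}, by simp [hr0.le], isPreconnected_singleton, Or.inl ⟨htz, rfl⟩⟩
    · obtain ⟨G, hG, hGa⟩ := h t htz (hd.trans_le (min_le_right _ _))
      exact ⟨t, ht, G, hG.trans (closedBall_subset_closedBall (hd.le.trans (min_le_left _ _))),
        hGa.isPreconnected, Or.inr hGa⟩
  obtain ⟨t₁, ht₁, G₁, hG₁, -, hG₁'⟩ := near z₁ h1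
  obtain ⟨t₂, ht₂, G₂, hG₂, -, hG₂'⟩ := near z₂ h2
  have tG₁ : t₁ ∈ G₁ := by
    rcases hG₁' with ⟨rfl, rfl⟩ | h
    · rfl
    · exact h.right_mem
  have tG₂ : t₂ ∈ G₂ := by
    rcases hG₂' with ⟨rfl, rfl⟩ | h
    · rfl
    · exact h.right_mem
  have hdisj : Disjoint (closedBall z₁ r) (closedBall z₂ r) :=
    closedBall_disjoint_closedBall (by have := dist_pos.2 hA.ne; linarith)
  have hz12 : t₁ ≠ z₂ := by
    rintro rfl
    exact hdisj.le_bot ⟨hG₁ tG₁, by simp [hr0.le]⟩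
  have ht12 : t₁ ≠ t₂ := by
    rintro rfl
    exact hdisj.le_bot ⟨hG₁ tG₁, hG₂ tG₂⟩
  obtain ⟨S₁, hS₁, hS₁a⟩ : ∃ S ⊆ G₁ ∪ A, IsArc S t₁ z₂ := by
    rcases hG₁' with ⟨rfl, rfl⟩ | h
    · exact ⟨A, subset_union_right, hA⟩
    · exact h.symm.exists_trans hA hz12
  obtain ⟨S, hS, hSa⟩ : ∃ S ⊆ S₁ ∪ G₂, IsArc S t₁ t₂ := by
    rcases hG₂' with ⟨rfl, rfl⟩ | h
    · exact ⟨S₁, subset_union_left, hS₁a⟩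
    · exact hS₁a.exists_trans h ht12
  have hST := hT.arc_subset hSa ht₁ ht₂
  have hcov : S ⊆ closedBall z₁ r ∪ closedBall z₂ r := by
    intro x hx
    rcases hS hx with h | h
    · rcases hS₁ h with h | h
      · exact Or.inl (hG₁ h)
      · have : x ∈ A ∩ closure T := ⟨h, subset_closure (hST hx)⟩
        rw [hAT] at this
        rcases this with rfl | rfl
        · left; simp [hr0.le]
        · right; simp [hr0.le]
    · exact Or.inr (hG₂ h)
  obtain ⟨x, hx, hx'⟩ := isPreconnected_closed_iff.1 hSa.isPreconnected _ _ isClosed_closedBall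
    isClosed_closedBall hcov ⟨t₁, hSa.left_mem, hG₁ tG₁⟩ ⟨t₂, hSa.right_mem, hG₂ tG₂⟩
  exact hdisj.le_bot hx'

/-- `z` is the point through which `w` is attached to `closure T`. -/
def Attached (T : Set M) (w z : M) : Prop := ∃ A, IsArc A w z ∧ A ∩ closure T = {z}

theorem Attached.unique (hT : IsMaximalCyclic T) (hM : LocallyArcJoined M) {w z z' : M}
    (h : Attached T w z) (h' : Attached T w z') : z = z' := by
  obtain ⟨A, hA, hAT⟩ := h
  obtain ⟨A', hA', hAT'⟩ := h'
  by_contra hne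
  obtain ⟨S, hS, hSa⟩ := hA.symm.exists_trans hA' hne
  refine hT.not_ear hM hSa (Subset.antisymm ?_ ?_)
  · rintro x ⟨hx, hxT⟩
    rcases hS hx with h | h
    · exact Or.inl (hAT.subset ⟨h, hxT⟩)
    · exact Or.inr (hAT'.subset ⟨h, hxT⟩)
  · rintro x (rfl | rfl)
    · exact ⟨hSa.left_mem, (hAT.symm.subset rfl).2⟩
    · exact ⟨hSa.right_mem, (hAT'.symm.subset rfl).2⟩

theorem Attached.trans {w w' z : M} {B : Set M} (h : Attached T w z) (hB : IsArc B w' w)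
    (hBT : Disjoint B (closure T)) : Attached T w' z := by
  obtain ⟨A, hA, hAT⟩ := h
  have hz : z ∈ closure T := (hAT.symm.subset rfl).2
  have hne : w' ≠ z := by
    rintro rfl; exact hBT.le_bot ⟨hB.left_mem, hz⟩
  obtain ⟨S, hS, hSa⟩ := hB.exists_trans hA hne
  refine ⟨S, hSa, Subset.antisymm ?_ ?_⟩
  · rintro x ⟨hx, hxT⟩
    rcases hS hx with h | h
    · exact (hBT.le_bot ⟨h, hxT⟩).elim
    · exact hAT.subset ⟨h, hxT⟩
  · rintro _ rfl
    exact ⟨hSa.right_mem, hz⟩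

/-- Points near `f ∈ closure T` are attached near `f`. -/
theorem LocallyArcJoined.exists_attached (hM : LocallyArcJoined M) {f : M}
    (hf : f ∈ closure T) :
    ∃ r > 0, ∀ w, w ∉ closure T → dist w f < r → ∃ z, Attached T w z ∧ dist z f ≤ dist w f := by
  obtain ⟨r, hr, h⟩ := hM f
  refine ⟨r, hr, fun w hw hd => ?_⟩
  have hwf : w ≠ f := by rintro rfl; exact hw hf
  obtain ⟨A, hA, hAa⟩ := h w hwf hd
  obtain ⟨z, hz, B, hB, hBa, hBT⟩ :=
    hAa.symm.first_hit isClosed_closure hw ⟨f, hAa.left_mem, hf⟩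
  exact ⟨z, ⟨B, hBa, hBT⟩, hA (hB hBa.right_mem)⟩

theorem IsMaximalCyclic.isPreconnected_inter (hT : IsMaximalCyclic T) (hM : LocallyArcJoined M)
    {C : Set M} (hC : IsClosed C) (hCc : IsPreconnected C) : IsPreconnected (closure T ∩ C) := by
  rw [isPreconnected_closed_iff]
  intro t t' ht ht' hcov hne hne'
  by_contra hdis
  -- points of `C` off `closure T` are attached at points of `C`
  have att : ∀ w ∈ C, w ∉ closure T → ∃ z ∈ closure T ∩ C, Attached T w z := by
    intro w hwC hwT
    set O : Set M := {w' | w' = w ∨ ∃ B, IsArc B w w' ∧ Disjoint B (closure T)} with hO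
    have hOT : ∀ w' ∈ O, w' ∉ closure T := by
      rintro w' (rfl | ⟨B, hB, hBT⟩)
      · exact hwT
      · exact fun h => hBT.le_bot ⟨hB.right_mem, h⟩
    have step : ∀ u, u ∉ closure T → ∃ r > 0, ∀ v, dist v u < r → (u ∈ O ↔ v ∈ O) := by
      intro u hu
      obtain ⟨r, hr, h⟩ := hM u
      obtain ⟨r', hr', h'⟩ := Metric.isOpen_iff.1 isClosed_closure.isOpen_compl u hu
      refine ⟨min r r', lt_min hr hr', fun v hv => ?_⟩
      by_cases hvu : v = u
      · rw [hvu]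
      obtain ⟨A, hA, hAa⟩ := h v hvu (hv.trans_le (min_le_left _ _))
      have hAT : Disjoint A (closure T) := by
        rw [Set.disjoint_left]
        intro x hx
        exact h' ((mem_closedBall.1 (hA hx)).trans_lt (hv.trans_le (min_le_right _ _)))
      have main : ∀ u v, ∀ A, IsArc A u v → Disjoint A (closure T) → u ∈ O → v ∈ O := by
        rintro u v A hA hAT (rfl | ⟨B, hB, hBT⟩)
        · exact Or.inr ⟨A, hA, hAT⟩
        · by_cases hwv : v = w
          · exact Or.inl hwv
          · obtain ⟨S, hS, hSa⟩ := hB.exists_trans hA (Ne.symm hwv)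
            exact Or.inr ⟨S, hSa, (hBT.union_left hAT).mono_left hS⟩
      exact ⟨main u v A hAa hAT, main v u A hAa.symm hAT⟩
    have hOopen : IsOpen O := by
      rw [Metric.isOpen_iff]
      intro u hu
      obtain ⟨r, hr, h⟩ := step u (hOT u hu)
      exact ⟨r, hr, fun v hv => (h v hv).1 hu⟩
    have : ∃ f ∈ C, f ∈ closure O ∧ f ∉ O := by
      by_contra! hcon
      obtain ⟨x, hx, -⟩ := hne
      have hsub := hCc.subset_of_closure_inter_subset hOopen ⟨w, hwC, Or.inl rfl⟩
        (fun y hy => hcon y hy.2 hy.1)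
      exact hOT x (hsub hx.2) hx.1
    obtain ⟨f, hfC, hfO, hfO'⟩ := this
    have hfT : f ∈ closure T := by
      by_contra hf
      obtain ⟨r, hr, h⟩ := step f hf
      obtain ⟨v, hv, hd⟩ := Metric.mem_closure_iff.1 hfO r hr
      exact hfO' ((h v (by rwa [dist_comm])).2 hv)
    refine ⟨f, ⟨hfT, hfC⟩, ?_⟩
    obtain ⟨r, hr, h⟩ := hM.exists_attached hfT
    have near : ∀ ε > 0, ∃ z, Attached T w z ∧ dist z f < ε := by
      intro ε hε
      obtain ⟨v, hv, hd⟩ := Metric.mem_closure_iff.1 hfO (min r ε) (lt_min hr hε)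
      rw [dist_comm] at hd
      obtain ⟨z, hz, hzd⟩ := h v (hOT v hv) (hd.trans_le (min_le_left _ _))
      refine ⟨z, ?_, hzd.trans_lt (hd.trans_le (min_le_right _ _))⟩
      rcases hv with rfl | ⟨B, hB, hBT⟩
      · exact hz
      · exact hz.trans hB hBT
    obtain ⟨z, hz, -⟩ := near 1 one_pos
    have : z = f := by
      refine dist_le_zero.1 (le_of_forall_pos_lt_add fun ε hε => ?_)
      obtain ⟨z', hz', hd⟩ := near ε hε
      rw [hz.unique hT hM hz']; linarith
    exact this ▸ hz
  set Q : Set M → Set M := fun t =>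
    {w | w ∈ C ∧ (w ∈ closure T ∧ w ∈ t ∨ w ∉ closure T ∧ ∃ z ∈ closure T ∩ C ∩ t, Attached T w z)}
  have hQ : ∀ t, IsClosed t → IsClosed (Q t) := by
    intro t ht
    refine isClosed_of_closure_subset fun w hw => ?_
    have hwC : w ∈ C := hC.closure_subset_iff.2 (fun x hx => hx.1) hw
    by_cases hwT : w ∈ closure T
    · refine ⟨hwC, Or.inl ⟨hwT, ?_⟩⟩
      rw [← ht.closure_eq, Metric.mem_closure_iff]
      intro ε hε
      obtain ⟨r, hr, h⟩ := hM.exists_attached hwT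
      obtain ⟨v, hv, hd⟩ := Metric.mem_closure_iff.1 hw (min r ε) (lt_min hr hε)
      rcases hv.2 with ⟨h1, h2⟩ | ⟨h1, z, hz, hza⟩
      · exact ⟨v, h2, hd.trans_le (min_le_right _ _)⟩
      · rw [dist_comm] at hd
        obtain ⟨z', hz', hzd⟩ := h v h1 (hd.trans_le (min_le_left _ _))
        rw [hz'.unique hT hM hza] at hzd
        exact ⟨z, hz.2, by rw [dist_comm]; exact hzd.trans_lt (hd.trans_le (min_le_right _ _))⟩
    · refine ⟨hwC, Or.inr ⟨hwT, ?_⟩⟩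
      obtain ⟨r, hr, h⟩ := hM w
      obtain ⟨r', hr', h'⟩ := Metric.isOpen_iff.1 isClosed_closure.isOpen_compl w hwT
      obtain ⟨v, hv, hd⟩ := Metric.mem_closure_iff.1 hw (min r r') (lt_min hr hr')
      rw [dist_comm] at hd
      have hvT : v ∉ closure T := h' (hd.trans_le (min_le_right _ _))
      obtain ⟨z, hz, hza⟩ := (hv.2.resolve_left (fun h => hvT h.1)).2
      refine ⟨z, hz, ?_⟩
      by_cases hvw : v = w
      · exact hvw ▸ hza
      obtain ⟨A, hA, hAa⟩ := h v hvw (hd.trans_le (min_le_left _ _))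
      refine hza.trans hAa (Set.disjoint_left.2 fun x hx => ?_)
      exact h' ((mem_closedBall.1 (hA hx)).trans_lt (hd.trans_le (min_le_right _ _)))
  have hCQ : C ⊆ Q t ∪ Q t' := by
    intro w hw
    by_cases hwT : w ∈ closure T
    · rcases hcov ⟨hwT, hw⟩ with h | h
      · exact Or.inl ⟨hw, Or.inl ⟨hwT, h⟩⟩
      · exact Or.inr ⟨hw, Or.inl ⟨hwT, h⟩⟩
    · obtain ⟨z, hz, hza⟩ := att w hw hwT
      rcases hcov hz with h | h
      · exact Or.inl ⟨hw, Or.inr ⟨hwT, z, ⟨hz, h⟩, hza⟩⟩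
      · exact Or.inr ⟨hw, Or.inr ⟨hwT, z, ⟨hz, h⟩, hza⟩⟩
  obtain ⟨x, hx, hxt⟩ := hne
  obtain ⟨y, hy, hyt⟩ := hne'
  obtain ⟨w, hw, h1, h2⟩ := isPreconnected_closed_iff.1 hCc _ _ (hQ t ht) (hQ t' ht') hCQ
    ⟨x, hx.2, hx.2, Or.inl ⟨hx.1, hxt⟩⟩ ⟨y, hy.2, hy.2, Or.inl ⟨hy.1, hyt⟩⟩
  apply hdis
  rcases h1.2 with ⟨a, b⟩ | ⟨a, z, hz, hza⟩ <;> rcases h2.2 with ⟨a', b'⟩ | ⟨a', z', hz', hza'⟩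
  · exact ⟨w, ⟨a, hw⟩, b, b'⟩
  · exact absurd a a'
  · exact absurd a' a
  · have := hza.unique hT hM hza'
    subst this
    exact ⟨z, hz.1, hz.2, hz'.2⟩

/-- No point separates two others in the closure of a maximal cyclic set. -/
theorem IsMaximalCyclic.exists_connected_avoiding (hT : IsMaximalCyclic T)
    (hM : LocallyArcJoined M) {x y z : M} (hx : x ∈ closure T) (hy : y ∈ closure T) (hxz : z ≠ x)
    (hyz : z ≠ y) : ∃ C, IsCompact C ∧ IsPreconnected C ∧ x ∈ C ∧ y ∈ C ∧ z ∉ C := by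
  have near : ∀ x ∈ closure T, z ≠ x → ∃ t ∈ T, ∃ G, IsCompact G ∧ IsPreconnected G ∧ t ∈ G ∧
      x ∈ G ∧ z ∉ G := by
    intro x hx hxz
    obtain ⟨r₀, hr₀, h⟩ := hM x
    obtain ⟨t, ht, hd⟩ := Metric.mem_closure_iff.1 hx (min (dist z x) r₀)
      (lt_min (dist_pos.2 hxz) hr₀)
    rw [dist_comm] at hd
    by_cases htx : t = x
    · exact ⟨t, ht, {x}, isCompact_singleton, isPreconnected_singleton, htx, rfl, hxz⟩
    · obtain ⟨G, hG, hGa⟩ := h t htx (hd.trans_le (min_le_right _ _))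
      refine ⟨t, ht, G, hGa.isCompact, hGa.isPreconnected, hGa.right_mem, hGa.left_mem, ?_⟩
      intro hz
      have := mem_closedBall.1 (hG hz)
      linarith [hd.trans_le (min_le_left _ _)]
  obtain ⟨t, ht, G, hGc, hGp, htG, hxG, hzG⟩ := near x hx hxz
  obtain ⟨s, hs, H, hHc, hHp, hsH, hyH, hzH⟩ := near y hy hyz
  have : ∃ K, IsCompact K ∧ IsPreconnected K ∧ t ∈ K ∧ s ∈ K ∧ z ∉ K := by
    have htz : z ≠ t := by rintro rfl; exact hzG htG
    have hsz : z ≠ s := by rintro rfl; exact hzH hsH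
    by_cases hts : t = s
    · subst hts
      exact ⟨{t}, isCompact_singleton, isPreconnected_singleton, rfl, rfl, htz⟩
    obtain ⟨J, hJT, hJ, htJ, hsJ⟩ := hT.2.1 t ht s hs hts
    obtain ⟨A, B, hA, hB, -, hI⟩ := hJ.split htJ hsJ hts
    by_cases hzA : z ∈ A
    · refine ⟨B, hB.isCompact, hB.isPreconnected, hB.left_mem, hB.right_mem, fun hzB => ?_⟩
      rcases hI.subset ⟨hzA, hzB⟩ with h | h
      · exact htz h
      · exact hsz h
    · exact ⟨A, hA.isCompact, hA.isPreconnected, hA.left_mem, hA.right_mem, hzA⟩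
  obtain ⟨K, hKc, hKp, htK, hsK, hzK⟩ := this
  refine ⟨G ∪ K ∪ H, (hGc.union hKc).union hHc, ?_, Or.inl (Or.inl hxG), Or.inr hyH, ?_⟩
  · exact (hGp.union t htG htK hKp).union s (Or.inr hsK) hsH hHp
  · rintro ((h | h) | h)
    · exact hzG h
    · exact hzK h
    · exact hzH h

end Cyclic

/-! ## A characterization of the circle -/

section CircleCharacterization

theorem IsPreconnected.of_union_inter_singleton {A : Type*} [TopologicalSpace A] {L R : Set A}
    {z : A} (hL : IsClosed L) (hR : IsClosed R) (h : IsPreconnected (L ∪ R)) (hz : L ∩ R = {z}) :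
    IsPreconnected L := by
  have key : ∀ t t', IsClosed t → IsClosed t' → L ⊆ t ∪ t' → (L ∩ t).Nonempty →
      (L ∩ t').Nonempty → z ∈ t → (L ∩ (t ∩ t')).Nonempty := by
    intro t t' ht ht' hcov hne hne' hzt
    obtain ⟨w, hw, hw1, hw2⟩ := isPreconnected_closed_iff.1 h ((L ∩ t) ∪ R) (L ∩ t')
      ((hL.inter ht).union hR) (hL.inter ht') (by
        rintro w (hw | hw)
        · rcases hcov hw with h | h
          · exact Or.inl (Or.inl ⟨hw, h⟩)
          · exact Or.inr ⟨hw, h⟩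
        · exact Or.inl (Or.inr hw))
      (hne.mono fun w hw => ⟨Or.inl hw.1, Or.inl hw⟩)
      (hne'.mono fun w hw => ⟨Or.inl hw.1, hw⟩)
    rcases hw1 with hw1 | hw1
    · exact ⟨w, hw1.1, hw1.2, hw2.2⟩
    · have : w ∈ L ∩ R := ⟨hw2.1, hw1⟩
      rw [hz, mem_singleton_iff] at this
      subst this
      exact ⟨w, hw2.1, hzt, hw2.2⟩
  rw [isPreconnected_closed_iff]
  intro t t' ht ht' hcov hne hne'
  have hzL : z ∈ L := (hz.symm.subset rfl).1
  rcases hcov hzL with h | h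
  · exact key t t' ht ht' hcov hne hne' h
  · rw [inter_comm t t']
    exact key t' t ht' ht (by rwa [union_comm]) hne' hne h

theorem exists_cut_function {A : Type*} [MetricSpace A] [CompactSpace A] [PreconnectedSpace A]
    {x y : A} (hcut : ∀ z, z ≠ x → z ≠ y → ∃ L R, IsClosed L ∧ IsClosed R ∧
      L ∪ R = univ ∧ L ∩ R = {z} ∧ x ∈ L ∧ y ∈ R) :
    ∃ h : A → ℝ, Continuous h ∧ Function.Injective h ∧ ∀ z, h z ∈ Icc (h x) (h y) := by
  have hcut' : ∀ z, ∃ L R, IsClosed L ∧ IsClosed R ∧ L ∪ R = univ ∧ L ∩ R = {z} ∧ x ∈ L ∧ y ∈ R := by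
    intro z
    by_cases hzx : z = x
    · exact ⟨{x}, univ, isClosed_singleton, isClosed_univ, by simp, by simp [hzx], rfl, trivial⟩
    by_cases hzy : z = y
    · exact ⟨univ, {y}, isClosed_univ, isClosed_singleton, by simp, by simp [hzy], trivial, rfl⟩
    exact hcut z hzx hzy
  choose L R hL hR hU hI hxL hyR using hcut'
  have zL : ∀ z, z ∈ L z := fun z => ((hI z).symm.subset rfl).1
  have zR : ∀ z, z ∈ R z := fun z => ((hI z).symm.subset rfl).2
  have hc : ∀ z w, w ∈ L z ∨ w ∈ R z := fun z w => (hU z).symm.subset (mem_univ w)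
  have huniq : ∀ z w, w ∈ L z → w ∈ R z → w = z := fun z w h1 h2 => (hI z).subset ⟨h1, h2⟩
  have pL : ∀ z, IsPreconnected (L z) := fun z =>
    .of_union_inter_singleton (hL z) (hR z) (by rw [hU]; exact isPreconnected_univ) (hI z)
  have pR : ∀ z, IsPreconnected (R z) := fun z =>
    .of_union_inter_singleton (hR z) (hL z) (by rw [union_comm, hU]; exact isPreconnected_univ)
      (by rw [inter_comm, hI])
  have side : ∀ (P : Set A) z, IsPreconnected P → z ∉ P → P ⊆ L z ∨ P ⊆ R z := by
    intro P z hP hz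
    by_contra! h
    obtain ⟨⟨a, ha, ha'⟩, ⟨b, hb, hb'⟩⟩ := h.imp not_subset.1 not_subset.1
    obtain ⟨w, hw, h1, h2⟩ := isPreconnected_closed_iff.1 hP _ _ (hL z) (hR z)
      (fun w _ => hc z w) ⟨b, hb, (hc z b).resolve_right hb'⟩ ⟨a, ha, (hc z a).resolve_left ha'⟩
    exact hz (huniq z w h1 h2 ▸ hw)
  have hRR : ∀ z z', z' ∈ L z → R z ⊆ R z' := by
    intro z z' hz
    by_cases h : z' = z
    · rw [h]
    have hzR : z' ∉ R z := fun h' => h (huniq z z' hz h')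
    refine (side _ z' (pR z) hzR).resolve_left fun hs => ?_
    have : y = z' := huniq z' y (hs (hyR z)) (hyR z')
    exact hzR (this ▸ hyR z)
  have hLL' : ∀ z z', z' ∈ R z → L z ⊆ L z' := by
    intro z z' hz
    by_cases h : z' = z
    · rw [h]
    have hzL : z' ∉ L z := fun h' => h (huniq z z' h' hz)
    refine (side _ z' (pL z) hzL).resolve_right fun hs => ?_
    have : x = z' := huniq z' x (hxL z') (hs (hxL z))
    exact hzL (this ▸ hxL z)
  have hLL : ∀ z z', z' ∈ L z → L z' ⊆ L z := fun z z' hz => hLL' z' z (hRR z z' hz (zR z))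
  have anti : ∀ z z', z' ∈ L z → z ∈ L z' → z = z' := by
    intro z z' h1 h2
    exact huniq z' z h2 (hRR z z' h1 (zR z))
  have tot : ∀ z z', z' ∈ L z ∨ z ∈ L z' := fun z z' => (hc z z').imp id fun h => hLL' z z' h (zL z)
  have nL : ∀ z z', z' ∉ L z → z ∈ L z' := fun z z' h => (tot z z').resolve_left h
  have between : ∀ t s, s ∉ L t → ∃ u, u ≠ t ∧ u ≠ s ∧ u ∈ L s ∧ t ∈ L u := by
    intro t s hst
    by_contra! hcon
    have hts : t ∈ L s := nL t s hst
    have hcov : (univ : Set A) ⊆ L t ∪ R s := by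
      intro z _
      by_contra! hz
      rw [mem_union, not_or] at hz
      have h1 : t ∈ L z := nL t z hz.1
      have h2 : z ∈ L s := (hc s z).resolve_right hz.2
      exact hcon z (by rintro rfl; exact hz.1 (zL z)) (by rintro rfl; exact hz.2 (zR z)) h2 h1
    obtain ⟨u, -, h1, h2⟩ := isPreconnected_closed_iff.1 (isPreconnected_univ (α := A)) _ _
      (hL t) (hR s) hcov ⟨t, trivial, zL t⟩ ⟨s, trivial, zR s⟩
    exact hst (huniq s u (hLL s t hts h1) h2 ▸ h1)
  have nonempty : Nonempty A := ⟨x⟩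
  let d : ℕ → A := TopologicalSpace.denseSeq A
  have gcont : ∀ a : A, Continuous fun t => infDist a (L t) := by
    intro a
    rw [continuous_iff_lower_upperSemicontinuous]
    constructor
    · rw [lowerSemicontinuous_iff_isOpen_preimage]
      intro c
      rw [← isClosed_compl_iff]
      refine isClosed_of_closure_subset fun t ht => ?_
      simp only [mem_compl_iff, mem_preimage, mem_Ioi, not_lt] at ht ⊢
      by_contra! hlt
      obtain ⟨tn, htn, hlim⟩ := mem_closure_iff_seq_limit.1 ht
      have : ∀ n, ∃ s ∈ L (tn n), dist a s ≤ c := by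
        intro n
        obtain ⟨s, hs, h⟩ := (hL (tn n)).exists_infDist_eq_dist ⟨x, hxL _⟩ a
        refine ⟨s, hs, ?_⟩
        have := htn n
        simp only [mem_compl_iff, mem_preimage, mem_Ioi, not_lt] at this
        exact h ▸ this
      choose sn hsn hd using this
      obtain ⟨s, -, φ, hφ, hs⟩ := isCompact_univ.tendsto_subseq (x := sn) (fun n => mem_univ _)
      have hsd : dist a s ≤ c := le_of_tendsto (tendsto_const_nhds.dist hs)
        (Eventually.of_forall fun n => hd _)
      have hst : s ∉ L t := fun h => by
        have := infDist_le_dist_of_mem (x := a) h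
        linarith
      obtain ⟨u, hut, hus, hu1, hu2⟩ := between t s hst
      have e1 : ∀ᶠ n in atTop, tn (φ n) ∈ (R u)ᶜ :=
        (hlim.comp hφ.tendsto_atTop).eventually_mem ((hR u).isOpen_compl.mem_nhds
          fun h => hut (huniq u t hu2 h).symm)
      have e2 : ∀ᶠ n in atTop, sn (φ n) ∈ (L u)ᶜ :=
        hs.eventually_mem ((hL u).isOpen_compl.mem_nhds fun h => hus (anti u s h hu1))
      obtain ⟨n, h1, h2⟩ := (e1.and e2).exists
      exact h2 (hLL _ _ ((hc u _).resolve_right h1) (hsn _))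
    · rw [upperSemicontinuous_iff_isOpen_preimage]
      intro c
      rw [isOpen_iff_mem_nhds]
      intro t ht
      simp only [mem_preimage, mem_Iio] at ht
      obtain ⟨s, hs, hd⟩ := (infDist_lt_iff ⟨x, hxL t⟩).1 ht
      by_cases hts : t = s
      · subst hts
        have : ball a c ∈ 𝓝 t := isOpen_ball.mem_nhds (by rwa [mem_ball, dist_comm])
        filter_upwards [this] with t' ht'
        exact (infDist_le_dist_of_mem (zL t')).trans_lt (by rwa [mem_ball, dist_comm] at ht')
      · have : (L s)ᶜ ∈ 𝓝 t := (hL s).isOpen_compl.mem_nhds fun h => hts (anti t s hs h)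
        filter_upwards [this] with t' ht'
        exact (infDist_le_dist_of_mem (nL _ _ ht')).trans_lt hd
  have gmono : ∀ a z z', z' ∈ L z → infDist a (L z) ≤ infDist a (L z') := fun a z z' h =>
    infDist_le_infDist_of_subset (hLL z z' h) ⟨x, hxL _⟩
  set h : A → ℝ := fun t => ∑' i, (1 / 2 : ℝ) ^ i * infDist (d i) (L t) with hh
  set D := diam (univ : Set A)
  have bd : ∀ i t, infDist (d i) (L t) ≤ D := fun i t =>
    (infDist_le_dist_of_mem (zL t)).trans (dist_le_diam_of_mem isCompact_univ.isBounded trivial trivial)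
  have bsum : Summable fun i : ℕ => (1 / 2 : ℝ) ^ i * D :=
    (summable_geometric_of_lt_one (by norm_num) (by norm_num)).mul_right D
  have bd' : ∀ i t, (1 / 2 : ℝ) ^ i * infDist (d i) (L t) ≤ (1 / 2 : ℝ) ^ i * D := fun i t =>
    mul_le_mul_of_nonneg_left (bd i t) (by positivity)
  have sum : ∀ t, Summable fun i => (1 / 2 : ℝ) ^ i * infDist (d i) (L t) := fun t =>
    bsum.of_nonneg_of_le (fun i => mul_nonneg (by positivity) infDist_nonneg) (fun i => bd' i t)
  have hcont : Continuous h := by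
    refine continuous_tsum (fun i => continuous_const.mul (gcont _)) bsum fun i t => ?_
    rw [Real.norm_of_nonneg (mul_nonneg (by positivity) infDist_nonneg)]
    exact bd' i t
  have hmono : ∀ z z', z' ∈ L z → h z ≤ h z' := fun z z' hz =>
    (sum z).tsum_le_tsum (fun i => mul_le_mul_of_nonneg_left (gmono _ _ _ hz) (by positivity)) (sum z')
  have hstrict : ∀ z z', z' ∈ L z → z' ≠ z → h z < h z' := by
    intro z z' hz hne
    have hzz : z ∉ L z' := fun h => hne (anti z z' hz h).symm
    have hpos : 0 < infDist z (L z') :=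
      ((hL z').notMem_iff_infDist_pos ⟨x, hxL _⟩).1 hzz
    obtain ⟨i, hi⟩ := (TopologicalSpace.denseRange_denseSeq A).exists_dist_lt z (half_pos hpos)
    refine (sum z).tsum_lt_tsum (i := i) (fun i => mul_le_mul_of_nonneg_left (gmono _ _ _ hz) (by positivity))
      ?_ (sum z')
    refine mul_lt_mul_of_pos_left ?_ (by positivity)
    have h1 : infDist (d i) (L z) ≤ dist (d i) z := infDist_le_dist_of_mem (zL z)
    have h2 : infDist z (L z') ≤ infDist (d i) (L z') + dist z (d i) := infDist_le_infDist_add_dist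
    have h3 : dist z (d i) < infDist z (L z') / 2 := hi
    rw [dist_comm] at h1
    linarith
  have hLx : ∀ z, x ∈ L z := hxL
  have hLy : ∀ z, z ∈ L y := fun z => hLL' z y (hyR z) (zL z)
  refine ⟨fun z => - h z, hcont.neg, ?_, fun z =>
    ⟨neg_le_neg (hmono _ _ (hLx z)), neg_le_neg (hmono _ _ (hLy z))⟩⟩
  intro z z' hzz
  have hzz : h z = h z' := neg_injective hzz
  by_contra hne
  rcases tot z z' with h' | h'
  · exact absurd hzz (hstrict z z' h' (Ne.symm hne)).ne
  · exact absurd hzz (hstrict z' z h' hne).ne'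

variable {M : Type*} [MetricSpace M]

theorem isArc_of_cut {A : Set M} (hA : IsCompact A) (hAp : IsPreconnected A) {x y : M}
    (hx : x ∈ A) (hy : y ∈ A) (hxy : x ≠ y)
    (hcut : ∀ z ∈ A, z ≠ x → z ≠ y → ∃ L R, IsClosed L ∧ IsClosed R ∧
      L ∪ R = A ∧ L ∩ R = {z} ∧ x ∈ L ∧ y ∈ R) : IsArc A x y := by
  have : CompactSpace A := isCompact_iff_compactSpace.1 hA
  have : PreconnectedSpace A := Subtype.preconnectedSpace hAp
  obtain ⟨h, hc, hi, hb⟩ := exists_cut_function (A := A) (x := ⟨x, hx⟩) (y := ⟨y, hy⟩)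
    (by
      intro z h1 h2
      obtain ⟨L, R, hL, hR, hU, hI, hxL, hyR⟩ := hcut z z.2 (fun h => h1 (Subtype.ext h))
        (fun h => h2 (Subtype.ext h))
      refine ⟨Subtype.val ⁻¹' L, Subtype.val ⁻¹' R, hL.preimage continuous_subtype_val,
        hR.preimage continuous_subtype_val, ?_, ?_, hxL, hyR⟩
      · rw [← preimage_union, hU]; simp
      · ext w
        rw [← preimage_inter, hI]
        simp [Subtype.ext_iff])
  have hlt : h ⟨x, hx⟩ < h ⟨y, hy⟩ := lt_of_le_of_ne (hb ⟨x, hx⟩).2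
    fun h => hxy (congrArg Subtype.val (hi h))
  have hr : range h = Icc (h ⟨x, hx⟩) (h ⟨y, hy⟩) := by
    apply Subset.antisymm
    · rintro _ ⟨z, rfl⟩; exact hb z
    · have := (isPreconnected_range hc).Icc_subset (mem_range_self ⟨x, hx⟩) (mem_range_self ⟨y, hy⟩)
      exact this
  let e : A ≃ₜ range h := (hc.isClosedEmbedding hi).toIsEmbedding.toHomeomorph
  have he : ∀ z, (e z : ℝ) = h z := fun z => rfl
  classical
  let f : ℝ → M := fun s => if hs : s ∈ range h then (e.symm ⟨s, hs⟩ : M) else x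
  have hf : ∀ z : A, f (h z) = z := by
    intro z
    simp only [f, mem_range_self, dif_pos]
    have : (⟨h z, mem_range_self z⟩ : range h) = e z := rfl
    rw [this, e.symm_apply_apply]
  have fc : ContinuousOn f (range h) := by
    rw [continuousOn_iff_continuous_domRestrict]
    have : (range h).domRestrict f = fun s => (e.symm s : M) := by
      ext ⟨s, z, rfl⟩
      have h1 : (range h).domRestrict f ⟨h z, mem_range_self z⟩ = f (h z) := rfl
      have h2 : (⟨h z, mem_range_self z⟩ : range h) = e z := rfl
      rw [h1, hf, h2, e.symm_apply_apply]
    rw [this]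
    fun_prop
  have fi : InjOn f (range h) := by
    rintro _ ⟨z, rfl⟩ _ ⟨w, rfl⟩ h
    rw [hf, hf] at h
    rw [Subtype.ext h]
  rw [hr] at fc fi
  have := IsArc.of_Icc hlt fc fi
  rw [hf, hf, ← hr, ← range_comp] at this
  have h3 : range (f ∘ h) = A := by
    have : f ∘ h = Subtype.val := funext hf
    rw [this, Subtype.range_coe]
  rwa [h3] at this

/-- A nondegenerate continuum that any two points split into two continua is a circle. -/
theorem isJordanCurve_of_splits {K : Set M} (hK : IsCompact K) (hKn : K.Nontrivial)
    (h : ∀ x ∈ K, ∀ y ∈ K, x ≠ y → ∃ A B, IsClosed A ∧ IsClosed B ∧ IsPreconnected A ∧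
      IsPreconnected B ∧ A ∪ B = K ∧ A ∩ B = {x, y}) : IsJordanCurve K := by
  obtain ⟨x, hx, y, hy, hxy⟩ := hKn
  obtain ⟨A, B, hA, hB, hAp, hBp, hU, hI⟩ := h x hx y hy hxy
  have key : ∀ A B, IsClosed A → IsClosed B → IsPreconnected A → IsPreconnected B → A ∪ B = K →
      A ∩ B = {x, y} → IsArc A x y := by
    intro A B hA hB hAp hBp hU hI
    have hxA := (hI.symm.subset (Or.inl rfl)).1
    have hyA := (hI.symm.subset (Or.inr rfl)).1
    have hxB := (hI.symm.subset (Or.inl rfl)).2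
    have hyB := (hI.symm.subset (Or.inr rfl)).2
    have hAK : A ⊆ K := hU ▸ subset_union_left
    have hBK : B ⊆ K := hU ▸ subset_union_right
    obtain ⟨w, hwB, hwx, hwy⟩ : ∃ w ∈ B, w ≠ x ∧ w ≠ y := by
      by_contra! hcon
      have : B ⊆ {x} ∪ {y} := fun w hw => by
        by_cases hwx : w = x
        · exact Or.inl hwx
        · exact Or.inr (hcon w hw hwx)
      obtain ⟨u, -, h1, h2⟩ := isPreconnected_closed_iff.1 hBp _ _ isClosed_singleton
        isClosed_singleton this ⟨x, hxB, rfl⟩ ⟨y, hyB, rfl⟩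
      exact hxy (h1.symm.trans h2)
    have hwA : w ∉ A := fun h => by
      rcases hI.subset ⟨h, hwB⟩ with h | h
      · exact hwx h
      · exact hwy h
    refine isArc_of_cut (hK.of_isClosed_subset hA hAK) hAp hxA hyA hxy fun z hz hzx hzy => ?_
    have hzB : z ∉ B := fun h => by
      rcases hI.subset ⟨hz, h⟩ with h | h
      · exact hzx h
      · exact hzy h
    obtain ⟨C, E, hC, hE, hCp, hEp, hCE, hCEI⟩ := h z (hAK hz) w (hBK hwB)
      (by rintro rfl; exact hwA hz)
    have main : ∀ C E, IsClosed C → IsClosed E → IsPreconnected E → C ∪ E = K →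
        C ∩ E = {z, w} → x ∈ C → y ∈ E := by
      intro C E hC hE hEp hCE hCEI hxC
      by_contra hyE
      have hxE : x ∉ E := fun h => by
        rcases hCEI.subset ⟨hxC, h⟩ with h | h
        · exact hzx h.symm
        · exact hwx h.symm
      have hEK : E ⊆ K := hCE ▸ subset_union_right
      obtain ⟨u, hu, h1, h2⟩ := isPreconnected_closed_iff.1 hEp A B hA hB (hU ▸ hEK)
        ⟨z, (hCEI.symm.subset (Or.inl rfl)).2, hz⟩ ⟨w, (hCEI.symm.subset (Or.inr rfl)).2, hwB⟩
      rcases hI.subset ⟨h1, h2⟩ with h | h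
      · exact hxE (h ▸ hu)
      · exact hyE (h ▸ hu)
    have fin : ∀ C E, IsClosed C → IsClosed E → C ∪ E = K →
        C ∩ E = {z, w} → x ∈ C → y ∈ E → ∃ L R, IsClosed L ∧ IsClosed R ∧
          L ∪ R = A ∧ L ∩ R = {z} ∧ x ∈ L ∧ y ∈ R := by
      intro C E hC hE hCE hCEI hxC hyE
      refine ⟨A ∩ C, A ∩ E, hA.inter hC, hA.inter hE, ?_, ?_, ⟨hxA, hxC⟩, ⟨hyA, hyE⟩⟩
      · rw [← inter_union_distrib_left, hCE, inter_eq_left.2 hAK]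
      · rw [← inter_inter_distrib_left, hCEI]
        ext u
        constructor
        · rintro ⟨hu, rfl | rfl⟩
          · rfl
          · exact absurd hu hwA
        · rintro rfl
          exact ⟨hz, Or.inl rfl⟩
    rcases hCE.symm.subset hx with hxC | hxE
    · exact fin C E hC hE hCE hCEI hxC (main C E hC hE hEp hCE hCEI hxC)
    · rw [union_comm] at hCE
      rw [inter_comm] at hCEI
      exact fin E C hE hC hCE hCEI hxE (main E C hE hC hCp hCE hCEI hxE)
  have h1 := key A B hA hB hAp hBp hU hI
  have h2 := key B A hB hA hBp hAp (by rwa [union_comm]) (by rwa [inter_comm])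
  rw [← hU]
  exact h1.isJordanCurve_union h2 hI

end CircleCharacterization

/-! ## Compact one-dimensional manifolds -/

section OneManifold

/-- A locally connected continuum has a non-cut point different from a given one. -/
theorem exists_isPreconnected_compl_singleton {K : Type*} [MetricSpace K] [CompactSpace K]
    [ConnectedSpace K] [LocallyConnectedSpace K] [Nontrivial K] (o : K) :
    ∃ p, p ≠ o ∧ IsPreconnected ({p}ᶜ : Set K) := by
  by_contra! hcon
  set C : K → Set K := fun p => connectedComponentIn {p}ᶜ o with hC
  have oC : ∀ p, p ≠ o → o ∈ C p := fun p hp => mem_connectedComponentIn (Ne.symm hp)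
  have pC : ∀ p, p ∉ C p := fun p h => connectedComponentIn_subset _ _ h rfl
  have Copen : ∀ p, IsOpen (C p) := fun p => isOpen_compl_singleton.connectedComponentIn
  have Cpre : ∀ p, IsPreconnected (C p) := fun p => isPreconnected_connectedComponentIn
  have Cmax : ∀ p s, IsPreconnected s → o ∈ s → p ∉ s → s ⊆ C p := fun p s hs ho hp =>
    hs.subset_connectedComponentIn ho (fun x hx h => hp (h ▸ hx))
  have Cpl : ∀ p, p ≠ o → IsPreconnected (insert p (C p)) ∧ IsClosed (insert p (C p)) := by
    intro p hp
    have hcl : closure (C p) = insert p (C p) := by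
      have h1 : closure (C p) ⊆ insert p (C p) := by
        intro x hx
        by_contra hxp
        rw [mem_insert_iff, not_or] at hxp
        have : closure (C p) \ {p} ⊆ C p := by
          refine Cmax p _ ?_ ⟨subset_closure (oC p hp), Ne.symm hp⟩ (fun h => h.2 rfl)
          exact (Cpre p).subset_closure (fun y hy => ⟨subset_closure hy, fun h => pC p (h ▸ hy)⟩)
            sdiff_subset
        exact hxp.2 (this ⟨hx, hxp.1⟩)
      refine h1.antisymm (insert_subset ?_ subset_closure)
      by_contra hpc
      have hcl : IsClosed (C p) := by
        refine isClosed_of_closure_subset fun x hx => (h1 hx).resolve_left ?_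
        rintro rfl; exact hpc hx
      have := IsClopen.eq_univ ⟨hcl, Copen p⟩ ⟨o, oC p hp⟩
      exact pC p (this ▸ trivial)
    rw [← hcl]
    exact ⟨(Cpre p).closure, isClosed_closure⟩
  set V : K → Set K := fun p => (insert p (C p))ᶜ with hV
  have Vne : ∀ p, p ≠ o → (V p).Nonempty := by
    intro p hp
    by_contra h
    rw [not_nonempty_iff_eq_empty, compl_empty_iff] at h
    refine hcon p hp ?_
    have : ({p}ᶜ : Set K) = C p := by
      apply Subset.antisymm
      · intro x hx
        exact ((h ▸ mem_univ x : x ∈ insert p (C p))).resolve_left hx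
      · intro x hx h
        exact pC p (h ▸ hx)
    rw [this]; exact Cpre p
  have oV : ∀ p q, p ≠ o → q ∈ V p → q ≠ o := by
    rintro p q hp hq rfl; exact hq (Or.inr (oC p hp))
  have Vsub : ∀ p q, p ≠ o → q ∈ V p → (C q)ᶜ ⊆ V p := by
    intro p q hp hq
    refine compl_subset_compl.2 (Cmax q _ (Cpl p hp).1 (Or.inr (oC p hp)) hq)
  have VsubC : ∀ p, V p ⊆ (C p)ᶜ := fun p x hx h => hx (Or.inr h)
  let d : ℕ → K := TopologicalSpace.denseSeq K
  have hd : ∀ p, p ≠ o → ∃ i, d i ∈ V p := by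
    intro p hp
    exact (TopologicalSpace.denseRange_denseSeq K).exists_mem_open (Cpl p hp).2.isOpen_compl (Vne p hp)
  classical
  let nxt : {p : K // p ≠ o} → {p : K // p ≠ o} := fun p =>
    ⟨d (Nat.find (hd p p.2)), oV p _ p.2 (Nat.find_spec (hd p p.2))⟩
  obtain ⟨p₀, hp₀⟩ := exists_ne o
  let P : ℕ → {p : K // p ≠ o} := fun n => nxt^[n] ⟨p₀, hp₀⟩
  have Psucc : ∀ n, P (n + 1) = nxt (P n) := fun n => Function.iterate_succ_apply' _ _ _
  let ix : ℕ → ℕ := fun n => Nat.find (hd (P n) (P n).2)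
  have hix : ∀ n, d (ix n) ∈ V (P n) := fun n => Nat.find_spec (hd (P n) (P n).2)
  have hPix : ∀ n, (P (n + 1) : K) = d (ix n) := fun n => by rw [Psucc]
  have hsub : ∀ n, (C (P (n + 1)))ᶜ ⊆ V (P n) := fun n =>
    Vsub _ _ (P n).2 (by rw [hPix]; exact hix n)
  obtain ⟨q, hq⟩ := IsCompact.nonempty_iInter_of_sequence_nonempty_isCompact_isClosed
    (fun n => (C (P n))ᶜ) (fun n => (hsub n).trans (VsubC _))
    (fun n => ⟨P n, pC _⟩) (Copen _).isClosed_compl.isCompact (fun n => (Copen _).isClosed_compl)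
  rw [mem_iInter] at hq
  have hqV : ∀ n, q ∈ V (P n) := fun n => hsub n (hq (n + 1))
  have hqo : q ≠ o := oV _ _ (P 0).2 (hqV 0)
  obtain ⟨i, hi⟩ := hd q hqo
  have hle : ∀ n, ix n ≤ i := fun n =>
    Nat.find_min' _ (Vsub _ _ (P n).2 (hqV n) (VsubC _ hi))
  have hlt : ∀ n, ix n < ix (n + 1) := by
    intro n
    have h1 : ix n ≤ ix (n + 1) := Nat.find_min' _ (hsub n (VsubC _ (hix (n + 1))))
    refine lt_of_le_of_ne h1 fun h => ?_
    have := hix (n + 1)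
    rw [← h, ← hPix] at this
    exact this (Or.inl rfl)
  have := (strictMono_nat_of_lt_succ hlt).id_le (i + 1)
  have h2 := hle (i + 1)
  simp only [id] at this
  omega

variable {M : Type*} [MetricSpace M]

/-- Any two points of a connected, locally arc-joined set are joined by an arc in it. -/
theorem IsPreconnected.exists_arc {S : Set M} (hS : IsPreconnected S)
    (hloc : ∀ x ∈ S, ∀ᶠ y in 𝓝[S] x, y ≠ x → ∃ A ⊆ S, IsArc A x y) {x y : M} (hx : x ∈ S)
    (hy : y ∈ S) (hxy : x ≠ y) : ∃ A ⊆ S, IsArc A x y := by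
  refine (hS.induction₂ (fun x y => x = y ∨ ∃ A ⊆ S, IsArc A x y) ?_ ?_ ?_ hx hy).resolve_left hxy
  · intro x hx
    filter_upwards [hloc x hx] with y hy
    by_cases h : y = x
    · exact Or.inl h.symm
    · exact Or.inr (hy h)
  · rintro x y z hx hy hz (rfl | ⟨A, hA, hAa⟩) (rfl | ⟨B, hB, hBa⟩)
    · exact Or.inl rfl
    · exact Or.inr ⟨B, hB, hBa⟩
    · exact Or.inr ⟨A, hA, hAa⟩
    · by_cases h : x = z
      · exact Or.inl h
      · obtain ⟨E, hE, hEa⟩ := hAa.exists_trans hBa h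
        exact Or.inr ⟨E, hE.trans (union_subset hA hB), hEa⟩
  · rintro x y hx hy (rfl | ⟨A, hA, hAa⟩)
    · exact Or.inl rfl
    · exact Or.inr ⟨A, hA, hAa.symm⟩

theorem IsArc.between {S : Set M} {p q a b : M} (h : IsArc S p q) (ha : a ∈ S) (hb : b ∈ S)
    (hab : a ≠ b) : ∃ A ⊆ S, IsArc A a b := by
  by_cases hap : a = p
  · subst hap; exact h.exists_left hb hab.symm
  by_cases haq : a = q
  · subst haq
    obtain ⟨A, hA, hA'⟩ := h.exists_right hb hab.symm
    exact ⟨A, hA, hA'.symm⟩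
  obtain ⟨A, B, hA, hB, hU, -⟩ := h.split ha hap haq
  rcases hU.symm.subset hb with h | h
  · obtain ⟨E, hE, hE'⟩ := hA.exists_right h hab.symm
    exact ⟨E, hE.trans (hU ▸ subset_union_left), hE'.symm⟩
  · obtain ⟨E, hE, hE'⟩ := hB.exists_left h hab.symm
    exact ⟨E, hE.trans (hU ▸ subset_union_right), hE'⟩

/-- Every point of `K` has a neighbourhood in `K` which is an open arc. -/
def IsOneManifold (K : Set M) : Prop :=
  ∀ p ∈ K, ∃ f : ℝ → M, Continuous f ∧ Function.Injective f ∧ f 0 = p ∧ range f ⊆ K ∧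
    ∀ δ > 0, f '' Ioo (-δ) δ ∈ 𝓝[K] p

/-- An interior point of an arc in a one-manifold is interior to the arc. -/
theorem IsOneManifold.mem_nhdsWithin {K : Set M} (hK : IsOneManifold K) {g : ℝ → M}
    (hg : ContinuousOn g (Icc (-1) 1)) (hgi : InjOn g (Icc (-1) 1)) (hgK : g '' Icc (-1) 1 ⊆ K) :
    g '' Icc (-1) 1 ∈ 𝓝[K] (g 0) := by
  have h0 : (0 : ℝ) ∈ Icc (-1 : ℝ) 1 := by norm_num
  obtain ⟨f, fc, fi, f0, fK, fn⟩ := hK (g 0) (hgK ⟨0, h0, rfl⟩)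
  -- the coordinate of `g` in the chart
  have hemb : IsClosedEmbedding ((Icc (-1 : ℝ) 1).domRestrict f) :=
    (fc.comp continuous_subtype_val).isClosedEmbedding (fi.comp Subtype.val_injective)
  have hgt : Tendsto g (𝓝[Icc (-1) 1] 0) (𝓝[K] (g 0)) :=
    tendsto_nhdsWithin_of_tendsto_nhds_of_eventually_within _ (hg 0 h0)
      (eventually_nhdsWithin_of_forall fun s hs => hgK ⟨s, hs, rfl⟩)
  have h1 : ∀ᶠ s in 𝓝[Icc (-1) 1] 0, g s ∈ f '' Ioo (-1) 1 := hgt (fn 1 one_pos)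
  rw [nhdsWithin_eq_nhds.2 (Icc_mem_nhds (by norm_num) (by norm_num))] at h1
  obtain ⟨η, hη, hball⟩ := Metric.eventually_nhds_iff_ball.1 h1
  set ρ := min (η / 2) 1 with hρ
  have hρ0 : 0 < ρ := lt_min (half_pos hη) one_pos
  have hsub : Icc (-ρ) ρ ⊆ Icc (-1) 1 := Icc_subset_Icc (neg_le_neg (min_le_right _ _)) (min_le_right _ _)
  have hmem : ∀ s ∈ Icc (-ρ) ρ, ∃ t ∈ Icc (-1 : ℝ) 1, f t = g s := by
    intro s hs
    have : s ∈ ball (0 : ℝ) η := by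
      rw [mem_ball, Real.dist_0_eq_abs, abs_lt]
      have := min_le_left (η / 2) 1
      constructor <;> linarith [hs.1, hs.2]
    obtain ⟨t, ht, h⟩ := hball s this
    exact ⟨t, Ioo_subset_Icc_self ht, h⟩
  choose! k hk hkf using hmem
  have kc : ContinuousOn k (Icc (-ρ) ρ) := by
    rw [continuousOn_iff_continuous_domRestrict]
    let k' : Icc (-ρ) ρ → Icc (-1 : ℝ) 1 := fun s => ⟨k s, hk s s.2⟩
    have : Continuous k' := by
      rw [hemb.isEmbedding.isInducing.continuous_iff]
      have : (Icc (-1 : ℝ) 1).domRestrict f ∘ k' = (Icc (-ρ) ρ).domRestrict g :=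
        funext fun s => hkf s s.2
      rw [this]
      exact (hg.mono hsub).domRestrict
    exact continuous_subtype_val.comp this
  have ki : InjOn k (Icc (-ρ) ρ) := by
    intro s hs t ht h
    refine hgi (hsub hs) (hsub ht) ?_
    rw [← hkf s hs, ← hkf t ht, h]
  have hz : (0 : ℝ) ∈ Icc (-ρ) ρ := ⟨by linarith, hρ0.le⟩
  have k0 : k 0 = 0 := fi (by rw [hkf 0 hz, f0])
  have him : ∃ δ > 0, Ioo (-δ) δ ⊆ k '' Icc (-ρ) ρ := by
    have hl : -ρ ∈ Icc (-ρ) ρ := ⟨le_rfl, by linarith⟩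
    have hr : ρ ∈ Icc (-ρ) ρ := ⟨by linarith, le_rfl⟩
    rcases kc.strictMonoOn_of_injOn_Icc' (by linarith) ki with h | h
    · have e1 := h hl hz (by linarith)
      have e2 := h hz hr hρ0
      rw [k0] at e1 e2
      refine ⟨min (-(k (-ρ))) (k ρ), lt_min (by linarith) e2, fun t ht => ?_⟩
      refine intermediate_value_Icc (by linarith) kc ⟨?_, ?_⟩
      · have := min_le_left (-(k (-ρ))) (k ρ); linarith [ht.1]
      · have := min_le_right (-(k (-ρ))) (k ρ); linarith [ht.2]
    · have e1 := h hl hz (by linarith)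
      have e2 := h hz hr hρ0
      rw [k0] at e1 e2
      refine ⟨min (-(k ρ)) (k (-ρ)), lt_min (by linarith) e1, fun t ht => ?_⟩
      refine intermediate_value_Icc' (by linarith) kc ⟨?_, ?_⟩
      · have := min_le_left (-(k ρ)) (k (-ρ)); linarith [ht.1]
      · have := min_le_right (-(k ρ)) (k (-ρ)); linarith [ht.2]
  obtain ⟨δ, hδ, hsubk⟩ := him
  refine mem_of_superset (fn δ hδ) ?_
  rintro _ ⟨t, ht, rfl⟩
  obtain ⟨s, hs, rfl⟩ := hsubk ht
  exact ⟨s, hsub hs, (hkf s hs).symm⟩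

theorem IsOneManifold.jordan_eq {K J : Set M} (hK : IsOneManifold K) (hKc : IsPreconnected K)
    (hJ : IsJordanCurve J) (hJK : J ⊆ K) : J = K := by
  refine hJK.antisymm ?_
  have hopen : ∀ z ∈ J, J ∈ 𝓝[K] z := by
    intro z hz
    have : ∃ w ∈ J, w ≠ z := by
      obtain ⟨F, hc, hi, rfl⟩ := isJordanCurve_iff.1 hJ
      by_contra! h
      have h01 := hi ((h _ (mem_range_self ((0 : ℝ) : AddCircle (1 : ℝ)))).trans
        (h _ (mem_range_self ((1 / 2 : ℝ) : AddCircle (1 : ℝ)))).symm)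
      have : Fact ((0 : ℝ) < 1) := ⟨one_pos⟩
      have := (AddCircle.coe_eq_coe_iff_of_mem_Ico (p := (1 : ℝ)) (a := 0) (x := 0) (y := 1 / 2)
        (by norm_num) (by norm_num)).1 h01
      norm_num at this
    obtain ⟨w, hw, hwz⟩ := this
    obtain ⟨A, B, hA, hB, hU, hI⟩ := hJ.split hz hw hwz.symm
    -- cut both arcs in their middle to obtain an arc around `z`
    obtain ⟨a, ha, haz, haw⟩ : ∃ a ∈ A, a ≠ z ∧ a ≠ w := by
      obtain ⟨f, fc, fi, f0, f1, rfl⟩ := hA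
      refine ⟨f (1 / 2), ⟨1 / 2, by norm_num, rfl⟩, ?_, ?_⟩
      · rw [← f0]; intro h; have := fi (by norm_num) (by norm_num) h; norm_num at this
      · rw [← f1]; intro h; have := fi (by norm_num) (by norm_num) h; norm_num at this
    obtain ⟨A₁, A₂, hA₁, hA₂, hAU, hAI⟩ := hA.split ha haz haw
    have hwA₁ : w ∉ A₁ := fun h => haw (hAI.subset ⟨h, hA₂.right_mem⟩).symm
    have hI' : A₁ ∩ B = {z} := by
      apply Subset.antisymm
      · rintro x ⟨h1, h2⟩
        rcases hI.subset ⟨(hAU ▸ subset_union_left : A₁ ⊆ A) h1, h2⟩ with h | h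
        · exact h
        · exact (hwA₁ (h ▸ h1)).elim
      · rintro _ rfl; exact ⟨hA₁.left_mem, hB.left_mem⟩
    have hE := hA₁.symm.concat hB hI'
    have hEJ : A₁ ∪ B ⊆ J := by
      rw [← hU, ← hAU]; exact union_subset_union_left _ subset_union_left
    obtain ⟨f, fc, fi, f0, f1, hf⟩ := hE
    obtain ⟨t, ht, htz⟩ := hf.symm.subset (Or.inl hA₁.left_mem : z ∈ A₁ ∪ B)
    have ht0 : 0 < t := lt_of_le_of_ne ht.1 (by rintro rfl; exact haz (f0.symm.trans htz))
    have ht1 : t < 1 := lt_of_le_of_ne ht.2 (by rintro rfl; exact hwz (f1.symm.trans htz))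
    set m := min t (1 - t)
    have hm : 0 < m := lt_min ht0 (by linarith)
    have hm1 : m ≤ t := min_le_left _ _
    have hm2 : m ≤ 1 - t := min_le_right _ _
    have hmaps : MapsTo (fun s : ℝ => t + m * s) (Icc (-1) 1) (Icc 0 1) := fun s hs => by
      constructor <;> nlinarith [hs.1, hs.2]
    have := hK.mem_nhdsWithin (g := fun s => f (t + m * s)) (fc.comp (by fun_prop) hmaps)
      (fun s hs u hu h => by
        have := fi (hmaps hs) (hmaps hu) h
        have h3 : m * (s - u) = 0 := by linarith
        rcases mul_eq_zero.1 h3 with h | h <;> linarith)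
      (by
        rintro _ ⟨s, hs, rfl⟩
        exact hJK (hEJ (hf ▸ ⟨_, hmaps hs, rfl⟩)))
    simp only [mul_zero, add_zero, htz] at this
    refine mem_of_superset this ?_
    rintro _ ⟨s, hs, rfl⟩
    exact hEJ (hf ▸ ⟨_, hmaps hs, rfl⟩)
  obtain ⟨z, hz⟩ : J.Nonempty := by
    obtain ⟨F, hc, hi, rfl⟩ := isJordanCurve_iff.1 hJ
    exact range_nonempty F
  have : ∀ x ∈ K, (z ∈ J ↔ x ∈ J) := fun x hx =>
    hKc.induction₂ (fun x y => x ∈ J ↔ y ∈ J) (fun x hx => by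
      by_cases h : x ∈ J
      · filter_upwards [hopen x h] with y hy; exact ⟨fun _ => hy, fun _ => h⟩
      · have : Jᶜ ∈ 𝓝[K] x := mem_nhdsWithin_of_mem_nhds (hJ.isClosed.isOpen_compl.mem_nhds h)
        filter_upwards [this] with y hy; exact ⟨fun h' => (h h').elim, fun h' => (hy h').elim⟩)
      (fun _ _ _ _ _ _ h1 h2 => h1.trans h2) (fun _ _ _ _ h => h.symm) (hJK hz) hx
  exact fun x hx => (this x hx).1 hz

/-- A compact connected one-manifold is a circle. -/
theorem IsOneManifold.isJordanCurve {K : Set M} (hK : IsOneManifold K) (hKc : IsCompact K)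
    (hKp : IsConnected K) : IsJordanCurve K := by
  have hbas : ∀ p : K, ∃ b : ℝ → Set K, (𝓝 p).HasBasis (fun δ : ℝ => 0 < δ) b ∧
      ∀ δ, 0 < δ → IsPreconnected (b δ) := by
    intro p
    obtain ⟨f, fc, fi, f0, fK, fn⟩ := hK p p.2
    let f' : ℝ → K := fun t => ⟨f t, fK ⟨t, rfl⟩⟩
    have f'c : Continuous f' := fc.subtype_mk _
    have f'0 : f' 0 = p := Subtype.ext f0
    refine ⟨fun δ => image f' (Ioo (-δ) δ), ⟨fun U => ⟨fun hU => ?_, ?_⟩⟩, fun δ _ =>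
      isPreconnected_Ioo.image _ f'c.continuousOn⟩
    · have : f' ⁻¹' U ∈ 𝓝 0 := f'c.continuousAt (f'0 ▸ hU)
      obtain ⟨δ, hδ, h⟩ := Metric.mem_nhds_iff.1 this
      rw [Real.ball_eq_Ioo, zero_sub, zero_add] at h
      exact ⟨δ, hδ, image_subset_iff.2 h⟩
    · rintro ⟨δ, hδ, h⟩
      refine mem_of_superset ?_ h
      rw [nhds_subtype_eq_comap_nhdsWithin]
      refine ⟨_, fn δ hδ, ?_⟩
      rintro x ⟨t, ht, hx⟩
      exact ⟨t, ht, Subtype.ext hx⟩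
  choose b hb hbp using hbas
  have : CompactSpace K := isCompact_iff_compactSpace.1 hKc
  have : ConnectedSpace K := Subtype.connectedSpace hKp
  have : LocallyConnectedSpace K :=
    locallyConnectedSpace_of_connected_bases b (fun _ δ => 0 < δ) hb hbp
  obtain ⟨o, ho⟩ := hKp.nonempty
  have : Nontrivial K := by
    obtain ⟨f, fc, fi, f0, fK, fn⟩ := hK o ho
    refine ⟨⟨f 0, fK ⟨0, rfl⟩⟩, ⟨f 1, fK ⟨1, rfl⟩⟩, fun h => ?_⟩
    have := fi (congrArg Subtype.val h)
    norm_num at this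
  obtain ⟨p, -, hp⟩ := exists_isPreconnected_compl_singleton (⟨o, ho⟩ : K)
  have hP : IsPreconnected (K \ {(p : M)}) := by
    have := hp.image (Subtype.val) continuous_subtype_val.continuousOn
    convert this using 1
    ext x
    simp only [Set.mem_sdiff, mem_singleton_iff, mem_image, mem_compl_iff]
    constructor
    · rintro ⟨h1, h2⟩
      exact ⟨⟨x, h1⟩, fun h => h2 (congrArg Subtype.val h), rfl⟩
    · rintro ⟨y, hy, rfl⟩
      exact ⟨y.2, fun h => hy (Subtype.ext h)⟩
  have arcs : ∀ f : ℝ → M, Continuous f → Function.Injective f → ∀ s t, s < t →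
      IsArc (f '' Icc s t) (f s) (f t) := fun f fc fi s t hst =>
    .of_Icc hst fc.continuousOn fi.injOn
  have hloc : ∀ x ∈ K \ {(p : M)}, ∀ᶠ y in 𝓝[K \ {(p : M)}] x, y ≠ x →
      ∃ A ⊆ K \ {(p : M)}, IsArc A x y := by
    rintro x ⟨hxK, hxp⟩
    obtain ⟨f, fc, fi, f0, fK, fn⟩ := hK x hxK
    have : f ⁻¹' {(p : M)}ᶜ ∈ 𝓝 0 := fc.continuousAt (isOpen_compl_singleton.mem_nhds (by rwa [f0]))
    obtain ⟨δ, hδ, hsub⟩ := Metric.mem_nhds_iff.1 this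
    rw [Real.ball_eq_Ioo, zero_sub, zero_add] at hsub
    filter_upwards [nhdsWithin_mono x sdiff_subset (fn δ hδ)] with y hy hyx
    obtain ⟨t, ht, rfl⟩ := hy
    have ht0 : t ≠ 0 := by rintro rfl; exact hyx f0
    rcases lt_or_gt_of_ne ht0 with h | h
    · refine ⟨f '' Icc t 0, ?_, f0 ▸ (arcs f fc fi t 0 h).symm⟩
      rintro _ ⟨u, hu, rfl⟩
      exact ⟨fK ⟨u, rfl⟩, hsub ⟨ht.1.trans_le hu.1, hu.2.trans_lt hδ⟩⟩
    · refine ⟨f '' Icc 0 t, ?_, f0 ▸ (arcs f fc fi 0 t h)⟩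
      rintro _ ⟨u, hu, rfl⟩
      exact ⟨fK ⟨u, rfl⟩, hsub ⟨by linarith [hu.1], hu.2.trans_lt ht.2⟩⟩
  obtain ⟨f, fc, fi, f0, fK, fn⟩ := hK p p.2
  have hne : ∀ t, t ≠ 0 → f t ∈ K \ {(p : M)} := fun t ht =>
    ⟨fK ⟨t, rfl⟩, fun h => ht (fi (h.trans f0.symm))⟩
  obtain ⟨S, hS, hSa⟩ := hP.exists_arc hloc (hne (-1) (by norm_num)) (hne 1 (by norm_num))
    (fun h => by have := fi h; norm_num at this)
  have hpS : f 0 ∉ S := fun h => (hS h).2 f0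
  have hL := (arcs f fc fi (-1) 0 (by norm_num)).symm
  have hR := arcs f fc fi 0 1 (by norm_num)
  obtain ⟨w₁, hw₁, C₁, hC₁, hC₁a, hC₁S⟩ := hL.first_hit hSa.isClosed hpS ⟨_, hL.right_mem, hSa.left_mem⟩
  obtain ⟨w₂, hw₂, C₂, hC₂, hC₂a, hC₂S⟩ := hR.first_hit hSa.isClosed hpS ⟨_, hR.right_mem, hSa.right_mem⟩
  have hI : C₁ ∩ C₂ = {f 0} := by
    apply Subset.antisymm
    · rintro x ⟨h1, h2⟩
      obtain ⟨s, hs, rfl⟩ := hC₁ h1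
      obtain ⟨t, ht, h⟩ := hC₂ h2
      have := fi h
      subst this
      rw [le_antisymm hs.2 ht.1]; rfl
    · rintro _ rfl; exact ⟨hC₁a.left_mem, hC₂a.left_mem⟩
  have hw : w₁ ≠ w₂ := by
    rintro rfl
    have := hI.subset ⟨hC₁a.right_mem, hC₂a.right_mem⟩
    exact hpS (this ▸ hw₁)
  have hE := hC₁a.symm.concat hC₂a hI
  obtain ⟨A, hA, hAa⟩ := hSa.between hw₁ hw₂ hw
  have hJ : IsJordanCurve ((C₁ ∪ C₂) ∪ A) := by
    refine hE.isJordanCurve_union hAa (Subset.antisymm ?_ ?_)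
    · have : (C₁ ∪ C₂) ∩ S = {w₁, w₂} := by
        rw [union_inter_distrib_right, hC₁S, hC₂S]; rfl
      rw [← this]; exact inter_subset_inter_right _ hA
    · rintro z (rfl | rfl)
      · exact ⟨hE.left_mem, hAa.left_mem⟩
      · exact ⟨hE.right_mem, hAa.right_mem⟩
  have hfK : ∀ s : Set ℝ, f '' s ⊆ K := fun s => (image_subset_range _ _).trans fK
  rw [← hK.jordan_eq hKp.isPreconnected hJ (union_subset (union_subset (hC₁.trans (hfK _))
    (hC₂.trans (hfK _))) (hA.trans (hS.trans sdiff_subset)))]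
  exact hJ

end OneManifold

/-! ## Circle-valued maps -/

section CircleMaps

/-- A homotopy of circle-valued maps lifts to `ℝ` as soon as its beginning does. -/
theorem Circle.exists_lift_homotopy {A : Type*} [TopologicalSpace A] (H : C(I × A, Circle))
    (g : C(A, ℝ)) (hg : ∀ a, H (0, a) = Circle.exp (g a)) :
    ∃ G : C(I × A, ℝ), (∀ p, H p = Circle.exp (G p)) ∧ ∀ a, G (0, a) = g a :=
  ⟨Circle.isCoveringMap_exp.liftHomotopy H g hg,
    fun p => (congrFun (Circle.isCoveringMap_exp.liftHomotopy_lifts H g hg) p).symm,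
    fun a => Circle.isCoveringMap_exp.liftHomotopy_zero H g hg a⟩

theorem Circle.exists_exp_eq (z : Circle) : ∃ t : ℝ, z = Circle.exp t :=
  ⟨Complex.arg z, (Circle.exp_arg z).symm⟩

theorem Circle.exists_lift_of_starConvex {E : Type*} [AddCommGroup E] [Module ℝ E]
    [TopologicalSpace E] [ContinuousAdd E] [ContinuousSMul ℝ E] {S : Set E} {c : E}
    (hS : StarConvex ℝ c S) (hc : c ∈ S) {f : E → Circle} (hf : ContinuousOn f S) :
    ∃ θ : E → ℝ, ContinuousOn θ S ∧ ∀ w ∈ S, f w = Circle.exp (θ w) := by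
  classical
  have hmem : ∀ p : I × S, (1 - (p.1 : ℝ)) • c + (p.1 : ℝ) • (p.2 : E) ∈ S := fun p =>
    hS p.2.2 (by linarith [p.1.2.2]) p.1.2.1 (by ring)
  let k : C(I × S, S) := ⟨fun p => ⟨_, hmem p⟩, by
    refine Continuous.subtype_mk ?_ _
    fun_prop⟩
  obtain ⟨t0, ht0⟩ := Circle.exists_exp_eq (f c)
  let F : C(S, Circle) := ⟨S.domRestrict f, continuousOn_iff_continuous_domRestrict.1 hf⟩
  obtain ⟨G, hG, -⟩ := Circle.exists_lift_homotopy (F.comp k) (ContinuousMap.const S t0) (by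
    intro a
    have : k (0, a) = ⟨c, hc⟩ := by
      apply Subtype.ext; simp [k]
    simp only [ContinuousMap.comp_apply, this]
    exact ht0)
  refine ⟨fun w => if hw : w ∈ S then G (1, ⟨w, hw⟩) else 0, ?_, ?_⟩
  · rw [continuousOn_iff_continuous_domRestrict]
    have : S.domRestrict (fun w => if hw : w ∈ S then G (1, ⟨w, hw⟩) else 0) = fun w => G (1, w) := by
      ext w; simp [Set.domRestrict, w.2]
    rw [this]; fun_prop
  · intro w hw
    have h1 := hG (1, ⟨w, hw⟩)
    have : k (1, ⟨w, hw⟩) = ⟨w, hw⟩ := by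
      apply Subtype.ext; simp [k]
    simp only [ContinuousMap.comp_apply, this] at h1
    simp only [hw, dif_pos]
    exact h1

theorem Circle.exists_sq_eq_of_starConvex {E : Type*} [AddCommGroup E] [Module ℝ E]
    [TopologicalSpace E] [ContinuousAdd E] [ContinuousSMul ℝ E] {S : Set E} {c : E}
    (hS : StarConvex ℝ c S) (hc : c ∈ S) {f : E → Circle} (hf : ContinuousOn f S) :
    ∃ g : E → Circle, ContinuousOn g S ∧ ∀ w ∈ S, g w ^ 2 = f w := by
  obtain ⟨θ, hθ, h⟩ := Circle.exists_lift_of_starConvex hS hc hf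
  refine ⟨fun w => Circle.exp (θ w / 2), Circle.exp.continuous.comp_continuousOn (by fun_prop), ?_⟩
  intro w hw
  rw [h w hw, sq, ← Circle.exp_add, add_halves]

theorem Circle.neg_ne (z : Circle) : -z ≠ z := by
  intro h
  have : (-(z : ℂ)) = z := congrArg Subtype.val h
  have h2 : (z : ℂ) = 0 := by linear_combination (-1 / 2 : ℂ) * this
  exact z.coe_ne_zero h2

theorem Circle.sq_eq_sq {z w : Circle} (h : z ^ 2 = w ^ 2) : z = w ∨ z = -w := by
  have h1 : (z : ℂ) ^ 2 = (w : ℂ) ^ 2 := by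
    have := congrArg Subtype.val h
    exact_mod_cast this
  rcases sq_eq_sq_iff_eq_or_eq_neg.1 h1 with h | h
  · exact Or.inl (Circle.ext h)
  · exact Or.inr (Circle.ext (by simpa using h))

theorem Circle.continuous_neg : Continuous fun z : Circle => -z :=
  Continuous.subtype_mk (continuous_subtype_val.neg) _

theorem IsPreconnected.circle_eq_or_eq_neg {Y : Type*} [TopologicalSpace Y] {S : Set Y}
    (hS : IsPreconnected S) {f g : Y → Circle} (hf : ContinuousOn f S) (hg : ContinuousOn g S)
    (h : ∀ w ∈ S, f w ^ 2 = g w ^ 2) : (∀ w ∈ S, f w = g w) ∨ ∀ w ∈ S, f w = -g w := by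
  have hq : ContinuousOn (fun w => f w / g w) S := hf.div' hg
  have hfin : IsDiscrete ({1, -1} : Set Circle) := (Set.toFinite _).isDiscrete
  have hm : Set.MapsTo (fun w => f w / g w) S {1, -1} := by
    intro w hw
    rcases Circle.sq_eq_sq (h w hw) with h | h
    · left; simp [h]
    · right; simp only [h, Set.mem_singleton_iff]
      rw [div_eq_iff_eq_mul, neg_one_mul]
  rcases S.eq_empty_or_nonempty with rfl | ⟨w0, hw0⟩
  · simp
  rcases hm hw0 with h0 | h0
  · left; intro w hw
    have := hS.constant_of_mapsTo hfin hq hm hw hw0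
    simp only at this h0
    rw [h0] at this
    exact div_eq_one.1 this
  · right; intro w hw
    have := hS.constant_of_mapsTo hfin hq hm hw hw0
    simp only [Set.mem_singleton_iff] at this h0
    rw [h0, div_eq_iff_eq_mul, neg_one_mul] at this
    exact this

theorem IsPreconnected.exists_lift_sub_eq {Y : Type*} [TopologicalSpace Y] {S : Set Y}
    (hS : IsPreconnected S) {f g : Y → ℝ} (hf : ContinuousOn f S) (hg : ContinuousOn g S)
    (h : ∀ w ∈ S, Circle.exp (f w) = Circle.exp (g w)) :
    ∃ k : ℤ, ∀ w ∈ S, f w = g w + k * (2 * Real.pi) := by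
  rcases S.eq_empty_or_nonempty with rfl | ⟨w0, hw0⟩
  · exact ⟨0, by simp⟩
  have hq : ContinuousOn (fun w => (f w - g w) / (2 * Real.pi)) S := (hf.sub hg).div_const _
  have hpi := Real.pi_pos
  have hd : IsDiscrete (Set.range ((↑) : ℤ → ℝ)) :=
    ⟨(Int.isClosedEmbedding_coe_real.isEmbedding.toHomeomorph.symm.isEmbedding.discreteTopology)⟩
  have hm : Set.MapsTo (fun w => (f w - g w) / (2 * Real.pi)) S (Set.range ((↑) : ℤ → ℝ)) := by
    intro w hw
    obtain ⟨m, hm⟩ := Circle.exp_eq_exp.1 (h w hw)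
    exact ⟨m, by simp only [hm]; field_simp; ring⟩
  obtain ⟨k, hk⟩ := hm hw0
  refine ⟨k, fun w hw => ?_⟩
  have := hS.constant_of_mapsTo hd hq hm hw hw0
  simp only at this hk
  rw [← hk, div_eq_iff (by positivity)] at this
  linarith

theorem Circle.exp_add_int_mul (t : ℝ) (k : ℤ) :
    Circle.exp (t + k * (2 * Real.pi)) = Circle.exp t :=
  Circle.exp_eq_exp.2 ⟨k, rfl⟩

theorem Circle.exp_pi_eq : Circle.exp Real.pi = -1 := by
  apply Circle.ext; simp

theorem ContinuousOn.of_isClosed_cover {Y W : Type*} [TopologicalSpace Y] [TopologicalSpace W]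
    {S C C' : Set Y} {f : Y → W} (hC : IsClosed C) (hC' : IsClosed C')
    (hS : ∀ w ∈ S, w ∈ C ∨ w ∈ C') (h : ContinuousOn f (S ∩ C)) (h' : ContinuousOn f (S ∩ C')) :
    ContinuousOn f S := by
  have aux : ∀ {C : Set Y}, IsClosed C → ContinuousOn f (S ∩ C) → ∀ w ∈ S,
      Tendsto f (𝓝[S ∩ C] w) (𝓝 (f w)) := by
    intro C hC h w hw
    by_cases hwC : w ∈ C
    · exact h w ⟨hw, hwC⟩
    · have : 𝓝[S ∩ C] w = ⊥ := by
        rw [← not_neBot, ← mem_closure_iff_nhdsWithin_neBot]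
        intro hcl
        exact hwC (hC.closure_subset_iff.2 inter_subset_right hcl)
      rw [this]; exact tendsto_bot
  intro w hw
  have hcov : S = (S ∩ C) ∪ (S ∩ C') := by
    ext z; constructor
    · intro hz; rcases hS z hz with h | h
      · exact Or.inl ⟨hz, h⟩
      · exact Or.inr ⟨hz, h⟩
    · rintro (h | h) <;> exact h.1
  rw [ContinuousWithinAt, hcov, nhdsWithin_union]
  exact (aux hC h w hw).sup (aux hC' h' w hw)

/-- The clamp of `(1 + t) / 2` to the unit interval. -/
noncomputable def clampHalf (t : ℝ) : ℝ := max 0 (min 1 ((1 + t) / 2))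

theorem continuous_clampHalf : Continuous clampHalf := by unfold clampHalf; fun_prop

theorem clampHalf_of_le {t : ℝ} (h : t ≤ -1) : clampHalf t = 0 := by
  unfold clampHalf
  rw [min_eq_right (by linarith), max_eq_left (by linarith)]

theorem clampHalf_of_ge {t : ℝ} (h : 1 ≤ t) : clampHalf t = 1 := by
  unfold clampHalf
  rw [min_eq_left (by linarith), max_eq_right (by linarith)]

/-- A circle-valued map on the punctured plane winding once around the origin and equal to one
outside of the open lower quadrant `|re| < -im`. -/
noncomputable def tri (w : ℂ) : Circle :=
  if w.im < 0 then Circle.exp (2 * Real.pi * clampHalf (w.re / (-w.im))) else 1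

theorem tri_of_im_neg {w : ℂ} (h : w.im < 0) :
    tri w = Circle.exp (2 * Real.pi * clampHalf (w.re / (-w.im))) := if_pos h

theorem tri_eq_one {w : ℂ} (h : -w.im ≤ |w.re|) : tri w = 1 := by
  unfold tri
  split_ifs with h0
  · rcases le_abs'.1 h with h1 | h1
    · rw [clampHalf_of_le (by rw [div_le_iff₀ (by linarith)]; linarith)]; simp
    · rw [clampHalf_of_ge (by rw [le_div_iff₀ (by linarith)]; linarith)]; simp
  · rfl

theorem continuousAt_tri {w : ℂ} (hw : w ≠ 0) : ContinuousAt tri w := by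
  by_cases h : w.im < 0
  · have : tri =ᶠ[𝓝 w] fun w => Circle.exp (2 * Real.pi * clampHalf (w.re / (-w.im))) := by
      filter_upwards [(isOpen_lt Complex.continuous_im continuous_const).mem_nhds h] with v hv
      exact tri_of_im_neg hv
    refine ContinuousAt.congr ?_ this.symm
    refine Circle.exp.continuous.continuousAt.comp ?_
    refine continuousAt_const.mul (continuous_clampHalf.continuousAt.comp ?_)
    exact Complex.continuous_re.continuousAt.div Complex.continuous_im.neg.continuousAt
      (by simpa using h.ne)
  · have hlt : -w.im < |w.re| := by
      rcases lt_or_eq_of_le (not_lt.1 h) with h1 | h1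
      · linarith [abs_nonneg w.re]
      · rw [← h1]; simp only [neg_zero, abs_pos]
        intro h2; exact hw (Complex.ext h2 h1.symm)
    have : tri =ᶠ[𝓝 w] fun _ => 1 := by
      filter_upwards [(isOpen_lt Complex.continuous_im.neg Complex.continuous_re.abs).mem_nhds hlt]
        with v hv
      exact tri_eq_one (le_of_lt hv)
    exact continuousAt_const.congr this.symm

/-- The complement of the lower quadrant in a punctured disc. -/
def upperSector (r : ℝ) : Set ℂ := {w | ‖w‖ ≤ r ∧ w ≠ 0 ∧ -w.im ≤ |w.re|}

/-- The lower quadrant in a punctured disc. -/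
def lowerSector (r : ℝ) : Set ℂ := {w | ‖w‖ ≤ r ∧ w ≠ 0 ∧ |w.re| ≤ -w.im}

theorem upperSector_starConvex {r : ℝ} (hr : 0 < r) :
    StarConvex ℝ (r * Complex.I) (upperSector r) := by
  rintro w ⟨hw1, hw2, hw3⟩ a b ha hb hab
  have hre : (a • (r * Complex.I : ℂ) + b • w).re = b * w.re := by simp
  have him : (a • (r * Complex.I : ℂ) + b • w).im = a * r + b * w.im := by simp
  refine ⟨?_, ?_, ?_⟩
  · calc ‖a • (r * Complex.I : ℂ) + b • w‖ ≤ a * r + b * r := by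
          refine (norm_add_le _ _).trans (add_le_add ?_ ?_)
          · rw [norm_smul]; simp [abs_of_nonneg ha, abs_of_pos hr]
          · rw [norm_smul, Real.norm_of_nonneg hb]; gcongr
      _ = r := by rw [← add_mul, hab, one_mul]
  · intro h0
    rw [Complex.ext_iff, hre, him] at h0
    obtain ⟨h1, h2⟩ := h0
    simp only [Complex.zero_re, Complex.zero_im] at h1 h2
    rcases mul_eq_zero.1 h1 with hb0 | hre0
    · subst hb0
      have : a = 1 := by linarith
      subst this; linarith
    · rw [hre0, abs_zero] at hw3
      have him0 : w.im ≠ 0 := fun h => hw2 (Complex.ext hre0 h)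
      have : 0 < w.im := lt_of_le_of_ne (by linarith) him0.symm
      rcases eq_or_lt_of_le hb with hb0 | hb0
      · rw [← hb0] at h2
        have : a = 1 := by linarith
        subst this; linarith
      · nlinarith [mul_pos hb0 this, mul_nonneg ha hr.le]
  · rw [hre, him, abs_mul, abs_of_nonneg hb]
    nlinarith [mul_nonneg ha hr.le, mul_le_mul_of_nonneg_left hw3 hb]

theorem mul_I_mem_upperSector {r : ℝ} (hr : 0 < r) : (r * Complex.I : ℂ) ∈ upperSector r := by
  refine ⟨by simp [abs_of_pos hr], by simp [hr.ne'], by simp [hr.le]⟩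

theorem lowerSector_im_neg {r : ℝ} {w : ℂ} (h : w ∈ lowerSector r) : w.im < 0 := by
  obtain ⟨-, h0, h1⟩ := h
  by_contra hn
  have h2 : w.im = 0 := by linarith [abs_nonneg w.re]
  rw [h2] at h1
  exact h0 (Complex.ext (abs_eq_zero.1 (le_antisymm (by simpa using h1) (abs_nonneg _))) h2)

theorem lowerSector_starConvex {r : ℝ} (hr : 0 < r) :
    StarConvex ℝ (-(r * Complex.I) : ℂ) (lowerSector r) := by
  intro w hw a b ha hb hab
  have hneg := lowerSector_im_neg hw
  obtain ⟨hw1, hw2, hw3⟩ := hw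
  have hre : (a • (-(r * Complex.I) : ℂ) + b • w).re = b * w.re := by simp
  have him : (a • (-(r * Complex.I) : ℂ) + b • w).im = -(a * r) + b * w.im := by simp
  refine ⟨?_, ?_, ?_⟩
  · calc ‖a • (-(r * Complex.I) : ℂ) + b • w‖ ≤ a * r + b * r := by
          refine (norm_add_le _ _).trans (add_le_add ?_ ?_)
          · rw [norm_smul]; simp [abs_of_nonneg ha, abs_of_pos hr]
          · rw [norm_smul, Real.norm_of_nonneg hb]; gcongr
      _ = r := by rw [← add_mul, hab, one_mul]
  · intro h0
    rw [Complex.ext_iff, hre, him] at h0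
    obtain ⟨-, h2⟩ := h0
    simp only [Complex.zero_im] at h2
    rcases eq_or_lt_of_le hb with hb0 | hb0
    · rw [← hb0] at h2
      have : a = 1 := by linarith
      subst this; linarith
    · nlinarith [mul_pos hb0 (neg_pos.2 hneg), mul_nonneg ha hr.le]
  · rw [hre, him, abs_mul, abs_of_nonneg hb]
    nlinarith [mul_nonneg ha hr.le, mul_le_mul_of_nonneg_left hw3 hb]

theorem neg_mul_I_mem_lowerSector {r : ℝ} (hr : 0 < r) :
    (-(r * Complex.I) : ℂ) ∈ lowerSector r := by
  refine ⟨by simp [abs_of_pos hr], by simp [hr.ne'], by simp [hr.le]⟩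

theorem continuousOn_lower_lift (r : ℝ) :
    ContinuousOn (fun w : ℂ => 2 * Real.pi * clampHalf (w.re / (-w.im))) (lowerSector r) := by
  refine continuousOn_const.mul (continuous_clampHalf.comp_continuousOn ?_)
  refine Complex.continuous_re.continuousOn.div Complex.continuous_im.neg.continuousOn ?_
  intro w hw; simpa using (lowerSector_im_neg hw).ne

theorem not_exists_sqrt_tri {ρ : ℝ} (hρ : 0 < ρ) :
    ¬ ∃ g : ℂ → Circle, ContinuousOn g (closedBall 0 ρ \ {0}) ∧
      ∀ w ∈ closedBall (0 : ℂ) ρ \ {0}, g w ^ 2 = tri w := by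
  rintro ⟨g, hg, hsq⟩
  have hU : upperSector ρ ⊆ closedBall 0 ρ \ {0} := fun w hw =>
    ⟨by simpa using hw.1, hw.2.1⟩
  have hL : lowerSector ρ ⊆ closedBall 0 ρ \ {0} := fun w hw =>
    ⟨by simpa using hw.1, hw.2.1⟩
  have h1 := ((upperSector_starConvex hρ).isPathConnected
    (mul_I_mem_upperSector hρ)).isConnected.isPreconnected.circle_eq_or_eq_neg (g := fun _ => 1)
    (hg.mono hU) continuousOn_const (by
      intro w hw; rw [hsq w (hU hw), tri_eq_one hw.2.2]; simp)
  have h2 := ((lowerSector_starConvex hρ).isPathConnected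
    (neg_mul_I_mem_lowerSector hρ)).isConnected.isPreconnected.circle_eq_or_eq_neg
    (g := fun w => Circle.exp (2 * Real.pi * clampHalf (w.re / (-w.im)) / 2))
    (hg.mono hL) (Circle.exp.continuous.comp_continuousOn
      ((continuousOn_lower_lift ρ).div_const 2)) (by
      intro w hw
      rw [hsq w (hL hw), tri_of_im_neg (lowerSector_im_neg hw), sq, ← Circle.exp_add, add_halves])
  have hn : ∀ s : ℝ, |s| = 1 → ‖(ρ / 2 * s : ℂ) - ρ / 2 * Complex.I‖ ≤ ρ := by
    intro s hs
    refine (norm_sub_le _ _).trans ?_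
    simp only [norm_mul, norm_div, Complex.norm_real, Complex.norm_I, Real.norm_eq_abs, hs,
      abs_of_pos hρ, Complex.norm_ofNat]
    linarith
  have hm : ∀ s : ℝ, |s| = 1 → ((ρ / 2 * s : ℂ) - ρ / 2 * Complex.I) ∈ upperSector ρ ∩ lowerSector ρ := by
    intro s hs
    have hne : ((ρ / 2 * s : ℂ) - ρ / 2 * Complex.I) ≠ 0 := by
      intro h
      have := congrArg Complex.im h
      simp at this
      exact hρ.ne' this
    have e1 : |((ρ / 2 * s : ℂ) - ρ / 2 * Complex.I).re| = ρ / 2 := by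
      simp only [Complex.sub_re, Complex.mul_re, Complex.ofReal_re, Complex.ofReal_im,
        Complex.I_re, Complex.I_im, Complex.div_ofNat_re, Complex.div_ofNat_im]
      simp only [zero_div, mul_zero, sub_zero, mul_one, abs_mul, hs]
      exact abs_of_pos (by linarith)
    have e2 : -((ρ / 2 * s : ℂ) - ρ / 2 * Complex.I).im = ρ / 2 := by simp
    refine ⟨⟨hn s hs, hne, ?_⟩, ⟨hn s hs, hne, ?_⟩⟩ <;> rw [e1, e2]
  set p : ℂ := (ρ / 2 * (1 : ℝ) : ℂ) - ρ / 2 * Complex.I with hp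
  set m : ℂ := (ρ / 2 * (-1 : ℝ) : ℂ) - ρ / 2 * Complex.I with hmdef
  have hpm := hm 1 (by simp)
  have hmm := hm (-1) (by simp)
  have hpr : p.re / (-p.im) = 1 := by simp [hp, hρ.ne']
  have hmr : m.re / (-m.im) = -1 := by simp [hmdef, hρ.ne']
  have hvp : Circle.exp (2 * Real.pi * clampHalf (p.re / (-p.im)) / 2) = -1 := by
    rw [hpr, clampHalf_of_ge le_rfl, ← Circle.exp_pi_eq]; congr 1; ring
  have hvm : Circle.exp (2 * Real.pi * clampHalf (m.re / (-m.im)) / 2) = 1 := by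
    rw [hmr, clampHalf_of_le le_rfl]; simp
  have hUU : g p = g m := by
    rcases h1 with h | h <;> rw [h p hpm.1, h m hmm.1]
  have hLL : g p = - g m := by
    rcases h2 with h | h <;> rw [h p hpm.2, h m hmm.2, hvp, hvm]
  exact Circle.neg_ne (g m) (hLL ▸ hUU)

/-- Every circle-valued map on a punctured disc is a power of `tri` up to homotopy. -/
theorem exists_tri_zpow {ρ : ℝ} (hρ : 0 < ρ) {f : ℂ → Circle}
    (hf : ContinuousOn f (closedBall 0 ρ \ {0})) :
    ∃ (k : ℤ) (θ : ℂ → ℝ), ContinuousOn θ (closedBall 0 ρ \ {0}) ∧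
      ∀ w ∈ closedBall (0 : ℂ) ρ \ {0}, f w = tri w ^ k * Circle.exp (θ w) := by
  classical
  have hU : upperSector ρ ⊆ closedBall 0 ρ \ {0} := fun w hw =>
    ⟨by simpa using hw.1, hw.2.1⟩
  have hL : lowerSector ρ ⊆ closedBall 0 ρ \ {0} := fun w hw =>
    ⟨by simpa using hw.1, hw.2.1⟩
  obtain ⟨θ1, hc1, h1⟩ := Circle.exists_lift_of_starConvex (upperSector_starConvex hρ)
    (mul_I_mem_upperSector hρ) (hf.mono hU)
  obtain ⟨θ2, hc2, h2⟩ := Circle.exists_lift_of_starConvex (lowerSector_starConvex hρ)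
    (neg_mul_I_mem_lowerSector hρ) (hf.mono hL)
  have hray : ∀ s : ℝ, IsPreconnected ((fun t : ℝ => ((t * s : ℝ) : ℂ) - t * Complex.I) ''
      {t | 0 < t ∧ ‖((t * s : ℝ) : ℂ) - t * Complex.I‖ ≤ ρ}) := by
    intro s
    refine IsPreconnected.image ?_ _ (by fun_prop)
    have heq : ∀ t : ℝ, 0 < t → ‖((t * s : ℝ) : ℂ) - t * Complex.I‖ = t * ‖(s : ℂ) - Complex.I‖ := by
      intro t ht
      rw [show ((t * s : ℝ) : ℂ) - t * Complex.I = t * ((s : ℂ) - Complex.I) by push_cast; ring,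
        norm_mul, Complex.norm_real, Real.norm_of_nonneg ht.le]
    refine Set.OrdConnected.isPreconnected ⟨?_⟩
    rintro t ⟨ht, -⟩ t' ⟨ht', hn'⟩ x ⟨hx1, hx2⟩
    have hx : 0 < x := by linarith
    refine ⟨hx, ?_⟩
    rw [heq x hx]
    rw [heq t' ht'] at hn'
    exact (mul_le_mul_of_nonneg_right hx2 (norm_nonneg _)).trans hn'
  have hsub : ∀ s : ℝ, |s| = 1 → ((fun t : ℝ => ((t * s : ℝ) : ℂ) - t * Complex.I) ''
      {t | 0 < t ∧ ‖((t * s : ℝ) : ℂ) - t * Complex.I‖ ≤ ρ}) ⊆ upperSector ρ ∩ lowerSector ρ := by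
    rintro s hs _ ⟨t, ⟨ht, hn⟩, rfl⟩
    have e1 : |(((t * s : ℝ) : ℂ) - t * Complex.I).re| = t := by
      simp [abs_mul, hs, abs_of_pos ht]
    have e2 : (((t * s : ℝ) : ℂ) - t * Complex.I).im = -t := by simp
    have hne : ((t * s : ℝ) : ℂ) - t * Complex.I ≠ 0 := by
      intro h; rw [h] at e2; simp at e2; exact ht.ne' e2
    exact ⟨⟨hn, hne, by rw [e1, e2, neg_neg]⟩, ⟨hn, hne, by rw [e1, e2, neg_neg]⟩⟩
  have hpart : ∀ w ∈ upperSector ρ ∩ lowerSector ρ, ∃ s : ℝ, (s = 1 ∨ s = -1) ∧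
      w ∈ ((fun t : ℝ => ((t * s : ℝ) : ℂ) - t * Complex.I) ''
        {t | 0 < t ∧ ‖((t * s : ℝ) : ℂ) - t * Complex.I‖ ≤ ρ}) ∧ w.re / (-w.im) = s := by
    rintro w ⟨hw1, hw2⟩
    have hi := lowerSector_im_neg hw2
    have he : |w.re| = -w.im := le_antisymm hw2.2.2 hw1.2.2
    rcases (abs_eq (by linarith)).1 he with h | h
    · refine ⟨1, Or.inl rfl, ⟨-w.im, ?_, ?_⟩, ?_⟩
      · have : (((-w.im) * 1 : ℝ) : ℂ) - (-w.im : ℝ) * Complex.I = w := by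
          apply Complex.ext <;> simp [h]
        refine ⟨by simpa using hi, ?_⟩
        rw [this]; exact hw1.1
      · apply Complex.ext <;> simp [h]
      · rw [h, div_self (by linarith)]
    · refine ⟨-1, Or.inr rfl, ⟨-w.im, ?_, ?_⟩, ?_⟩
      · have : (((-w.im) * (-1) : ℝ) : ℂ) - (-w.im : ℝ) * Complex.I = w := by
          apply Complex.ext <;> simp [h]
        refine ⟨by simpa using hi, ?_⟩
        rw [this]; exact hw1.1
      · apply Complex.ext <;> simp [h]
      · rw [h, neg_neg, div_neg, div_self (by linarith)]
  have hk : ∀ s : ℝ, |s| = 1 → ∃ k : ℤ, ∀ w ∈ ((fun t : ℝ => ((t * s : ℝ) : ℂ) - t * Complex.I) ''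
      {t | 0 < t ∧ ‖((t * s : ℝ) : ℂ) - t * Complex.I‖ ≤ ρ}), θ2 w = θ1 w + k * (2 * Real.pi) :=
    fun s hs => (hray s).exists_lift_sub_eq (hc2.mono ((hsub s hs).trans inter_subset_right))
      (hc1.mono ((hsub s hs).trans inter_subset_left)) (fun w hw => by
        rw [← h1 w (hsub s hs hw).1, ← h2 w (hsub s hs hw).2])
  obtain ⟨k1, hk1⟩ := hk 1 (by simp)
  obtain ⟨k2, hk2⟩ := hk (-1) (by simp)
  let θ3 : ℂ → ℝ := fun w => θ2 w - k2 * (2 * Real.pi) -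
    (k1 - k2 : ℤ) * (2 * Real.pi * clampHalf (w.re / (-w.im)))
  have hc3 : ContinuousOn θ3 (lowerSector ρ) :=
    (hc2.sub continuousOn_const).sub (continuousOn_const.mul (continuousOn_lower_lift ρ))
  have hagree : ∀ w ∈ upperSector ρ ∩ lowerSector ρ, θ3 w = θ1 w := by
    intro w hw
    obtain ⟨s, hs, hws, hr⟩ := hpart w hw
    simp only [θ3, hr]
    rcases hs with rfl | rfl
    · rw [hk1 w hws, clampHalf_of_ge le_rfl]; push_cast; ring
    · rw [hk2 w hws, clampHalf_of_le le_rfl]; push_cast; ring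
  have hcov : closedBall (0 : ℂ) ρ \ {0} ⊆ upperSector ρ ∪ lowerSector ρ := by
    rintro w ⟨hw, hw0⟩
    rcases le_total (-w.im) |w.re| with h | h
    · exact Or.inl ⟨by simpa using hw, hw0, h⟩
    · exact Or.inr ⟨by simpa using hw, hw0, h⟩
  refine ⟨k1 - k2, fun w => if -w.im ≤ |w.re| then θ1 w else θ3 w, ?_, ?_⟩
  · refine ContinuousOn.of_isClosed_cover (C := {w : ℂ | -w.im ≤ |w.re|})
      (C' := {w : ℂ | |w.re| ≤ -w.im})
      (isClosed_le Complex.continuous_im.neg Complex.continuous_re.abs)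
      (isClosed_le Complex.continuous_re.abs Complex.continuous_im.neg)
      (fun w _ => le_total (-w.im) |w.re|) ?_ ?_
    · refine (hc1.mono ?_).congr ?_
      · rintro w ⟨hw, h⟩; exact ⟨by simpa using hw.1, hw.2, h⟩
      · rintro w ⟨hw, h⟩; exact if_pos h
    · refine (hc3.mono ?_).congr ?_
      · rintro w ⟨hw, h⟩; exact ⟨by simpa using hw.1, hw.2, h⟩
      · rintro w ⟨hw, h⟩
        by_cases h' : -w.im ≤ |w.re|
        · simp only [h', if_true]
          exact (hagree w ⟨⟨by simpa using hw.1, hw.2, h'⟩, ⟨by simpa using hw.1, hw.2, h⟩⟩).symm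
        · simp only [h', if_false]
  · intro w hw
    by_cases h : -w.im ≤ |w.re|
    · have hwU : w ∈ upperSector ρ := ⟨by simpa using hw.1, hw.2, h⟩
      simp only [h, if_true]
      rw [tri_eq_one h, one_zpow, one_mul, h1 w hwU]
    · have hwL : w ∈ lowerSector ρ := ⟨by simpa using hw.1, hw.2, le_of_not_ge h⟩
      simp only [h, if_false]
      rw [tri_of_im_neg (lowerSector_im_neg hwL), ← Circle.exp_zsmul, zsmul_eq_mul, ← Circle.exp_add, h2 w hwL,
        ← Circle.exp_add_int_mul (θ2 w) (-k2)]
      congr 1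
      simp only [θ3]; push_cast; ring

end CircleMaps

/-! ## Parametrised charts of surfaces -/

section Charts

/-- The closed upper half plane in `ℂ`. -/
def upperHP : Set ℂ := {w | 0 ≤ w.im}

theorem isClosed_upperHP : IsClosed upperHP := isClosed_le continuous_const Complex.continuous_im

/-- A parametrisation of a piece of a surface by the part of the closed unit disc lying in `P`. -/
def IsChart {X : Type*} [TopologicalSpace X] (P : Set ℂ) (φ : ℂ → X) : Prop :=
  ContinuousOn φ (closedBall 0 1 ∩ P) ∧ InjOn φ (closedBall 0 1 ∩ P) ∧
    ∀ O : Set ℂ, IsOpen O → O ⊆ ball 0 1 → IsOpen (φ '' (O ∩ P))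

variable {X : Type*} [MetricSpace X]

namespace IsChart

variable {P P' : Set ℂ} {φ : ℂ → X}

theorem comp_affine (h : IsChart P φ) {c : ℂ} {r : ℝ} (hr : 0 < r) (hc : ‖c‖ + r ≤ 1)
    (hP : ∀ w ∈ closedBall (0 : ℂ) 1, w ∈ P' ↔ c + r * w ∈ P) :
    IsChart P' fun w => φ (c + r * w) := by
  have hr0 : (r : ℂ) ≠ 0 := by exact_mod_cast hr.ne'
  have hm : ∀ w ∈ closedBall (0 : ℂ) 1 ∩ P', c + r * w ∈ closedBall (0 : ℂ) 1 ∩ P := by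
    rintro w ⟨hw, hw'⟩
    refine ⟨?_, (hP w hw).1 hw'⟩
    rw [mem_closedBall_zero_iff] at hw ⊢
    calc ‖c + r * w‖ ≤ ‖c‖ + r * ‖w‖ := by
          refine (norm_add_le _ _).trans ?_
          rw [norm_mul, Complex.norm_real, Real.norm_of_nonneg hr.le]
      _ ≤ ‖c‖ + r := by nlinarith
      _ ≤ 1 := hc
  refine ⟨h.1.comp (by fun_prop) hm, ?_, ?_⟩
  · intro w hw w' hw' he
    have := h.2.1 (hm w hw) (hm w' hw') he
    exact mul_left_cancel₀ hr0 (add_left_cancel this)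
  · intro O hO hO1
    have hO' : IsOpen ((fun w : ℂ => (w - c) / r) ⁻¹' O) := hO.preimage (by fun_prop)
    have hinv : ∀ w : ℂ, (c + r * w - c) / r = w := fun w => by field_simp; ring
    have hinv' : ∀ w : ℂ, c + r * ((w - c) / r) = w := fun w => by field_simp; ring
    have hsub : (fun w : ℂ => (w - c) / r) ⁻¹' O ⊆ ball 0 1 := by
      intro w hw
      have h1 := hO1 hw
      rw [mem_ball_zero_iff, norm_div, Complex.norm_real, Real.norm_of_nonneg hr.le,
        div_lt_one hr] at h1
      rw [mem_ball_zero_iff]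
      calc ‖w‖ = ‖c + (w - c)‖ := by rw [add_sub_cancel]
        _ ≤ ‖c‖ + ‖w - c‖ := norm_add_le _ _
        _ < 1 := by linarith
    convert h.2.2 _ hO' hsub using 1
    ext x; constructor
    · rintro ⟨w, ⟨hw, hw'⟩, rfl⟩
      exact ⟨c + r * w, ⟨by rw [mem_preimage, hinv]; exact hw, (hP w (ball_subset_closedBall (hO1 hw))).1 hw'⟩, rfl⟩
    · rintro ⟨w, ⟨hw, hw'⟩, rfl⟩
      refine ⟨(w - c) / r, ⟨hw, ?_⟩, by simp only [hinv']⟩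
      rw [hP _ (ball_subset_closedBall (hO1 hw)), hinv']; exact hw'

theorem comp_smul_univ (h : IsChart univ φ) {r : ℝ} (hr : 0 < r) (hr1 : r ≤ 1) :
    IsChart univ fun w => φ (r * w) := by
  simpa using h.comp_affine (c := 0) (P' := univ) hr (by simpa using hr1) (by simp)

theorem comp_smul_upperHP (h : IsChart upperHP φ) {r : ℝ} (hr : 0 < r) (hr1 : r ≤ 1) :
    IsChart upperHP fun w => φ (r * w) := by
  simpa using h.comp_affine (c := 0) (P' := upperHP) hr (by simpa using hr1) (by
    intro w _; simp [upperHP, hr])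

theorem isCompact_image (h : IsChart P φ) (hP : IsClosed P) {r : ℝ} (hr : r ≤ 1) :
    IsCompact (φ '' (closedBall 0 r ∩ P)) :=
  ((isCompact_closedBall 0 r).inter_right hP).image_of_continuousOn
    (h.1.mono (inter_subset_inter_left _ (closedBall_subset_closedBall hr)))

theorem image_mem_nhds (h : IsChart P φ) {w : ℂ} (hw : w ∈ ball (0 : ℂ) 1) (hwP : w ∈ P)
    {V : Set ℂ} (hV : V ∈ 𝓝 w) : φ '' (V ∩ P) ∈ 𝓝 (φ w) := by
  obtain ⟨O, hOV, hO, hwO⟩ := _root_.mem_nhds_iff.1 (inter_mem hV (isOpen_ball.mem_nhds hw))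
  refine mem_of_superset ((h.2.2 O hO (hOV.trans inter_subset_right)).mem_nhds ⟨w, ⟨hwO, hwP⟩, rfl⟩)
    (image_mono (inter_subset_inter_left _ (hOV.trans inter_subset_left)))

open Classical in
/-- The inverse of a parametrised chart. -/
noncomputable def inv (P : Set ℂ) (φ : ℂ → X) : X → ℂ := Function.invFunOn φ (closedBall 0 1 ∩ P)

theorem inv_apply (h : IsChart P φ) {w : ℂ} (hw : w ∈ closedBall (0 : ℂ) 1) (hwP : w ∈ P) :
    inv P φ (φ w) = w :=
  h.2.1.leftInvOn_invFunOn ⟨hw, hwP⟩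

theorem continuousAt_inv (h : IsChart P φ) {w : ℂ} (hw : w ∈ ball (0 : ℂ) 1) (hwP : w ∈ P) :
    Tendsto (inv P φ) (𝓝 (φ w)) (𝓝[P] w) := by
  intro V hV
  obtain ⟨V', hV', hV''⟩ := mem_nhdsWithin_iff_exists_mem_nhds_inter.1 hV
  change inv P φ ⁻¹' V ∈ 𝓝 (φ w)
  filter_upwards [h.image_mem_nhds hw hwP (inter_mem hV' (isOpen_ball.mem_nhds hw))]
  rintro _ ⟨v, ⟨⟨hv1, hv2⟩, hv3⟩, rfl⟩
  rw [mem_preimage, h.inv_apply (ball_subset_closedBall hv2) hv3]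
  exact hV'' ⟨hv1, hv3⟩

open Classical in
/-- The function equal to `g` in chart coordinates and to `d` outside of the chart. -/
noncomputable def patch {W : Type*} (P : Set ℂ) (φ : ℂ → X) (g : ℂ → W) (d : X → W) (z : X) : W :=
  if z ∈ φ '' (closedBall 0 1 ∩ P) then g (inv P φ z) else d z

variable {W : Type*} {g : ℂ → W} {d : X → W}

theorem patch_apply (h : IsChart P φ) {w : ℂ} (hw : w ∈ closedBall (0 : ℂ) 1) (hwP : w ∈ P) :
    patch P φ g d (φ w) = g w := by
  unfold patch
  rw [if_pos ⟨w, ⟨hw, hwP⟩, rfl⟩, h.inv_apply hw hwP]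

theorem patch_of_notMem {z : X} (hz : z ∉ φ '' (closedBall 0 1 ∩ P)) :
    patch P φ g d z = d z := if_neg hz

theorem patch_eq (h : IsChart P φ) {r : ℝ}
    (hg : ∀ w ∈ closedBall (0 : ℂ) 1, w ∈ P → r < ‖w‖ → g w = d (φ w)) {z : X}
    (hz : z ∉ φ '' (closedBall 0 r ∩ P)) : patch P φ g d z = d z := by
  by_cases hz' : z ∈ φ '' (closedBall 0 1 ∩ P)
  · obtain ⟨w, ⟨hw, hwP⟩, rfl⟩ := hz'
    rw [h.patch_apply hw hwP]
    refine hg w hw hwP ?_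
    by_contra hn
    exact hz ⟨w, ⟨by simpa using hn, hwP⟩, rfl⟩
  · exact patch_of_notMem hz'

variable [TopologicalSpace W]

theorem continuousAt_patch (h : IsChart P φ) {w : ℂ} (hw : w ∈ ball (0 : ℂ) 1) (hwP : w ∈ P)
    (hg : ContinuousWithinAt g P w) : ContinuousAt (patch P φ g d) (φ w) := by
  rw [ContinuousAt, h.patch_apply (ball_subset_closedBall hw) hwP]
  refine Tendsto.congr' ?_ (hg.tendsto.comp (h.continuousAt_inv hw hwP))
  filter_upwards [h.image_mem_nhds hw hwP (isOpen_ball.mem_nhds hw)] with z hz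
  unfold patch
  rw [if_pos (image_mono (inter_subset_inter_left _ ball_subset_closedBall) hz)]; rfl

theorem continuousAt_patch_of_notMem (h : IsChart P φ) (hP : IsClosed P) {r : ℝ} (hr : r ≤ 1)
    (hg : ∀ w ∈ closedBall (0 : ℂ) 1, w ∈ P → r < ‖w‖ → g w = d (φ w)) {z : X}
    (hz : z ∉ φ '' (closedBall 0 r ∩ P)) (hd : ContinuousAt d z) :
    ContinuousAt (patch P φ g d) z := by
  refine hd.congr ?_
  filter_upwards [(h.isCompact_image hP hr).isClosed.isOpen_compl.mem_nhds hz] with v hv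
  exact (h.patch_eq hg hv).symm

end IsChart

theorem isChart_of_homeomorph {U : Set X} (hU : IsOpen U) {V : Set (ℝ × ℝ)} (h : U ≃ₜ V)
    {P : Set ℂ} {c : ℂ} {ε : ℝ} (hε : 0 < ε)
    (hP : ∀ w ∈ closedBall (0 : ℂ) 1, w ∈ P ↔ ((c + ε * w).re, (c + ε * w).im) ∈ V) (z : U)
    (hz : h z = ((c.re, c.im) : ℝ × ℝ)) :
    ∃ φ : ℂ → X, IsChart P φ ∧ φ 0 = z := by
  classical
  let a : ℂ → ℝ × ℝ := fun w => ((c + ε * w).re, (c + ε * w).im)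
  have hac : Continuous a := by fun_prop
  have hainj : Function.Injective a := by
    intro w w' hww
    have : c + ε * w = c + ε * w' := Complex.ext (congrArg Prod.fst hww) (congrArg Prod.snd hww)
    exact mul_left_cancel₀ (by exact_mod_cast hε.ne') (add_left_cancel this)
  have ha0 : a 0 = h z := by simp [a, hz]
  refine ⟨fun w => if hw : a w ∈ V then (h.symm ⟨a w, hw⟩ : U) else (z : X), ⟨?_, ?_, ?_⟩, ?_⟩
  · rw [continuousOn_iff_continuous_domRestrict]
    have hm : ∀ w : ↥(closedBall (0 : ℂ) 1 ∩ P), a w ∈ V := fun w => (hP w w.2.1).1 w.2.2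
    have : (closedBall (0 : ℂ) 1 ∩ P).domRestrict
        (fun w => if hw : a w ∈ V then ((h.symm ⟨a w, hw⟩ : U) : X) else (z : X)) =
        fun w : ↥(closedBall (0 : ℂ) 1 ∩ P) => ((h.symm ⟨a w, hm w⟩ : U) : X) := by
      funext w; exact dif_pos (hm w)
    rw [this]
    refine continuous_subtype_val.comp (h.symm.continuous.comp ?_)
    exact Continuous.subtype_mk (hac.comp continuous_subtype_val) _
  · rintro w ⟨hw, hw'⟩ v ⟨hv, hv'⟩ he
    have h1 : a w ∈ V := (hP w hw).1 hw'
    have h2 : a v ∈ V := (hP v hv).1 hv'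
    simp only [h1, h2, dif_pos] at he
    have := h.symm.injective (Subtype.ext he)
    exact hainj (congrArg Subtype.val this)
  · intro O hO hO1
    have hcinv : Continuous fun p : ℝ × ℝ => ((p.1 + p.2 * Complex.I : ℂ) - c) / ε := by fun_prop
    have hinv : ∀ p : ℝ × ℝ, a (((p.1 + p.2 * Complex.I : ℂ) - c) / ε) = p := by
      intro p
      have : c + ε * ((((p.1 : ℂ) + p.2 * Complex.I : ℂ) - c) / ε) = p.1 + p.2 * Complex.I := by
        have : (ε : ℂ) ≠ 0 := by exact_mod_cast hε.ne'
        field_simp; ring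
      exact Prod.ext ((congrArg Complex.re this).trans (by simp)) ((congrArg Complex.im this).trans (by simp))
    have hopen : IsOpen ((fun u : U => (((h u : ℝ × ℝ).1 + (h u : ℝ × ℝ).2 * Complex.I : ℂ) - c) / ε) ⁻¹' O) :=
      hO.preimage (hcinv.comp (continuous_subtype_val.comp h.continuous))
    convert hU.isOpenMap_subtype_val _ hopen using 1
    ext x; constructor
    · rintro ⟨w, ⟨hw, hw'⟩, rfl⟩
      have h1 : a w ∈ V := (hP w (ball_subset_closedBall (hO1 hw))).1 hw'
      simp only [h1, dif_pos]
      refine ⟨h.symm ⟨a w, h1⟩, ?_, rfl⟩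
      simp only [mem_preimage, Homeomorph.apply_symm_apply]
      have := hainj (hinv (a w))
      rw [this]; exact hw
    · rintro ⟨u, hu, rfl⟩
      set w := (((h u : ℝ × ℝ).1 + (h u : ℝ × ℝ).2 * Complex.I : ℂ) - c) / ε with hwdef
      have haw : a w = h u := hinv _
      have hV : a w ∈ V := haw ▸ (h u).2
      refine ⟨w, ⟨hu, (hP w (ball_subset_closedBall (hO1 hu))).2 hV⟩, ?_⟩
      simp only [hV, dif_pos]
      have : (⟨a w, hV⟩ : V) = h u := Subtype.ext haw
      rw [this, Homeomorph.symm_apply_apply]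
  · have : a 0 ∈ V := ha0 ▸ (h z).2
    simp only [this, dif_pos]
    have : (⟨a 0, this⟩ : V) = h z := Subtype.ext ha0
    rw [this, Homeomorph.symm_apply_apply]

theorem IsChart.exists_small_univ {φ : ℂ → X} (h : IsChart univ φ) {N : Set X} (hN : N ∈ 𝓝 (φ 0)) :
    ∃ ψ : ℂ → X, IsChart univ ψ ∧ ψ 0 = φ 0 ∧ ψ '' (closedBall 0 1 ∩ univ) ⊆ N := by
  have hc : ContinuousAt φ 0 := (h.1.mono (by simp)).continuousAt (closedBall_mem_nhds _ one_pos)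
  obtain ⟨r, hr, hrN⟩ := Metric.nhds_basis_closedBall.mem_iff.1 (hc hN)
  have hm : 0 < min r 1 := lt_min hr one_pos
  refine ⟨_, h.comp_smul_univ hm (min_le_right _ _), by simp, ?_⟩
  rintro _ ⟨w, ⟨hw, -⟩, rfl⟩
  refine hrN ?_
  rw [mem_closedBall_zero_iff] at hw ⊢
  rw [norm_mul, Complex.norm_real, Real.norm_of_nonneg hm.le]
  nlinarith [min_le_left r 1]

theorem IsChart.exists_small_upperHP {φ : ℂ → X} (h : IsChart upperHP φ) {N : Set X}
    (hN : N ∈ 𝓝 (φ 0)) :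
    ∃ ψ : ℂ → X, IsChart upperHP ψ ∧ ψ 0 = φ 0 ∧ ψ '' (closedBall 0 1 ∩ upperHP) ⊆ N := by
  have hc : ContinuousWithinAt φ (closedBall 0 1 ∩ upperHP) 0 := h.1 0 ⟨by simp, by simp [upperHP]⟩
  obtain ⟨V, hV, hVN⟩ := mem_nhdsWithin_iff_exists_mem_nhds_inter.1 (hc hN)
  obtain ⟨r, hr, hrN⟩ := Metric.nhds_basis_closedBall.mem_iff.1 hV
  have hm : 0 < min r 1 := lt_min hr one_pos
  refine ⟨_, h.comp_smul_upperHP hm (min_le_right _ _), by simp, ?_⟩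
  rintro _ ⟨w, ⟨hw, hw'⟩, rfl⟩
  rw [mem_closedBall_zero_iff] at hw
  have hn : ‖((min r 1 : ℝ) : ℂ) * w‖ ≤ min r 1 := by
    rw [norm_mul, Complex.norm_real, Real.norm_of_nonneg hm.le]
    nlinarith
  refine hVN ⟨hrN ?_, ?_, ?_⟩
  · rw [mem_closedBall_zero_iff]; exact hn.trans (min_le_left _ _)
  · rw [mem_closedBall_zero_iff]; exact hn.trans (min_le_right _ _)
  · have h0 : 0 ≤ w.im := hw'
    have := mul_nonneg hm.le h0
    simpa [upperHP] using this

theorem exists_isChart_of_notMem_boundary {z : X} (hz : z ∉ surfaceBoundary X) {N : Set X}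
    (hN : N ∈ 𝓝 z) :
    ∃ φ : ℂ → X, IsChart univ φ ∧ φ 0 = z ∧ φ '' (closedBall 0 1 ∩ univ) ⊆ N := by
  obtain ⟨U, V, hU, hzU, hV, ⟨h⟩⟩ := not_not.1 hz
  set p : ℝ × ℝ := Subtype.val (h ⟨z, hzU⟩) with hp
  obtain ⟨ε, hε, hεV⟩ := Metric.nhds_basis_closedBall.mem_iff.1 (hV.mem_nhds (h ⟨z, hzU⟩).2)
  obtain ⟨φ, hφ, h0⟩ := isChart_of_homeomorph (P := univ) (c := ⟨p.1, p.2⟩) hU h hε (by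
    intro w hw
    simp only [mem_univ, true_iff]
    refine hεV ?_
    rw [mem_closedBall_zero_iff] at hw
    rw [mem_closedBall, ← hp, Prod.dist_eq, Real.dist_eq, Real.dist_eq]
    have h1 := (Complex.abs_re_le_norm w).trans hw
    have h2 := (Complex.abs_im_le_norm w).trans hw
    refine max_le ?_ ?_
    · simp [abs_mul, abs_of_pos hε]; nlinarith
    · simp [abs_mul, abs_of_pos hε]; nlinarith) ⟨z, hzU⟩ rfl
  obtain ⟨φ', h1, h2, h3⟩ := hφ.exists_small_univ (N := N) (by rw [h0]; exact hN)
  exact ⟨φ', h1, h2.trans h0, h3⟩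

theorem IsSurface.exists_isChart (hX : IsSurface X) (z : X) {N : Set X} (hN : N ∈ 𝓝 z) :
    (∃ φ : ℂ → X, IsChart univ φ ∧ φ 0 = z ∧ φ '' (closedBall 0 1 ∩ univ) ⊆ N) ∨
    ∃ φ : ℂ → X, IsChart upperHP φ ∧ φ 0 = z ∧ φ '' (closedBall 0 1 ∩ upperHP) ⊆ N := by
  obtain ⟨U, V, hU, hzU, hV, ⟨h⟩⟩ := hX z
  obtain ⟨W, hW, hWV⟩ := isOpen_induced_iff.1 hV
  let V' : Set (ℝ × ℝ) := Subtype.val '' V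
  let h' : U ≃ₜ V' := h.trans (Topology.IsEmbedding.subtypeVal.homeomorphImage V)
  have hmem : ∀ p : ℝ × ℝ, p ∈ V' ↔ p ∈ W ∧ 0 ≤ p.2 := by
    intro p; subst hWV
    constructor
    · rintro ⟨q, hq, rfl⟩; exact ⟨hq, q.2⟩
    · rintro ⟨h1, h2⟩; exact ⟨⟨p, h2⟩, h1, rfl⟩
  set p : ℝ × ℝ := Subtype.val (h' ⟨z, hzU⟩) with hp
  have hpV : p ∈ W ∧ 0 ≤ p.2 := (hmem p).1 (h' ⟨z, hzU⟩).2
  obtain ⟨ε, hε, hεW⟩ := Metric.nhds_basis_closedBall.mem_iff.1 (hW.mem_nhds hpV.1)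
  have key : ∀ ε' : ℝ, 0 < ε' → ε' ≤ ε → ∀ w ∈ closedBall (0 : ℂ) 1,
      (((⟨p.1, p.2⟩ : ℂ) + ε' * w).re, ((⟨p.1, p.2⟩ : ℂ) + ε' * w).im) ∈ W := by
    intro ε' hε' hle w hw
    refine hεW ?_
    rw [mem_closedBall_zero_iff] at hw
    rw [mem_closedBall, Prod.dist_eq, Real.dist_eq, Real.dist_eq]
    have h1 := (Complex.abs_re_le_norm w).trans hw
    have h2 := (Complex.abs_im_le_norm w).trans hw
    refine max_le ?_ ?_
    · simp [abs_mul, abs_of_pos hε']; nlinarith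
    · simp [abs_mul, abs_of_pos hε']; nlinarith
  rcases eq_or_lt_of_le hpV.2 with h0 | h0
  · right
    obtain ⟨φ, hφ, hφ0⟩ := isChart_of_homeomorph (P := upperHP) (c := ⟨p.1, p.2⟩) hU h' hε (by
      intro w hw
      rw [hmem]
      simp only [key ε hε le_rfl w hw, true_and]
      simp [upperHP, ← h0, hε]) ⟨z, hzU⟩ rfl
    obtain ⟨φ', h1, h2, h3⟩ := hφ.exists_small_upperHP (N := N) (by rw [hφ0]; exact hN)
    exact ⟨φ', h1, h2.trans hφ0, h3⟩
  · left
    have hm : 0 < min ε p.2 := lt_min hε h0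
    obtain ⟨φ, hφ, hφ0⟩ := isChart_of_homeomorph (P := univ) (c := ⟨p.1, p.2⟩) hU h' hm (by
      intro w hw
      rw [hmem]
      simp only [key _ hm (min_le_left _ _) w hw, true_and, mem_univ, true_iff]
      rw [mem_closedBall_zero_iff] at hw
      have h2 := (abs_le.1 ((Complex.abs_im_le_norm w).trans hw)).1
      have : p.2 + min ε p.2 * w.im ≥ 0 := by nlinarith [min_le_right ε p.2]
      simpa using this) ⟨z, hzU⟩ rfl
    obtain ⟨φ', h1, h2, h3⟩ := hφ.exists_small_univ (N := N) (by rw [hφ0]; exact hN)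
    exact ⟨φ', h1, h2.trans hφ0, h3⟩

theorem IsChart.notMem_boundary {φ : ℂ → X} (h : IsChart univ φ) {w : ℂ}
    (hw : w ∈ ball (0 : ℂ) 1) : φ w ∉ surfaceBoundary X := by
  refine not_not.2 ⟨φ '' ball 0 1, {p : ℝ × ℝ | (⟨p.1, p.2⟩ : ℂ) ∈ ball (0 : ℂ) 1}, ?_,
    ⟨w, hw, rfl⟩, ?_, ?_⟩
  · simpa using h.2.2 (ball 0 1) isOpen_ball subset_rfl
  · have : Continuous fun p : ℝ × ℝ => (⟨p.1, p.2⟩ : ℂ) :=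
      Complex.equivRealProdCLM.symm.continuous
    exact isOpen_ball.preimage this
  · have hemb : Topology.IsOpenEmbedding fun v : ball (0 : ℂ) 1 => φ v := by
      refine Topology.IsOpenEmbedding.of_continuous_injective_isOpenMap ?_ ?_ ?_
      · exact continuousOn_iff_continuous_domRestrict.1
          (h.1.mono fun v hv => ⟨ball_subset_closedBall hv, mem_univ _⟩)
      · intro v v' he
        exact Subtype.ext (h.2.1 ⟨ball_subset_closedBall v.2, mem_univ _⟩
          ⟨ball_subset_closedBall v'.2, mem_univ _⟩ he)
      · intro O hO
        have h1 : IsOpen (Subtype.val '' O) := isOpen_ball.isOpenMap_subtype_val O hO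
        have := h.2.2 _ h1 (by rintro _ ⟨v, -, rfl⟩; exact v.2)
        rw [inter_univ, image_image] at this
        exact this
    have hr : range (fun v : ball (0 : ℂ) 1 => φ v) = φ '' ball 0 1 := by
      rw [image_eq_range]
    let e1 : ↥(ball (0 : ℂ) 1) ≃ₜ ↥(φ '' ball 0 1) :=
      hemb.isEmbedding.toHomeomorph.trans (Homeomorph.setCongr hr)
    let e2 : ↥(ball (0 : ℂ) 1) ≃ₜ ↥{p : ℝ × ℝ | (⟨p.1, p.2⟩ : ℂ) ∈ ball (0 : ℂ) 1} :=
      Complex.equivRealProdCLM.toHomeomorph.subtype (by intro a; rfl)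
    exact ⟨e1.symm.trans e2⟩

end Charts

section Boundary

variable {X : Type*} [MetricSpace X]

theorem IsChart.zero_mem_boundary {φ : ℂ → X} (h : IsChart upperHP φ) :
    φ 0 ∈ surfaceBoundary X := by
  by_contra hn
  have h0P : (0 : ℂ) ∈ upperHP := by simp [upperHP]
  obtain ⟨ψ, hψ, hψ0, -⟩ := exists_isChart_of_notMem_boundary hn univ_mem
  have hN1 : ψ '' (ball 0 1 ∩ univ) ∈ 𝓝 (φ 0) := by
    rw [← hψ0]; exact hψ.image_mem_nhds (by simp) (mem_univ _) (ball_mem_nhds _ one_pos)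
  have hc : ContinuousWithinAt φ (closedBall 0 1 ∩ upperHP) 0 := h.1 0 ⟨by simp, h0P⟩
  obtain ⟨V, hV, hVN⟩ := mem_nhdsWithin_iff_exists_mem_nhds_inter.1 (hc hN1)
  obtain ⟨s, hs, hsV⟩ := Metric.nhds_basis_closedBall.mem_iff.1
    (inter_mem hV (closedBall_mem_nhds (0 : ℂ) one_pos))
  have hmaps : ∀ w ∈ closedBall (0 : ℂ) s ∩ upperHP, φ w ∈ ψ '' (ball 0 1 ∩ univ) :=
    fun w hw => hVN ⟨(hsV hw.1).1, (hsV hw.1).2, hw.2⟩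
  let S : Set ℂ := {w | ‖w‖ ≤ s ∧ w ≠ 0 ∧ 0 ≤ w.im}
  have hSc : StarConvex ℝ (s * Complex.I : ℂ) S := by
    rintro w ⟨hw1, hw2, hw3⟩ a b ha hb hab
    have him : (a • (s * Complex.I : ℂ) + b • w).im = a * s + b * w.im := by simp
    refine ⟨?_, ?_, ?_⟩
    · calc ‖a • (s * Complex.I : ℂ) + b • w‖ ≤ a * s + b * s := by
            refine (norm_add_le _ _).trans (add_le_add ?_ ?_)
            · rw [norm_smul]; simp [abs_of_nonneg ha, abs_of_pos hs]
            · rw [norm_smul, Real.norm_of_nonneg hb]; gcongr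
        _ = s := by rw [← add_mul, hab, one_mul]
    · intro h0
      rcases eq_or_lt_of_le ha with ha0 | ha0
      · rw [← ha0, zero_smul, zero_add] at h0
        have : b = 1 := by linarith
        rw [this, one_smul] at h0; exact hw2 h0
      · rw [h0] at him
        simp only [Complex.zero_im] at him
        nlinarith [mul_pos ha0 hs, mul_nonneg hb hw3]
    · rw [him]; positivity
  have hcS : (s * Complex.I : ℂ) ∈ S :=
    ⟨by simp [abs_of_pos hs], by simp [hs.ne'], by simp [hs.le]⟩
  have hSsub : S ⊆ closedBall (0 : ℂ) 1 ∩ upperHP := fun w hw =>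
    ⟨(hsV (mem_closedBall_zero_iff.2 hw.1)).2, hw.2.2⟩
  have hfc : ContinuousOn (fun w => tri (IsChart.inv univ ψ (φ w))) S := by
    intro w hw
    obtain ⟨v, ⟨hv, -⟩, hvw⟩ := hmaps w ⟨mem_closedBall_zero_iff.2 hw.1, hw.2.2⟩
    have hv0 : v ≠ 0 := by
      rintro rfl
      rw [hψ0] at hvw
      exact hw.2.1 (h.2.1 ⟨by simp, h0P⟩ (hSsub hw) hvw).symm
    have h1 : Tendsto (IsChart.inv univ ψ) (𝓝 (φ w)) (𝓝 v) := by
      have := hψ.continuousAt_inv hv (mem_univ _)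
      rwa [nhdsWithin_univ, hvw] at this
    have h2 : IsChart.inv univ ψ (φ w) = v := by
      rw [← hvw]; exact hψ.inv_apply (ball_subset_closedBall hv) (mem_univ _)
    have h3 : Tendsto φ (𝓝[S] w) (𝓝 (φ w)) := (h.1.mono hSsub) w hw
    have h4 : Tendsto tri (𝓝 v) (𝓝 (tri v)) := continuousAt_tri hv0
    rw [ContinuousWithinAt, h2]
    exact h4.comp (h1.comp h3)
  obtain ⟨g, hgc, hg⟩ := Circle.exists_sq_eq_of_starConvex hSc hcS hfc
  have hN2 : φ '' (ball 0 (min s 1) ∩ upperHP) ∈ 𝓝 (ψ 0) := by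
    rw [hψ0]; exact h.image_mem_nhds (by simp) h0P (ball_mem_nhds _ (lt_min hs one_pos))
  have hcψ : ContinuousAt ψ 0 := (hψ.1.mono (by simp)).continuousAt (closedBall_mem_nhds _ one_pos)
  obtain ⟨ρ, hρ, hρN⟩ := Metric.nhds_basis_closedBall.mem_iff.1
    (inter_mem (hcψ hN2) (ball_mem_nhds (0 : ℂ) one_pos))
  refine not_exists_sqrt_tri hρ ⟨fun v => g (IsChart.inv upperHP φ (ψ v)), ?_, ?_⟩
  · rintro v ⟨hv, hv0⟩
    obtain ⟨w, ⟨hw, hwP⟩, hwv⟩ := (hρN hv).1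
    have hw1 : w ∈ ball (0 : ℂ) 1 := ball_subset_ball (min_le_right _ _) hw
    have hw0 : w ≠ 0 := by
      rintro rfl
      rw [← hψ0] at hwv
      exact hv0 (hψ.2.1 ⟨by simp, mem_univ _⟩ ⟨ball_subset_closedBall (hρN hv).2, mem_univ _⟩ hwv).symm
    have hwS : w ∈ S := ⟨by
      have := ball_subset_ball (min_le_left _ _) hw
      exact (mem_ball_zero_iff.1 this).le, hw0, hwP⟩
    have h1 := h.continuousAt_inv hw1 hwP
    rw [hwv] at h1
    have h2 : IsChart.inv upperHP φ (ψ v) = w := by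
      rw [← hwv]; exact h.inv_apply (ball_subset_closedBall hw1) hwP
    have h3 : ContinuousAt ψ v := (hψ.1.mono (by simp)).continuousAt
      (closedBall_mem_nhds_of_mem (hρN hv).2)
    have h4 : 𝓝[upperHP] w ≤ 𝓝[S] w := by
      rw [nhdsWithin_le_iff, mem_nhdsWithin_iff_exists_mem_nhds_inter]
      refine ⟨ball 0 s ∩ {0}ᶜ, inter_mem (isOpen_ball.mem_nhds ?_) (isOpen_compl_singleton.mem_nhds hw0), ?_⟩
      · exact ball_subset_ball (min_le_left _ _) hw
      · rintro z ⟨⟨hz1, hz2⟩, hz3⟩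
        exact ⟨(mem_ball_zero_iff.1 hz1).le, hz2, hz3⟩
    refine ContinuousAt.continuousWithinAt ?_
    rw [ContinuousAt, h2]
    exact ((hgc w hwS).tendsto.mono_left h4).comp (h1.comp h3)
  · rintro v ⟨hv, hv0⟩
    obtain ⟨w, ⟨hw, hwP⟩, hwv⟩ := (hρN hv).1
    have hw1 : w ∈ ball (0 : ℂ) 1 := ball_subset_ball (min_le_right _ _) hw
    have hw0 : w ≠ 0 := by
      rintro rfl
      rw [← hψ0] at hwv
      exact hv0 (hψ.2.1 ⟨by simp, mem_univ _⟩ ⟨ball_subset_closedBall (hρN hv).2, mem_univ _⟩ hwv).symm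
    have hwS : w ∈ S := ⟨by
      have := ball_subset_ball (min_le_left _ _) hw
      exact (mem_ball_zero_iff.1 this).le, hw0, hwP⟩
    have h2 : IsChart.inv upperHP φ (ψ v) = w := by
      rw [← hwv]; exact h.inv_apply (ball_subset_closedBall hw1) hwP
    simp only [h2]
    rw [hg w hwS, hwv, hψ.inv_apply (ball_subset_closedBall (hρN hv).2) (mem_univ _)]

theorem IsChart.mem_boundary_iff {φ : ℂ → X} (h : IsChart upperHP φ) {w : ℂ}
    (hw : w ∈ ball (0 : ℂ) 1) (hwP : w ∈ upperHP) : φ w ∈ surfaceBoundary X ↔ w.im = 0 := by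
  have hw1 := mem_ball_zero_iff.1 hw
  constructor
  · intro hb
    by_contra h0
    have hpos : 0 < w.im := lt_of_le_of_ne hwP (Ne.symm h0)
    have hr : 0 < min w.im (1 - ‖w‖) := lt_min hpos (by linarith)
    have := (h.comp_affine (c := w) (P' := univ) hr (by linarith [min_le_right w.im (1 - ‖w‖)]) (by
      intro v hv
      rw [mem_closedBall_zero_iff] at hv
      have h2 := (abs_le.1 ((Complex.abs_im_le_norm v).trans hv)).1
      have : 0 ≤ w.im + min w.im (1 - ‖w‖) * v.im := by nlinarith [min_le_left w.im (1 - ‖w‖)]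
      simpa [upperHP] using this)).notMem_boundary (w := 0) (by simp)
    simp only [mul_zero, add_zero] at this
    exact this hb
  · intro h0
    have := (h.comp_affine (c := w) (r := 1 - ‖w‖) (P' := upperHP) (by linarith) (by linarith) (by
      intro v _
      simp only [upperHP, mem_ofPred_eq, Complex.add_im, h0, zero_add, Complex.im_ofReal_mul]
      rw [mul_nonneg_iff_of_pos_left (by linarith)])).zero_mem_boundary
    simpa using this

theorem isClosed_surfaceBoundary : IsClosed (surfaceBoundary X) := by
  rw [← isOpen_compl_iff, isOpen_iff_mem_nhds]
  intro z hz
  obtain ⟨φ, hφ, h0, -⟩ := exists_isChart_of_notMem_boundary hz univ_mem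
  have := hφ.image_mem_nhds (w := 0) (by simp) (mem_univ _) (ball_mem_nhds _ one_pos)
  rw [h0] at this
  refine mem_of_superset this ?_
  rintro _ ⟨w, ⟨hw, -⟩, rfl⟩
  exact hφ.notMem_boundary hw

theorem IsSurface.exists_isChart_boundary (hX : IsSurface X) {z : X} (hz : z ∈ surfaceBoundary X)
    {N : Set X} (hN : N ∈ 𝓝 z) :
    ∃ φ : ℂ → X, IsChart upperHP φ ∧ φ 0 = z ∧ φ '' (closedBall 0 1 ∩ upperHP) ⊆ N := by
  rcases hX.exists_isChart z hN with ⟨φ, hφ, h0, -⟩ | h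
  · exact absurd (h0 ▸ hz) (hφ.notMem_boundary (by simp))
  · exact h

theorem IsSurface.isOneManifold (hX : IsSurface X) {K : Set X} (hK : K ⊆ surfaceBoundary X)
    (hK' : ∀ z ∈ K, K ∈ 𝓝[surfaceBoundary X] z) : IsOneManifold K := by
  intro p hp
  obtain ⟨N, hN, hNK⟩ := mem_nhdsWithin_iff_exists_mem_nhds_inter.1 (hK' p hp)
  obtain ⟨φ, hφ, h0, hφN⟩ := hX.exists_isChart_boundary (hK hp) hN
  have hlt : ∀ t : ℝ, ((t / (1 + |t|) : ℝ) : ℂ) ∈ ball (0 : ℂ) 1 := by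
    intro t
    rw [mem_ball_zero_iff, Complex.norm_real, Real.norm_eq_abs, abs_div,
      abs_of_pos (by positivity : 0 < 1 + |t|), div_lt_one (by positivity)]
    linarith
  have hHP : ∀ t : ℝ, ((t : ℝ) : ℂ) ∈ upperHP := fun t => by simp [upperHP]
  refine ⟨fun t => φ ((t / (1 + |t|) : ℝ) : ℂ), ?_, ?_, by simp [h0], ?_, ?_⟩
  · refine hφ.1.comp_continuous ?_ fun t => ⟨ball_subset_closedBall (hlt t), hHP _⟩
    refine Complex.continuous_ofReal.comp (continuous_id.div (by fun_prop) fun t => ?_)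
    positivity
  · intro t t' he
    have h1 := hφ.2.1 ⟨ball_subset_closedBall (hlt t), hHP _⟩
      ⟨ball_subset_closedBall (hlt t'), hHP _⟩ he
    have h2 : t / (1 + |t|) = t' / (1 + |t'|) := by exact_mod_cast h1
    rw [div_eq_div_iff (by positivity) (by positivity)] at h2
    rcases le_total 0 t with h | h <;> rcases le_total 0 t' with h' | h'
    · rw [abs_of_nonneg h, abs_of_nonneg h'] at h2; linarith
    · rw [abs_of_nonneg h, abs_of_nonpos h'] at h2
      nlinarith [mul_nonneg h (neg_nonneg.2 h')]
    · rw [abs_of_nonpos h, abs_of_nonneg h'] at h2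
      nlinarith [mul_nonneg h' (neg_nonneg.2 h)]
    · rw [abs_of_nonpos h, abs_of_nonpos h'] at h2; linarith
  · rintro _ ⟨t, rfl⟩
    refine hNK ⟨hφN ⟨_, ⟨ball_subset_closedBall (hlt t), hHP _⟩, rfl⟩, ?_⟩
    rw [hφ.mem_boundary_iff (hlt t) (hHP _)]; exact Complex.ofReal_im _
  · intro δ hδ
    have hr : 0 < δ / (1 + δ) := by positivity
    have hr1 : δ / (1 + δ) < 1 := by rw [div_lt_one (by positivity)]; linarith
    have h1 := hφ.image_mem_nhds (w := 0) (by simp) (hHP 0) (ball_mem_nhds _ hr)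
    rw [h0] at h1
    rw [mem_nhdsWithin_iff_exists_mem_nhds_inter]
    refine ⟨_, h1, ?_⟩
    rintro _ ⟨⟨w, ⟨hw, hwP⟩, rfl⟩, hwK⟩
    have him := (hφ.mem_boundary_iff (ball_subset_ball hr1.le hw) hwP).1 (hK hwK)
    have hre : |w.re| < δ / (1 + δ) := (Complex.abs_re_le_norm w).trans_lt (mem_ball_zero_iff.1 hw)
    have hre1 : 0 < 1 - |w.re| := by linarith
    have hwre : ((w.re : ℝ) : ℂ) = w := Complex.ext (by simp) (by simp [him])
    refine ⟨w.re / (1 - |w.re|), ?_, ?_⟩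
    · rw [mem_Ioo, ← abs_lt, abs_div, abs_of_pos hre1, div_lt_iff₀ hre1]
      rw [lt_div_iff₀ (by positivity)] at hre
      nlinarith
    · simp only []
      have : w.re / (1 - |w.re|) / (1 + |w.re / (1 - |w.re|)|) = w.re := by
        rw [abs_div, abs_of_pos hre1]; field_simp; ring
      rw [this, hwre]

theorem isClosed_connectedComponentIn {Y : Type*} [TopologicalSpace Y] {F : Set Y}
    (hF : IsClosed F) (z : Y) : IsClosed (connectedComponentIn F z) := by
  by_cases hz : z ∈ F
  · rw [connectedComponentIn_eq_image hz]
    exact hF.isClosedMap_subtype_val _ isClosed_connectedComponent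
  · rw [connectedComponentIn_eq_empty hz]; exact isClosed_empty

theorem isClosed_diff_of_finite_components
    (hfin : (surfaceBoundaryComponents X).Finite) {b : Set X}
    (hb : b ∈ surfaceBoundaryComponents X) : IsClosed (surfaceBoundary X \ b) := by
  have : surfaceBoundary X \ b = ⋃ b' ∈ surfaceBoundaryComponents X \ {b}, b' := by
    obtain ⟨x, hx, rfl⟩ := hb
    ext z; simp only [mem_iUnion, exists_prop]
    constructor
    · rintro ⟨hz, hzb⟩
      refine ⟨_, ⟨⟨z, hz, rfl⟩, ?_⟩, mem_connectedComponentIn hz⟩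
      intro he
      exact hzb (he ▸ mem_connectedComponentIn hz)
    · rintro ⟨b', ⟨⟨y, hy, rfl⟩, hne⟩, hz⟩
      refine ⟨connectedComponentIn_subset _ _ hz, fun hz' => hne ?_⟩
      rw [mem_singleton_iff, connectedComponentIn_eq hz, connectedComponentIn_eq hz']
  rw [this]
  refine (hfin.subset sdiff_subset).isClosed_biUnion ?_
  rintro b' ⟨⟨y, hy, rfl⟩, -⟩
  exact isClosed_connectedComponentIn isClosed_surfaceBoundary y

theorem IsCompactSurface.isJordanCurve_boundaryComponent [CompactSpace X] (hX : IsSurface X)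
    (hfin : (surfaceBoundaryComponents X).Finite) {b : Set X}
    (hb : b ∈ surfaceBoundaryComponents X) : IsJordanCurve b := by
  have hcl := isClosed_diff_of_finite_components hfin hb
  obtain ⟨x, hx, rfl⟩ := hb
  have hsub := connectedComponentIn_subset (surfaceBoundary X) x
  refine (hX.isOneManifold hsub ?_).isJordanCurve
    (isClosed_connectedComponentIn isClosed_surfaceBoundary x).isCompact
    (isConnected_connectedComponentIn_iff.2 hx)
  intro z hz
  rw [mem_nhdsWithin_iff_exists_mem_nhds_inter]
  refine ⟨_, hcl.isOpen_compl.mem_nhds (fun h => h.2 hz), ?_⟩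
  rintro y ⟨hy1, hy2⟩
  by_contra hn
  exact hy1 ⟨hy2, hn⟩

end Boundary

section Homogeneity

variable {X : Type*} [MetricSpace X]

theorem IsChart.exists_homeomorph [CompactSpace X] {φ : ℂ → X} (h : IsChart univ φ) {c : ℂ}
    (hc : ‖c‖ < 1) :
    ∃ ψ : X ≃ₜ X, (∀ z, z ∉ φ '' (closedBall 0 1 ∩ univ) → ψ z = z) ∧ ψ (φ 0) = φ c := by
  obtain ⟨r, hr0, hcr, hr1⟩ : ∃ r : ℝ, 0 < r ∧ ‖c‖ < r ∧ r < 1 :=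
    ⟨(1 + ‖c‖) / 2, by positivity, by linarith, by linarith⟩
  let m : ℂ → ℝ := fun w => max 0 (1 - ‖w‖ / r)
  let F : ℂ → ℂ := fun w => w + (m w : ℂ) * c
  have hmc : Continuous m := by fun_prop
  have hFc : Continuous F := by fun_prop
  have hm0 : ∀ w, 0 ≤ m w := fun w => le_max_left _ _
  have hmr : ∀ w : ℂ, r ≤ ‖w‖ → m w = 0 := fun w hw => max_eq_left (by
    have : 1 ≤ ‖w‖ / r := (one_le_div hr0).2 hw
    linarith)
  have hFr : ∀ w : ℂ, r ≤ ‖w‖ → F w = w := fun w hw => by simp [F, hmr w hw]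
  have hFle : ∀ w : ℂ, ‖w‖ ≤ r → ‖F w‖ ≤ r := by
    intro w hw
    have h1 : m w = 1 - ‖w‖ / r := max_eq_right (by
      have : ‖w‖ / r ≤ 1 := (div_le_one hr0).2 hw
      linarith)
    calc ‖F w‖ ≤ ‖w‖ + m w * ‖c‖ := by
          refine (norm_add_le _ _).trans ?_
          rw [norm_mul, Complex.norm_real, Real.norm_of_nonneg (hm0 w)]
      _ ≤ ‖w‖ + m w * r := by gcongr
      _ = r := by rw [h1]; field_simp; ring
  have hFb : ∀ w ∈ ball (0 : ℂ) 1, F w ∈ ball (0 : ℂ) 1 := by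
    intro w hw
    rw [mem_ball_zero_iff] at hw ⊢
    rcases le_total ‖w‖ r with h1 | h1
    · exact (hFle w h1).trans_lt hr1
    · rwa [hFr w h1]
  have hFcb : ∀ w ∈ closedBall (0 : ℂ) 1, F w ∈ closedBall (0 : ℂ) 1 := by
    intro w hw
    rw [mem_closedBall_zero_iff] at hw ⊢
    rcases le_total ‖w‖ r with h1 | h1
    · exact (hFle w h1).trans hr1.le
    · rwa [hFr w h1]
  have hFinj : Function.Injective F := by
    intro w w' he
    have h1 : w - w' = ((m w' - m w : ℝ) : ℂ) * c := by
      simp only [F] at he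
      push_cast
      linear_combination he
    have h2 : ‖w - w'‖ = |m w' - m w| * ‖c‖ := by
      rw [h1, norm_mul, Complex.norm_real, Real.norm_eq_abs]
    have h3 : |m w' - m w| ≤ ‖w - w'‖ / r := by
      refine (abs_max_sub_max_le_max _ _ _ _).trans ?_
      rw [sub_self, abs_zero, max_eq_right (abs_nonneg _)]
      · have : (1 - ‖w'‖ / r) - (1 - ‖w‖ / r) = (‖w‖ - ‖w'‖) / r := by ring
        rw [this, abs_div, abs_of_pos hr0]
        gcongr
        exact abs_norm_sub_norm_le _ _
    have h4 : ‖w - w'‖ * r ≤ ‖w - w'‖ * ‖c‖ := by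
      calc ‖w - w'‖ * r = |m w' - m w| * ‖c‖ * r := by rw [h2]
        _ ≤ ‖w - w'‖ / r * ‖c‖ * r := by gcongr
        _ = _ := by field_simp
    by_contra hne
    have : 0 < ‖w - w'‖ := norm_pos_iff.2 (sub_ne_zero.2 hne)
    nlinarith
  have hFsurj : ∀ v ∈ closedBall (0 : ℂ) 1, ∃ w ∈ closedBall (0 : ℂ) 1, F w = v := by
    intro v hv
    rcases le_total r ‖v‖ with h1 | h1
    · exact ⟨v, hv, hFr v h1⟩
    · have hcont : ContinuousOn (fun s : ℝ => s - 1 + ‖v - s * c‖ / r) (Icc 0 1) := by fun_prop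
      have hmem : (0 : ℝ) ∈ Icc ((0 : ℝ) - 1 + ‖v - (0 : ℝ) * c‖ / r)
          ((1 : ℝ) - 1 + ‖v - (1 : ℝ) * c‖ / r) := by
        constructor
        · have : ‖v‖ / r ≤ 1 := (div_le_one hr0).2 h1
          simpa using this
        · simp only [sub_self, zero_add]; positivity
      obtain ⟨s, hs, hs0⟩ := intermediate_value_Icc zero_le_one hcont hmem
      simp only at hs0
      have h2 : ‖v - s * c‖ = r * (1 - s) := by field_simp at hs0; linarith
      refine ⟨v - s * c, ?_, ?_⟩
      · rw [mem_closedBall_zero_iff, h2]; nlinarith [hs.1]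
      · have : m (v - s * c) = s := by
          simp only [m]
          rw [show 1 - ‖v - s * c‖ / r = s by linarith, max_eq_right hs.1]
        simp only [F, this]; ring
  let Ψ : X → X := IsChart.patch univ φ (fun w => φ (F w)) id
  have hΨ : ∀ w ∈ closedBall (0 : ℂ) 1, Ψ (φ w) = φ (F w) := fun w hw =>
    h.patch_apply hw (mem_univ _)
  have hΨ' : ∀ z, z ∉ φ '' (closedBall 0 1 ∩ univ) → Ψ z = z := fun z hz =>
    IsChart.patch_of_notMem hz
  have hcont : Continuous Ψ := by
    rw [continuous_iff_continuousAt]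
    intro z
    by_cases hz : z ∈ φ '' (closedBall 0 r ∩ univ)
    · obtain ⟨w, ⟨hw, -⟩, rfl⟩ := hz
      have hw1 := closedBall_subset_ball hr1 hw
      refine h.continuousAt_patch hw1 (mem_univ _) ?_
      refine ContinuousAt.continuousWithinAt (ContinuousAt.comp ?_ hFc.continuousAt)
      exact (h.1.mono (by simp)).continuousAt (closedBall_mem_nhds_of_mem (hFb w hw1))
    · refine h.continuousAt_patch_of_notMem isClosed_univ hr1.le ?_ hz continuousAt_id
      intro w _ _ hw
      simp [hFr w hw.le]
  have hbij : Function.Bijective Ψ := by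
    constructor
    · intro z z' he
      by_cases hz : z ∈ φ '' (closedBall 0 1 ∩ univ) <;>
        by_cases hz' : z' ∈ φ '' (closedBall 0 1 ∩ univ)
      · obtain ⟨w, ⟨hw, -⟩, rfl⟩ := hz
        obtain ⟨w', ⟨hw', -⟩, rfl⟩ := hz'
        rw [hΨ w hw, hΨ w' hw'] at he
        rw [hFinj (h.2.1 ⟨hFcb w hw, mem_univ _⟩ ⟨hFcb w' hw', mem_univ _⟩ he)]
      · obtain ⟨w, ⟨hw, -⟩, rfl⟩ := hz
        rw [hΨ w hw, hΨ' z' hz'] at he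
        exact absurd ⟨_, ⟨hFcb w hw, mem_univ _⟩, he⟩ hz'
      · obtain ⟨w, ⟨hw, -⟩, rfl⟩ := hz'
        rw [hΨ w hw, hΨ' z hz] at he
        exact absurd ⟨_, ⟨hFcb w hw, mem_univ _⟩, he.symm⟩ hz
      · rwa [hΨ' z hz, hΨ' z' hz'] at he
    · intro z
      by_cases hz : z ∈ φ '' (closedBall 0 1 ∩ univ)
      · obtain ⟨v, ⟨hv, -⟩, rfl⟩ := hz
        obtain ⟨w, hw, hwv⟩ := hFsurj v hv
        exact ⟨φ w, by rw [hΨ w hw, hwv]⟩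
      · exact ⟨z, hΨ' z hz⟩
  have hcont' : Continuous (Equiv.ofBijective Ψ hbij) := hcont
  refine ⟨hcont'.homeoOfEquivCompactToT2, hΨ', ?_⟩
  change Ψ (φ 0) = φ c
  rw [hΨ 0 (by simp)]
  simp [F, m]

theorem IsPreconnected.invariant_of_homeomorph [CompactSpace X] {F : Set X} (hF : IsClosed F)
    (hF' : surfaceBoundary X ⊆ F) {Q : X → Prop}
    (hQ : ∀ ψ : X ≃ₜ X, (∀ z ∈ F, ψ z = z) → ∀ p, p ∉ F → Q p → Q (ψ p)) {S : Set X}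
    (hS : IsPreconnected S) (hSF : S ⊆ Fᶜ) {p p' : X} (hp : p ∈ S) (hp' : p' ∈ S) (h : Q p) :
    Q p' := by
  have key : ∀ z ∈ S, ∃ N : Set X, IsOpen N ∧ z ∈ N ∧ ∀ z' ∈ N, Q z ↔ Q z' := by
    intro z hz
    obtain ⟨φ, hφ, h0, hN⟩ := exists_isChart_of_notMem_boundary (fun hb => hSF hz (hF' hb))
      (hF.isOpen_compl.mem_nhds (hSF hz))
    refine ⟨φ '' (ball 0 1 ∩ univ), hφ.2.2 _ isOpen_ball subset_rfl,
      ⟨0, ⟨by simp, mem_univ _⟩, h0⟩, ?_⟩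
    rintro _ ⟨w, ⟨hw, -⟩, rfl⟩
    obtain ⟨ψ, h1, h2⟩ := hφ.exists_homeomorph (mem_ball_zero_iff.1 hw)
    have hfix : ∀ y ∈ F, ψ y = y := fun y hy => h1 y fun hm => hN hm hy
    rw [h0] at h2
    constructor
    · intro hq; rw [← h2]; exact hQ ψ hfix z (hSF hz) hq
    · intro hq
      have h3 : ψ.symm (φ w) = z := by rw [← h2, ψ.symm_apply_apply]
      rw [← h3]
      refine hQ ψ.symm (fun y hy => ?_) _ (hN ⟨w, ⟨ball_subset_closedBall hw, mem_univ _⟩, rfl⟩) hq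
      rw [ψ.symm_apply_eq, hfix y hy]
  choose! N hNo hzN hN using key
  by_contra hn
  have := hS (⋃ z ∈ {z | z ∈ S ∧ Q z}, N z) (⋃ z ∈ {z | z ∈ S ∧ ¬ Q z}, N z)
    (isOpen_biUnion fun z hz => hNo z hz.1) (isOpen_biUnion fun z hz => hNo z hz.1)
    (fun z hz => by
      by_cases hq : Q z
      · exact Or.inl (mem_biUnion (x := z) ⟨hz, hq⟩ (hzN z hz))
      · exact Or.inr (mem_biUnion (x := z) ⟨hz, hq⟩ (hzN z hz)))
    ⟨p, hp, mem_biUnion (x := p) ⟨hp, h⟩ (hzN p hp)⟩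
    ⟨p', hp', mem_biUnion (x := p') ⟨hp', hn⟩ (hzN p' hp')⟩
  obtain ⟨z, -, h1, h2⟩ := this
  simp only [mem_iUnion] at h1 h2
  obtain ⟨z1, ⟨h3, h4⟩, h5⟩ := h1
  obtain ⟨z2, ⟨h6, h7⟩, h8⟩ := h2
  exact h7 ((hN z2 h6 z h8).2 ((hN z1 h3 z h5).1 h4))

theorem IsSurface.eventually_of_invariant [CompactSpace X] (hX : IsSurface X) {K : Set X}
    (hK : IsClosed K) {Q : X → Prop}
    (hQ : ∀ ψ : X ≃ₜ X, (∀ z ∈ surfaceBoundary X ∪ K, ψ z = z) →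
      ∀ p, p ∉ surfaceBoundary X ∪ K → Q p → Q (ψ p)) {C : Set X}
    (hC : IsPreconnected C) (hCK : C ⊆ Kᶜ) {x y : X} (hx : x ∈ C) (hy : y ∈ C)
    (h : ∃ᶠ p in 𝓝 x, p ∉ surfaceBoundary X ∪ K ∧ Q p) :
    ∀ᶠ p in 𝓝 y, p ∉ surfaceBoundary X ∪ K → Q p := by
  set F := surfaceBoundary X ∪ K with hFdef
  have hF : IsClosed F := isClosed_surfaceBoundary.union hK
  have key : ∀ z ∈ C, ∃ N : Set X, IsOpen N ∧ z ∈ N ∧ (N ∩ Fᶜ).Nonempty ∧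
      ∀ p ∈ N ∩ Fᶜ, ∀ p' ∈ N ∩ Fᶜ, Q p → Q p' := by
    intro z hz
    have main : ∀ (P : Set ℂ) (φ : ℂ → X), IsChart P φ → (0 : ℂ) ∈ P → φ 0 = z →
        φ '' (closedBall 0 1 ∩ P) ⊆ Kᶜ → ∀ O : Set ℂ, IsPreconnected (ball 0 1 ∩ O) → O ⊆ P →
        (ball 0 1 ∩ O).Nonempty → (∀ w ∈ ball (0 : ℂ) 1, w ∈ P → (φ w ∉ surfaceBoundary X ↔ w ∈ O)) →
        ∃ N : Set X, IsOpen N ∧ z ∈ N ∧ (N ∩ Fᶜ).Nonempty ∧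
      ∀ p ∈ N ∩ Fᶜ, ∀ p' ∈ N ∩ Fᶜ, Q p → Q p' := by
      intro P φ hφ h0P h0 hN O hO hOP hne hb
      have hsub : φ '' (ball 0 1 ∩ O) ⊆ Fᶜ := by
        rintro _ ⟨w, ⟨hw, hwO⟩, rfl⟩ hm
        rcases hm with hm | hm
        · exact (hb w hw (hOP hwO)).2 hwO hm
        · exact hN ⟨w, ⟨ball_subset_closedBall hw, hOP hwO⟩, rfl⟩ hm
      have hpre : IsPreconnected (φ '' (ball 0 1 ∩ O)) :=
        hO.image _ (hφ.1.mono (inter_subset_inter ball_subset_closedBall hOP))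
      have hmem : ∀ p ∈ φ '' (ball 0 1 ∩ P) ∩ Fᶜ, p ∈ φ '' (ball 0 1 ∩ O) := by
        rintro _ ⟨⟨w, ⟨hw, hwP⟩, rfl⟩, hp⟩
        exact ⟨w, ⟨hw, (hb w hw hwP).1 fun hm => hp (Or.inl hm)⟩, rfl⟩
      refine ⟨φ '' (ball 0 1 ∩ P), hφ.2.2 _ isOpen_ball subset_rfl, ⟨0, ⟨by simp, h0P⟩, h0⟩, ?_, ?_⟩
      · obtain ⟨w, hw⟩ := hne
        exact ⟨φ w, ⟨w, ⟨hw.1, hOP hw.2⟩, rfl⟩, hsub ⟨w, hw, rfl⟩⟩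
      · intro p hp p' hp' hq
        exact hpre.invariant_of_homeomorph hF subset_union_left hQ hsub (hmem p hp) (hmem p' hp') hq
    rcases hX.exists_isChart z (hK.isOpen_compl.mem_nhds (hCK hz)) with
      ⟨φ, hφ, h0, hN⟩ | ⟨φ, hφ, h0, hN⟩
    · refine main univ φ hφ (mem_univ _) h0 hN univ ?_ subset_rfl ⟨0, by simp⟩ ?_
      · rw [inter_univ]; exact (convex_ball _ _).isPreconnected
      · intro w hw _; simp [hφ.notMem_boundary hw]
    · refine main upperHP φ hφ (by simp [upperHP]) h0 hN {w | 0 < w.im} ?_ ?_ ?_ ?_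
      · exact ((convex_ball _ _).inter (convex_halfSpace_im_gt 0)).isPreconnected
      · intro w hw; exact (show 0 < w.im from hw).le
      · exact ⟨Complex.I / 2, by simp; norm_num, by simp⟩
      · intro w hw hwP
        rw [hφ.mem_boundary_iff hw hwP]
        exact ⟨fun hn => lt_of_le_of_ne hwP (Ne.symm hn), fun h' => ne_of_gt h'⟩
  choose! N hNo hzN hNe hN using key
  by_contra hn
  let G : X → Prop := fun z => ∃ p ∈ N z ∩ Fᶜ, Q p
  have hGx : G x := by
    obtain ⟨p, ⟨h1, h2⟩, h3⟩ := (h.and_eventually ((hNo x hx).mem_nhds (hzN x hx))).exists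
    exact ⟨p, ⟨h3, h1⟩, h2⟩
  have hGy : ¬ G y := by
    rintro ⟨p, hp, hq⟩
    refine hn ?_
    filter_upwards [(hNo y hy).mem_nhds (hzN y hy)] with p' hp' hp'F
    exact hN y hy p hp p' ⟨hp', hp'F⟩ hq
  have := hC (⋃ z ∈ {z | z ∈ C ∧ G z}, N z) (⋃ z ∈ {z | z ∈ C ∧ ¬ G z}, N z)
    (isOpen_biUnion fun z hz => hNo z hz.1) (isOpen_biUnion fun z hz => hNo z hz.1)
    (fun z hz => by
      by_cases hq : G z
      · exact Or.inl (mem_biUnion (x := z) ⟨hz, hq⟩ (hzN z hz))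
      · exact Or.inr (mem_biUnion (x := z) ⟨hz, hq⟩ (hzN z hz)))
    ⟨x, hx, mem_biUnion (x := x) ⟨hx, hGx⟩ (hzN x hx)⟩
    ⟨y, hy, mem_biUnion (x := y) ⟨hy, hGy⟩ (hzN y hy)⟩
  obtain ⟨z, hzC, h1, h2⟩ := this
  simp only [mem_iUnion] at h1 h2
  obtain ⟨z1, ⟨h3, p1, hp1, hq1⟩, h5⟩ := h1
  obtain ⟨z2, ⟨h6, h7⟩, h8⟩ := h2
  obtain ⟨φ, O, hO, hne⟩ : ∃ (_ : Unit) (O : Set X), O ⊆ N z1 ∩ N z2 ∧ (O ∩ Fᶜ).Nonempty := by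
    refine ⟨(), N z1 ∩ N z2, subset_rfl, ?_⟩
    have hnb : N z1 ∩ N z2 ∩ Kᶜ ∈ 𝓝 z := inter_mem (inter_mem ((hNo z1 h3).mem_nhds h5)
      ((hNo z2 h6).mem_nhds h8)) (hK.isOpen_compl.mem_nhds (hCK hzC))
    rcases hX.exists_isChart z hnb with ⟨φ, hφ, h0, hN'⟩ | ⟨φ, hφ, h0, hN'⟩
    · have hm := hN' ⟨0, ⟨by simp, mem_univ _⟩, rfl⟩
      exact ⟨φ 0, hm.1, fun hF' => hF'.elim (hφ.notMem_boundary (by simp)) hm.2⟩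
    · have hI : Complex.I / 2 ∈ ball (0 : ℂ) 1 := by simp; norm_num
      have hIP : Complex.I / 2 ∈ upperHP := by simp [upperHP]
      have hm := hN' ⟨_, ⟨ball_subset_closedBall hI, hIP⟩, rfl⟩
      refine ⟨_, hm.1, fun hF' => hF'.elim (fun hb => ?_) hm.2⟩
      have := (hφ.mem_boundary_iff hI hIP).1 hb
      simp at this
  obtain ⟨p, hpO, hpF⟩ := hne
  exact h7 ⟨p, ⟨(hO hpO).2, hpF⟩, hN z1 h3 p1 hp1 p ⟨(hO hpO).1, hpF⟩ hq1⟩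

end Homogeneity

section OddArcs

variable {X : Type*} [MetricSpace X]

/-- An arc of a surface meeting the boundary exactly in its two endpoints, together with a
circle-valued function on the surface and a square root of it on the boundary whose signs at the
two endpoints differ. -/
def IsOddArc (K : Set X) : Prop :=
  ∃ (a a' : X) (u v : X → Circle), IsArc K a a' ∧ K ∩ surfaceBoundary X = {a, a'} ∧
    Continuous u ∧ ContinuousOn v (surfaceBoundary X) ∧ (∀ z ∈ surfaceBoundary X, v z ^ 2 = u z) ∧
    (∀ z ∈ K, u z = 1) ∧ v a = 1 ∧ v a' = -1

theorem isOddArc_of_isClosed {K A : Set X} {a a' : X} (hK : IsArc K a a')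
    (hKB : K ∩ surfaceBoundary X = {a, a'}) (hA : IsClosed A)
    (hA' : IsClosed (surfaceBoundary X \ A)) (ha : a ∈ A) (ha' : a' ∉ A) : IsOddArc K := by
  classical
  refine ⟨a, a', fun _ => 1, fun z => if z ∈ A then 1 else -1, hK, hKB, continuous_const, ?_, ?_,
    fun _ _ => rfl, if_pos ha, if_neg ha'⟩
  · refine ContinuousOn.of_isClosed_cover hA hA'
      (fun z hz => (em (z ∈ A)).imp id fun h => ⟨hz, h⟩) ?_ ?_
    · exact continuousOn_const.congr fun z hz => if_pos hz.2
    · exact continuousOn_const.congr fun z hz => if_neg hz.2.2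
  · intro z _
    simp only []
    split_ifs
    · simp
    · simp

theorem tri_smul {r : ℝ} (hr : 0 < r) (w : ℂ) : tri (r * w) = tri w := by
  unfold tri
  simp only [Complex.im_ofReal_mul, Complex.re_ofReal_mul]
  by_cases h : w.im < 0
  · rw [if_pos h, if_pos (mul_neg_of_pos_of_neg hr h)]
    congr 3
    rw [← mul_neg, mul_div_mul_left _ _ hr.ne']
  · rw [if_neg h, if_neg (by push Not at h ⊢; positivity)]

/-- The function equal to `-1` right of `1 / 2`, to `1` left of `-1 / 2`, and turning by a half
turn in between. -/
noncomputable def halfTurn (t : ℝ) : Circle := Circle.exp (Real.pi * clampHalf (2 * t))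

theorem continuous_halfTurn : Continuous halfTurn :=
  Circle.exp.continuous.comp (continuous_const.mul (continuous_clampHalf.comp (by fun_prop)))

theorem halfTurn_of_le {t : ℝ} (h : t ≤ -(1 / 2)) : halfTurn t = 1 := by
  unfold halfTurn; rw [clampHalf_of_le (by linarith)]; simp

theorem halfTurn_of_ge {t : ℝ} (h : 1 / 2 ≤ t) : halfTurn t = -1 := by
  unfold halfTurn; rw [clampHalf_of_ge (by linarith), mul_one, Circle.exp_pi_eq]

theorem halfTurn_sq (t : ℝ) : halfTurn t ^ 2 = tri (t - Complex.I / 2) := by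
  rw [tri_of_im_neg (by simp)]
  unfold halfTurn
  rw [← Circle.exp_nsmul]
  congr 1
  simp
  ring_nf

theorem tri_sub_eq_one {w : ℂ} (hw : 1 / 2 ≤ ‖w‖) (hwP : w ∈ upperHP) :
    tri (w - Complex.I / 2) = 1 := by
  refine tri_eq_one ?_
  have h0 : 0 ≤ w.im := hwP
  have h1 := Complex.norm_le_abs_re_add_abs_im w
  rw [abs_of_nonneg h0] at h1
  simp
  linarith

/-- `f` has no continuous square root on punctured neighbourhoods of `p`. -/
def NoSqrtNear (f : X → Circle) (p : X) : Prop :=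
  ∀ N ∈ 𝓝 p, ¬ ∃ g : X → Circle, ContinuousOn g (N \ {p}) ∧ ∀ z ∈ N \ {p}, g z ^ 2 = f z

theorem NoSqrtNear.comp_homeomorph {f : X → Circle} {p : X} (h : NoSqrtNear f p) (ψ : X ≃ₜ X) :
    NoSqrtNear (f ∘ ψ) (ψ.symm p) := by
  rintro N hN ⟨g, hg, hsq⟩
  have hm : ∀ z ∈ ψ.symm ⁻¹' N \ {p}, ψ.symm z ∈ N \ {ψ.symm p} := fun z hz =>
    ⟨hz.1, fun he => hz.2 (ψ.symm.injective he)⟩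
  refine h (ψ.symm ⁻¹' N) (ψ.symm.continuous.continuousAt hN) ⟨g ∘ ψ.symm, ?_, ?_⟩
  · exact hg.comp ψ.symm.continuous.continuousOn hm
  · intro z hz
    have := hsq _ (hm z hz)
    simpa using this

theorem IsChart.noSqrtNear {φ : ℂ → X} (h : IsChart univ φ) {f : X → Circle}
    (hf : ∀ w ∈ closedBall (0 : ℂ) 1 \ {0}, f (φ w) = tri w) : NoSqrtNear f (φ 0) := by
  rintro N hN ⟨g, hg, hsq⟩
  have hc : ContinuousAt φ 0 := (h.1.mono (by simp)).continuousAt (closedBall_mem_nhds _ one_pos)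
  obtain ⟨ρ, hρ, hρN⟩ := Metric.nhds_basis_closedBall.mem_iff.1
    (inter_mem (hc hN) (closedBall_mem_nhds (0 : ℂ) one_pos))
  have hm : ∀ w ∈ closedBall (0 : ℂ) ρ \ {0}, φ w ∈ N \ {φ 0} := fun w hw =>
    ⟨(hρN hw.1).1, fun he => hw.2 (h.2.1 ⟨(hρN hw.1).2, mem_univ _⟩ ⟨by simp, mem_univ _⟩ he)⟩
  refine not_exists_sqrt_tri hρ ⟨g ∘ φ, ?_, ?_⟩
  · exact hg.comp (h.1.mono fun w hw => ⟨(hρN hw.1).2, mem_univ _⟩) hm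
  · intro w hw
    rw [Function.comp, hsq _ (hm w hw), hf w ⟨(hρN hw.1).2, hw.2⟩]

theorem NoSqrtNear.exists_odd {φ : ℂ → X} (h : IsChart univ φ) {f : X → Circle}
    (hf : ContinuousOn f {φ 0}ᶜ) (hn : NoSqrtNear f (φ 0)) :
    ∃ (k : ℤ) (θ : ℂ → ℝ), Odd k ∧ ContinuousOn θ (closedBall 0 1 \ {0}) ∧
      ∀ w ∈ closedBall (0 : ℂ) 1 \ {0}, f (φ w) = tri w ^ k * Circle.exp (θ w) := by
  obtain ⟨k, θ, hθ, hk⟩ := exists_tri_zpow one_pos (f := f ∘ φ)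
    (hf.comp (h.1.mono fun w hw => ⟨hw.1, mem_univ _⟩) fun w hw he =>
      hw.2 (h.2.1 ⟨hw.1, mem_univ _⟩ ⟨by simp, mem_univ _⟩ he))
  refine ⟨k, θ, ?_, hθ, hk⟩
  by_contra hodd
  obtain ⟨m, rfl⟩ := Int.not_odd_iff_even.1 hodd
  refine hn (φ '' (ball 0 1 ∩ univ)) (h.image_mem_nhds (by simp) (mem_univ _)
    (ball_mem_nhds _ one_pos)) ⟨fun z => tri (IsChart.inv univ φ z) ^ m *
      Circle.exp (θ (IsChart.inv univ φ z) / 2), ?_, ?_⟩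
  · rintro _ ⟨⟨w, ⟨hw, -⟩, rfl⟩, hz⟩
    have hw0 : w ≠ 0 := fun h0 => hz (by rw [h0]; rfl)
    have h1 := h.continuousAt_inv hw (mem_univ _)
    rw [nhdsWithin_univ] at h1
    have h2 := h.inv_apply (ball_subset_closedBall hw) (mem_univ _)
    have h3 : ContinuousAt (fun w => tri w ^ m * Circle.exp (θ w / 2)) w := by
      refine ((continuousAt_tri hw0).zpow m).mul
        (Circle.exp.continuous.continuousAt.comp (ContinuousAt.div_const ?_ 2))
      exact hθ.continuousAt (inter_mem (closedBall_mem_nhds_of_mem hw)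
        (isOpen_compl_singleton.mem_nhds hw0))
    refine ContinuousAt.continuousWithinAt ?_
    rw [ContinuousAt, h2]
    exact h3.tendsto.comp h1
  · rintro _ ⟨⟨w, ⟨hw, -⟩, rfl⟩, hz⟩
    have hw0 : w ≠ 0 := fun h0 => hz (by rw [h0]; rfl)
    have h4 := hk w ⟨ball_subset_closedBall hw, hw0⟩
    simp only [Function.comp] at h4
    simp only [h.inv_apply (ball_subset_closedBall hw) (mem_univ _)]
    rw [h4, mul_pow, ← Circle.exp_nsmul, ← zpow_natCast, ← zpow_mul]
    congr 2
    · push_cast; ring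
    · simp; ring

theorem IsChart.comp_neg_conj {φ : ℂ → X} (h : IsChart upperHP φ) :
    IsChart upperHP fun w => φ (-(starRingEnd ℂ w)) := by
  have hm : ∀ w, w ∈ closedBall (0 : ℂ) 1 ∩ upperHP →
      -(starRingEnd ℂ w) ∈ closedBall (0 : ℂ) 1 ∩ upperHP := by
    rintro w ⟨h1, h2⟩
    refine ⟨by simpa using h1, ?_⟩
    simpa [upperHP] using h2
  have hinv : ∀ w : ℂ, -(starRingEnd ℂ (-(starRingEnd ℂ w))) = w := fun w => by simp
  have hc : Continuous fun w : ℂ => -(starRingEnd ℂ w) := Complex.continuous_conj.neg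
  refine ⟨h.1.comp hc.continuousOn hm, ?_, ?_⟩
  · intro w hw w' hw' he
    have := h.2.1 (hm w hw) (hm w' hw') he
    rw [← hinv w, this, hinv]
  · intro O hO hO1
    convert h.2.2 _ (hO.preimage hc) (fun w hw => by simpa using hO1 hw) using 1
    ext z; constructor
    · rintro ⟨w, ⟨hw, hwP⟩, rfl⟩
      exact ⟨_, ⟨by rw [mem_preimage, hinv]; exact hw,
        (hm w ⟨ball_subset_closedBall (hO1 hw), hwP⟩).2⟩, rfl⟩
    · rintro ⟨w, ⟨hw, hwP⟩, rfl⟩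
      refine ⟨-(starRingEnd ℂ w), ⟨hw, ?_⟩, by simp only [hinv]⟩
      simpa [upperHP] using hwP

theorem IsSurface.exists_isChart_sides (hX : IsSurface X) {A B : Set X} (hA : IsClosed A)
    (hB : IsClosed B) (hAB : A ∪ B = surfaceBoundary X) {x : X} (hxA : x ∈ A)
    {N : Set X} (hN : N ∈ 𝓝 x) (hNx : A ∩ B ∩ N ⊆ {x}) (hA' : x ∈ closure (A \ {x}))
    (hB' : x ∈ closure (B \ {x})) :
    ∃ φ : ℂ → X, IsChart upperHP φ ∧ φ 0 = x ∧ φ '' (closedBall 0 1 ∩ upperHP) ⊆ N ∧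
      (∀ w ∈ closedBall (0 : ℂ) 1, w ∈ upperHP → φ w ∈ surfaceBoundary X → w.im = 0) ∧
      (∀ t : ℝ, -1 ≤ t → t < 0 → φ t ∈ A ∧ φ t ∉ B) ∧
      ∀ t : ℝ, 0 < t → t ≤ 1 → φ t ∈ B ∧ φ t ∉ A := by
  obtain ⟨φ₀, hφ₀, h00, hN₀⟩ := hX.exists_isChart_boundary (hAB ▸ Or.inl hxA) hN
  have hhalf : (0 : ℝ) < 1 / 2 := by norm_num
  set φ : ℂ → X := fun w => φ₀ ((1 / 2 : ℝ) * w) with hφdef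
  have hφ : IsChart upperHP φ := hφ₀.comp_smul_upperHP hhalf (by norm_num)
  have h0 : φ 0 = x := by simp [hφdef, h00]
  have hscale : ∀ w ∈ closedBall (0 : ℂ) 1, w ∈ upperHP →
      ((1 / 2 : ℝ) : ℂ) * w ∈ ball (0 : ℂ) 1 ∩ upperHP := by
    intro w hw hwP
    rw [mem_closedBall_zero_iff] at hw
    refine ⟨?_, ?_⟩
    · rw [mem_ball_zero_iff, norm_mul, Complex.norm_real, Real.norm_of_nonneg hhalf.le]; linarith
    · have h1 : 0 ≤ w.im := hwP
      change 0 ≤ (((1 / 2 : ℝ) : ℂ) * w).im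
      rw [Complex.im_ofReal_mul]; positivity
  have hbd : ∀ w ∈ closedBall (0 : ℂ) 1, w ∈ upperHP → (φ w ∈ surfaceBoundary X ↔ w.im = 0) := by
    intro w hw hwP
    obtain ⟨h1, h2⟩ := hscale w hw hwP
    rw [hφdef, hφ₀.mem_boundary_iff h1 h2, Complex.im_ofReal_mul]
    simp
  have hreal : ∀ t : ℝ, -1 ≤ t → t ≤ 1 → (t : ℂ) ∈ closedBall (0 : ℂ) 1 ∩ upperHP := by
    intro t h1 h2
    refine ⟨?_, by simp [upperHP]⟩
    rw [mem_closedBall_zero_iff, Complex.norm_real, Real.norm_eq_abs, abs_le]; exact ⟨h1, h2⟩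
  have himN : φ '' (closedBall 0 1 ∩ upperHP) ⊆ N := by
    rintro _ ⟨w, ⟨hw, hwP⟩, rfl⟩
    obtain ⟨h1, h2⟩ := hscale w hw hwP
    exact hN₀ ⟨_, ⟨ball_subset_closedBall h1, h2⟩, rfl⟩
  have hnot : ∀ t : ℝ, -1 ≤ t → t ≤ 1 → t ≠ 0 → ¬ (φ t ∈ A ∧ φ t ∈ B) := by
    intro t h1 h2 h3 h4
    have h5 : φ t = x := hNx ⟨h4, himN ⟨_, hreal t h1 h2, rfl⟩⟩
    rw [← h0] at h5
    have := hφ.2.1 (hreal t h1 h2) ⟨by simp, by simp [upperHP]⟩ h5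
    exact h3 (by exact_mod_cast this)
  have hseg : ∀ S : Set ℝ, IsPreconnected S → S ⊆ Icc (-1) 1 → (0 : ℝ) ∉ S →
      (∀ t ∈ S, φ t ∈ A ∧ φ t ∉ B) ∨ ∀ t ∈ S, φ t ∈ B ∧ φ t ∉ A := by
    intro S hS hS1 hS0
    have hne : ∀ t ∈ S, t ≠ 0 := fun t ht h => hS0 (h ▸ ht)
    have hpre : IsPreconnected ((fun t : ℝ => φ t) '' S) := by
      refine hS.image _ (hφ.1.comp Complex.continuous_ofReal.continuousOn fun t ht => ?_)
      exact hreal t (hS1 ht).1 (hS1 ht).2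
    have hcov : ∀ t ∈ S, φ t ∈ A ∨ φ t ∈ B := by
      intro t ht
      have := (hbd t (hreal t (hS1 ht).1 (hS1 ht).2).1 (by simp [upperHP])).2 (by simp)
      rwa [← hAB] at this
    by_contra hcon
    push Not at hcon
    obtain ⟨⟨t, ht, h1⟩, ⟨s, hs, h2⟩⟩ := hcon
    have htB : φ t ∈ B := (hcov t ht).elim h1 id
    have hsA : φ s ∈ A := (hcov s hs).elim id h2
    obtain ⟨_, ⟨r, hr, rfl⟩, hrA, hrB⟩ := isPreconnected_closed_iff.1 hpre A B hA hB
      (by rintro _ ⟨r, hr, rfl⟩; exact hcov r hr) ⟨_, ⟨s, hs, rfl⟩, hsA⟩ ⟨_, ⟨t, ht, rfl⟩, htB⟩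
    exact hnot r (hS1 hr).1 (hS1 hr).2 (hne r hr) ⟨hrA, hrB⟩
  have hacc : ∀ {E E' : Set X}, x ∈ closure (E \ {x}) → E ⊆ surfaceBoundary X →
      (∀ t : ℝ, -1 ≤ t → t ≤ 1 → t ≠ 0 → φ t ∈ E' ∧ φ t ∉ E) → False := by
    intro E E' hE hEb hall
    have hnb := hφ.image_mem_nhds (w := 0) (by simp) (by simp [upperHP]) (ball_mem_nhds _ one_pos)
    rw [h0] at hnb
    obtain ⟨_, ⟨w, ⟨hw, hwP⟩, rfl⟩, hwE, hwx⟩ := mem_closure_iff_nhds.1 hE _ hnb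
    have him := (hbd w (ball_subset_closedBall hw) hwP).1 (hEb hwE)
    have hwre : ((w.re : ℝ) : ℂ) = w := Complex.ext (by simp) (by simp [him])
    have hlt := abs_lt.1 ((Complex.abs_re_le_norm w).trans_lt (mem_ball_zero_iff.1 hw))
    refine (hall w.re hlt.1.le hlt.2.le fun h => ?_).2 (by rw [hwre]; exact hwE)
    rw [h] at hwre
    exact hwx (by rw [← hwre]; simpa using h0)
  have hAb : A ⊆ surfaceBoundary X := hAB ▸ subset_union_left
  have hBb : B ⊆ surfaceBoundary X := hAB ▸ subset_union_right
  have hneg := hseg (Ico (-1) 0) isPreconnected_Ico (fun t ht => ⟨ht.1, by linarith [ht.2]⟩) (by simp)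
  have hpos := hseg (Ioc 0 1) isPreconnected_Ioc (fun t ht => ⟨by linarith [ht.1], ht.2⟩) (by simp)
  have hcomb : ∀ Q : ℝ → Prop, (∀ t ∈ Ico (-1 : ℝ) 0, Q t) → (∀ t ∈ Ioc (0 : ℝ) 1, Q t) →
      ∀ t : ℝ, -1 ≤ t → t ≤ 1 → t ≠ 0 → Q t := by
    intro Q h1 h2 t h3 h4 h5
    rcases lt_or_gt_of_ne h5 with h | h
    · exact h1 t ⟨h3, h⟩
    · exact h2 t ⟨h, h4⟩
  rcases hneg with hn | hn <;> rcases hpos with hp | hp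
  · exact absurd (hcomb _ hn hp) fun h => hacc hB' hBb h
  · exact ⟨φ, hφ, h0, himN, fun w hw hwP => (hbd w hw hwP).1, fun t h1 h2 => hn t ⟨h1, h2⟩,
      fun t h1 h2 => hp t ⟨h1, h2⟩⟩
  · refine ⟨_, hφ.comp_neg_conj, by simp [h0], ?_, ?_, fun t h1 h2 => ?_, fun t h1 h2 => ?_⟩
    · rintro _ ⟨w, ⟨hw, hwP⟩, rfl⟩
      exact himN ⟨_, ⟨by simpa using hw, by simpa [upperHP] using hwP⟩, rfl⟩
    · intro w hw hwP hwb
      simpa using (hbd (-(starRingEnd ℂ w)) (by simpa using hw) (by simpa [upperHP] using hwP)).1 hwb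
    · have := hp (-t) ⟨by linarith, by linarith⟩
      simpa using this
    · have := hn (-t) ⟨by linarith, by linarith⟩
      simpa using this
  · exact absurd (hcomb _ hn hp) fun h => hacc hA' hAb h

end OddArcs

section TwoPoint

variable {X : Type*} [MetricSpace X]

/-- A circle-valued function supported near the centre of a boundary chart, winding once around
an interior point and restricting on the boundary to the square of a half turn. -/
noncomputable def bump (φ : ℂ → X) : X → Circle :=
  IsChart.patch upperHP φ (fun w => tri (w - Complex.I / 2)) fun _ => 1

namespace IsChart

variable {φ : ℂ → X}

theorem bump_apply (h : IsChart upperHP φ) {w : ℂ} (hw : w ∈ closedBall (0 : ℂ) 1)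
    (hwP : w ∈ upperHP) : bump φ (φ w) = tri (w - Complex.I / 2) := h.patch_apply hw hwP

theorem bump_of_notMem {z : X} (hz : z ∉ φ '' (closedBall 0 1 ∩ upperHP)) : bump φ z = 1 :=
  patch_of_notMem hz

theorem continuousAt_bump (h : IsChart upperHP φ) {z : X} (hz : z ≠ φ (Complex.I / 2)) :
    ContinuousAt (bump φ) z := by
  by_cases hz' : z ∈ φ '' (closedBall 0 (1 / 2) ∩ upperHP)
  · obtain ⟨w, ⟨hw, hwP⟩, rfl⟩ := hz'
    refine h.continuousAt_patch (closedBall_subset_ball (by norm_num) hw) hwP ?_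
    refine ContinuousAt.continuousWithinAt (ContinuousAt.comp (g := tri) (continuousAt_tri ?_) (by fun_prop))
    exact fun h0 => hz (by rw [sub_eq_zero.1 h0])
  · refine h.continuousAt_patch_of_notMem isClosed_upperHP (by norm_num : (1 / 2 : ℝ) ≤ 1) ?_ hz'
      continuousAt_const
    intro w _ hwP hw
    exact tri_sub_eq_one hw.le hwP

/-- The disc chart centred at the singular point of `bump φ`. -/
theorem isChart_apex (h : IsChart upperHP φ) :
    IsChart univ fun w => φ (Complex.I / 2 + (1 / 4 : ℝ) * w) := by
  refine h.comp_affine (by norm_num) (by simp; norm_num) ?_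
  intro w hw
  simp only [mem_univ, true_iff]
  rw [mem_closedBall_zero_iff] at hw
  have h2 := (abs_le.1 ((Complex.abs_im_le_norm w).trans hw)).1
  change 0 ≤ (Complex.I / 2 + (1 / 4 : ℝ) * w).im
  rw [Complex.add_im, Complex.im_ofReal_mul]
  simp; linarith

theorem apex_mem {w : ℂ} (hw : w ∈ closedBall (0 : ℂ) 1) :
    Complex.I / 2 + (1 / 4 : ℝ) * w ∈ ball (0 : ℂ) 1 ∧
      0 < (Complex.I / 2 + (1 / 4 : ℝ) * w).im := by
  rw [mem_closedBall_zero_iff] at hw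
  constructor
  · rw [mem_ball_zero_iff]
    refine (norm_add_le _ _).trans_lt ?_
    rw [norm_mul, Complex.norm_real]
    simp; linarith
  · have h2 := (abs_le.1 ((Complex.abs_im_le_norm w).trans hw)).1
    rw [Complex.add_im, Complex.im_ofReal_mul]
    simp; linarith

theorem bump_apex (h : IsChart upperHP φ) {w : ℂ} (hw : w ∈ closedBall (0 : ℂ) 1) :
    bump φ (φ (Complex.I / 2 + (1 / 4 : ℝ) * w)) = tri w := by
  obtain ⟨h1, h2⟩ := apex_mem hw
  rw [h.bump_apply (ball_subset_closedBall h1) h2.le, add_sub_cancel_left,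
    tri_smul (by norm_num)]

end IsChart

theorem isOddArc_of_separates [CompactSpace X] (hX : IsSurface X) {A B K C : Set X}
    {x y a a' : X} (hA : IsClosed A) (hB : IsClosed B) (hAB : A ∪ B = surfaceBoundary X)
    (hxy : x ≠ y) (hABi : A ∩ B = {x, y})
    (hxA : x ∈ closure (A \ {x})) (hxB : x ∈ closure (B \ {x}))
    (hyA : y ∈ closure (A \ {y})) (hyB : y ∈ closure (B \ {y}))
    (hK : IsArc K a a') (hKB : K ∩ surfaceBoundary X = {a, a'}) (ha : a ∈ A) (ha' : a' ∉ A)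
    (hC : IsPreconnected C) (hCK : C ⊆ Kᶜ) (hx : x ∈ C) (hy : y ∈ C) : IsOddArc K := by
  classical
  have hKc : IsClosed K := hK.isClosed
  set F := surfaceBoundary X ∪ K with hF
  have hxAB : x ∈ A ∩ B := hABi ▸ Or.inl rfl
  have hyAB : y ∈ A ∩ B := hABi ▸ Or.inr rfl
  obtain ⟨Nx, Ny, hNx, hNy, hxNx, hyNy, hdisj⟩ := t2_separation hxy
  have hNxK : Nx ∩ Kᶜ ∈ 𝓝 x := inter_mem (hNx.mem_nhds hxNx) (hKc.isOpen_compl.mem_nhds (hCK hx))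
  have hNyK : Ny ∩ Kᶜ ∈ 𝓝 y := inter_mem (hNy.mem_nhds hyNy) (hKc.isOpen_compl.mem_nhds (hCK hy))
  obtain ⟨φ, hφ, hφ0, hφN, hφb, hφA, hφB⟩ := hX.exists_isChart_sides hA hB hAB hxAB.1 hNxK (by
    rw [hABi]; rintro z ⟨rfl | rfl, h2, -⟩
    · rfl
    · exact (Set.disjoint_left.1 hdisj h2 hyNy).elim) hxA hxB
  set px := φ (Complex.I / 2) with hpx
  let Q : X → Prop := fun p => ∃ f : X → Circle, ContinuousOn f {p}ᶜ ∧
    (∀ z ∈ F, f z = bump φ z) ∧ NoSqrtNear f p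
  have hQ : ∀ ψ : X ≃ₜ X, (∀ z ∈ F, ψ z = z) → ∀ p, p ∉ F → Q p → Q (ψ p) := by
    rintro ψ hψ p - ⟨f, hf, hfF, hfn⟩
    have hψ' : ∀ z ∈ F, ψ.symm z = z := fun z hz => by rw [ψ.symm_apply_eq, hψ z hz]
    refine ⟨f ∘ ψ.symm, hf.comp ψ.symm.continuous.continuousOn ?_, ?_, ?_⟩
    · intro z hz he
      exact hz (by rw [mem_singleton_iff] at he ⊢; rw [← he, ψ.apply_symm_apply])
    · intro z hz; rw [Function.comp, hψ' z hz, hfF z hz]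
    · simpa using hfn.comp_homeomorph ψ.symm
  have hapexF : ∀ {x : X} {φ : ℂ → X}, IsChart upperHP φ →
      φ '' (closedBall 0 1 ∩ upperHP) ⊆ Kᶜ → ∀ w ∈ closedBall (0 : ℂ) 1,
        φ (Complex.I / 2 + (1 / 4 : ℝ) * w) ∉ F := by
    rintro x φ hφ hK' w hw (hb | hb)
    · obtain ⟨h1, h2⟩ := IsChart.apex_mem hw
      exact h2.ne' ((hφ.mem_boundary_iff h1 h2.le).1 hb)
    · obtain ⟨h1, h2⟩ := IsChart.apex_mem hw
      exact hK' ⟨_, ⟨ball_subset_closedBall h1, h2.le⟩, rfl⟩ hb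
  have hQpx : ∀ φ' : ℂ → X, IsChart upperHP φ' →
      (∀ z ∈ F, bump φ' z = bump φ z) → Q (φ' (Complex.I / 2)) := by
    intro φ' hφ' hsame
    refine ⟨bump φ', fun z hz => (hφ'.continuousAt_bump hz).continuousWithinAt, hsame, ?_⟩
    have := hφ'.isChart_apex.noSqrtNear (f := bump φ') fun w hw => hφ'.bump_apex hw.1
    simpa using this
  -- scaled charts produce singular points arbitrarily close to `x`
  have hev : ∀ᶠ p in 𝓝 y, p ∉ F → Q p := by
    refine hX.eventually_of_invariant hKc hQ
      (C := C ∪ φ '' (ball 0 1 ∩ upperHP)) (x := px) ?_ ?_ ?_ (Or.inl hy) ?_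
    · refine IsPreconnected.union x hx ⟨0, ⟨by simp, by simp [upperHP]⟩, hφ0⟩ hC ?_
      refine IsPreconnected.image ?_ _ (hφ.1.mono (inter_subset_inter_left _ ball_subset_closedBall))
      exact ((convex_ball _ _).inter (convex_halfSpace_im_ge 0)).isPreconnected
    · rintro z (hz | ⟨w, ⟨hw, hwP⟩, rfl⟩)
      · exact hCK hz
      · exact (hφN ⟨w, ⟨ball_subset_closedBall hw, hwP⟩, rfl⟩).2
    · exact Or.inr ⟨_, ⟨by simp; norm_num, by simp [upperHP]⟩, rfl⟩
    · have hpF : px ∉ F := by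
        have := hapexF (x := x) hφ (hφN.trans inter_subset_right) 0 (by simp)
        simpa using this
      refine (Filter.Eventually.frequently ?_ : ∃ᶠ p in pure px, p ∉ F ∧ Q p).filter_mono (pure_le_nhds _)
      exact ⟨hpF, hQpx φ hφ fun _ _ => rfl⟩
  obtain ⟨χ, hχ, hχ0, hχN, hχb, hχA, hχB⟩ := hX.exists_isChart_sides hA hB hAB hyAB.1
    (inter_mem hNyK hev) (by
    rw [hABi]; rintro z ⟨rfl | rfl, ⟨h2, -⟩, -⟩
    · exact (Set.disjoint_left.1 hdisj hxNx h2).elim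
    · rfl) hyA hyB
  set py := χ (Complex.I / 2) with hpy
  set Φ : ℂ → X := fun w => χ (Complex.I / 2 + (1 / 4 : ℝ) * w) with hΦdef
  have hΦ : IsChart univ Φ := hχ.isChart_apex
  have hΦ0 : Φ 0 = py := by simp [hΦdef, hpy]
  have hΦF : ∀ w ∈ closedBall (0 : ℂ) 1, Φ w ∉ F := fun w hw =>
    hapexF (x := y) hχ (fun z hz => (hχN hz).1.2) w hw
  obtain ⟨f, hf, hfF, hfn⟩ : Q py :=
    (hχN ⟨_, ⟨by simp; norm_num, by simp [upperHP]⟩, rfl⟩).2 (by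
      have := hΦF 0 (by simp)
      rw [hΦ0] at this; exact this)
  obtain ⟨k, θ, hk, hθ, hfk⟩ := (hΦ0 ▸ hfn : NoSqrtNear f (Φ 0)).exists_odd hΦ (hΦ0.symm ▸ hf)
  let c : ℂ → ℝ := fun w => max 0 (min 1 (4 * ‖w‖ - 2))
  have hc : Continuous c := by fun_prop
  have hc0 : ∀ w : ℂ, ‖w‖ ≤ 1 / 2 → c w = 0 := fun w hw => by
    simp only [c]; rw [max_eq_left]; exact (min_le_right _ _).trans (by linarith)
  have hc1 : ∀ w : ℂ, 3 / 4 ≤ ‖w‖ → c w = 1 := fun w hw => by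
    simp only [c]; rw [min_eq_left (by linarith), max_eq_right zero_le_one]
  let U₁ : X → Circle := fun z => f z * bump χ z ^ (-k)
  let g : ℂ → Circle := fun w => Circle.exp (c w * θ w)
  let U : X → Circle := IsChart.patch univ Φ g U₁
  have hgU : ∀ w ∈ closedBall (0 : ℂ) 1, w ∈ (univ : Set ℂ) → 3 / 4 < ‖w‖ → g w = U₁ (Φ w) := by
    intro w hw _ hn
    have hw0 : w ≠ 0 := by rintro rfl; norm_num at hn
    simp only [g, U₁, hc1 w hn.le, one_mul]
    rw [hfk w ⟨hw, hw0⟩, hχ.bump_apex hw, zpow_neg, mul_comm (tri w ^ k), mul_assoc,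
      mul_inv_cancel, mul_one]
  have hgc : ∀ w ∈ ball (0 : ℂ) 1, ContinuousAt g w := by
    intro w hw
    by_cases hw0 : w = 0
    · subst hw0
      refine (continuousAt_const (y := (1 : Circle))).congr ?_
      filter_upwards [closedBall_mem_nhds (0 : ℂ) (by norm_num : (0 : ℝ) < 1 / 2)] with v hv
      simp only [g]
      rw [hc0 v (by simpa using hv)]; simp
    · refine Circle.exp.continuous.continuousAt.comp (hc.continuousAt.mul ?_)
      exact hθ.continuousAt (inter_mem (closedBall_mem_nhds_of_mem hw)
        (isOpen_compl_singleton.mem_nhds hw0))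
  have hUc : Continuous U := by
    rw [continuous_iff_continuousAt]
    intro z
    by_cases hz : z ∈ Φ '' (closedBall 0 (3 / 4) ∩ univ)
    · obtain ⟨w, ⟨hw, -⟩, rfl⟩ := hz
      have hw1 := closedBall_subset_ball (by norm_num : (3 / 4 : ℝ) < 1) hw
      exact hΦ.continuousAt_patch hw1 (mem_univ _) (hgc w hw1).continuousWithinAt
    · refine hΦ.continuousAt_patch_of_notMem isClosed_univ (by norm_num : (3 / 4 : ℝ) ≤ 1) hgU hz ?_
      have hzp : z ≠ py := fun h => hz ⟨0, ⟨by simp; norm_num, mem_univ _⟩, hΦ0.trans h.symm⟩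
      exact (hf.continuousAt (isOpen_compl_singleton.mem_nhds hzp)).mul
        ((hχ.continuousAt_bump hzp).zpow _)
  have hUF : ∀ z ∈ F, U z = bump φ z * bump χ z ^ (-k) := by
    intro z hz
    have : z ∉ Φ '' (closedBall 0 1 ∩ univ) := by
      rintro ⟨w, ⟨hw, -⟩, rfl⟩; exact hΦF w hw hz
    rw [show U z = U₁ z from IsChart.patch_of_notMem this, ← hfF z hz]
  -- the square root on the boundary
  let s : X → Circle := fun z => if z ∈ A then 1 else -1
  let v₁ : X → Circle := IsChart.patch upperHP φ (fun w => halfTurn w.re) s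
  let v : X → Circle := IsChart.patch upperHP χ (fun w => halfTurn w.re ^ (-k)) v₁
  have hφχ : ∀ z ∈ χ '' (closedBall 0 1 ∩ upperHP), z ∉ φ '' (closedBall 0 1 ∩ upperHP) :=
    fun z h1 h2 => Set.disjoint_left.1 hdisj (hφN h2).1 (hχN h1).1.1
  have hKφ : ∀ z ∈ K, z ∉ φ '' (closedBall 0 1 ∩ upperHP) := fun z hz h => (hφN h).2 hz
  have hKχ : ∀ z ∈ K, z ∉ χ '' (closedBall 0 1 ∩ upperHP) := fun z hz h => (hχN h).1.2 hz
  have hneg : ((-1 : Circle)) ^ (-k) = -1 := by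
    obtain ⟨m, rfl⟩ := hk
    have h2 : (-1 : Circle) ^ (2 : ℤ) = 1 := by
      rw [show (2 : ℤ) = ((2 : ℕ) : ℤ) from rfl, zpow_natCast]; exact Circle.ext (by simp)
    rw [neg_add, zpow_add, ← mul_neg, zpow_mul, h2, one_zpow, one_mul, zpow_neg, zpow_one]
    exact inv_eq_of_mul_eq_one_left (by simp)
  have hreal : ∀ w : ℂ, w.im = 0 → ((w.re : ℝ) : ℂ) = w := fun w h =>
    Complex.ext (by simp) (by simp [h])
  refine ⟨a, a', U, v, hK, hKB, hUc, ?_, ?_, ?_, ?_, ?_⟩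
  · intro z hz
    by_cases hzχ : z ∈ χ '' (closedBall 0 (3 / 4) ∩ upperHP)
    · obtain ⟨w, ⟨hw, hwP⟩, rfl⟩ := hzχ
      refine (hχ.continuousAt_patch (closedBall_subset_ball (by norm_num) hw) hwP ?_).continuousWithinAt
      exact ((continuous_halfTurn.comp Complex.continuous_re).zpow _).continuousWithinAt
    by_cases hzφ : z ∈ φ '' (closedBall 0 (3 / 4) ∩ upperHP)
    · obtain ⟨w, ⟨hw, hwP⟩, rfl⟩ := hzφ
      have h1 : ContinuousAt v₁ (φ w) :=
        hφ.continuousAt_patch (closedBall_subset_ball (by norm_num) hw) hwP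
          (continuous_halfTurn.comp Complex.continuous_re).continuousWithinAt
      refine (h1.congr ?_).continuousWithinAt
      have h2 : φ w ∉ χ '' (closedBall 0 1 ∩ upperHP) := fun h => hφχ _ h
        ⟨w, ⟨closedBall_subset_closedBall (by norm_num) hw, hwP⟩, rfl⟩
      filter_upwards [(hχ.isCompact_image isClosed_upperHP le_rfl).isClosed.isOpen_compl.mem_nhds h2]
        with z' hz'
      exact (IsChart.patch_of_notMem hz').symm
    · have hcl : ∀ (φ : ℂ → X), IsChart upperHP φ →
          IsClosed (φ '' (closedBall 0 (3 / 4) ∩ upperHP)) := fun φ h =>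
        (h.isCompact_image isClosed_upperHP (by norm_num : (3 / 4 : ℝ) ≤ 1)).isClosed
      have hzAB : z ∉ A ∩ B := by
        rw [hABi]; rintro (rfl | rfl)
        · exact hzφ ⟨0, ⟨by simp; norm_num, by simp [upperHP]⟩, hφ0⟩
        · exact hzχ ⟨0, ⟨by simp; norm_num, by simp [upperHP]⟩, hχ0⟩
      have hval : ∀ z' ∈ surfaceBoundary X, z' ∉ χ '' (closedBall 0 (3 / 4) ∩ upperHP) →
          z' ∉ φ '' (closedBall 0 (3 / 4) ∩ upperHP) → v z' = s z' := by
        have hside : ∀ (φ : ℂ → X), (∀ w ∈ closedBall (0 : ℂ) 1, w ∈ upperHP →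
            φ w ∈ surfaceBoundary X → w.im = 0) → (∀ t : ℝ, -1 ≤ t → t < 0 → φ t ∈ A ∧ φ t ∉ B) →
            (∀ t : ℝ, 0 < t → t ≤ 1 → φ t ∈ B ∧ φ t ∉ A) → ∀ w ∈ closedBall (0 : ℂ) 1,
            w ∈ upperHP → φ w ∈ surfaceBoundary X → φ w ∉ φ '' (closedBall 0 (3 / 4) ∩ upperHP) →
            halfTurn w.re = s (φ w) := by
          intro φ hφb hφA hφB w hw hwP hwb hwn
          have hwr := hreal w (hφb w hw hwP hwb)
          have h1 := abs_le.1 ((Complex.abs_re_le_norm w).trans (mem_closedBall_zero_iff.1 hw))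
          have h2 : 3 / 4 < |w.re| := by
            by_contra hcon
            refine hwn ⟨w, ⟨?_, hwP⟩, rfl⟩
            rw [mem_closedBall_zero_iff, ← hwr, Complex.norm_real, Real.norm_eq_abs]
            exact not_lt.1 hcon
          rcases lt_abs.1 h2 with h3 | h3
          · rw [halfTurn_of_ge (by linarith)]
            have := (hφB w.re (by linarith) h1.2).2
            rw [hwr] at this
            exact (if_neg this).symm
          · rw [halfTurn_of_le (by linarith)]
            have := (hφA w.re h1.1 (by linarith)).1
            rw [hwr] at this
            exact (if_pos this).symm
        intro z' hz'b h1 h2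
        by_cases h3 : z' ∈ χ '' (closedBall 0 1 ∩ upperHP)
        · obtain ⟨w, ⟨hw, hwP⟩, rfl⟩ := h3
          rw [show v (χ w) = halfTurn w.re ^ (-k) from hχ.patch_apply hw hwP,
            hside χ hχb hχA hχB w hw hwP hz'b h1]
          simp only [s]
          split_ifs
          · simp
          · exact hneg
        · rw [show v z' = v₁ z' from IsChart.patch_of_notMem h3]
          by_cases h4 : z' ∈ φ '' (closedBall 0 1 ∩ upperHP)
          · obtain ⟨w, ⟨hw, hwP⟩, rfl⟩ := h4
            rw [show v₁ (φ w) = halfTurn w.re from hφ.patch_apply hw hwP,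
              hside φ hφb hφA hφB w hw hwP hz'b h2]
          · exact IsChart.patch_of_notMem h4
      obtain ⟨E, hE, hzE, hEs⟩ : ∃ E : Set X, IsOpen E ∧ z ∈ E ∧
          ∀ z' ∈ surfaceBoundary X, z' ∈ E → s z' = s z := by
        by_cases hzA : z ∈ A
        · refine ⟨Bᶜ, hB.isOpen_compl, fun h => hzAB ⟨hzA, h⟩, fun z' hz' hz'B => ?_⟩
          have : z' ∈ A := ((hAB ▸ hz' : z' ∈ A ∪ B)).resolve_right hz'B
          simp [s, this, hzA]
        · refine ⟨Aᶜ, hA.isOpen_compl, hzA, fun z' hz' hz'A => ?_⟩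
          rw [mem_compl_iff] at hz'A
          simp [s, hz'A, hzA]
      have hvz : v z = s z := hval z hz hzχ hzφ
      rw [ContinuousWithinAt, hvz]
      refine tendsto_const_nhds.congr' ?_
      filter_upwards [self_mem_nhdsWithin, mem_nhdsWithin_of_mem_nhds
        (inter_mem (inter_mem ((hcl χ hχ).isOpen_compl.mem_nhds hzχ)
          ((hcl φ hφ).isOpen_compl.mem_nhds hzφ)) (hE.mem_nhds hzE))] with z' h1 h2
      rw [hval z' h1 h2.1.1 h2.1.2, hEs z' h1 h2.2]
  · intro z hz
    rw [hUF z (Or.inl hz)]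
    by_cases h3 : z ∈ χ '' (closedBall 0 1 ∩ upperHP)
    · rw [IsChart.bump_of_notMem (hφχ z h3), one_mul]
      obtain ⟨w, ⟨hw, hwP⟩, rfl⟩ := h3
      rw [show v (χ w) = halfTurn w.re ^ (-k) from hχ.patch_apply hw hwP, hχ.bump_apply hw hwP]
      have := halfTurn_sq w.re
      rw [hreal w (hχb w hw hwP hz)] at this
      rw [← this, ← zpow_natCast, ← zpow_natCast, ← zpow_mul, ← zpow_mul, mul_comm]
    · rw [IsChart.bump_of_notMem h3, one_zpow, mul_one, show v z = v₁ z from IsChart.patch_of_notMem h3]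
      by_cases h4 : z ∈ φ '' (closedBall 0 1 ∩ upperHP)
      · obtain ⟨w, ⟨hw, hwP⟩, rfl⟩ := h4
        rw [show v₁ (φ w) = halfTurn w.re from hφ.patch_apply hw hwP, hφ.bump_apply hw hwP]
        have := halfTurn_sq w.re
        rwa [hreal w (hφb w hw hwP hz)] at this
      · rw [IsChart.bump_of_notMem h4, show v₁ z = s z from IsChart.patch_of_notMem h4]
        simp only [s]
        split_ifs <;> simp
  · intro z hz
    rw [hUF z (Or.inr hz), IsChart.bump_of_notMem (hKφ z hz), IsChart.bump_of_notMem (hKχ z hz)]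
    simp
  · rw [show v a = v₁ a from IsChart.patch_of_notMem (hKχ a hK.left_mem),
      show v₁ a = s a from IsChart.patch_of_notMem (hKφ a hK.left_mem)]
    exact if_pos ha
  · rw [show v a' = v₁ a' from IsChart.patch_of_notMem (hKχ a' hK.right_mem),
      show v₁ a' = s a' from IsChart.patch_of_notMem (hKφ a' hK.right_mem)]
    exact if_neg ha'

end TwoPoint

section Double

theorem IsMetricDouble.eq_of_eq {X D : Type*} [MetricSpace X] [MetricSpace D] {B : Set X}
    {ip im : X → D} (hD : IsMetricDouble X B D ip im) (hB : IsClosed B) (hne : B.Nonempty)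
    {a b : X} (h : ip a = im b) : a = b ∧ a ∈ B := by
  have : Nonempty B := hne.to_subtype
  have h0 : ⨅ z : B, (dist a (z : X) + dist (z : X) b) = 0 := by
    rw [← hD.dist_mix, h, dist_self]
  have h1 : ∀ ε > 0, ∃ z ∈ B, dist a z + dist z b < ε := by
    intro ε hε
    obtain ⟨z, hz⟩ := exists_lt_of_ciInf_lt (h0.trans_lt hε)
    exact ⟨z, z.2, hz⟩
  constructor
  · refine dist_le_zero.1 (le_of_forall_gt_imp_ge_of_dense fun ε hε => ?_)
    obtain ⟨z, -, hz⟩ := h1 ε hε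
    exact (dist_triangle a z b).trans hz.le
  · rw [← hB.closure_eq, Metric.mem_closure_iff]
    intro ε hε
    obtain ⟨z, hzB, hz⟩ := h1 ε hε
    exact ⟨z, hzB, by linarith [dist_nonneg (x := z) (y := b)]⟩

theorem IsMetricDouble.exists_fold {X D : Type*} [MetricSpace X] [MetricSpace D] {B : Set X}
    {ip im : X → D} (hD : IsMetricDouble X B D ip im) (hB : IsClosed B) (hne : B.Nonempty) :
    ∃ r : D → X, Continuous r ∧ (∀ a, r (ip a) = a) ∧ ∀ a, r (im a) = a := by
  have hs : ∀ d : D, ∃ a : X, d = ip a ∨ d = im a := by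
    intro d
    have : d ∈ range ip ∪ range im := hD.surj ▸ mem_univ d
    rcases this with ⟨a, rfl⟩ | ⟨a, rfl⟩
    exacts [⟨a, Or.inl rfl⟩, ⟨a, Or.inr rfl⟩]
  have : Nonempty B := hne.to_subtype
  have hmix : ∀ a b : X, dist a b ≤ dist (ip a) (im b) := fun a b => by
    rw [hD.dist_mix]
    exact le_ciInf fun z => dist_triangle a z b
  choose r hr using hs
  have hp : ∀ a, r (ip a) = a := fun a => by
    rcases hr (ip a) with h | h
    · exact (hD.isom_p.injective h).symm
    · exact (hD.eq_of_eq hB hne h).1.symm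
  have hm : ∀ a, r (im a) = a := fun a => by
    rcases hr (im a) with h | h
    · exact (hD.eq_of_eq hB hne h.symm).1
    · exact (hD.isom_m.injective h).symm
  refine ⟨r, (LipschitzWith.of_dist_le_mul (K := 1) fun d d' => ?_).continuous, hp, hm⟩
  rw [NNReal.coe_one, one_mul]
  rcases hr d with h | h <;> rcases hr d' with h' | h' <;> rw [h, h'] <;> simp only [hp, hm]
  · rw [hD.isom_p.dist_eq]
  · exact hmix _ _
  · rw [dist_comm, dist_comm (im _)]; exact hmix _ _
  · rw [hD.isom_m.dist_eq]

theorem connectedSpace_circle1 : ConnectedSpace ↥Circle1 := by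
  obtain ⟨h⟩ := nonempty_circle1_homeomorph
  exact h.symm.surjective.connectedSpace h.symm.continuous

theorem compactSpace_circle1 : CompactSpace ↥Circle1 := by
  obtain ⟨h⟩ := nonempty_circle1_homeomorph
  have : Fact ((0 : ℝ) < 1) := ⟨one_pos⟩
  exact h.symm.compactSpace

theorem IsOddArc.isNonContractibleJordanCurve {X D : Type*} [MetricSpace X] [CompactSpace X]
    [MetricSpace D] {ip im : X → D} (hD : IsMetricDouble X (surfaceBoundary X) D ip im)
    {K : Set X} (hK : IsOddArc K) : IsNonContractibleJordanCurve (ip '' K ∪ im '' K) := by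
  classical
  obtain ⟨a, a', u, v, hKa, hKB, hu, hv, hvu, huK, hva, hva'⟩ := hK
  have hBc : IsClosed (surfaceBoundary X) := isClosed_surfaceBoundary
  have haK : a ∈ K ∩ surfaceBoundary X := hKB ▸ Or.inl rfl
  have haK' : a' ∈ K ∩ surfaceBoundary X := hKB ▸ Or.inr rfl
  have hne : (surfaceBoundary X).Nonempty := ⟨a, haK.2⟩
  obtain ⟨r, hr, hrp, hrm⟩ := hD.exists_fold hBc hne
  have hinter : ip '' K ∩ im '' K = {ip a, ip a'} := by
    ext d; constructor
    · rintro ⟨⟨x, hx, rfl⟩, ⟨y, hy, hxy⟩⟩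
      obtain ⟨rfl, hxB⟩ := hD.eq_of_eq hBc hne hxy.symm
      have : x ∈ ({a, a'} : Set X) := hKB ▸ ⟨hx, hxB⟩
      rcases this with rfl | rfl
      exacts [Or.inl rfl, Or.inr rfl]
    · rintro (rfl | rfl)
      · exact ⟨mem_image_of_mem _ haK.1, ⟨a, haK.1, (hD.agree a haK.2).symm⟩⟩
      · exact ⟨mem_image_of_mem _ haK'.1, ⟨a', haK'.1, (hD.agree a' haK'.2).symm⟩⟩
  have harcp : IsArc (ip '' K) (ip a) (ip a') :=
    hKa.image hD.isom_p.continuous.continuousOn hD.isom_p.injective.injOn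
  have harcm : IsArc (im '' K) (ip a) (ip a') := by
    rw [hD.agree a haK.2, hD.agree a' haK'.2]
    exact hKa.image hD.isom_m.continuous.continuousOn hD.isom_m.injective.injOn
  refine ⟨harcp.isJordanCurve_union harcm hinter, ?_⟩
  rintro f hf hfr ⟨y, ⟨H0⟩⟩
  have := connectedSpace_circle1
  have := compactSpace_circle1
  let H : C(I × ↥Circle1, D) := H0.symm.toContinuousMap
  have hH0 : ∀ θ, H (0, θ) = y := fun θ => H0.symm.apply_zero θ
  have hH1 : ∀ θ, H (1, θ) = f θ := fun θ => H0.symm.apply_one θ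
  -- a square root of the pullback of `u`
  obtain ⟨s, hs⟩ := Circle.exp_surjective (u (r y))
  obtain ⟨G, hG, -⟩ := Circle.exists_lift_homotopy
    ((ContinuousMap.mk (fun d => u (r d)) (hu.comp hr)).comp H) (ContinuousMap.const _ s)
    (fun θ => by simp [hH0, hs])
  let g : I × ↥Circle1 → Circle := fun p => Circle.exp (G p / 2)
  have hg : Continuous g := Circle.exp.continuous.comp (G.continuous.div_const 2)
  have hgu : ∀ p, g p ^ 2 = u (r (H p)) := fun p => by
    have := hG p
    simp only [ContinuousMap.comp_apply, ContinuousMap.coe_mk] at this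
    rw [this, sq, ← Circle.exp_add]; congr 1; ring
  have hrK : ∀ θ, r (f θ) ∈ K := fun θ => by
    have : f θ ∈ ip '' K ∪ im '' K := hfr ▸ mem_range_self θ
    rcases this with ⟨x, hx, h⟩ | ⟨x, hx, h⟩ <;> rw [← h]
    · rwa [hrp]
    · rwa [hrm]
  obtain ⟨ε, hε⟩ : ∃ ε : Circle, ∀ θ, g (1, θ) = ε := by
    rcases (isPreconnected_univ (α := ↥Circle1)).circle_eq_or_eq_neg
      (f := fun θ => g (1, θ)) (g := fun _ => 1) (hg.comp (by fun_prop)).continuousOn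
      continuousOn_const
      (fun θ _ => by rw [hgu, hH1, huK _ (hrK θ), one_pow]) with h | h
    · exact ⟨1, fun θ => h θ (mem_univ _)⟩
    · exact ⟨-1, fun θ => h θ (mem_univ _)⟩
  let BD : Set D := ip '' surfaceBoundary X
  have hBD : IsClosed BD := (hBc.isCompact.image hD.isom_p.continuous).isClosed
  have hBDr : ∀ d ∈ BD, r d ∈ surfaceBoundary X := by
    rintro _ ⟨x, hx, rfl⟩; rwa [hrp]
  have hvr : ContinuousOn (fun p => v (r (H p))) (H ⁻¹' BD) :=
    hv.comp (hr.comp H.continuous).continuousOn fun p hp => hBDr _ hp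
  have hclosed : ∀ w : I × ↥Circle1 → Circle, ContinuousOn w (H ⁻¹' BD) →
      IsClosed {p | p ∈ H ⁻¹' BD ∧ g p = w p} := by
    intro w hw
    have := (hw.div' hg.continuousOn).preimage_isClosed_of_isClosed (hBD.preimage H.continuous)
      (isClosed_singleton (x := (1 : Circle)))
    convert this using 1
    ext p
    simp only [mem_ofPred_eq, mem_inter_iff, mem_preimage, mem_singleton_iff, div_eq_one, Pi.div_apply]
    exact and_congr_right fun _ => eq_comm
  -- the two sheets, normalised so that `a` lies over the first
  obtain ⟨h, hh0, hh1, -⟩ := exists_continuous_zero_one_of_isClosed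
    (hclosed (fun p => ε * v (r (H p))) (continuousOn_const.mul hvr))
    (hclosed (fun p => -(ε * v (r (H p))))
      (Circle.continuous_neg.comp_continuousOn (continuousOn_const.mul hvr)))
    (Set.disjoint_left.2 fun p h1 h2 => Circle.neg_ne _ (h2.2.symm.trans h1.2))
  have hε2 : ε ^ 2 = 1 := by
    obtain ⟨θ⟩ : Nonempty ↥Circle1 := inferInstance
    rw [← hε θ, hgu, hH1, huK _ (hrK θ)]
  have hh : ∀ p, H p ∈ BD → h p = 0 ∨ h p = 1 := by
    intro p hp
    have : g p ^ 2 = (ε * v (r (H p))) ^ 2 := by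
      rw [hgu, mul_pow, hε2, one_mul, hvu _ (hBDr _ hp)]
    rcases Circle.sq_eq_sq this with h1 | h1
    · exact Or.inl (hh0 ⟨hp, h1⟩)
    · exact Or.inr (hh1 ⟨hp, h1⟩)
  let R : I × ↥Circle1 → Circle := fun p =>
    if H p ∈ range ip then Circle.exp (Real.pi * h p) else Circle.exp (-(Real.pi * h p))
  have hRp : ∀ p, H p ∈ range ip → R p = Circle.exp (Real.pi * h p) := fun p hp => if_pos hp
  have hRm : ∀ p, H p ∈ range im → R p = Circle.exp (-(Real.pi * h p)) := by
    rintro p ⟨x, hx⟩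
    by_cases hp : H p ∈ range ip
    · rw [hRp p hp]
      obtain ⟨x', hx'⟩ := hp
      have := hD.eq_of_eq hBc hne (hx'.trans hx.symm)
      rcases hh p ⟨x', this.2, hx'⟩ with h0 | h0
      · simp [h0]
      · rw [h0, Circle.exp_eq_exp]; exact ⟨1, by push_cast; ring⟩
    · exact if_neg hp
  have hRc : Continuous R := by
    rw [← continuousOn_univ]
    refine ContinuousOn.of_isClosed_cover
      ((isCompact_range hD.isom_p.continuous).isClosed.preimage H.continuous)
      ((isCompact_range hD.isom_m.continuous).isClosed.preimage H.continuous)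
      (fun p _ => by
        have : H p ∈ range ip ∪ range im := hD.surj ▸ mem_univ _
        exact this)
      (ContinuousOn.congr (f := fun p => Circle.exp (Real.pi * h p)) ?_ fun p hp => hRp p hp.2)
      (ContinuousOn.congr (f := fun p => Circle.exp (-(Real.pi * h p))) ?_ fun p hp => hRm p hp.2)
    · exact (Circle.exp.continuous.comp (h.continuous.const_mul _)).continuousOn
    · exact (Circle.exp.continuous.comp (h.continuous.const_mul _).neg).continuousOn
  obtain ⟨g0, hg0⟩ : ∃ g0 : C(↥Circle1, ℝ), ∀ θ, R (0, θ) = Circle.exp (g0 θ) := by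
    by_cases hy : y ∈ range ip
    · exact ⟨⟨fun θ => Real.pi * h (0, θ), by fun_prop⟩, fun θ => hRp _ (by rwa [hH0])⟩
    · have : y ∈ range ip ∪ range im := hD.surj ▸ mem_univ _
      exact ⟨⟨fun θ => -(Real.pi * h (0, θ)), by fun_prop⟩,
        fun θ => hRm _ (by rw [hH0]; exact this.resolve_left hy)⟩
  obtain ⟨Λ, hΛ, -⟩ := Circle.exists_lift_homotopy ⟨R, hRc⟩ g0 hg0
  have hfcl : IsClosedMap f := f.continuous.isClosedMap
  have hpre : ∀ S : Set D, IsPreconnected S → S ⊆ range f → IsPreconnected (f ⁻¹' S) :=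
    fun S hS hSf => hS.preimage_of_isClosedMap hf hfcl hSf
  have hsp : ip '' K ⊆ range f := hfr ▸ subset_union_left
  have hsm : im '' K ⊆ range f := hfr ▸ subset_union_right
  obtain ⟨k, hk⟩ := (hpre _ harcp.isPreconnected hsp).exists_lift_sub_eq
    (f := fun θ => Λ (1, θ)) (g := fun θ => Real.pi * h (1, θ))
    (by fun_prop) (by fun_prop) (fun θ hθ => by
      rw [← hRp (1, θ) (by rw [hH1]; exact image_subset_range _ _ hθ)]
      exact (hΛ (1, θ)).symm)
  obtain ⟨m, hm⟩ := (hpre _ harcm.isPreconnected hsm).exists_lift_sub_eq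
    (f := fun θ => Λ (1, θ)) (g := fun θ => -(Real.pi * h (1, θ)))
    (by fun_prop) (by fun_prop) (fun θ hθ => by
      rw [← hRm (1, θ) (by rw [hH1]; exact image_subset_range _ _ hθ)]
      exact (hΛ (1, θ)).symm)
  have hval : ∀ z ∈ K ∩ surfaceBoundary X, ∃ θ, f θ = ip z ∧ h (1, θ) = m - k := by
    rintro z ⟨hzK, hzB⟩
    obtain ⟨θ, hθ⟩ := hsp (mem_image_of_mem ip hzK)
    have h1 := hk θ (by rw [mem_preimage, hθ]; exact mem_image_of_mem _ hzK)
    have h2 := hm θ (by rw [mem_preimage, hθ, hD.agree z hzB]; exact mem_image_of_mem _ hzK)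
    refine ⟨θ, hθ, ?_⟩
    have h3 : (2 * Real.pi) * h (1, θ) = (2 * Real.pi) * (m - k) := by linarith
    exact mul_left_cancel₀ (by positivity) h3
  obtain ⟨θ, hθ, h1⟩ := hval a haK
  obtain ⟨θ', hθ', h2⟩ := hval a' haK'
  have h3 : h (1, θ) = 0 := hh0 ⟨by
    rw [mem_preimage, hH1, hθ]; exact mem_image_of_mem _ haK.2, by
    simp only [hε, hH1, hθ, hrp, hva, mul_one]⟩
  have h4 : h (1, θ') = 1 := hh1 ⟨by
    rw [mem_preimage, hH1, hθ']; exact mem_image_of_mem _ haK'.2, by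
    simp only [hε, hH1, hθ', hrp, hva', mul_neg, mul_one, neg_neg]⟩
  linarith

end Double

section LengthSpace

variable {X : Type*} [MetricSpace X]

theorem edist_add_edist_add_edist_le_pathLength {x y : X} (γ : Path x y) {a b : I} (hab : a ≤ b) :
    edist x (γ a) + edist (γ a) (γ b) + edist (γ b) y ≤ pathLength γ := by
  have h : ∀ {s t : I}, s ≤ t → edist (γ s) (γ t) ≤ eVariationOn (fun t => γ t) (univ ∩ Icc s t) :=
    fun {s t} hst => eVariationOn.edist_le (fun t => γ t) ⟨mem_univ _, left_mem_Icc.2 hst⟩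
      ⟨mem_univ _, right_mem_Icc.2 hst⟩
  have h1 := h (s := 0) (t := a) a.2.1
  have h2 := h hab
  have h3 := h (s := b) (t := 1) b.2.2
  rw [γ.source] at h1
  rw [γ.target] at h3
  refine (add_le_add (add_le_add h1 h2) h3).trans ?_
  rw [eVariationOn.Icc_add_Icc _ (show (0 : I) ≤ a from a.2.1) hab (mem_univ _),
    eVariationOn.Icc_add_Icc _ (show (0 : I) ≤ b from b.2.1) b.2.2 (mem_univ _)]
  exact eVariationOn.mono _ inter_subset_left

theorem IsLengthSpace.exists_almost_geodesic (hX : IsLengthSpace X) (x y : X) {ε : ℝ}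
    (hε : 0 < ε) : ∃ f : ℝ → X, f 0 = x ∧ dist (f (dist x y)) y ≤ ε ∧
      ∀ s t, 0 ≤ s → s ≤ t → t ≤ dist x y →
        t - s ≤ dist (f s) (f t) ∧ dist (f s) (f t) ≤ t - s + ε := by
  have hlt : ⨅ γ : Path x y, pathLength γ < edist x y + ENNReal.ofReal ε := by
    rw [← hX x y]
    exact ENNReal.lt_add_right (edist_ne_top x y) (by simpa using hε)
  obtain ⟨γ, hγ⟩ := iInf_lt_iff.1 hlt
  let S : ℝ → Set ℝ := fun t => {s | s ∈ Icc (0 : ℝ) 1 ∧ t ≤ dist x (γ.extend s)}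
  have hc : Continuous fun s => dist x (γ.extend s) := continuous_const.dist γ.continuous_extend
  have hSc : ∀ t, IsCompact (S t) := fun t =>
    isCompact_Icc.inter_right (isClosed_le continuous_const hc)
  have hSne : ∀ t ≤ dist x y, (S t).Nonempty := fun t ht => ⟨1, by simp, by simpa using ht⟩
  let s : ℝ → ℝ := fun t => sInf (S t)
  have hs : ∀ t ≤ dist x y, s t ∈ S t := fun t ht => (hSc t).sInf_mem (hSne t ht)
  have hsm : ∀ t t', t ≤ t' → t' ≤ dist x y → s t ≤ s t' := fun t t' htt ht' =>
    csInf_le_csInf (hSc t).bddBelow (hSne t' ht') fun r hr => ⟨hr.1, htt.trans hr.2⟩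
  have hsd : ∀ t, 0 ≤ t → t ≤ dist x y → dist x (γ.extend (s t)) = t := by
    intro t h0 ht
    have h1 := hs t ht
    obtain ⟨r, hr, hrt⟩ := intermediate_value_Icc h1.1.1 hc.continuousOn
      (show t ∈ Icc (dist x (γ.extend 0)) (dist x (γ.extend (s t))) from ⟨by simpa using h0, h1.2⟩)
    simp only at hrt
    have : s t ≤ r := csInf_le (hSc t).bddBelow ⟨⟨hr.1, hr.2.trans h1.1.2⟩, hrt.ge⟩
    rw [← le_antisymm hr.2 this, hrt]
  have hlen : ∀ a b : ℝ, a ∈ Icc (0 : ℝ) 1 → b ∈ Icc (0 : ℝ) 1 → a ≤ b →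
      dist x (γ.extend a) + dist (γ.extend a) (γ.extend b) + dist (γ.extend b) y
        ≤ dist x y + ε := by
    intro a b ha hb hab
    have h1 := (edist_add_edist_add_edist_le_pathLength γ
      (show (⟨a, ha⟩ : I) ≤ ⟨b, hb⟩ from hab)).trans hγ.le
    rw [γ.extend_apply ha, γ.extend_apply hb]
    simp only [edist_dist] at h1
    rw [← ENNReal.ofReal_add dist_nonneg dist_nonneg, ← ENNReal.ofReal_add (by positivity)
      dist_nonneg, ← ENNReal.ofReal_add dist_nonneg hε.le] at h1
    exact (ENNReal.ofReal_le_ofReal_iff (by positivity)).1 h1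
  refine ⟨fun t => γ.extend (s t), ?_, ?_, fun a b h0 hab hb => ⟨?_, ?_⟩⟩
  · exact (dist_eq_zero.1 (hsd 0 le_rfl dist_nonneg)).symm
  · have h1 := (hs _ le_rfl).1
    have := hlen _ _ h1 h1 le_rfl
    rw [hsd _ dist_nonneg le_rfl, dist_self] at this
    simp only; linarith
  · have := dist_triangle x (γ.extend (s a)) (γ.extend (s b))
    rw [hsd a h0 (hab.trans hb), hsd b (h0.trans hab) hb] at this
    simp only; linarith
  · have := hlen _ _ (hs a (hab.trans hb)).1 (hs b hb).1 (hsm a b hab hb)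
    rw [hsd a h0 (hab.trans hb)] at this
    have h2 := dist_triangle x (γ.extend (s b)) y
    rw [hsd b (h0.trans hab) hb] at h2
    simp only; linarith

end LengthSpace

section UltraLimit

variable {Z : Type*} [MetricSpace Z]

/-- The limit of a sequence of sets along the hyperfilter on `ℕ`. -/
def ulim (A : ℕ → Set Z) : Set Z :=
  {z | ∀ ε > 0, ∀ᶠ n in (hyperfilter ℕ : Filter ℕ), ∃ a ∈ A n, dist a z < ε}

theorem hyperfilter_le_atTop : (hyperfilter ℕ : Filter ℕ) ≤ atTop :=
  Nat.hyperfilter_le_atTop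

theorem exists_tendsto_hyperfilter [CompactSpace Z] (x : ℕ → Z) :
    ∃ z, Tendsto x (hyperfilter ℕ : Filter ℕ) (𝓝 z) := by
  obtain ⟨z, -, hz⟩ := isCompact_univ.ultrafilter_le_nhds ((hyperfilter ℕ).map x) (by simp)
  exact ⟨z, hz⟩

theorem mem_ulim_of_tendsto {A : ℕ → Set Z} {a : ℕ → Z} {z : Z}
    (hA : ∀ᶠ n in (hyperfilter ℕ : Filter ℕ), a n ∈ A n)
    (ha : Tendsto a (hyperfilter ℕ : Filter ℕ) (𝓝 z)) : z ∈ ulim A := fun ε hε => by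
  filter_upwards [hA, ha (ball_mem_nhds z hε)] with n h1 h2 using ⟨a n, h1, h2⟩

theorem exists_tendsto_of_mem_ulim {A : ℕ → Set Z} {z : Z} (hz : z ∈ ulim A) :
    ∃ a : ℕ → Z, (∀ᶠ n in (hyperfilter ℕ : Filter ℕ), a n ∈ A n) ∧
      Tendsto a (hyperfilter ℕ : Filter ℕ) (𝓝 z) := by
  have h : ∀ n, ∃ a, (A n).Nonempty → a ∈ A n ∧ dist z a < infDist z (A n) + 1 / (n + 1 : ℝ) := by
    intro n
    by_cases hn : (A n).Nonempty
    · obtain ⟨a, ha, h⟩ := (infDist_lt_iff (r := infDist z (A n) + 1 / (n + 1 : ℝ)) hn).1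
        (lt_add_of_pos_right _ (by positivity))
      exact ⟨a, fun _ => ⟨ha, h⟩⟩
    · exact ⟨z, fun h => (hn h).elim⟩
  choose a ha using h
  refine ⟨a, ?_, Metric.tendsto_nhds.2 fun ε hε => ?_⟩
  · filter_upwards [hz 1 one_pos] with n hn
    exact (ha n ⟨hn.choose, hn.choose_spec.1⟩).1
  · filter_upwards [hz (ε / 2) (half_pos hε), hyperfilter_le_atTop
      ((tendsto_one_div_add_atTop_nhds_zero_nat (𝕜 := ℝ)).eventually_lt_const (half_pos hε))]
      with n hn hn'
    obtain ⟨b, hb, hbz⟩ := hn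
    have h1 := (ha n ⟨b, hb⟩).2
    have h2 := infDist_le_dist_of_mem (x := z) hb
    rw [dist_comm] at hbz ⊢
    have h3 : 1 / ((n : ℝ) + 1) < ε / 2 := hn'
    linarith

theorem ulim_mono {A B : ℕ → Set Z} (h : ∀ᶠ n in (hyperfilter ℕ : Filter ℕ), A n ⊆ B n) :
    ulim A ⊆ ulim B := fun z hz ε hε => by
  filter_upwards [h, hz ε hε] with n h1 ⟨a, ha, h2⟩ using ⟨a, h1 ha, h2⟩

theorem ulim_union (A B : ℕ → Set Z) : ulim (fun n => A n ∪ B n) = ulim A ∪ ulim B := by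
  refine subset_antisymm (fun z hz => ?_) (union_subset
    (ulim_mono (Eventually.of_forall fun n => subset_union_left))
    (ulim_mono (Eventually.of_forall fun n => subset_union_right)))
  obtain ⟨a, ha, hz⟩ := exists_tendsto_of_mem_ulim hz
  exact (Ultrafilter.eventually_or.1 ha).imp (mem_ulim_of_tendsto · hz) (mem_ulim_of_tendsto · hz)

theorem isClosed_ulim (A : ℕ → Set Z) : IsClosed (ulim A) := by
  refine isClosed_of_closure_subset fun z hz ε hε => ?_
  obtain ⟨w, hw, hzw⟩ := Metric.mem_closure_iff.1 hz _ (half_pos hε)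
  filter_upwards [hw _ (half_pos hε)] with n ⟨a, ha, h⟩
  refine ⟨a, ha, (dist_triangle _ w _).trans_lt ?_⟩
  rw [dist_comm w]; linarith

theorem isPreconnected_ulim [CompactSpace Z] {A : ℕ → Set Z}
    (hA : ∀ᶠ n in (hyperfilter ℕ : Filter ℕ), IsPreconnected (A n)) : IsPreconnected (ulim A) := by
  rw [isPreconnected_closed_iff]
  rintro u v hu hv hcov ⟨x, hxA, hxu⟩ ⟨y, hyA, hyv⟩
  by_contra hne
  have hd : Disjoint (ulim A ∩ u) (ulim A ∩ v) :=
    Set.disjoint_left.2 fun z h1 h2 => hne ⟨z, h1.1, h1.2, h2.2⟩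
  obtain ⟨U, V, hU, hV, huU, hvV, hUV⟩ := normal_separation
    ((isClosed_ulim A).inter hu) ((isClosed_ulim A).inter hv) hd
  obtain ⟨a, ha, hax⟩ := exists_tendsto_of_mem_ulim hxA
  obtain ⟨b, hb, hby⟩ := exists_tendsto_of_mem_ulim hyA
  have hsub : ∀ᶠ n in (hyperfilter ℕ : Filter ℕ), A n ⊆ U ∪ V := by
    by_contra hcon
    rw [← Ultrafilter.eventually_not] at hcon
    have : ∀ n, ∃ p, ¬ A n ⊆ U ∪ V → p ∈ A n ∧ p ∉ U ∪ V := fun n => by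
      by_cases h : A n ⊆ U ∪ V
      · exact ⟨x, fun h' => (h' h).elim⟩
      · obtain ⟨p, h1, h2⟩ := not_subset.1 h
        exact ⟨p, fun _ => ⟨h1, h2⟩⟩
    choose p hp using this
    obtain ⟨z, hz⟩ := exists_tendsto_hyperfilter p
    have hzA : z ∈ ulim A := mem_ulim_of_tendsto (hcon.mono fun n hn => (hp n hn).1) hz
    have hzU : z ∈ (U ∪ V)ᶜ := (hU.union hV).isClosed_compl.mem_of_tendsto hz
      (hcon.mono fun n hn => (hp n hn).2)
    exact hzU ((hcov hzA).imp (fun h => huU ⟨hzA, h⟩) fun h => hvV ⟨hzA, h⟩)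
  obtain ⟨n, h1, h2, h3, h4, h5, h6⟩ := (hA.and (hsub.and (ha.and ((hax.eventually_mem
    (hU.mem_nhds (huU ⟨hxA, hxu⟩))).and (hb.and (hby.eventually_mem
    (hV.mem_nhds (hvV ⟨hyA, hyv⟩)))))))).exists
  obtain ⟨w, -, hwU, hwV⟩ := h1 U V hU hV h2 ⟨_, h3, h4⟩ ⟨_, h5, h6⟩
  exact Set.disjoint_left.1 hUV hwU hwV

theorem ulim_eq_of_tendsto_hausdorffEdist {A : ℕ → Set Z} {S : Set Z} (hS : IsClosed S)
    (h : Tendsto (fun n => Metric.hausdorffEDist (A n) S) atTop (𝓝 0)) : ulim A = S := by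
  have key : ∀ ε > 0, ∀ᶠ n in (hyperfilter ℕ : Filter ℕ),
      (∀ a ∈ A n, ∃ s ∈ S, dist a s < ε) ∧ ∀ s ∈ S, ∃ a ∈ A n, dist a s < ε := by
    intro ε hε
    filter_upwards [hyperfilter_le_atTop (h.eventually_lt_const (ENNReal.ofReal_pos.2 hε))]
      with n hn
    constructor
    · intro a ha
      obtain ⟨s, hs, h⟩ := Metric.exists_edist_lt_of_hausdorffEDist_lt ha hn
      exact ⟨s, hs, by rwa [edist_lt_ofReal] at h⟩
    · intro s hs
      replace hn : Metric.hausdorffEDist S (A n) < ENNReal.ofReal ε := by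
        rw [Metric.hausdorffEDist_comm]; exact hn
      obtain ⟨a, ha, h⟩ := Metric.exists_edist_lt_of_hausdorffEDist_lt hs hn
      exact ⟨a, ha, by rwa [edist_comm, edist_lt_ofReal] at h⟩
  refine subset_antisymm (fun z hz => ?_) fun s hs ε hε => (key ε hε).mono fun n hn => hn.2 s hs
  rw [← hS.closure_eq, Metric.mem_closure_iff]
  intro ε hε
  obtain ⟨n, ⟨a, ha, h1⟩, h2, -⟩ := ((hz _ (half_pos hε)).and (key _ (half_pos hε))).exists
  obtain ⟨s, hs, h3⟩ := h2 a ha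
  refine ⟨s, hs, (dist_triangle_left _ _ a).trans_lt (by linarith)⟩

theorem exists_geodesic_ulim [CompactSpace Z] {Y : ℕ → Type*} [∀ n, MetricSpace (Y n)]
    (hY : ∀ n, IsLengthSpace (Y n)) {e : ∀ n, Y n → Z} (he : ∀ n, Isometry (e n))
    {x y : Z} (hx : x ∈ ulim fun n => range (e n)) (hy : y ∈ ulim fun n => range (e n)) :
    ∃ g : ℝ → Z, g 0 = x ∧ g (dist x y) = y ∧ (∀ t, g t ∈ ulim fun n => range (e n)) ∧
      ∀ s ∈ Icc 0 (dist x y), ∀ t ∈ Icc 0 (dist x y), dist (g s) (g t) = dist s t := by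
  obtain ⟨a, ha, hax⟩ := exists_tendsto_of_mem_ulim hx
  obtain ⟨b, hb, hby⟩ := exists_tendsto_of_mem_ulim hy
  have h : ∀ n, ∃ f : ℝ → Z, a n ∈ range (e n) → b n ∈ range (e n) → (∀ t, f t ∈ range (e n)) ∧
      f 0 = a n ∧ dist (f (dist (a n) (b n))) (b n) ≤ 1 / (n + 1 : ℝ) ∧
      ∀ s t, 0 ≤ s → s ≤ t → t ≤ dist (a n) (b n) →
        t - s ≤ dist (f s) (f t) ∧ dist (f s) (f t) ≤ t - s + 1 / (n + 1 : ℝ) := by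
    intro n
    by_cases hn : a n ∈ range (e n) ∧ b n ∈ range (e n)
    · obtain ⟨⟨a', ha'⟩, b', hb'⟩ := hn
      obtain ⟨f, h0, h1, h2⟩ := (hY n).exists_almost_geodesic a' b'
        (show (0 : ℝ) < 1 / (n + 1) by positivity)
      refine ⟨fun t => e n (f t), fun _ _ => ⟨fun t => mem_range_self _, ?_⟩⟩
      rw [← ha', ← hb', (he n).dist_eq]
      refine ⟨congrArg (e n) h0, by rwa [(he n).dist_eq], fun s t hs hst ht => ?_⟩
      rw [(he n).dist_eq] at ht ⊢; exact h2 s t hs hst ht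
    · exact ⟨fun _ => x, fun h1 h2 => (hn ⟨h1, h2⟩).elim⟩
  choose f hf using h
  have hd : Tendsto (fun n => dist (a n) (b n)) (hyperfilter ℕ : Filter ℕ) (𝓝 (dist x y)) :=
    hax.dist hby
  have hz : Tendsto (fun n : ℕ => 1 / (n + 1 : ℝ)) (hyperfilter ℕ : Filter ℕ) (𝓝 0) :=
    tendsto_one_div_add_atTop_nhds_zero_nat.mono_left hyperfilter_le_atTop
  have hmin : ∀ t ≤ dist x y, Tendsto (fun n => min t (dist (a n) (b n)))
      (hyperfilter ℕ : Filter ℕ) (𝓝 t) := fun t ht => by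
    have := (tendsto_const_nhds (x := t)).min hd
    rwa [min_eq_left ht] at this
  choose g hg using fun t : ℝ =>
    exists_tendsto_hyperfilter fun n => f n (min t (dist (a n) (b n)))
  have hdist : ∀ s t, 0 ≤ s → s ≤ t → t ≤ dist x y → dist (g s) (g t) = t - s := by
    intro s t hs hst ht
    have h1 := (hmin t ht).sub (hmin s (hst.trans ht))
    refine tendsto_nhds_unique ((hg s).dist (hg t)) (tendsto_of_tendsto_of_tendsto_of_le_of_le' h1
      (by have := h1.add hz; rwa [add_zero] at this) ?_ ?_)
    · filter_upwards [ha, hb] with n h1 h2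
      exact ((hf n h1 h2).2.2.2 _ _ (le_min hs dist_nonneg) (min_le_min_right _ hst)
        (min_le_right _ _)).1
    · filter_upwards [ha, hb] with n h1 h2
      exact ((hf n h1 h2).2.2.2 _ _ (le_min hs dist_nonneg) (min_le_min_right _ hst)
        (min_le_right _ _)).2
  refine ⟨g, ?_, ?_, fun t => mem_ulim_of_tendsto ?_ (hg t), ?_⟩
  · refine tendsto_nhds_unique (hg 0) (hax.congr' ?_)
    filter_upwards [ha, hb] with n h1 h2
    rw [min_eq_left dist_nonneg, (hf n h1 h2).2.1]
  · refine tendsto_nhds_unique (hg (dist x y)) ?_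
    have h3 : Tendsto (fun n : ℕ => 1 / (n + 1 : ℝ) + |dist (a n) (b n) - dist x y| + 1 / (n + 1 : ℝ))
        (hyperfilter ℕ : Filter ℕ) (𝓝 0) := by
      simpa using (hz.add (hd.sub_const (dist x y)).abs).add hz
    refine tendsto_of_tendsto_of_dist hby (squeeze_zero' (Eventually.of_forall fun _ => dist_nonneg) ?_ h3)
    filter_upwards [ha, hb] with n h1 h2
    have h5 := hf n h1 h2
    have h6 := (h5.2.2.2 (min (dist x y) (dist (a n) (b n))) _ (le_min dist_nonneg dist_nonneg)
      (min_le_right _ _) le_rfl).2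
    have h7 : dist (a n) (b n) - min (dist x y) (dist (a n) (b n))
        ≤ |dist (a n) (b n) - dist x y| := by
      rcases min_cases (dist x y) (dist (a n) (b n)) with ⟨h, -⟩ | ⟨h, -⟩ <;> rw [h]
      · exact le_abs_self _
      · simp
    have h8 := dist_triangle_right (b n) (f n (min (dist x y) (dist (a n) (b n))))
      (f n (dist (a n) (b n)))
    rw [dist_comm (b n) (f n (dist (a n) (b n)))] at h8
    linarith [h5.2.2.1]
  · filter_upwards [ha, hb] with n h1 h2 using (hf n h1 h2).1 _
  · intro s hs t ht
    rcases le_total s t with h | h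
    · rw [hdist s t hs.1 h ht.2, Real.dist_eq, abs_sub_comm, abs_of_nonneg (sub_nonneg.2 h)]
    · rw [dist_comm, hdist t s ht.1 h hs.2, Real.dist_eq, abs_of_nonneg (sub_nonneg.2 h)]

theorem IsLengthSpace.exists_geodesic [CompactSpace Z] (hZ : IsLengthSpace Z) (x y : Z) :
    ∃ g : ℝ → Z, g 0 = x ∧ g (dist x y) = y ∧
      ∀ s ∈ Icc 0 (dist x y), ∀ t ∈ Icc 0 (dist x y), dist (g s) (g t) = dist s t := by
  have h : ∀ z : Z, z ∈ ulim fun _ : ℕ => range (id : Z → Z) := fun z =>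
    mem_ulim_of_tendsto (a := fun _ => z) (by simp) tendsto_const_nhds
  obtain ⟨g, h0, h1, -, h2⟩ := exists_geodesic_ulim (Y := fun _ => Z) (fun _ => hZ)
    (fun _ => isometry_id) (h x) (h y)
  exact ⟨g, h0, h1, h2⟩

end UltraLimit

section SmallArcs

theorem exists_gap {M : Type*} [TopologicalSpace M] {f : ℝ → M} {d : ℝ} (hd : 0 ≤ d)
    (hf : ContinuousOn f (Icc 0 d)) {P Q : Set M} (hP : IsClosed P) (hQ : IsClosed Q)
    (h0 : f 0 ∈ P) (h1 : f d ∈ Q) (hPQ : ∀ t ∈ Icc 0 d, f t ∉ P ∩ Q) :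
    ∃ s t, 0 ≤ s ∧ s < t ∧ t ≤ d ∧ f s ∈ P ∧ f t ∈ Q ∧ ∀ r ∈ Ioo s t, f r ∉ P ∪ Q := by
  have hQc : IsCompact (Icc 0 d ∩ f ⁻¹' Q) := isCompact_Icc.of_isClosed_subset
    (hf.preimage_isClosed_of_isClosed isClosed_Icc hQ) inter_subset_left
  obtain ⟨t, ⟨htd, htQ⟩, ht⟩ := hQc.exists_isLeast ⟨d, ⟨hd, le_rfl⟩, h1⟩
  have hsub : Icc 0 t ⊆ Icc 0 d := Icc_subset_Icc_right htd.2
  have hPc : IsCompact (Icc 0 t ∩ f ⁻¹' P) := isCompact_Icc.of_isClosed_subset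
    ((hf.mono hsub).preimage_isClosed_of_isClosed isClosed_Icc hP) inter_subset_left
  obtain ⟨s, ⟨hst, hsP⟩, hs⟩ := hPc.exists_isGreatest ⟨0, ⟨le_rfl, htd.1⟩, h0⟩
  refine ⟨s, t, hst.1, lt_of_le_of_ne hst.2 ?_, htd.2, hsP, htQ, fun r hr => ?_⟩
  · rintro rfl; exact hPQ s htd ⟨hsP, htQ⟩
  · have hr0 : 0 ≤ r := hst.1.trans hr.1.le
    rintro (h | h)
    · exact hr.1.not_ge (hs ⟨⟨hr0, hr.2.le⟩, h⟩)
    · exact hr.2.not_ge (ht ⟨⟨hr0, hr.2.le.trans htd.2⟩, h⟩)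

variable {X : Type*} [MetricSpace X]

theorem IsLengthSpace.exists_arc_between [CompactSpace X] (hX : IsLengthSpace X) {P Q : Set X}
    (hP : IsClosed P) (hQ : IsClosed Q) {a a' : X} (ha : a ∈ P) (ha' : a' ∈ Q)
    (hPQ : ∀ p ∈ P ∩ Q, dist a a' < dist a p) :
    ∃ K s t, IsArc K s t ∧ K ⊆ closedBall a (dist a a') ∧ s ∈ P ∧ t ∈ Q ∧ s ∉ Q ∧ t ∉ P ∧
      K ∩ (P ∪ Q) = {s, t} := by
  obtain ⟨g, g0, g1, hg⟩ := hX.exists_geodesic a a'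
  have hgi : InjOn g (Icc 0 (dist a a')) := fun s hs t ht h => by
    rw [← dist_eq_zero, ← hg s hs t ht, h, dist_self]
  have hgc : ContinuousOn g (Icc 0 (dist a a')) :=
    (LipschitzOnWith.of_dist_le_mul (K := 1) fun s hs t ht => by
      rw [hg s hs t ht]; simp).continuousOn
  have hball : ∀ t ∈ Icc 0 (dist a a'), dist a (g t) ≤ dist a a' := fun t ht => by
    rw [← g0, hg 0 ⟨le_rfl, dist_nonneg⟩ t ht, g0, Real.dist_eq, zero_sub, abs_neg,
      abs_of_nonneg ht.1]
    exact ht.2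
  have hav : ∀ t ∈ Icc 0 (dist a a'), g t ∉ P ∩ Q := fun t ht h =>
    (hPQ _ h).not_ge (hball t ht)
  obtain ⟨s, t, hs0, hst, htd, hsP, htQ, hgap⟩ := exists_gap dist_nonneg hgc hP hQ (by rwa [g0])
    (by rwa [g1]) hav
  have hsub : Icc s t ⊆ Icc 0 (dist a a') := Icc_subset_Icc hs0 htd
  refine ⟨g '' Icc s t, g s, g t, IsArc.of_Icc hst (hgc.mono hsub) (hgi.mono hsub), ?_, hsP, htQ,
    fun h => hav s (hsub ⟨le_rfl, hst.le⟩) ⟨hsP, h⟩, fun h => hav t (hsub ⟨hst.le, le_rfl⟩) ⟨h, htQ⟩,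
    ?_⟩
  · rintro _ ⟨r, hr, rfl⟩
    rw [mem_closedBall, dist_comm]; exact hball r (hsub hr)
  · ext p; constructor
    · rintro ⟨⟨r, hr, rfl⟩, hp⟩
      rcases hr.1.eq_or_lt with rfl | h1
      · exact Or.inl rfl
      rcases hr.2.eq_or_lt with rfl | h2
      · exact Or.inr rfl
      exact (hgap r ⟨h1, h2⟩ hp).elim
    · rintro (rfl | rfl)
      exacts [⟨⟨s, ⟨le_rfl, hst.le⟩, rfl⟩, Or.inl hsP⟩, ⟨⟨t, ⟨hst.le, le_rfl⟩, rfl⟩, Or.inr htQ⟩]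

theorem subset_surfaceBoundary_of_mem {b : Set X} (hb : b ∈ surfaceBoundaryComponents X) :
    b ⊆ surfaceBoundary X := by
  obtain ⟨x, -, rfl⟩ := hb; exact connectedComponentIn_subset _ _

theorem isClosed_of_mem_surfaceBoundaryComponents {b : Set X}
    (hb : b ∈ surfaceBoundaryComponents X) : IsClosed b := by
  obtain ⟨x, -, rfl⟩ := hb; exact isClosed_connectedComponentIn isClosed_surfaceBoundary x

theorem exists_isOddArc_of_notMem [CompactSpace X] (hlen : IsLengthSpace X)
    (hfin : (surfaceBoundaryComponents X).Finite) {b : Set X}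
    (hb : b ∈ surfaceBoundaryComponents X) {a a' : X} (ha : a ∈ b)
    (ha' : a' ∈ surfaceBoundary X \ b) :
    ∃ K, IsOddArc K ∧ K ⊆ closedBall a (dist a a') := by
  have hbc := isClosed_of_mem_surfaceBoundaryComponents hb
  have hbc' := isClosed_diff_of_finite_components hfin hb
  obtain ⟨K, s, t, hK, hKa, hs, ht, -, ht', hKst⟩ := hlen.exists_arc_between hbc hbc' ha ha'
    fun p hp => (hp.2.2 hp.1).elim
  rw [union_sdiff_cancel (subset_surfaceBoundary_of_mem hb)] at hKst
  exact ⟨K, isOddArc_of_isClosed hK hKst hbc hbc' hs ht', hKa⟩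

theorem IsPreconnected.mem_closure_diff_singleton {A : Set X} (hA : IsPreconnected A)
    (hn : A.Nontrivial) {x : X} (hx : x ∈ A) : x ∈ closure (A \ {x}) :=
  mem_closure_iff_clusterPt.2 (accPt_principal_iff_clusterPt.1 (hA.preperfect_of_nontrivial hn x hx))

theorem exists_isOddArc_of_split [CompactSpace X] (hX : IsSurface X) (hlen : IsLengthSpace X)
    (hfin : (surfaceBoundaryComponents X).Finite) {b A B C : Set X}
    (hb : b ∈ surfaceBoundaryComponents X) {x y a a' : X} (hA : IsArc A x y) (hB : IsArc B x y)
    (hAB : A ∪ B = b) (hABi : A ∩ B = {x, y}) (ha : a ∈ A) (ha' : a' ∈ B)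
    (hC : IsPreconnected C) (hx : x ∈ C) (hy : y ∈ C) (hCa : ∀ p ∈ C, dist a a' < dist a p) :
    ∃ K, IsOddArc K ∧ K ⊆ closedBall a (dist a a') := by
  have hbB := subset_surfaceBoundary_of_mem hb
  have hbc' := isClosed_diff_of_finite_components hfin hb
  have hPc : IsClosed (A ∪ surfaceBoundary X \ b) := hA.isClosed.union hbc'
  have hPB : (A ∪ surfaceBoundary X \ b) ∩ B = {x, y} := by
    rw [union_inter_distrib_right, hABi]
    refine union_eq_left.2 ?_
    rintro p ⟨⟨-, h⟩, hp⟩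
    exact (h (hAB ▸ Or.inr hp)).elim
  have hPU : A ∪ surfaceBoundary X \ b ∪ B = surfaceBoundary X := by
    rw [union_right_comm, hAB, union_sdiff_cancel hbB]
  obtain ⟨K, s, t, hK, hKa, hs, ht, -, ht', hKst⟩ := hlen.exists_arc_between hPc hB.isClosed
    (Or.inl ha) ha' (by
      rw [hPB]; rintro p (rfl | rfl)
      exacts [hCa _ hx, hCa _ hy])
  rw [hPU] at hKst
  have hcl : ∀ {S : Set X} {p : X}, IsArc S x y → p ∈ S → p ∈ closure (S \ {p}) := fun hS hp =>
    hS.isPreconnected.mem_closure_diff_singleton hS.nontrivial hp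
  refine ⟨K, isOddArc_of_separates hX hPc hB.isClosed hPU hA.ne hPB
    (closure_mono (sdiff_subset_sdiff_left subset_union_left) (hcl hA hA.left_mem))
    (hcl hB hB.left_mem)
    (closure_mono (sdiff_subset_sdiff_left subset_union_left) (hcl hA hA.right_mem))
    (hcl hB hB.right_mem) hK hKst hs ht' hC (fun p hp hpK => ?_) hx hy, hKa⟩
  have := hKa hpK
  rw [mem_closedBall, dist_comm] at this
  exact (hCa p hp).not_ge this

theorem IsMetricDouble.diam_union_le {D : Type*} [MetricSpace D] {B : Set X} {ip im : X → D}
    (hD : IsMetricDouble X B D ip im) {K : Set X} (hKB : (K ∩ B).Nonempty) {a : X} {r : ℝ}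
    (hK : K ⊆ closedBall a r) : diam (ip '' K ∪ im '' K) ≤ 4 * r := by
  obtain ⟨k, hkK, hkB⟩ := hKB
  have hr : 0 ≤ r := dist_nonneg.trans (hK hkK)
  have h2 : ∀ p ∈ K, dist p k ≤ 2 * r := fun p hp => by
    have := dist_triangle_right p k a
    linarith [mem_closedBall.1 (hK hp), mem_closedBall.1 (hK hkK)]
  have h3 : ∀ p ∈ ip '' K ∪ im '' K, dist p (ip k) ≤ 2 * r := by
    rintro _ (⟨p, hp, rfl⟩ | ⟨p, hp, rfl⟩)
    · rw [hD.isom_p.dist_eq]; exact h2 p hp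
    · rw [hD.agree k hkB, hD.isom_m.dist_eq]; exact h2 p hp
  refine diam_le_of_forall_dist_le (by positivity) fun p hp p' hp' => ?_
  linarith [dist_triangle_right p p' (ip k), h3 p hp, h3 p' hp']

theorem RegularDoubleSeq.exists_forall_le_diam {D : ℕ → Type} [∀ n, MetricSpace (D n)]
    (hreg : RegularDoubleSeq D) (hne : ∀ n, ∃ J : Set (D n), IsNonContractibleJordanCurve J) :
    ∃ δ > 0, ∀ᶠ n in atTop, ∀ J : Set (D n), IsNonContractibleJordanCurve J → δ ≤ diam J := by
  let m : ℕ → ℝ := fun n => sInf {r | ∃ J : Set (D n), IsNonContractibleJordanCurve J ∧ diam J = r}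
  have hb : ∀ n, BddBelow {r | ∃ J : Set (D n), IsNonContractibleJordanCurve J ∧ diam J = r} :=
    fun n => ⟨0, by rintro _ ⟨J, -, rfl⟩; exact diam_nonneg⟩
  have h : ∀ n, ∃ J : Set (D n), IsNonContractibleJordanCurve J ∧
      diam J < m n + 1 / (n + 1 : ℝ) := by
    intro n
    obtain ⟨J0, hJ0⟩ := hne n
    obtain ⟨_, ⟨J, hJ, rfl⟩, h⟩ := exists_lt_of_csInf_lt (s := {r | ∃ J : Set (D n),
      IsNonContractibleJordanCurve J ∧ diam J = r}) ⟨_, J0, hJ0, rfl⟩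
      (lt_add_of_pos_right (m n) (show (0 : ℝ) < 1 / (n + 1) by positivity))
    exact ⟨J, hJ, h⟩
  choose J hJ hJd using h
  have hpos := hreg J hJ
  refine ⟨_, half_pos hpos, ?_⟩
  filter_upwards [(tendsto_one_div_add_atTop_nhds_zero_nat (𝕜 := ℝ)).eventually_lt_const
    (half_pos hpos)] with n hn J' hJ'
  have h1 : ⨅ n, diam (J n) ≤ diam (J n) :=
    ciInf_le ⟨0, by rintro _ ⟨n, rfl⟩; exact diam_nonneg⟩ n
  have h2 : m n ≤ diam J' := csInf_le (hb n) ⟨J', hJ', rfl⟩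
  linarith [hJd n]

end SmallArcs

section GeodesicArc

variable {M : Type*} [MetricSpace M]

theorem exists_isArc_of_geodesic {x y : M} (hxy : x ≠ y) {g : ℝ → M} (h0 : g 0 = x)
    (h1 : g (dist x y) = y)
    (hg : ∀ s ∈ Icc 0 (dist x y), ∀ t ∈ Icc 0 (dist x y), dist (g s) (g t) = dist s t) :
    IsArc (g '' Icc 0 (dist x y)) x y ∧ g '' Icc 0 (dist x y) ⊆ closedBall x (dist x y) := by
  have hd := dist_pos.2 hxy
  have hc : ContinuousOn g (Icc 0 (dist x y)) :=
    (LipschitzOnWith.of_dist_le_mul (K := 1) fun s hs t ht => by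
      simp [hg s hs t ht]).continuousOn
  have hi : InjOn g (Icc 0 (dist x y)) := fun s hs t ht h => by
    rw [← dist_eq_zero, ← hg s hs t ht, h, dist_self]
  refine ⟨?_, ?_⟩
  · have := IsArc.of_Icc hd hc hi
    rwa [h0, h1] at this
  · rintro _ ⟨t, ht, rfl⟩
    have := hg t ht 0 (left_mem_Icc.2 hd.le)
    rw [h0] at this
    rw [mem_closedBall, this, Real.dist_eq, sub_zero, abs_of_nonneg ht.1]
    exact ht.2

theorem IsLengthSpace.exists_isPreconnected [CompactSpace M] (hM : IsLengthSpace M) (x y : M) :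
    ∃ C, IsPreconnected C ∧ x ∈ C ∧ y ∈ C ∧ C ⊆ closedBall x (dist x y) := by
  rcases eq_or_ne x y with rfl | hxy
  · exact ⟨{x}, isPreconnected_singleton, rfl, rfl, by simp⟩
  · obtain ⟨g, h0, h1, hg⟩ := hM.exists_geodesic x y
    obtain ⟨ha, hb⟩ := exists_isArc_of_geodesic hxy h0 h1 hg
    exact ⟨_, ha.isPreconnected, ha.left_mem, ha.right_mem, hb⟩

theorem LocallyArcJoined.of_union {P Q : Set M} (hP : IsClosed P) (hQ : IsClosed Q)
    (hPQ : P ∪ Q = univ)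
    (hgP : ∀ x ∈ P, ∀ y ∈ P, x ≠ y → ∃ A ⊆ closedBall x (dist x y), IsArc A x y)
    (hgQ : ∀ x ∈ Q, ∀ y ∈ Q, x ≠ y → ∃ A ⊆ closedBall x (dist x y), IsArc A x y) :
    LocallyArcJoined M := by
  have hor : ∀ d, d ∈ P ∨ d ∈ Q := fun d => (hPQ ▸ mem_univ d : d ∈ P ∪ Q)
  intro d
  by_cases hdP : d ∈ P
  · by_cases hdQ : d ∈ Q
    · refine ⟨1, one_pos, fun d' hne _ => ?_⟩
      rw [dist_comm]
      exact (hor d').elim (hgP d hdP d' · hne.symm) (hgQ d hdQ d' · hne.symm)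
    · obtain ⟨r, hr, h⟩ := Metric.isOpen_iff.1 hQ.isOpen_compl d hdQ
      refine ⟨r, hr, fun d' hne hd => ?_⟩
      rw [dist_comm]
      exact hgP d hdP d' ((hor d').resolve_right (h hd)) hne.symm
  · obtain ⟨r, hr, h⟩ := Metric.isOpen_iff.1 hP.isOpen_compl d hdP
    refine ⟨r, hr, fun d' hne hd => ?_⟩
    rw [dist_comm]
    exact hgQ d ((hor d).resolve_left hdP) d' ((hor d').resolve_left (h hd)) hne.symm

end GeodesicArc

section Sequence

theorem exists_tendsto_of_mem_ulim_image {Z : Type*} [MetricSpace Z] {Xs : ℕ → Type*}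
    {e : ∀ n, Xs n → Z} {A : ∀ n, Set (Xs n)} {z : Z}
    [∀ n, Nonempty (Xs n)] (hz : z ∈ ulim fun n => e n '' A n) :
    ∃ a : ∀ n, Xs n, (∀ᶠ n in (hyperfilter ℕ : Filter ℕ), a n ∈ A n) ∧
      Tendsto (fun n => e n (a n)) (hyperfilter ℕ : Filter ℕ) (𝓝 z) := by
  obtain ⟨w, hw, hwz⟩ := exists_tendsto_of_mem_ulim hz
  have h : ∀ n, ∃ a : Xs n, w n ∈ e n '' A n → a ∈ A n ∧ e n a = w n := fun n => by
    by_cases hn : w n ∈ e n '' A n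
    · obtain ⟨a, ha, hae⟩ := hn
      exact ⟨a, fun _ => ⟨ha, hae⟩⟩
    · exact ⟨Classical.arbitrary _, fun h => (hn h).elim⟩
  choose a ha using h
  refine ⟨a, hw.mono fun n hn => (ha n hn).1, hwz.congr' ?_⟩
  filter_upwards [hw] with n hn using ((ha n hn).2).symm

variable {Z : Type*} [MetricSpace Z] {Xs : ℕ → Type*} [∀ n, MetricSpace (Xs n)]
  {e : ∀ n, Xs n → Z}

/-- The radii of balls containing an odd arc are bounded below along the ultrafilter. -/
def OddArcsLarge (Xs : ℕ → Type*) [∀ n, MetricSpace (Xs n)] : Prop :=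
  ∃ δ > 0, ∀ᶠ n in (hyperfilter ℕ : Filter ℕ), ∀ (K : Set (Xs n)) (a : Xs n) (r : ℝ),
    IsOddArc K → K ⊆ closedBall a r → δ ≤ r

theorem tendsto_dist_of_tendsto (he : ∀ n, Isometry (e n)) {a b : ∀ n, Xs n} {z w : Z}
    (ha : Tendsto (fun n => e n (a n)) (hyperfilter ℕ : Filter ℕ) (𝓝 z))
    (hb : Tendsto (fun n => e n (b n)) (hyperfilter ℕ : Filter ℕ) (𝓝 w)) :
    Tendsto (fun n => dist (a n) (b n)) (hyperfilter ℕ : Filter ℕ) (𝓝 (dist z w)) :=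
  (ha.dist hb).congr fun n => (he n).dist_eq _ _

theorem disjoint_ulim_component [∀ n, Nonempty (Xs n)] [∀ n, CompactSpace (Xs n)]
    (hlen : ∀ n, IsLengthSpace (Xs n))
    (hfin : ∀ n, (surfaceBoundaryComponents (Xs n)).Finite) (he : ∀ n, Isometry (e n))
    (hno : OddArcsLarge Xs) {b : ∀ n, Set (Xs n)}
    (hb : ∀ n, b n ∈ surfaceBoundaryComponents (Xs n)) :
    Disjoint (ulim fun n => e n '' b n)
      (ulim fun n => e n '' (surfaceBoundary (Xs n) \ b n)) := by
  rw [Set.disjoint_left]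
  intro z hz hz'
  obtain ⟨a, ha, haz⟩ := exists_tendsto_of_mem_ulim_image hz
  obtain ⟨a', ha', haz'⟩ := exists_tendsto_of_mem_ulim_image hz'
  obtain ⟨δ, hδ, hK⟩ := hno
  have hd := tendsto_dist_of_tendsto he haz haz'
  rw [dist_self] at hd
  obtain ⟨n, h1, h2, h3, h4⟩ :=
    (ha.and (ha'.and (hK.and (hd.eventually_lt_const hδ)))).exists
  obtain ⟨K, hK1, hK2⟩ := exists_isOddArc_of_notMem (hlen n) (hfin n) (hb n) h1 h2
  exact (h3 K _ _ hK1 hK2).not_gt h4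

theorem exists_ulim_eq_component [CompactSpace Z] [∀ n, Nonempty (Xs n)]
    [∀ n, CompactSpace (Xs n)] (hlen : ∀ n, IsLengthSpace (Xs n))
    (hfin : ∀ n, (surfaceBoundaryComponents (Xs n)).Finite) (he : ∀ n, Isometry (e n))
    (hno : OddArcsLarge Xs) (hne : ∀ n, (surfaceBoundary (Xs n)).Nonempty) {S : Set Z}
    (hS : (ulim fun n => e n '' surfaceBoundary (Xs n)) = S) {z : Z} (hz : z ∈ S) :
    ∃ b : ∀ n, Set (Xs n), (∀ n, b n ∈ surfaceBoundaryComponents (Xs n)) ∧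
      (ulim fun n => e n '' b n) = connectedComponentIn S z := by
  obtain ⟨ζ, hζ, hζz⟩ := exists_tendsto_of_mem_ulim_image (hS ▸ hz)
  have h : ∀ n, ∃ b ∈ surfaceBoundaryComponents (Xs n), ζ n ∈ surfaceBoundary (Xs n) → ζ n ∈ b := by
    intro n
    by_cases hn : ζ n ∈ surfaceBoundary (Xs n)
    · exact ⟨_, ⟨ζ n, hn, rfl⟩, fun _ => mem_connectedComponentIn hn⟩
    · obtain ⟨x, hx⟩ := hne n
      exact ⟨_, ⟨x, hx, rfl⟩, fun h => (hn h).elim⟩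
  choose b hb hζb using h
  have hzb : z ∈ ulim fun n => e n '' b n :=
    mem_ulim_of_tendsto (hζ.mono fun n hn => mem_image_of_mem _ (hζb n hn)) hζz
  have hu : (ulim fun n => e n '' b n) ∪
      (ulim fun n => e n '' (surfaceBoundary (Xs n) \ b n)) = S := by
    rw [← ulim_union, ← hS]
    congr 1
    funext n
    rw [← image_union, union_sdiff_cancel (subset_surfaceBoundary_of_mem (hb n))]
  refine ⟨b, hb, subset_antisymm ?_ ?_⟩
  · refine IsPreconnected.subset_connectedComponentIn (isPreconnected_ulim ?_) hzb ?_
    · refine Eventually.of_forall fun n => ?_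
      obtain ⟨x, hx, hbx⟩ := hb n
      rw [hbx]
      exact isPreconnected_connectedComponentIn.image _ (he n).continuous.continuousOn
    · rw [← hu]; exact subset_union_left
  · have hd := disjoint_ulim_component hlen hfin he hno hb
    rcases isPreconnected_iff_subset_of_disjoint_closed.1
      (isPreconnected_connectedComponentIn (F := S) (x := z)) _ _ (isClosed_ulim _) (isClosed_ulim _)
      ((connectedComponentIn_subset S z).trans hu.symm.subset)
      (by rw [hd.inter_eq, inter_empty]) with h | h
    · exact h
    · exact (Set.disjoint_left.1 hd hzb (h (mem_connectedComponentIn hz))).elim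

theorem eventually_exists_isPreconnected_thickening [∀ n, Nonempty (Xs n)]
    [∀ n, CompactSpace (Xs n)] (hlen : ∀ n, IsLengthSpace (Xs n)) (he : ∀ n, Isometry (e n))
    {C : Set Z} (hC : IsPreconnected C) (hCX : C ⊆ ulim fun n => range (e n)) {x y : Z}
    (hx : x ∈ C) (hy : y ∈ C) {xs ys : ∀ n, Xs n}
    (hxs : Tendsto (fun n => e n (xs n)) (hyperfilter ℕ : Filter ℕ) (𝓝 x))
    (hys : Tendsto (fun n => e n (ys n)) (hyperfilter ℕ : Filter ℕ) (𝓝 y)) {ε : ℝ} (hε : 0 < ε) :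
    ∀ᶠ n in (hyperfilter ℕ : Filter ℕ), ∃ G : Set (Xs n), IsPreconnected G ∧ xs n ∈ G ∧ ys n ∈ G ∧
      ∀ p ∈ G, ∃ c ∈ C, dist (e n p) c < ε := by
  -- short geodesics stay in the thickening
  have short : ∀ p ∈ C, ∀ p', dist p p' < ε / 4 → ∀ u v : ∀ n, Xs n,
      Tendsto (fun n => e n (u n)) (hyperfilter ℕ : Filter ℕ) (𝓝 p) →
      Tendsto (fun n => e n (v n)) (hyperfilter ℕ : Filter ℕ) (𝓝 p') →
      ∀ᶠ n in (hyperfilter ℕ : Filter ℕ), ∃ G : Set (Xs n), IsPreconnected G ∧ u n ∈ G ∧ v n ∈ G ∧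
        ∀ q ∈ G, ∃ c ∈ C, dist (e n q) c < ε := by
    intro p hp p' hpp u v hu hv
    filter_upwards [(tendsto_dist_of_tendsto he hu hv).eventually_lt_const hpp,
      hu (ball_mem_nhds p (by positivity : 0 < ε / 4))] with n h1 h2
    obtain ⟨G, hG, huG, hvG, hGb⟩ := (hlen n).exists_isPreconnected (u n) (v n)
    refine ⟨G, hG, huG, hvG, fun q hq => ⟨p, hp, ?_⟩⟩
    have h3 := mem_closedBall.1 (hGb hq)
    rw [← (he n).dist_eq] at h3
    have h4 : dist (e n (u n)) p < ε / 4 := h2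
    have h1' : dist (u n) (v n) < ε / 4 := h1
    linarith [dist_triangle (e n q) (e n (u n)) p]
  let R : Z → Prop := fun p => ∀ u : ∀ n, Xs n,
    Tendsto (fun n => e n (u n)) (hyperfilter ℕ : Filter ℕ) (𝓝 p) →
    ∀ᶠ n in (hyperfilter ℕ : Filter ℕ), ∃ G : Set (Xs n), IsPreconnected G ∧ xs n ∈ G ∧ u n ∈ G ∧
      ∀ q ∈ G, ∃ c ∈ C, dist (e n q) c < ε
  have step : ∀ p ∈ C, ∀ p' ∈ C, dist p p' < ε / 4 → R p → R p' := by
    intro p hp p' hp' hpp hR v hv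
    have hp2 := hCX hp
    simp only [← image_univ] at hp2
    obtain ⟨u, -, hu⟩ := exists_tendsto_of_mem_ulim_image hp2
    filter_upwards [hR u hu, short p hp p' hpp u v hu hv] with n ⟨G, h1, h2, h3, h4⟩
      ⟨G', h1', h2', h3', h4'⟩
    exact ⟨G ∪ G', h1.union (u n) h3 h2' h1', Or.inl h2, Or.inr h3',
      fun q hq => hq.elim (h4 q) (h4' q)⟩
  have hRxy : R x → R y := by
    refine hC.induction₂' (fun p p' => R p → R p') (fun p hp => ?_)
      (fun p q r _ _ _ h1 h2 h => h2 (h1 h)) hx hy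
    filter_upwards [mem_nhdsWithin_of_mem_nhds (ball_mem_nhds p (by positivity : 0 < ε / 4)),
      self_mem_nhdsWithin] with q hq hqC
    exact ⟨step p hp q hqC (by rw [dist_comm]; exact hq), step q hqC p hp hq⟩
  exact hRxy (fun u hu => short x hx x (by simpa using by positivity) xs u hxs hu) ys hys

/-- Limits of complementary arcs of a boundary curve meet only at points that separate, in
the limit space, the limits of the end points. -/
theorem mem_of_mem_ulim_arcs [∀ n, Nonempty (Xs n)] [∀ n, CompactSpace (Xs n)]
    (hsurf : ∀ n, IsSurface (Xs n)) (hlen : ∀ n, IsLengthSpace (Xs n))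
    (hfin : ∀ n, (surfaceBoundaryComponents (Xs n)).Finite) (he : ∀ n, Isometry (e n))
    (hno : OddArcsLarge Xs) {b A B : ∀ n, Set (Xs n)} {xs ys : ∀ n, Xs n}
    (hb : ∀ n, b n ∈ surfaceBoundaryComponents (Xs n))
    (hAB : ∀ᶠ n in (hyperfilter ℕ : Filter ℕ), IsArc (A n) (xs n) (ys n) ∧
      IsArc (B n) (xs n) (ys n) ∧ A n ∪ B n = b n ∧ A n ∩ B n = {xs n, ys n}) {x y z : Z}
    (hxs : Tendsto (fun n => e n (xs n)) (hyperfilter ℕ : Filter ℕ) (𝓝 x))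
    (hys : Tendsto (fun n => e n (ys n)) (hyperfilter ℕ : Filter ℕ) (𝓝 y))
    (hzA : z ∈ ulim fun n => e n '' A n) (hzB : z ∈ ulim fun n => e n '' B n) {C : Set Z}
    (hC : IsCompact C) (hCp : IsPreconnected C) (hCX : C ⊆ ulim fun n => range (e n))
    (hx : x ∈ C) (hy : y ∈ C) : z ∈ C := by
  by_contra hz
  obtain ⟨ε, hε, hball⟩ := Metric.isOpen_iff.1 hC.isClosed.isOpen_compl z hz
  have hdist : ∀ c ∈ C, ε ≤ dist c z := fun c hc => not_lt.1 fun h => hball h hc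
  obtain ⟨a, ha, haz⟩ := exists_tendsto_of_mem_ulim_image hzA
  obtain ⟨a', ha', haz'⟩ := exists_tendsto_of_mem_ulim_image hzB
  obtain ⟨δ, hδ, hK⟩ := hno
  have hd := tendsto_dist_of_tendsto he haz haz'
  rw [dist_self] at hd
  have hε3 : 0 < ε / 3 := by positivity
  obtain ⟨n, h1, h2, h3, h4, h5, ⟨G, hG, hxG, hyG, hGC⟩, hA, hB, hU, hI⟩ :=
    (ha.and (ha'.and (hK.and ((hd.eventually_lt_const (lt_min hδ hε3)).and
      ((haz.eventually_mem (ball_mem_nhds z hε3)).and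
      ((eventually_exists_isPreconnected_thickening hlen he hCp hCX hx hy hxs hys hε3).and
        hAB)))))).exists
  have h5' : dist (e n (a n)) z < ε / 3 := h5
  obtain ⟨K, hK1, hK2⟩ := exists_isOddArc_of_split (hsurf n) (hlen n) (hfin n) (hb n) hA hB hU hI
    h1 h2 hG hxG hyG fun p hp => by
      obtain ⟨c, hc, hpc⟩ := hGC p hp
      have := hdist c hc
      have h6 := dist_triangle_left c z (e n p)
      have h7 := dist_triangle_left (e n p) z (e n (a n))
      rw [(he n).dist_eq] at h7
      linarith [h4.trans_le (min_le_right _ _)]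
  exact (h3 K _ _ hK1 hK2).not_gt (h4.trans_le (min_le_left _ _))

end Sequence

section LimitDouble

theorem plusCopy_eq_image {Z D : Type*} {X : Set Z} {Xp : Set D} (j : ↥X → ↥Xp) {A : Set Z} :
    plusCopy j A = (fun x : ↥X => (j x : D)) '' (Subtype.val ⁻¹' A) := rfl

variable {Z : Type*} [MetricSpace Z] {X : Set Z} {D : Type*} [MetricSpace D] {Xp Xm : Set D}

theorem exists_fold_of_union [CompactSpace Z] (hX : IsClosed X) (hunion : Xp ∪ Xm = univ)
    (jp : ↥X ≃ᵢ ↥Xp) (jm : ↥X ≃ᵢ ↥Xm) (hj : ∀ x y : ↥X, (jp x : D) = jm y → x = y) :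
    ∃ r : D → Z, Continuous r ∧ (∀ x : ↥X, r (jp x) = x) ∧ (∀ x : ↥X, r (jm x) = x) ∧
      ∀ d, r d ∈ X := by
  classical
  have : CompactSpace ↥X := isCompact_iff_compactSpace.1 hX.isCompact
  have hXp : IsClosed Xp :=
    (isCompact_iff_compactSpace.2 jp.toHomeomorph.compactSpace).isClosed
  have hXm : IsClosed Xm :=
    (isCompact_iff_compactSpace.2 jm.toHomeomorph.compactSpace).isClosed
  have hor : ∀ d, d ∉ Xp → d ∈ Xm := fun d h =>
    ((hunion ▸ mem_univ d : d ∈ Xp ∪ Xm)).resolve_left h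
  let r : D → Z := fun d => if h : d ∈ Xp then jp.symm ⟨d, h⟩ else jm.symm ⟨d, hor d h⟩
  have hp : ∀ d (h : d ∈ Xp), r d = jp.symm ⟨d, h⟩ := fun d h => dif_pos h
  have hm : ∀ d (h : d ∈ Xm), r d = jm.symm ⟨d, h⟩ := fun d h => by
    by_cases h' : d ∈ Xp
    · rw [hp d h']
      congr 1
      exact hj _ _ (by simp)
    · exact dif_neg h'
  refine ⟨r, ?_, fun x => ?_, fun x => ?_, fun d => ?_⟩
  · rw [← continuousOn_univ]
    refine ContinuousOn.of_isClosed_cover hXp hXm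
      (fun d _ => (hunion ▸ mem_univ d : d ∈ Xp ∪ Xm)) ?_ ?_
    · rw [univ_inter, continuousOn_iff_continuous_domRestrict]
      refine (continuous_subtype_val.comp jp.symm.continuous).congr fun d => ?_
      simp [hp d d.2]
    · rw [univ_inter, continuousOn_iff_continuous_domRestrict]
      refine (continuous_subtype_val.comp jm.symm.continuous).congr fun d => ?_
      simp [hm d d.2]
  · simp [hp _ (jp x).2]
  · simp [hm _ (jm x).2]
  · by_cases h : d ∈ Xp
    · rw [hp d h]; exact Subtype.coe_prop _
    · rw [hm d (hor d h)]; exact Subtype.coe_prop _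

theorem exists_arc_of_isometryEquiv
    (hg : ∀ x ∈ X, ∀ y ∈ X, ∃ g : ℝ → Z, g 0 = x ∧ g (dist x y) = y ∧ (∀ t, g t ∈ X) ∧
      ∀ s ∈ Icc 0 (dist x y), ∀ t ∈ Icc 0 (dist x y), dist (g s) (g t) = dist s t)
    (j : ↥X ≃ᵢ ↥Xp) :
    ∀ x ∈ Xp, ∀ y ∈ Xp, x ≠ y → ∃ A ⊆ closedBall x (dist x y), IsArc A x y := by
  intro x hx y hy hxy
  obtain ⟨a, ha⟩ := j.surjective ⟨x, hx⟩
  obtain ⟨b, hb⟩ := j.surjective ⟨y, hy⟩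
  have hja : (j a : D) = x := by rw [ha]
  have hjb : (j b : D) = y := by rw [hb]
  have hd : dist (a : Z) b = dist x y := by
    rw [← hja, ← hjb]; exact (j.isometry.dist_eq a b).symm
  obtain ⟨g, h0, h1, hgX, hgd⟩ := hg a a.2 b b.2
  rw [hd] at h1 hgd
  obtain ⟨h2, h3⟩ := exists_isArc_of_geodesic (g := fun t => (j ⟨g t, hgX t⟩ : D)) hxy
    (by
      have : (⟨g 0, hgX _⟩ : ↥X) = a := Subtype.ext h0
      simp only [this, hja]) (by
      have : (⟨g (dist x y), hgX _⟩ : ↥X) = b := Subtype.ext h1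
      simp only [this, hjb])
    (fun s hs t ht => by
      rw [← hgd s hs t ht]; exact j.isometry.dist_eq _ _)
  exact ⟨_, h3, h2⟩

theorem isClosed_plusCopy [CompactSpace Z] (hX : IsClosed X) (j : ↥X ≃ᵢ ↥Xp) {A : Set Z}
    (hA : IsClosed A) : IsClosed (plusCopy j A) := by
  have : CompactSpace ↥X := isCompact_iff_compactSpace.1 hX.isCompact
  exact (((hA.preimage continuous_subtype_val).isCompact).image
    (continuous_subtype_val.comp j.continuous)).isClosed

theorem IsPreconnected.plusCopy (j : ↥X ≃ᵢ ↥Xp) {A : Set Z} (hAX : A ⊆ X)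
    (hA : IsPreconnected A) : IsPreconnected (plusCopy j A) := by
  refine IsPreconnected.image ?_ _ (continuous_subtype_val.comp j.continuous).continuousOn
  rw [← IsInducing.subtypeVal.isPreconnected_image]
  change IsPreconnected (Subtype.val '' (Subtype.val ⁻¹' A))
  rwa [Subtype.image_preimage_coe, inter_eq_right.2 hAX]

theorem isJordanCurve_inter_plusCopy [CompactSpace Z] [CompactSpace D]
    {Xs : ℕ → Type*} [∀ n, MetricSpace (Xs n)] {e : ∀ n, Xs n → Z}
    [∀ n, Nonempty (Xs n)] [∀ n, CompactSpace (Xs n)]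
    (hsurf : ∀ n, IsSurface (Xs n)) (hlen : ∀ n, IsLengthSpace (Xs n))
    (hfin : ∀ n, (surfaceBoundaryComponents (Xs n)).Finite) (he : ∀ n, Isometry (e n))
    (hne : ∀ n, (surfaceBoundary (Xs n)).Nonempty) (hno : OddArcsLarge Xs)
    (hX : IsClosed X) (hXlim : (ulim fun n => range (e n)) = X)
    {Binf : Set Z} (hBsub : Binf ⊆ X)
    (hBlim : (ulim fun n => e n '' surfaceBoundary (Xs n)) = Binf)
    (hunion : Xp ∪ Xm = univ) (jp : ↥X ≃ᵢ ↥Xp) (jm : ↥X ≃ᵢ ↥Xm)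
    (hj : ∀ x y : ↥X, (jp x : D) = jm y → x = y)
    (hjB : ∀ x : ↥X, (x : Z) ∈ Binf → (jp x : D) = jm x)
    {z : Z} (hz : z ∈ Binf) {T : Set D} (hT : IsMaximalCyclic T)
    (hTb : (T ∩ plusCopy jp (connectedComponentIn Binf z)).Nontrivial) :
    IsJordanCurve (T ∩ plusCopy jp (connectedComponentIn Binf z)) := by
  have hgeo : ∀ x ∈ X, ∀ y ∈ X, ∃ g : ℝ → Z, g 0 = x ∧ g (dist x y) = y ∧ (∀ t, g t ∈ X) ∧
      ∀ s ∈ Icc 0 (dist x y), ∀ t ∈ Icc 0 (dist x y), dist (g s) (g t) = dist s t := by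
    rw [← hXlim]
    exact fun x hx y hy => exists_geodesic_ulim hlen he hx hy
  obtain ⟨r, hrc, hrp, hrm, hrX⟩ := exists_fold_of_union hX hunion jp jm hj
  have : CompactSpace ↥X := isCompact_iff_compactSpace.1 hX.isCompact
  have hM : LocallyArcJoined D := by
    refine LocallyArcJoined.of_union ?_ ?_ hunion (exists_arc_of_isometryEquiv hgeo jp)
      (exists_arc_of_isometryEquiv hgeo jm)
    · exact (isCompact_iff_compactSpace.2 jp.toHomeomorph.compactSpace).isClosed
    · exact (isCompact_iff_compactSpace.2 jm.toHomeomorph.compactSpace).isClosed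
  obtain ⟨b, hb, hblim⟩ := exists_ulim_eq_component hlen hfin he hno hne hBlim hz
  set β := connectedComponentIn Binf z with hβ
  have hβB : β ⊆ Binf := connectedComponentIn_subset _ _
  have hβc : IsClosed β := hblim ▸ isClosed_ulim _
  have hinj : Function.Injective fun x : ↥X => (jp x : D) :=
    Subtype.val_injective.comp jp.injective
  have hK : IsJordanCurve (closure T ∩ plusCopy jp β) := by
    refine isJordanCurve_of_splits
      (isClosed_closure.inter (isClosed_plusCopy hX jp hβc)).isCompact
      (hTb.mono (inter_subset_inter_left _ subset_closure)) ?_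
    rintro _ ⟨hxT, x, hx, rfl⟩ _ ⟨hyT, y, hy, rfl⟩ hxy
    have hx' : (x : Z) ∈ ulim fun n => e n '' b n := hblim.symm.subset hx
    have hy' : (y : Z) ∈ ulim fun n => e n '' b n := hblim.symm.subset hy
    obtain ⟨xs, hxs, hxl⟩ := exists_tendsto_of_mem_ulim_image hx'
    obtain ⟨ys, hys, hyl⟩ := exists_tendsto_of_mem_ulim_image hy'
    have hxyZ : (x : Z) ≠ y := fun h => hxy (by rw [Subtype.ext h])
    have hd := tendsto_dist_of_tendsto he hxl hyl
    have hsplit : ∀ n, ∃ A B : Set (Xs n), xs n ∈ b n ∧ ys n ∈ b n ∧ 0 < dist (xs n) (ys n) →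
        IsArc A (xs n) (ys n) ∧ IsArc B (xs n) (ys n) ∧ A ∪ B = b n ∧
          A ∩ B = {xs n, ys n} := by
      intro n
      by_cases h : xs n ∈ b n ∧ ys n ∈ b n ∧ 0 < dist (xs n) (ys n)
      · obtain ⟨A, B, h'⟩ := (IsCompactSurface.isJordanCurve_boundaryComponent (hsurf n) (hfin n)
          (hb n)).split h.1 h.2.1 (dist_pos.1 h.2.2)
        exact ⟨A, B, fun _ => h'⟩
      · exact ⟨∅, ∅, fun h' => (h h').elim⟩
    choose A B hAB using hsplit
    have hAB' : ∀ᶠ n in (hyperfilter ℕ : Filter ℕ), IsArc (A n) (xs n) (ys n) ∧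
        IsArc (B n) (xs n) (ys n) ∧ A n ∪ B n = b n ∧ A n ∩ B n = {xs n, ys n} := by
      filter_upwards [hxs, hys, hd.eventually_const_lt (dist_pos.2 hxyZ)] with n h1 h2 h3
        using hAB n ⟨h1, h2, h3⟩
    have hU : (ulim fun n => e n '' A n) ∪ (ulim fun n => e n '' B n) = β := by
      rw [← ulim_union, ← hblim]
      refine subset_antisymm (ulim_mono ?_) (ulim_mono ?_) <;>
        filter_upwards [hAB'] with n h <;> rw [← image_union, h.2.2.1]
    have hAβ : (ulim fun n => e n '' A n) ⊆ β := subset_union_left.trans hU.subset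
    have hBβ : (ulim fun n => e n '' B n) ⊆ β := subset_union_right.trans hU.subset
    have hAp : IsPreconnected (ulim fun n => e n '' A n) := isPreconnected_ulim <| by
      filter_upwards [hAB'] with n h using h.1.isPreconnected.image _ (he n).continuous.continuousOn
    have hBp : IsPreconnected (ulim fun n => e n '' B n) := isPreconnected_ulim <| by
      filter_upwards [hAB'] with n h using
        h.2.1.isPreconnected.image _ (he n).continuous.continuousOn
    have hxA : (x : Z) ∈ ulim fun n => e n '' A n := mem_ulim_of_tendsto
      (hAB'.mono fun n h => mem_image_of_mem _ h.1.left_mem) hxl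
    have hyA : (y : Z) ∈ ulim fun n => e n '' A n := mem_ulim_of_tendsto
      (hAB'.mono fun n h => mem_image_of_mem _ h.1.right_mem) hyl
    have hxB : (x : Z) ∈ ulim fun n => e n '' B n := mem_ulim_of_tendsto
      (hAB'.mono fun n h => mem_image_of_mem _ h.2.1.left_mem) hxl
    have hyB : (y : Z) ∈ ulim fun n => e n '' B n := mem_ulim_of_tendsto
      (hAB'.mono fun n h => mem_image_of_mem _ h.2.1.right_mem) hyl
    have hcl := fun (S : ∀ n, Set (Xs n)) =>
      isClosed_plusCopy (A := ulim fun n => e n '' S n) hX jp (isClosed_ulim _)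
    refine ⟨closure T ∩ plusCopy jp (ulim fun n => e n '' A n),
      closure T ∩ plusCopy jp (ulim fun n => e n '' B n), isClosed_closure.inter (hcl A),
      isClosed_closure.inter (hcl B),
      hT.isPreconnected_inter hM (hcl A) (hAp.plusCopy jp ((hAβ.trans hβB).trans hBsub)),
      hT.isPreconnected_inter hM (hcl B) (hBp.plusCopy jp ((hBβ.trans hβB).trans hBsub)), ?_, ?_⟩
    · rw [← inter_union_distrib_left, plusCopy_eq_image, plusCopy_eq_image, ← image_union,
        ← preimage_union, hU]
      rfl
    · refine subset_antisymm ?_ ?_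
      · rintro _ ⟨⟨hwT, w, hwA, rfl⟩, -, w', hwB, hww⟩
        obtain rfl : w' = w := hinj hww
        by_contra hw
        simp only [mem_insert_iff, mem_singleton_iff, not_or] at hw
        obtain ⟨C, hC, hCp, hxC, hyC, hwC⟩ :=
          hT.exists_connected_avoiding hM hxT hyT hw.1 hw.2
        have hwr : (w' : Z) ∈ r '' C := mem_of_mem_ulim_arcs hsurf hlen hfin he hno hb hAB' hxl hyl
          hwA hwB (hC.image hrc) (hCp.image _ hrc.continuousOn)
          (by rw [hXlim]; rintro _ ⟨d, -, rfl⟩; exact hrX d)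
          ⟨_, hxC, hrp x⟩ ⟨_, hyC, hrp y⟩
        obtain ⟨d, hdC, hdw⟩ := hwr
        rcases (hunion ▸ mem_univ d : d ∈ Xp ∪ Xm) with h | h
        · obtain ⟨v, hv⟩ := jp.surjective ⟨d, h⟩
          have hvd : (jp v : D) = d := by rw [hv]
          rw [← hvd, hrp] at hdw
          rw [Subtype.ext hdw] at hvd
          exact hwC (hvd ▸ hdC)
        · obtain ⟨v, hv⟩ := jm.surjective ⟨d, h⟩
          have hvd : (jm v : D) = d := by rw [hv]
          rw [← hvd, hrm] at hdw
          rw [Subtype.ext hdw, ← hjB w' (hβB (hAβ hwA))] at hvd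
          exact hwC (hvd ▸ hdC)
      · rintro _ (rfl | rfl)
        · exact ⟨⟨hxT, x, hxA, rfl⟩, hxT, x, hxB, rfl⟩
        · exact ⟨⟨hyT, y, hyA, rfl⟩, hyT, y, hyB, rfl⟩
  have hKT : closure T ∩ plusCopy jp β ⊆ T := hT.jordan_subset hK
    (hTb.mono fun d hd => ⟨hd.1, subset_closure hd.1, hd.2⟩)
  have hEq : T ∩ plusCopy jp β = closure T ∩ plusCopy jp β :=
    subset_antisymm (inter_subset_inter_left _ subset_closure) fun d hd => ⟨hKT hd, hd.2⟩
  rw [hEq]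
  exact hK

end LimitDouble

/-! ### Homotopy classes of short paths -/

theorem IsChart.homotopic {X : Type*} [MetricSpace X] {P : Set ℂ} (hP : Convex ℝ P)
    {φ : ℂ → X} (h : IsChart P φ) {x y : X} (p q : Path x y)
    (hp : ∀ t, p t ∈ φ '' (ball 0 1 ∩ P)) (hq : ∀ t, q t ∈ φ '' (ball 0 1 ∩ P)) :
    p.Homotopic q := by
  have hinv : ∀ z ∈ φ '' (ball 0 1 ∩ P), IsChart.inv P φ z ∈ ball (0 : ℂ) 1 ∩ P ∧
      φ (IsChart.inv P φ z) = z := by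
    rintro z ⟨w, hw, rfl⟩
    rw [h.inv_apply (ball_subset_closedBall hw.1) hw.2]
    exact ⟨hw, rfl⟩
  have hcont : ∀ r : Path x y, (∀ t, r t ∈ φ '' (ball 0 1 ∩ P)) →
      Continuous fun t => IsChart.inv P φ (r t) := by
    intro r hr
    refine continuous_iff_continuousAt.2 fun t => ?_
    obtain ⟨w, hw, hwt⟩ := hr t
    have h1 := h.continuousAt_inv hw.1 hw.2
    rw [hwt] at h1
    have h2 : IsChart.inv P φ (r t) = w := by
      rw [← hwt]; exact h.inv_apply (ball_subset_closedBall hw.1) hw.2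
    have h3 : ContinuousAt (IsChart.inv P φ) (r t) := by
      have h4 := h1.mono_right (nhdsWithin_le_nhds (s := P))
      rwa [← h2] at h4
    exact h3.comp r.continuous.continuousAt
  have hmem : ∀ z : I × I, (1 - (z.1 : ℝ)) • IsChart.inv P φ (p z.2) +
      (z.1 : ℝ) • IsChart.inv P φ (q z.2) ∈ ball (0 : ℂ) 1 ∩ P := by
    intro z
    refine ((convex_ball _ _).inter hP) (hinv _ (hp _)).1 (hinv _ (hq _)).1 ?_ z.1.2.1 (by ring)
    linarith [z.1.2.2]
  have hHc : Continuous fun z : I × I => φ ((1 - (z.1 : ℝ)) • IsChart.inv P φ (p z.2) +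
      (z.1 : ℝ) • IsChart.inv P φ (q z.2)) := by
    refine h.1.comp_continuous ?_ fun z => ⟨ball_subset_closedBall (hmem z).1, (hmem z).2⟩
    have h1 := (hcont p hp).comp (continuous_snd (X := I) (Y := I))
    have h2 := (hcont q hq).comp (continuous_snd (X := I) (Y := I))
    have h3 : Continuous fun z : I × I => (z.1 : ℝ) := continuous_subtype_val.comp continuous_fst
    exact ((continuous_const.sub h3).smul h1).add (h3.smul h2)
  refine ⟨⟨⟨⟨_, hHc⟩, fun t => ?_, fun t => ?_⟩, ?_⟩⟩
  · simp [(hinv _ (hp t)).2]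
  · simp [(hinv _ (hq t)).2]
  · intro s t ht
    rcases ht with rfl | rfl
    · have h2 := (hinv _ (hp 0)).2
      simp only [Path.source] at h2
      simp [← add_mul, h2]
    · have h2 := (hinv _ (hp 1)).2
      simp only [Path.target] at h2
      simp [← add_mul, h2]

theorem convex_upperHP : Convex ℝ upperHP := by
  intro x hx y hy a b ha hb _
  have hx' : 0 ≤ x.im := hx
  have hy' : 0 ≤ y.im := hy
  change 0 ≤ (a • x + b • y).im
  simp only [Complex.add_im, Complex.smul_im, smul_eq_mul]
  positivity

theorem IsSurface.exists_forall_homotopic {X : Type*} [MetricSpace X] [CompactSpace X]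
    (hX : IsSurface X) : ∃ δ > 0, ∀ (x y : X) (p q : Path x y), (∀ t, dist (p t) x < δ) →
      (∀ t, dist (q t) x < δ) → p.Homotopic q := by
  have key : ∀ z : X, ∃ U : Set X, IsOpen U ∧ z ∈ U ∧ ∀ (x y : X) (p q : Path x y),
      (∀ t, p t ∈ U) → (∀ t, q t ∈ U) → p.Homotopic q := by
    intro z
    rcases hX.exists_isChart z univ_mem with ⟨φ, hφ, hz, -⟩ | ⟨φ, hφ, hz, -⟩
    · exact ⟨φ '' (ball 0 1 ∩ univ), hφ.2.2 _ isOpen_ball Subset.rfl, ⟨0, by simp, hz⟩,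
        fun x y p q => hφ.homotopic convex_univ p q⟩
    · exact ⟨φ '' (ball 0 1 ∩ upperHP), hφ.2.2 _ isOpen_ball Subset.rfl,
        ⟨0, by simp [upperHP], hz⟩, fun x y p q => hφ.homotopic convex_upperHP p q⟩
  choose U hUo hzU hU using key
  obtain ⟨δ, hδ, h⟩ := lebesgue_number_lemma_of_metric (isCompact_univ (X := X)) hUo
    fun z _ => mem_iUnion.2 ⟨z, hzU z⟩
  refine ⟨δ, hδ, fun x y p q hp hq => ?_⟩
  obtain ⟨z, hz⟩ := h x (mem_univ _)
  exact hU z x y p q (fun t => hz (hp t)) fun t => hz (hq t)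

theorem IsLengthSpace.exists_geodesicPath {X : Type*} [MetricSpace X] [CompactSpace X]
    (hX : IsLengthSpace X) (x y : X) :
    ∃ p : Path x y, ∀ s t : I, dist (p s) (p t) = dist x y * dist s t := by
  obtain ⟨g, h0, h1, h⟩ := hX.exists_geodesic x y
  have hmem : ∀ t : I, dist x y * t ∈ Icc 0 (dist x y) := fun t =>
    ⟨mul_nonneg dist_nonneg t.2.1, mul_le_of_le_one_right dist_nonneg t.2.2⟩
  have hd : ∀ s t : I, dist (g (dist x y * s)) (g (dist x y * t)) = dist x y * dist s t := by
    intro s t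
    rw [h _ (hmem s) _ (hmem t), Real.dist_eq, ← mul_sub, abs_mul, abs_of_nonneg dist_nonneg]
    rfl
  have hL : LipschitzWith (nndist x y) fun t : I => g (dist x y * t) :=
    LipschitzWith.of_dist_le_mul fun s t => (hd s t).le
  exact ⟨⟨⟨_, hL.continuous⟩, by simp [h0], by simp [h1]⟩, hd⟩

theorem Path.exists_forall_dist_subpath_lt {X : Type*} [MetricSpace X] {x y : X} (p : Path x y)
    {ε : ℝ} (hε : 0 < ε) :
    ∃ η > 0, ∀ s t : I, dist s t < η → ∀ u, dist (p.subpath s t u) (p s) < ε := by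
  obtain ⟨η, hη, h⟩ := Metric.uniformContinuous_iff.1
    (CompactSpace.uniformContinuous_of_continuous p.continuous) ε hε
  refine ⟨η, hη, fun s t hst u => h ?_⟩
  refine lt_of_le_of_lt ?_ hst
  rw [Subtype.dist_eq, Subtype.dist_eq, Real.dist_eq, Real.dist_eq]
  have h1 : ((Set.Icc.convexComb s t u : I) : ℝ) - s = u * (t - s) := by
    change (1 - (u : ℝ)) * s + u * t - s = _
    ring
  rw [h1, abs_mul, abs_of_nonneg u.2.1, abs_sub_comm (s : ℝ)]
  exact mul_le_of_le_one_left (abs_nonneg _) u.2.2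

theorem unitInterval.induction_of_dist_lt {P : I → I → Prop} {η : ℝ} (hη : 0 < η)
    (h : ∀ s t, dist s t < η → P s t) (htr : ∀ s t u, P s t → P t u → P s u) (s t : I) :
    P s t := by
  refine isPreconnected_univ.induction₂' P (fun s _ => ?_) (fun s t u _ _ _ => htr s t u)
    (mem_univ s) (mem_univ t)
  rw [nhdsWithin_univ]
  filter_upwards [ball_mem_nhds s hη] with t ht
  exact ⟨h _ _ (mem_ball'.1 ht), h _ _ ht⟩

/-- A choice of geodesics at whose scale `δ` paths with the same endpoints are homotopic. -/
structure GeodesicSystem (X : Type*) [MetricSpace X] where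
  /-- The scale. -/
  δ : ℝ
  pos : 0 < δ
  /-- The chosen geodesic. -/
  path : ∀ x y : X, Path x y
  dist_path : ∀ x y s t, dist (path x y s) (path x y t) = dist x y * dist s t
  homotopic : ∀ (x y : X) (p q : Path x y), (∀ t, dist (p t) x < δ) →
      (∀ t, dist (q t) x < δ) → p.Homotopic q

theorem IsLengthSpace.nonempty_geodesicSystem {X : Type*} [MetricSpace X] [CompactSpace X]
    (hX : IsLengthSpace X) (hs : IsSurface X) : Nonempty (GeodesicSystem X) := by
  obtain ⟨δ, hδ, h⟩ := hs.exists_forall_homotopic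
  choose g hg using hX.exists_geodesicPath
  exact ⟨⟨δ, hδ, g, hg, h⟩⟩

namespace GeodesicSystem

variable {X : Type*} [MetricSpace X] (S : GeodesicSystem X)

theorem dist_path_le (x y : X) (t : I) : dist (S.path x y t) x ≤ dist x y := by
  have h := S.dist_path x y t 0
  rw [Path.source] at h
  rw [h]
  refine mul_le_of_le_one_right dist_nonneg ?_
  rw [Subtype.dist_eq, Real.dist_eq]
  simpa [abs_of_nonneg t.2.1] using t.2.2

/-- The homotopy class of the chosen geodesic. -/
def cls (x y : X) : Path.Homotopic.Quotient x y := Path.Homotopic.Quotient.mk (S.path x y)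

theorem mk_eq_cls {x y : X} (p : Path x y) (hp : ∀ t, dist (p t) x < S.δ) :
    Path.Homotopic.Quotient.mk p = S.cls x y := by
  refine Path.Homotopic.Quotient.eq.2 (S.homotopic x y _ _ hp fun t => ?_)
  refine (S.dist_path_le x y t).trans_lt ?_
  have := hp 1
  rwa [Path.target, dist_comm] at this

theorem cls_trans {x y z : X} (h : dist x y + dist y z < S.δ) :
    (S.cls x y).trans (S.cls y z) = S.cls x z := by
  refine (Path.Homotopic.Quotient.mk_trans _ _).symm.trans (S.mk_eq_cls _ fun t => ?_)
  rw [Path.trans_apply]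
  split_ifs with ht
  · exact (S.dist_path_le _ _ _).trans_lt (by linarith [dist_nonneg (x := y) (y := z)])
  · refine (dist_triangle _ y _).trans_lt ?_
    rw [dist_comm y x]
    linarith [S.dist_path_le y z ⟨2 * (t : ℝ) - 1,
      unitInterval.two_mul_sub_one_mem_iff.2 ⟨(not_le.1 ht).le, t.2.2⟩⟩]

theorem cls_self (x : X) : S.cls x x = Path.Homotopic.Quotient.refl x := by
  rw [← S.mk_eq_cls (Path.refl x) fun t => by simpa using S.pos]
  rfl

theorem cls_symm {x y : X} (h : dist x y + dist x y < S.δ) :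
    (S.cls x y).trans (S.cls y x) = Path.Homotopic.Quotient.refl x := by
  rw [S.cls_trans (by rwa [dist_comm y x]), cls_self]

theorem mk_subpath_trans {x y : X} (p : Path x y) (s t u : I) :
    (Path.Homotopic.Quotient.mk (p.subpath s t)).trans (Path.Homotopic.Quotient.mk (p.subpath t u))
      = Path.Homotopic.Quotient.mk (p.subpath s u) :=
  Path.Homotopic.Quotient.eq.2 ⟨Path.Homotopy.subpathTransSubpath p s t u⟩

/-- Uniformly close paths are homotopic up to short geodesics at the ends. -/
theorem mk_trans_cls {x y x' y' : X} (p : Path x y) (q : Path x' y') {ε : ℝ}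
    (hε : 3 * ε ≤ S.δ) (h : ∀ t, dist (p t) (q t) < ε) :
    (Path.Homotopic.Quotient.mk p).trans (S.cls y y') =
      (S.cls x x').trans (Path.Homotopic.Quotient.mk q) := by
  have hε0 : 0 < ε := dist_nonneg.trans_lt (h 0)
  obtain ⟨η₁, hη₁, h₁⟩ := p.exists_forall_dist_subpath_lt hε0
  obtain ⟨η₂, hη₂, h₂⟩ := q.exists_forall_dist_subpath_lt hε0
  have key := unitInterval.induction_of_dist_lt
    (P := fun s t => (Path.Homotopic.Quotient.mk (p.subpath s t)).trans (S.cls (p t) (q t)) =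
      (S.cls (p s) (q s)).trans (Path.Homotopic.Quotient.mk (q.subpath s t)))
    (lt_min hη₁ hη₂) ?_ ?_ 0 1
  · rw [Path.subpath_zero_one, Path.subpath_zero_one] at key
    have e : ∀ {a b a' b' : X} (r : Path x y) (r' : Path x' y') (ha : a = x) (hb : b = y)
        (ha' : a' = x') (hb' : b' = y'),
        (Path.Homotopic.Quotient.mk (r.cast ha hb)).trans (S.cls b b') =
          (S.cls a a').trans (Path.Homotopic.Quotient.mk (r'.cast ha' hb')) →
        (Path.Homotopic.Quotient.mk r).trans (S.cls y y') =
          (S.cls x x').trans (Path.Homotopic.Quotient.mk r') := by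
      rintro a b a' b' r r' rfl rfl rfl rfl h
      exact h
    exact e p q _ _ _ _ key
  · intro s t hst
    have a₁ := h₁ s t (hst.trans_le (min_le_left _ _))
    have a₂ := h₂ s t (hst.trans_le (min_le_right _ _))
    have b₁ := a₁ 1
    have b₂ := a₂ 1
    rw [Path.target, dist_comm] at b₁ b₂
    rw [S.mk_eq_cls _ fun u => (a₁ u).trans_le (by linarith),
      S.mk_eq_cls _ fun u => (a₂ u).trans_le (by linarith), S.cls_trans, S.cls_trans]
    · linarith [h s]
    · linarith [h t]
  · intro s t u h1 h2
    rw [← mk_subpath_trans p s t u, ← mk_subpath_trans q s t u,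
      Path.Homotopic.Quotient.trans_assoc, h2, ← Path.Homotopic.Quotient.trans_assoc, h1,
      Path.Homotopic.Quotient.trans_assoc]

end GeodesicSystem

/-! ### The rank of the first homology -/

theorem IsArc.exists_path {M : Type*} [MetricSpace M] {S : Set M} {p q : M} (h : IsArc S p q) :
    ∃ γ : Path p q, ∀ t, γ t ∈ S := by
  obtain ⟨f, fc, -, rfl, rfl, rfl⟩ := h
  exact ⟨⟨⟨fun t : I => f t, fc.comp_continuous continuous_subtype_val fun t => t.2⟩,
    by simp, by simp⟩, fun t => ⟨t, t.2, rfl⟩⟩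

theorem GeodesicSystem.fundamentalGroup_fg {X : Type*} [MetricSpace X] [CompactSpace X]
    (S : GeodesicSystem X) (a : X) : Group.FG (FundamentalGroup X a) := by
  have hε : 0 < S.δ / 3 := by linarith [S.pos]
  obtain ⟨V₀, -, hV₀, hcov₀⟩ := (isCompact_univ (X := X)).finite_cover_balls hε
  set V := insert a V₀
  have hV : V.Finite := hV₀.insert a
  have hcov : ∀ x : X, ∃ v ∈ V, dist v x < S.δ / 3 := by
    intro x
    obtain ⟨v, hv, hx⟩ := mem_iUnion₂.1 (hcov₀ (mem_univ x))
    exact ⟨v, mem_insert_of_mem _ hv, mem_ball'.1 hx⟩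
  let G : ∀ {x y : X} (v w : X) (q : Path.Homotopic.Quotient x y), FundamentalGroup X a :=
    fun {x y} v w q => ((S.cls a v).trans ((S.cls v x).trans (q.trans ((S.cls y w).trans
      (S.cls a w).symm))) : Path.Homotopic.Quotient a a)
  let E : X × X → FundamentalGroup X a := fun p =>
    ((S.cls a p.1).trans ((S.cls p.1 p.2).trans (S.cls a p.2).symm) :
      Path.Homotopic.Quotient a a)
  set H := Subgroup.closure (E '' (V ×ˢ V))
  have key : ∀ {x y : X} (p : Path x y), ∀ v ∈ V, ∀ w ∈ V, dist v x < S.δ / 3 →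
      dist w y < S.δ / 3 → G v w (Path.Homotopic.Quotient.mk p) ∈ H := by
    intro x y p
    obtain ⟨η, hη, h⟩ := p.exists_forall_dist_subpath_lt hε
    have := unitInterval.induction_of_dist_lt (P := fun s t => ∀ v ∈ V, ∀ w ∈ V,
      dist v (p s) < S.δ / 3 → dist w (p t) < S.δ / 3 →
        G v w (Path.Homotopic.Quotient.mk (p.subpath s t)) ∈ H) hη ?_ ?_ 0 1
    · rw [Path.subpath_zero_one] at this
      have e : ∀ {x' y' : X} (r : Path x y) (hx : x' = x) (hy : y' = y) (v w : X),
          G v w (Path.Homotopic.Quotient.mk (r.cast hx hy)) =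
            G v w (Path.Homotopic.Quotient.mk r) := by
        rintro x' y' r rfl rfl v w; rfl
      intro v hv w hw hvx hwy
      have h1 := this v hv w hw (by rwa [p.source]) (by rwa [p.target])
      rwa [e] at h1
    · intro s t hst v hv w hw hvs hwt
      refine Subgroup.subset_closure ⟨(v, w), ⟨hv, hw⟩, ?_⟩
      have h1 := h s t hst
      have h2 := h1 1
      rw [Path.target, dist_comm] at h2
      rw [dist_comm] at hwt
      have h3 : (S.cls v (p s)).trans ((S.cls (p s) (p t)).trans (S.cls (p t) w)) = S.cls v w := by
        rw [S.cls_trans (by linarith), S.cls_trans]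
        linarith [dist_triangle (p s) (p t) w]
      change (S.cls a v).trans ((S.cls v w).trans (S.cls a w).symm) = _
      simp only [G]
      rw [S.mk_eq_cls _ fun u => (h1 u).trans (by linarith), ← h3,
        Path.Homotopic.Quotient.trans_assoc, Path.Homotopic.Quotient.trans_assoc]
    · intro s t u h1 h2 v hv w hw hvs hwu
      obtain ⟨k, hk, hkt⟩ := hcov (p t)
      have h3 := H.mul_mem (h2 k hk w hw hkt hwu) (h1 v hv k hk hvs hkt)
      convert h3 using 1
      rw [FundamentalGroup.mul_def]
      have h4 : (S.cls (p t) k).trans (S.cls k (p t)) = Path.Homotopic.Quotient.refl (p t) :=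
        S.cls_symm (by rw [dist_comm]; linarith)
      simp only [G]
      rw [← GeodesicSystem.mk_subpath_trans p s t u]
      simp only [Path.Homotopic.Quotient.trans_assoc]
      rw [← Path.Homotopic.Quotient.trans_assoc (S.cls a k).symm, Path.Homotopic.Quotient.symm_trans,
        Path.Homotopic.Quotient.refl_trans, ← Path.Homotopic.Quotient.trans_assoc (S.cls (p t) k),
        h4, Path.Homotopic.Quotient.refl_trans]
  refine Group.fg_iff.2 ⟨E '' (V ×ˢ V), ?_, (hV.prod hV).image E⟩
  refine eq_top_iff.2 fun g _ => ?_
  induction g using Path.Homotopic.Quotient.ind with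
  | mk p =>
    have h1 := key p a (mem_insert a _) a (mem_insert a _) (by simpa using S.pos)
      (by simpa using S.pos)
    simp only [G, S.cls_self] at h1
    convert h1 using 1
    rw [Path.Homotopic.Quotient.refl_trans, Path.Homotopic.Quotient.refl_trans,
      Path.Homotopic.Quotient.trans_symm]
    exact (Path.Homotopic.Quotient.trans_refl _).symm

theorem exists_winding {X : Type*} [TopologicalSpace X] {u : X → Circle} (hu : Continuous u)
    (a : X) : ∃ w : FundamentalGroup X a →* Multiplicative ℝ, ∀ (p : Path a a) (θ : I → ℝ),
      Continuous θ → (∀ t, u (p t) = Circle.exp (θ t)) →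
      (w (Path.Homotopic.Quotient.mk p)).toAdd = θ 1 - θ 0 := by
  have hex : ∀ p : Path a a, ∃ θ : I → ℝ, Continuous θ ∧ ∀ t, u (p t) = Circle.exp (θ t) := by
    intro p
    obtain ⟨e, he⟩ := Circle.exists_exp_eq (u (p 0))
    obtain ⟨Γ, h1, -⟩ := Circle.isCoveringMap_exp.exists_path_lifts
      ⟨fun t => u (p t), hu.comp p.continuous⟩ e he
    exact ⟨Γ, Γ.continuous, fun t => (congrFun h1 t).symm⟩
  choose Θ hΘc hΘ using hex
  have huniq : ∀ (f g : I → ℝ), Continuous f → Continuous g →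
      (∀ t, Circle.exp (f t) = Circle.exp (g t)) → f 1 - f 0 = g 1 - g 0 := by
    intro f g hf hg h
    obtain ⟨k, hk⟩ := isPreconnected_univ.exists_lift_sub_eq hf.continuousOn hg.continuousOn
      fun t _ => h t
    rw [hk 1 trivial, hk 0 trivial]
    ring
  have hhom : ∀ p q : Path a a, p.Homotopic q → Θ p 1 - Θ p 0 = Θ q 1 - Θ q 0 := by
    rintro p q ⟨F⟩
    obtain ⟨G, hG, -⟩ := Circle.exists_lift_homotopy
      ⟨fun z : I × I => u (F z), hu.comp F.continuous⟩ ⟨Θ p, hΘc p⟩ fun t => by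
        simpa using hΘ p t
    have hG' : ∀ z, u (F z) = Circle.exp (G z) := hG
    have e0 := huniq (Θ p) (fun t => G (0, t)) (hΘc p) (by fun_prop) fun t => by
      rw [← hΘ, ← hG']; simp
    have e1 := huniq (Θ q) (fun t => G (1, t)) (hΘc q) (by fun_prop) fun t => by
      rw [← hΘ, ← hG']; simp
    have e2 := huniq (fun s => G (s, 0)) (fun _ => Θ p 0) (by fun_prop) continuous_const fun s => by
      rw [← hΘ, ← hG']; simp
    have e3 := huniq (fun s => G (s, 1)) (fun _ => Θ p 0) (by fun_prop) continuous_const fun s => by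
      rw [← hΘ, ← hG']; simp
    linarith
  let W : Path.Homotopic.Quotient a a → ℝ := Quotient.lift (fun p => Θ p 1 - Θ p 0) hhom
  have hW : ∀ (p : Path a a) (θ : I → ℝ), Continuous θ → (∀ t, u (p t) = Circle.exp (θ t)) →
      W (Path.Homotopic.Quotient.mk p) = θ 1 - θ 0 := fun p θ hθ h =>
    huniq _ _ (hΘc p) hθ fun t => by rw [← hΘ, h]
  have hmul : ∀ p q : Path.Homotopic.Quotient a a, W (p.trans q) = W p + W q := by
    intro p q
    induction p using Path.Homotopic.Quotient.ind with
    | mk p =>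
    induction q using Path.Homotopic.Quotient.ind with
    | mk q =>
    rw [← Path.Homotopic.Quotient.mk_trans]
    set θ := Θ (p.trans q)
    have hθ : Continuous θ := hΘc _
    have hl : Continuous fun t : I => (⟨(t : ℝ) / 2, by
        constructor <;> linarith [t.2.1, t.2.2]⟩ : I) := by
      refine Continuous.subtype_mk (by fun_prop) _
    have hr : Continuous fun t : I => (⟨((t : ℝ) + 1) / 2, by
        constructor <;> linarith [t.2.1, t.2.2]⟩ : I) := by
      refine Continuous.subtype_mk (by fun_prop) _
    rw [hW (p.trans q) θ hθ fun t => hΘ _ t,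
      hW p _ (hθ.comp hl) fun t => ?_, hW q _ (hθ.comp hr) fun t => ?_]
    · have e1 : (⟨((1 : I) : ℝ) / 2, by norm_num⟩ : I) = ⟨(((0 : I) : ℝ) + 1) / 2, by norm_num⟩ := by
        ext; simp
      have e2 : (⟨((0 : I) : ℝ) / 2, by norm_num⟩ : I) = 0 := by ext; simp
      have e3 : (⟨(((1 : I) : ℝ) + 1) / 2, by norm_num⟩ : I) = 1 := by ext; simp
      simp only [Function.comp_apply, e1, e2, e3]
      ring
    · rw [Function.comp_apply, ← hΘ, Path.trans_apply]
      rcases eq_or_lt_of_le t.2.1 with h0 | h0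
      · split_ifs with h
        · obtain rfl : t = 0 := Subtype.ext h0.symm
          rw [q.source]
          refine congrArg u (Eq.trans p.target.symm (congrArg p ?_))
          ext; simp
        · exact absurd (show (((⟨((t : ℝ) + 1) / 2, _⟩ : I) : ℝ)) ≤ 1 / 2 by
            simp [← h0]) h
      · split_ifs with h
        · have h' : ((t : ℝ) + 1) / 2 ≤ 1 / 2 := h
          linarith
        · congr 2; ext; simp only; ring
    · rw [Function.comp_apply, ← hΘ, Path.trans_apply]
      split_ifs with h
      · congr 2; ext; simp only; ring
      · exact absurd (show ((t : ℝ) / 2) ≤ 1 / 2 by linarith [t.2.2]) h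
  refine ⟨MonoidHom.mk' (fun g => Multiplicative.ofAdd (W g)) fun p q => ?_, hW⟩
  rw [FundamentalGroup.mul_def, hmul, add_comm]
  rfl

theorem IsOddArc.exists_winding_ne_zero {X : Type*} [MetricSpace X] [CompactSpace X]
    {K : Set X} (hK : IsOddArc K) (hJ : IsJordanCurve (surfaceBoundary X)) :
    ∃ (a : X) (w : FundamentalGroup X a →* Multiplicative ℝ) (g : FundamentalGroup X a),
      (w g).toAdd ≠ 0 := by
  obtain ⟨a, a', u, v, hKa, hKB, hu, hv, huv, hu1, hva, hva'⟩ := hK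
  have haB : a ∈ surfaceBoundary X := (hKB.symm.subset (by simp : a ∈ ({a, a'} : Set X))).2
  have ha'B : a' ∈ surfaceBoundary X := (hKB.symm.subset (by simp : a' ∈ ({a, a'} : Set X))).2
  obtain ⟨A, A', hA, -, hAB, -⟩ := hJ.split ha'B haB hKa.ne.symm
  have hAB' : A ⊆ surfaceBoundary X := subset_union_left.trans hAB.subset
  obtain ⟨p, hp⟩ := hKa.exists_path
  obtain ⟨q, hq⟩ := hA.exists_path
  obtain ⟨w, hw⟩ := exists_winding hu a
  obtain ⟨e, he⟩ := Circle.exists_exp_eq (u (p.trans q 0))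
  obtain ⟨θ, h1, -⟩ := Circle.isCoveringMap_exp.exists_path_lifts
    ⟨fun t => u (p.trans q t), hu.comp (p.trans q).continuous⟩ e he
  have hθ : ∀ t, u (p.trans q t) = Circle.exp (θ t) := fun t => (congrFun h1 t).symm
  refine ⟨a, w, Path.Homotopic.Quotient.mk (p.trans q), ?_⟩
  rw [hw _ θ θ.continuous hθ]
  intro h0
  have hh : (1 / 2 : ℝ) ∈ I := by norm_num
  set m : I := ⟨1 / 2, hh⟩
  have hm : p.trans q m = a' := by
    rw [Path.trans_apply, dif_pos le_rfl]
    have : (⟨2 * ((m : I) : ℝ), (unitInterval.mul_pos_mem_iff zero_lt_two).2 ⟨m.2.1, le_rfl⟩⟩ : I)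
        = 1 := by ext; simp [m]
    exact (congrArg p this).trans p.target
  have hL : θ m = θ 0 := by
    obtain ⟨k, hk⟩ := (isPreconnected_Icc (a := (0 : I)) (b := m)).exists_lift_sub_eq
      θ.continuous.continuousOn (continuousOn_const (c := (0 : ℝ))) fun t ht => by
        rw [← hθ, Path.trans_apply, dif_pos (show (t : ℝ) ≤ 1 / 2 from ht.2), hu1 _ (hp _)]
        simp
    rw [hk m (by simp [m]), hk 0 (by simp [m])]
  have hB : ∀ t ∈ Icc m 1, p.trans q t ∈ surfaceBoundary X := by
    intro t ht
    rcases eq_or_lt_of_le ht.1 with h | h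
    · rw [← h, hm]; exact ha'B
    · have h' : ¬ (t : ℝ) ≤ 1 / 2 := not_le.2 (show (1 / 2 : ℝ) < t from h)
      rw [Path.trans_apply, dif_neg h']
      exact hAB' (hq _)
  have hsq : ∀ t ∈ Icc m 1, v (p.trans q t) ^ 2 = Circle.exp (θ t / 2) ^ 2 := by
    intro t ht
    rw [huv _ (hB t ht), hθ, sq, ← Circle.exp_add]
    congr 1; ring
  have hend : Circle.exp (θ m / 2) = Circle.exp (θ 1 / 2) := by
    rw [hL, sub_eq_zero.1 h0]
  have hm1 : m ∈ Icc m 1 := ⟨le_rfl, m.2.2⟩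
  have h11 : (1 : I) ∈ Icc m 1 := ⟨m.2.2, le_rfl⟩
  have hne : (1 : Circle) ≠ -1 := fun h => by
    have := congrArg (Subtype.val : Circle → ℂ) h
    norm_num [Complex.ext_iff] at this
  have hvv : v a = v a' := by
    rcases isPreconnected_Icc.circle_eq_or_eq_neg
      (hv.comp (p.trans q).continuous.continuousOn hB)
      (g := fun t => Circle.exp (θ t / 2)) (by fun_prop) hsq with h | h
    · have e1 := h m hm1
      have e2 := h 1 h11
      simp only [Function.comp_apply, hm, Path.target] at e1 e2
      rw [e1, e2, hend]
    · have e1 := h m hm1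
      have e2 := h 1 h11
      simp only [Function.comp_apply, hm, Path.target] at e1 e2
      rw [e1, e2, hend]
  rw [hva, hva'] at hvv
  exact hne hvv

theorem h1Rank_pos {X : Type*} [TopologicalSpace X] [PathConnectedSpace X]
    (hfg : ∀ a : X, Group.FG (FundamentalGroup X a)) {a : X}
    {w : FundamentalGroup X a →* Multiplicative ℝ} {g : FundamentalGroup X a}
    (hg : (w g).toAdd ≠ 0) : 0 < h1Rank X := by
  set R : X → ℕ := fun x =>
    (Module.rank ℤ (Additive (Abelianization (FundamentalGroup X x)))).toNat
  have hR : ∀ x, R x = R a := by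
    intro x
    have e := (FundamentalGroup.fundamentalGroupMulEquivOfPathConnected x a).abelianizationCongr
    have e' : Additive (Abelianization (FundamentalGroup X x)) ≃ₗ[ℤ]
        Additive (Abelianization (FundamentalGroup X a)) := e.toAdditive.toIntLinearEquiv
    simp only [R, e'.rank_eq]
  have h1 : R a ≠ 0 := by
    have := hfg a
    have : Group.FG (Abelianization (FundamentalGroup X a)) :=
      Group.fg_of_surjective (f := Abelianization.of) (QuotientGroup.mk_surjective)
    have : Module.Finite ℤ (Additive (Abelianization (FundamentalGroup X a))) :=
      Module.Finite.iff_addGroup_fg.2 (GroupFG.iff_add_fg.1 this)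
    simp only [R]
    rw [Ne, Cardinal.toNat_eq_zero, not_or]
    refine ⟨fun h => ?_, not_le.2 (Module.rank_lt_aleph0 _ _)⟩
    obtain ⟨n, hn, hng⟩ := rank_eq_zero_iff.1 h (Additive.ofMul (Abelianization.of g))
    have h2 : (Abelianization.of g) ^ n = 1 := hng
    have h3 := congrArg (Abelianization.lift w) h2
    rw [map_zpow, Abelianization.lift_apply_of, map_one] at h3
    have h4 := congrArg Multiplicative.toAdd h3
    rw [toAdd_zpow, toAdd_one, zsmul_eq_mul] at h4
    rcases mul_eq_zero.1 h4 with h5 | h5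
    · exact hn (by exact_mod_cast h5)
    · exact hg h5
  have h2 : h1Rank X = R a := by
    have : Nonempty X := ⟨a⟩
    change ⨆ x, R x = _
    simp only [hR, ciSup_const]
  rw [h2]
  exact Nat.pos_of_ne_zero h1

theorem exists_not_homotopic_refl_of_h1Rank_pos {X : Type*} [TopologicalSpace X]
    (h : 0 < h1Rank X) : ∃ (a : X) (p : Path a a), ¬ p.Homotopic (Path.refl a) := by
  by_contra! hall
  refine h.ne' ?_
  have key : ∀ a : X,
      (Module.rank ℤ (Additive (Abelianization (FundamentalGroup X a)))).toNat = 0 := by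
    intro a
    rw [Cardinal.toNat_eq_zero]
    left
    refine rank_eq_zero_iff.2 fun x => ⟨1, one_ne_zero, ?_⟩
    obtain ⟨g, hg⟩ := QuotientGroup.mk_surjective x.toMul
    have : g = 1 := by
      induction g using Path.Homotopic.Quotient.ind with
      | mk p => exact Path.Homotopic.Quotient.eq.2 (hall a p)
    subst this
    rw [one_smul]
    exact hg.symm
  rw [h1Rank]
  simp only [key]
  rcases isEmpty_or_nonempty X with h | h
  · simp
  · exact ciSup_const

/-! ### Shortest essential loops -/

section NullPath

variable {X : Type*} [TopologicalSpace X] {x y z x' y' : X}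

/-- A path which is a contractible loop. -/
def IsNullPath (p : Path x y) : Prop :=
  ∃ h : x = y, (p.cast rfl h).Homotopic (Path.refl x)

theorem isNullPath_iff {p : Path x x} : IsNullPath p ↔ p.Homotopic (Path.refl x) :=
  ⟨fun ⟨_, h⟩ => h, fun h => ⟨rfl, h⟩⟩

theorem IsNullPath.congr {p : Path x y} (hp : IsNullPath p) {q : Path x' y'}
    (h : ∀ t, p t = q t) : IsNullPath q := by
  obtain rfl : x = x' := by simpa using h 0
  obtain rfl : y = y' := by simpa using h 1
  obtain rfl : p = q := Path.ext (funext h)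
  exact hp

theorem IsNullPath.trans {p : Path x y} {q : Path y z} {r : Path x z} (hp : IsNullPath p)
    (hq : IsNullPath q) (h : (p.trans q).Homotopic r) : IsNullPath r := by
  obtain ⟨rfl, hp⟩ := hp
  obtain ⟨rfl, hq⟩ := hq
  exact ⟨rfl, h.symm.trans ((hp.hcomp hq).trans ⟨Path.Homotopy.reflTrans _⟩)⟩

theorem IsNullPath.conj {r : Path y y'} (hr : IsNullPath r) {q : Path x x'} {m : Path x y}
    {m' : Path x' y'} (h : (q.trans m').Homotopic (m.trans r)) (hm : ∀ t, m t = m' t) :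
    IsNullPath q := by
  obtain rfl : x = x' := by simpa using hm 0
  obtain rfl : y = y' := by simpa using hm 1
  obtain rfl : m = m' := Path.ext (funext hm)
  refine isNullPath_iff.2 (Path.Homotopic.Quotient.eq.1 ?_)
  have h1 := Path.Homotopic.Quotient.eq.2 h
  have h2 := Path.Homotopic.Quotient.eq.2 (isNullPath_iff.1 hr)
  rw [Path.Homotopic.Quotient.mk_trans, Path.Homotopic.Quotient.mk_trans, h2,
    Path.Homotopic.Quotient.mk_refl, Path.Homotopic.Quotient.trans_refl] at h1
  have h3 := congrArg (fun c => c.trans (Path.Homotopic.Quotient.mk m).symm) h1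
  simpa only [Path.Homotopic.Quotient.trans_assoc, Path.Homotopic.Quotient.trans_symm,
    Path.Homotopic.Quotient.trans_refl, Path.Homotopic.Quotient.mk_refl] using h3

/-- The restriction of a function on the line to a segment. -/
def segPath {F : ℝ → X} (hF : Continuous F) (a b : ℝ) : Path (F a) (F b) where
  toFun t := F (a + t * (b - a))
  continuous_toFun := by fun_prop
  source' := by simp
  target' := by simp

theorem segPath_trans {F : ℝ → X} (hF : Continuous F) (a b c : ℝ) :
    ((segPath hF a b).trans (segPath hF b c)).Homotopic (segPath hF a c) := by
  have h : ((segPath continuous_id a b).trans (segPath continuous_id b c)).Homotopic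
      (segPath continuous_id a c) := SimplyConnectedSpace.paths_homotopic _ _
  have h1 := h.map ⟨F, hF⟩
  rw [Path.map_trans] at h1
  exact h1

theorem Path.map_homotopic_refl {C : Type*} [TopologicalSpace C] {f : C(C, X)}
    (hf : ∃ y, f.Homotopic (ContinuousMap.const C y)) {c : C} (p : Path c c) :
    (p.map f.continuous).Homotopic (Path.refl (f c)) := by
  obtain ⟨y, ⟨G⟩⟩ := hf
  exact isNullPath_iff.1 (IsNullPath.conj (isNullPath_iff.2 (Path.Homotopic.refl (Path.refl y)))
    (Path.Homotopic.map_trans_evalAt G p) fun t => rfl)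

end NullPath

theorem LipschitzWith.of_le {α Y : Type*} [LinearOrder α] [PseudoMetricSpace α] [MetricSpace Y]
    {f : α → Y} {L : NNReal} (h : ∀ a b, a ≤ b → dist (f a) (f b) ≤ L * dist a b) :
    LipschitzWith L f := by
  refine LipschitzWith.of_dist_le_mul fun a b => ?_
  rcases le_total a b with hab | hab
  · exact h a b hab
  · rw [dist_comm, dist_comm a]; exact h b a hab

section Lipschitz

variable {X : Type*} [MetricSpace X]

theorem LipschitzWith.pathTrans {x y z : X} {p : Path x y} {q : Path y z} {L : NNReal}
    (hp : LipschitzWith L p) (hq : LipschitzWith L q) : LipschitzWith (2 * L) (p.trans q) := by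
  have hL : (0 : ℝ) ≤ L := L.2
  have key : ∀ {u v : X} {r : Path u v}, LipschitzWith L r → ∀ s t : I, s ≤ t →
      dist (r s) (r t) ≤ L * (t - s) := by
    intro u v r hr s t hst
    refine (hr.dist_le_mul s t).trans_eq ?_
    rw [Subtype.dist_eq, dist_comm, Real.dist_eq, abs_of_nonneg
      (sub_nonneg.2 (show (s : ℝ) ≤ t from hst))]
  refine LipschitzWith.of_le fun s t hst => ?_
  have hst' : (s : ℝ) ≤ t := hst
  rw [Subtype.dist_eq s t, dist_comm (s : ℝ), Real.dist_eq, abs_of_nonneg (sub_nonneg.2 hst')]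
  rw [Path.trans_apply, Path.trans_apply]
  push_cast
  split_ifs with h1 h2 h2
  · refine (key hp _ _ (Subtype.mk_le_mk.2 (by linarith))).trans_eq ?_
    simp only; ring
  · refine (dist_triangle _ y _).trans ?_
    have e1 := key hp ⟨2 * (s : ℝ), unitInterval.mul_pos_mem_iff zero_lt_two |>.2 ⟨s.2.1, h1⟩⟩ 1
      unitInterval.le_one'
    have e2 := key hq 0 ⟨2 * (t : ℝ) - 1, unitInterval.two_mul_sub_one_mem_iff.2
      ⟨(not_le.1 h2).le, t.2.2⟩⟩ unitInterval.nonneg'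
    rw [Path.target] at e1
    rw [Path.source] at e2
    refine (add_le_add e1 e2).trans_eq ?_
    simp only [Icc.coe_one, Icc.coe_zero]; ring
  · exact absurd (hst'.trans h2) h1
  · refine (key hq _ _ (Subtype.mk_le_mk.2 (by linarith))).trans_eq ?_
    simp only; ring

theorem GeodesicSystem.exists_lipschitz_homotopic (S : GeodesicSystem X) {x y : X}
    (p : Path x y) : ∃ (q : Path x y) (L : NNReal), LipschitzWith L q ∧ p.Homotopic q := by
  obtain ⟨η, hη, h⟩ := p.exists_forall_dist_subpath_lt S.pos
  have := unitInterval.induction_of_dist_lt (P := fun s t => ∃ (q : Path (p s) (p t)) (L : NNReal),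
    LipschitzWith L q ∧ (p.subpath s t).Homotopic q) hη ?_ ?_ 0 1
  · rw [Path.subpath_zero_one] at this
    have e : ∀ {x' y' : X} (r : Path x y) (hx : x' = x) (hy : y' = y),
        (∃ (q : Path x' y') (L : NNReal), LipschitzWith L q ∧ (r.cast hx hy).Homotopic q) →
        ∃ (q : Path x y) (L : NNReal), LipschitzWith L q ∧ r.Homotopic q := by
      rintro x' y' r rfl rfl h
      exact h
    exact e p _ _ this
  · intro s t hst
    refine ⟨S.path (p s) (p t), nndist (p s) (p t), LipschitzWith.of_dist_le_mul fun a b =>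
      (S.dist_path _ _ a b).le, Path.Homotopic.Quotient.eq.1 (S.mk_eq_cls _ (h s t hst))⟩
  · rintro s t u ⟨q, L, hq, hqp⟩ ⟨q', L', hq', hqp'⟩
    refine ⟨q.trans q', 2 * max L L', (hq.weaken (le_max_left _ _)).pathTrans
      (hq'.weaken (le_max_right _ _)), ?_⟩
    exact Path.Homotopic.trans ⟨(Path.Homotopy.subpathTransSubpath p s t u).symm⟩ (hqp.hcomp hqp')

theorem LipschitzWith.exists_periodic {x : X} {p : Path x x} {L : NNReal}
    (hp : LipschitzWith L p) : ∃ F : ℝ → X, LipschitzWith L F ∧ Function.Periodic F 1 ∧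
      ∀ t : I, F t = p t := by
  have hfr : ∀ t : ℝ, Int.fract t ∈ I := fun t => ⟨Int.fract_nonneg t, (Int.fract_lt_one t).le⟩
  have hL : (0 : ℝ) ≤ L := L.2
  have hd : ∀ s t : I, s ≤ t → dist (p s) (p t) ≤ L * ((t : ℝ) - s) := by
    intro s t hst
    refine (hp.dist_le_mul s t).trans_eq ?_
    rw [Subtype.dist_eq, dist_comm, Real.dist_eq, abs_of_nonneg
      (sub_nonneg.2 (show (s : ℝ) ≤ t from hst))]
  refine ⟨fun t => p ⟨Int.fract t, hfr t⟩, LipschitzWith.of_le fun a b hab => ?_, fun t => ?_,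
    fun t => ?_⟩
  · rw [dist_comm a, Real.dist_eq, abs_of_nonneg (sub_nonneg.2 hab)]
    have ea := Int.floor_add_fract a
    have eb := Int.floor_add_fract b
    rcases (Int.floor_mono hab).eq_or_lt with h | h
    · rw [h] at ea
      refine (hd _ _ (Subtype.mk_le_mk.2 (by linarith))).trans_eq ?_
      simp only
      congr 1
      linarith
    · refine (dist_triangle _ x _).trans ?_
      have e1 := hd ⟨_, hfr a⟩ 1 unitInterval.le_one'
      have e2 := hd 0 ⟨_, hfr b⟩ unitInterval.nonneg'
      rw [Path.target] at e1
      rw [Path.source] at e2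
      refine (add_le_add e1 e2).trans ?_
      rw [← mul_add]
      refine mul_le_mul_of_nonneg_left ?_ hL
      have h' : ((⌊a⌋ + 1 : ℤ) : ℝ) ≤ ⌊b⌋ := by exact_mod_cast h
      push_cast at h'
      simp only [Icc.coe_one, Icc.coe_zero]
      linarith
  · simp
  · rcases eq_or_lt_of_le t.2.2 with h | h
    · obtain rfl : t = 1 := Subtype.ext h
      simp
    · exact congrArg p (Subtype.ext (Int.fract_eq_self.2 ⟨t.2.1, h⟩))

/-- There is an essential loop with Lipschitz constant `L`. -/
def HasEssentialLoop (X : Type*) [MetricSpace X] (L : NNReal) : Prop :=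
  ∃ (x : X) (p : Path x x), LipschitzWith L p ∧ ¬ p.Homotopic (Path.refl x)

theorem GeodesicSystem.hasEssentialLoop_sInf [CompactSpace X] (S : GeodesicSystem X) {L : NNReal}
    (hL : HasEssentialLoop X L) : HasEssentialLoop X (sInf {L | HasEssentialLoop X L}) := by
  set A : Set NNReal := {L | HasEssentialLoop X L}
  set L₀ := sInf A
  obtain ⟨l, -, hlim, hlA⟩ := exists_seq_tendsto_sInf (S := A) ⟨L, hL⟩ (OrderBot.bddBelow A)
  choose x p hp hpn using hlA
  choose f hf using fun t : I => exists_tendsto_hyperfilter fun n => p n t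
  have hlim' : Tendsto (fun n => (l n : ℝ)) (hyperfilter ℕ : Filter ℕ) (𝓝 (L₀ : ℝ)) :=
    (NNReal.tendsto_coe.2 hlim).mono_left hyperfilter_le_atTop
  have hfL : LipschitzWith L₀ f := by
    refine LipschitzWith.of_dist_le_mul fun s t => ?_
    exact le_of_tendsto_of_tendsto' ((hf s).dist (hf t)) (hlim'.mul_const _)
      fun n => (hp n).dist_le_mul s t
  have hf01 : f 1 = f 0 := by
    refine tendsto_nhds_unique (hf 1) ?_
    have h0 := hf 0
    simp only [Path.source] at h0
    simpa only [Path.target] using h0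
  let P : Path (f 0) (f 0) := ⟨⟨f, hfL.continuous⟩, rfl, hf01⟩
  refine ⟨f 0, P, hfL, fun hnull => ?_⟩
  set M : ℝ := L₀ + 1
  have hM : 0 < M := by have : (0 : ℝ) ≤ L₀ := L₀.2; positivity
  set ε := S.δ / 3
  have hε : 0 < ε := by have := S.pos; positivity
  have hr : 0 < ε / (3 * M) := by positivity
  obtain ⟨V, -, hV, hcov⟩ := (isCompact_univ (X := I)).finite_cover_balls hr
  have hev : ∀ᶠ n in (hyperfilter ℕ : Filter ℕ), ∀ v ∈ V, dist (p n v) (f v) < ε / 3 :=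
    (Filter.eventually_all_finite hV).2 fun v _ =>
      Metric.tendsto_nhds.1 (hf v) _ (by positivity)
  have hM' : ∀ᶠ n in (hyperfilter ℕ : Filter ℕ), (l n : ℝ) < M :=
    hlim'.eventually_lt_const (lt_add_one _)
  obtain ⟨n, hn, hnM⟩ := (hev.and hM').exists
  have hclose : ∀ t, dist (p n t) (P t) < ε := by
    intro t
    obtain ⟨v, hv, hvt⟩ := mem_iUnion₂.1 (hcov (mem_univ t))
    have hvt' : dist t v < ε / (3 * M) := hvt
    have e0 : M * dist t v < ε / 3 := by
      calc M * dist t v < M * (ε / (3 * M)) := mul_lt_mul_of_pos_left hvt' hM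
        _ = ε / 3 := by field_simp
    have e1 : dist (p n t) (p n v) ≤ M * dist t v := ((hp n).dist_le_mul t v).trans
      (mul_le_mul_of_nonneg_right hnM.le dist_nonneg)
    have e2 : dist (f v) (f t) ≤ M * dist t v := by
      rw [dist_comm t]
      exact (hfL.dist_le_mul v t).trans
        (mul_le_mul_of_nonneg_right (lt_add_one _).le dist_nonneg)
    have e3 := hn v hv
    change dist (p n t) (f t) < ε
    linarith [dist_triangle4 (p n t) (p n v) (f v) (f t)]
  have h1 := S.mk_trans_cls (p n) P (by simp only [ε]; linarith) hclose
  refine hpn n (isNullPath_iff.1 (IsNullPath.conj (isNullPath_iff.2 hnull)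
    (m := S.path (x n) (f 0)) (m' := S.path (x n) (f 0))
    (Path.Homotopic.Quotient.eq.1 h1) fun _ => rfl))

end Lipschitz

theorem GeodesicSystem.exists_isNonContractibleJordanCurve {X : Type*} [MetricSpace X]
    [CompactSpace X] (S : GeodesicSystem X) {a : X} {p₀ : Path a a}
    (hp₀ : ¬ p₀.Homotopic (Path.refl a)) : ∃ J : Set X, IsNonContractibleJordanCurve J := by
  have : Fact ((0 : ℝ) < 1) := ⟨one_pos⟩
  have := compactSpace_circle1
  obtain ⟨q, L, hqL, hq⟩ := S.exists_lipschitz_homotopic p₀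
  have hess : HasEssentialLoop X L := ⟨a, q, hqL, fun h => hp₀ (hq.trans h)⟩
  obtain ⟨x, p, hpL, hp⟩ := S.hasEssentialLoop_sInf hess
  set L₀ := sInf {L | HasEssentialLoop X L} with hL₀
  obtain ⟨F, hFL, hFp, hF⟩ := hpL.exists_periodic
  have hFc := hFL.continuous
  have hshort : ∀ s t, s < t → t - s < 1 → F s = F t → IsNullPath (segPath hFc s t) := by
    intro s t hst hst1 h
    by_contra hn
    have hL : LipschitzWith (L₀ * ⟨t - s, (sub_pos.2 hst).le⟩) ((segPath hFc s t).cast rfl h) := by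
      refine LipschitzWith.of_dist_le_mul fun u v => (hFL.dist_le_mul _ _).trans_eq ?_
      have e : |s + (u : ℝ) * (t - s) - (s + v * (t - s))| = (t - s) * |(u : ℝ) - v| := by
        rw [← abs_of_nonneg (sub_pos.2 hst).le, ← abs_mul, abs_of_nonneg (sub_pos.2 hst).le]
        congr 1
        ring
      change (L₀ : ℝ) * |_| = L₀ * (t - s) * |(u : ℝ) - v|
      rw [mul_assoc, ← e]
    have hle : L₀ ≤ L₀ * ⟨t - s, (sub_pos.2 hst).le⟩ :=
      csInf_le (OrderBot.bddBelow _) ⟨_, _, hL, fun h' => hn ⟨h, h'⟩⟩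
    have hle' : (L₀ : ℝ) ≤ L₀ * (t - s) := hle
    have h0 : (L₀ : ℝ) = 0 := by
      have : (0 : ℝ) ≤ L₀ := L₀.2
      nlinarith
    refine hp ?_
    have : p = Path.refl x := by
      ext u
      have := hpL.dist_le_mul u 0
      rw [h0, zero_mul, Path.source] at this
      exact dist_le_zero.1 this
    rw [this]
  have hinj : ∀ s t, 0 ≤ s → s < t → t < 1 → F s ≠ F t := by
    intro s t hs hst ht h
    have hper : F (s + 1) = F s := hFp s
    have h1 := hshort s t hst (by linarith) h
    have h2 := hshort t (s + 1) (by linarith) (by linarith) (by rw [hper, h])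
    have h3 := h1.trans h2 (segPath_trans hFc s t (s + 1))
    have h4 : IsNullPath (segPath hFc 0 1) := by
      refine h3.conj (m := segPath hFc 0 s) (m' := segPath hFc 1 (s + 1)) ?_ fun u => ?_
      · exact (segPath_trans hFc 0 1 (s + 1)).trans (segPath_trans hFc 0 s (s + 1)).symm
      · change F (0 + u * (s - 0)) = F (1 + u * (s + 1 - 1))
        rw [← hFp]
        congr 1
        ring
    refine hp (isNullPath_iff.1 (h4.congr fun u => ?_))
    change F (0 + u * (1 - 0)) = p u
    rw [← hF]
    congr 1
    ring
  let G : AddCircle (1 : ℝ) → X := hFp.lift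
  have hGF : ∀ t : ℝ, G t = F t := fun t => hFp.lift_coe t
  have hGc : Continuous G := continuous_coinduced_dom.2 hFc
  have hGi : Function.Injective G := by
    intro u v huv
    obtain ⟨s, hs, rfl⟩ := AddCircle.eq_coe_Ico u
    obtain ⟨t, ht, rfl⟩ := AddCircle.eq_coe_Ico v
    rw [hGF, hGF] at huv
    rcases lt_trichotomy s t with h | rfl | h
    · exact absurd huv (hinj s t hs.1 h ht.2)
    · rfl
    · exact absurd huv.symm (hinj t s ht.1 h hs.2)
  refine ⟨range G, isJordanCurve_iff.2 ⟨G, hGc, hGi, rfl⟩, fun f hf hfr hfn => hp ?_⟩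
  have hex : ∀ u, ∃ c, f c = G u := fun u => by
    have : G u ∈ range f := hfr ▸ mem_range_self u
    exact this
  choose h hh using hex
  have hhc : Continuous h := by
    rw [(f.continuous.isClosedEmbedding hf).isInducing.continuous_iff]
    exact hGc.congr fun u => (hh u).symm
  have h1 : ((1 : ℝ) : AddCircle (1 : ℝ)) = ((0 : ℝ) : AddCircle (1 : ℝ)) := by
    rw [AddCircle.coe_period, AddCircle.coe_zero]
  let l : Path (h ((0 : ℝ) : AddCircle (1 : ℝ))) (h ((0 : ℝ) : AddCircle (1 : ℝ))) :=
    ⟨⟨fun t : I => h ((t : ℝ) : AddCircle (1 : ℝ)),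
      hhc.comp ((AddCircle.continuous_mk' 1).comp continuous_subtype_val)⟩, by simp, congrArg h h1⟩
  have hl := Path.map_homotopic_refl hfn l
  refine isNullPath_iff.1 ((isNullPath_iff.2 hl).congr fun t => ?_)
  change f (h _) = p t
  rw [hh, hGF, hF]

theorem IsNonContractibleJordanCurve.image {X D : Type*} [MetricSpace X] [MetricSpace D]
    {i : X → D} {r : D → X} (hi : Continuous i) (hr : Continuous r) (hri : ∀ a, r (i a) = a)
    {J : Set X} (hJ : IsNonContractibleJordanCurve J) :
    IsNonContractibleJordanCurve (i '' J) := by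
  obtain ⟨hJ, hn⟩ := hJ
  obtain ⟨F, hF, hFi, hFr⟩ := isJordanCurve_iff.1 hJ
  have hii : Function.Injective i := Function.LeftInverse.injective hri
  refine ⟨isJordanCurve_iff.2 ⟨i ∘ F, hi.comp hF, hii.comp hFi, by rw [range_comp, hFr]⟩,
    fun f hf hfr ⟨y, hfy⟩ => hn ((⟨r, hr⟩ : C(D, X)).comp f) ?_ ?_ ⟨r y, ?_⟩⟩
  · intro u v huv
    have hu : f u ∈ i '' J := hfr ▸ mem_range_self u
    have hv : f v ∈ i '' J := hfr ▸ mem_range_self v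
    obtain ⟨b, -, hb⟩ := hu
    obtain ⟨c, -, hc⟩ := hv
    have h' : r (f u) = r (f v) := huv
    rw [← hb, ← hc, hri, hri] at h'
    exact hf (by rw [← hb, ← hc, h'])
  · change range (r ∘ f) = J
    rw [range_comp, hfr, image_image]
    simp [hri]
  · exact (ContinuousMap.Homotopic.refl (⟨r, hr⟩ : C(D, X))).comp hfy

section BoundaryCount

variable {X : Type*} [MetricSpace X]

theorem surfaceBoundary_nonempty_of_ncard_pos (h : 0 < (surfaceBoundaryComponents X).ncard) :
    (surfaceBoundary X).Nonempty := by
  obtain ⟨b, x, hx, -⟩ := nonempty_of_ncard_ne_zero h.ne'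
  exact ⟨x, hx⟩

theorem IsLengthSpace.exists_isOddArc_of_one_lt_ncard [CompactSpace X] (hlen : IsLengthSpace X)
    (h : 1 < (surfaceBoundaryComponents X).ncard) : ∃ K : Set X, IsOddArc K := by
  have hfin := finite_of_ncard_pos (one_pos.trans h)
  obtain ⟨b, hb, b', hb', hne⟩ := (one_lt_ncard hfin).1 h
  obtain ⟨x, hx, rfl⟩ := hb
  obtain ⟨y, hy, rfl⟩ := hb'
  obtain ⟨K, hK, -⟩ := exists_isOddArc_of_notMem hlen hfin ⟨x, hx, rfl⟩
    (mem_connectedComponentIn hx) (a' := y) ⟨hy, fun hyx => hne (connectedComponentIn_eq hyx)⟩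
  exact ⟨K, hK⟩

theorem isJordanCurve_surfaceBoundary [CompactSpace X] (hs : IsSurface X)
    (h : (surfaceBoundaryComponents X).ncard = 1) : IsJordanCurve (surfaceBoundary X) := by
  obtain ⟨b, hb⟩ := ncard_eq_one.1 h
  have hbm : b ∈ surfaceBoundaryComponents X := hb ▸ mem_singleton b
  have hbB : b = surfaceBoundary X := by
    refine (subset_surfaceBoundary_of_mem hbm).antisymm fun x hx => ?_
    have hx' : connectedComponentIn (surfaceBoundary X) x ∈ surfaceBoundaryComponents X :=
      ⟨x, hx, rfl⟩
    rw [hb, mem_singleton_iff] at hx'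
    exact hx' ▸ mem_connectedComponentIn hx
  have := IsCompactSurface.isJordanCurve_boundaryComponent hs
    (finite_of_ncard_pos (h ▸ one_pos)) hbm
  rwa [hbB] at this

theorem IsOddArc.h1Rank_pos [CompactSpace X] (hs : IsSurface X) (hlen : IsLengthSpace X)
    (h : (surfaceBoundaryComponents X).ncard = 1) {K : Set X} (hK : IsOddArc K) :
    0 < h1Rank X := by
  obtain ⟨S⟩ := hlen.nonempty_geodesicSystem hs
  obtain ⟨a, w, g, hg⟩ := hK.exists_winding_ne_zero (isJordanCurve_surfaceBoundary hs h)
  have : PathConnectedSpace X := ⟨⟨a⟩, fun x y => ⟨S.path x y⟩⟩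
  exact _root_.h1Rank_pos S.fundamentalGroup_fg hg

theorem exists_isNonContractibleJordanCurve_double [CompactSpace X] (hs : IsSurface X)
    (hlen : IsLengthSpace X) (h : 0 < h1Rank X) (hne : (surfaceBoundary X).Nonempty)
    {D : Type*} [MetricSpace D] {ip im : X → D}
    (hD : IsMetricDouble X (surfaceBoundary X) D ip im) :
    ∃ J : Set D, IsNonContractibleJordanCurve J := by
  obtain ⟨S⟩ := hlen.nonempty_geodesicSystem hs
  obtain ⟨a, p, hp⟩ := exists_not_homotopic_refl_of_h1Rank_pos h
  obtain ⟨J, hJ⟩ := S.exists_isNonContractibleJordanCurve hp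
  obtain ⟨r, hr, hrp, -⟩ := hD.exists_fold isClosed_surfaceBoundary hne
  exact ⟨_, hJ.image hD.isom_p.continuous hr hrp⟩

theorem h1Rank_eq_of_redConnNum_eq {Y : Type*} [MetricSpace Y]
    (hX : (surfaceBoundary X).Nonempty) (hY : (surfaceBoundary Y).Nonempty)
    (hn : (surfaceBoundaryComponents X).ncard = (surfaceBoundaryComponents Y).ncard)
    (h : redConnNum X = redConnNum Y) : h1Rank X = h1Rank Y := by
  have hX' := hX.ne_empty
  have hY' := hY.ne_empty
  simp only [redConnNum, connNum, hn, hX', hY', false_and, if_false, sub_left_inj] at h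
  have h' : h1Rank X + 1 = h1Rank Y + 1 := by exact_mod_cast h
  exact Nat.add_right_cancel h'

end BoundaryCount

theorem oddArcsLarge_of_regularDoubleSeq {c : ℤ} {q : ℕ} (hq : 0 < q)
    {Xs : ℕ → Type} [∀ n, MetricSpace (Xs n)] [∀ n, CompactSpace (Xs n)]
    (hsurf : ∀ n, IsSurface (Xs n)) (hlen : ∀ n, IsLengthSpace (Xs n))
    (hnb : ∀ n, (surfaceBoundaryComponents (Xs n)).ncard = q)
    (hrc : ∀ n, redConnNum (Xs n) = c)
    {D : ℕ → Type} [∀ n, MetricSpace (D n)] {ip im : ∀ n, Xs n → D n}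
    (hdouble : ∀ n, IsMetricDouble (Xs n) (surfaceBoundary (Xs n)) (D n) (ip n) (im n))
    (hreg : RegularDoubleSeq D) : OddArcsLarge Xs := by
  by_cases hex : ∃ (n : ℕ) (K : Set (Xs n)), IsOddArc K
  swap
  · exact ⟨1, one_pos, .of_forall fun n K a r hK _ => (hex ⟨n, K, hK⟩).elim⟩
  have hne : ∀ n, (surfaceBoundary (Xs n)).Nonempty := fun n =>
    surfaceBoundary_nonempty_of_ncard_pos (by rwa [hnb])
  have hJ : ∀ n, ∃ J : Set (D n), IsNonContractibleJordanCurve J := by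
    intro m
    rcases (Nat.succ_le_of_lt hq).eq_or_lt with h | h
    · obtain ⟨n, K, hK⟩ := hex
      refine exists_isNonContractibleJordanCurve_double (hsurf m) (hlen m) ?_ (hne m) (hdouble m)
      rw [h1Rank_eq_of_redConnNum_eq (hne m) (hne n) ((hnb m).trans (hnb n).symm)
        ((hrc m).trans (hrc n).symm)]
      exact hK.h1Rank_pos (hsurf n) (hlen n) ((hnb n).trans h.symm)
    · obtain ⟨K, hK⟩ := (hlen m).exists_isOddArc_of_one_lt_ncard ((hnb m).symm ▸ h)
      exact ⟨_, hK.isNonContractibleJordanCurve (hdouble m)⟩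
  obtain ⟨δ, hδ, h⟩ := hreg.exists_forall_le_diam hJ
  refine ⟨δ / 4, by positivity, (h.filter_mono hyperfilter_le_atTop).mono
    fun n hn K a r hK hKr => ?_⟩
  have h1 := hn _ (hK.isNonContractibleJordanCurve (hdouble n))
  have hKB : (K ∩ surfaceBoundary (Xs n)).Nonempty := by
    obtain ⟨a, a', -, -, -, hKB, -⟩ := hK
    exact hKB ▸ ⟨a, Or.inl rfl⟩
  linarith [(hdouble n).diam_union_le hKB hKr]

/-! ## STATEMENT 16 -/

theorem stmt16 (c : ℤ) (q : ℕ) (hq : 0 < q)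
    (Xs : ℕ → Type) [∀ n, MetricSpace (Xs n)]
    (hsurf : ∀ n, IsCompactSurface (Xs n)) (hlen : ∀ n, IsLengthSpace (Xs n))
    (hnb : ∀ n, (surfaceBoundaryComponents (Xs n)).ncard = q)
    (hrc : ∀ n, redConnNum (Xs n) = c)
    (D : ℕ → Type) [∀ n, MetricSpace (D n)] [∀ n, CompactSpace (D n)] [∀ n, Nonempty (D n)]
    (ip im : ∀ n, Xs n → D n)
    (hdouble : ∀ n, IsMetricDouble (Xs n) (surfaceBoundary (Xs n)) (D n) (ip n) (im n))
    (hreg : RegularDoubleSeq D)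
    (Z : Type) [MetricSpace Z] [CompactSpace Z]
    (e : ∀ n, Xs n → Z) (hiso : ∀ n, Isometry (e n))
    (X : Set Z) (hXcl : IsClosed X) (hXne : X.Nonempty)
    (hconv : Filter.Tendsto (fun n => EMetric.hausdorffEdist (Set.range (e n)) X)
      Filter.atTop (nhds 0))
    (Binf : Set Z) (hBcl : IsClosed Binf) (hBsub : Binf ⊆ X)
    (hBconv : Filter.Tendsto
      (fun n => EMetric.hausdorffEdist (e n '' surfaceBoundary (Xs n)) Binf)
      Filter.atTop (nhds 0))
    (Dinf : Type) [MetricSpace Dinf] [CompactSpace Dinf] [Nonempty Dinf]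
    (hDconv : Filter.Tendsto (fun n => GromovHausdorff.toGHSpace (D n)) Filter.atTop
      (nhds (GromovHausdorff.toGHSpace Dinf)))
    (Xp Xm : Set Dinf) (hunion : Xp ∪ Xm = Set.univ)
    (jp : ↥X ≃ᵢ ↥Xp) (jm : ↥X ≃ᵢ ↥Xm)
    (τp τm : Dinf → Dinf)
    (hτpr : Set.range τp = Xp) (hτmr : Set.range τm = Xm)
    (hτpfix : ∀ d ∈ Xp, τp d = d) (hτmfix : ∀ d ∈ Xm, τm d = d)
    (hτpiso : Isometry fun x : ↥Xm => τp ↑x)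
    (hτmiso : Isometry fun x : ↥Xp => τm ↑x)
    (hτpm : ∀ d ∈ Xp, τp (τm d) = d) (hτmp : ∀ d ∈ Xm, τm (τp d) = d)
    (hτpj : ∀ x : ↥X, τp ↑(jm x) = ↑(jp x)) (hτmj : ∀ x : ↥X, τm ↑(jp x) = ↑(jm x))
    (hcapp : Xp ∩ Xm = plusCopy (⇑jp) Binf)
    (hcapm : Xp ∩ Xm = plusCopy (⇑jm) Binf)
    (bcomp : Set Z) (hbc : ∃ z ∈ Binf, bcomp = connectedComponentIn Binf z)
    (T : Set Dinf) (hT : IsMaximalCyclic T)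
    (hTb : (T ∩ plusCopy (⇑jp) bcomp).Nontrivial) :
    Nonempty (↥(T ∩ plusCopy (⇑jp) bcomp) ≃ₜ ↥Circle1) := by
  have hcpt : ∀ n, CompactSpace (Xs n) := fun n => (hsurf n).1
  have hs : ∀ n, IsSurface (Xs n) := fun n => (hsurf n).2.2.2
  have hfin : ∀ n, (surfaceBoundaryComponents (Xs n)).Finite := fun n =>
    finite_of_ncard_pos (by rwa [hnb])
  have hne : ∀ n, (surfaceBoundary (Xs n)).Nonempty := fun n =>
    surfaceBoundary_nonempty_of_ncard_pos (by rwa [hnb])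
  have : ∀ n, Nonempty (Xs n) := fun n => (hne n).to_type
  have hj : ∀ x y : ↥X, (jp x : Dinf) = jm y → x = y := fun x y h => by
    have h1 := hτpj y
    rw [← h, hτpfix _ (jp x).2] at h1
    exact jp.injective (Subtype.ext h1)
  have hjB : ∀ x : ↥X, (x : Z) ∈ Binf → (jp x : Dinf) = jm x := fun x hx => by
    have h1 : (jp x : Dinf) ∈ plusCopy (⇑jm) Binf := by
      rw [← hcapm, hcapp]
      exact ⟨x, hx, rfl⟩
    obtain ⟨y, -, hy⟩ := h1
    have hy' : (jm y : Dinf) = jp x := hy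
    obtain rfl := hj x y hy'.symm
    exact hy'.symm
  obtain ⟨z, hz, rfl⟩ := hbc
  exact isJordanCurve_inter_plusCopy hs hlen hfin hiso hne
    (oddArcsLarge_of_regularDoubleSeq hq hs hlen hnb hrc hdouble hreg) hXcl
    (ulim_eq_of_tendsto_hausdorffEdist hXcl hconv) hBsub
    (ulim_eq_of_tendsto_hausdorffEdist hBcl hBconv) hunion jp jm hj hjB hz hT hTb
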